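/- For every finite simple graph G there exists a graph G', obtained from G by subdividing each edge of G at most 2|E(G)| times, such that rcr(G') = cr(G). -/

import Mathlib

open Set

noncomputable section

abbrev Plane : Type := ℝ × ℝ

/-- The setoid on nonzero vectors of `ℝ³` identifying nonzero scalar multiples. -/
def projSetoid : Setoid {v : Fin 3 → ℝ // v ≠ 0} where
  r v w := ∃ c : ℝ, c ≠ 0 ∧ c • v.1 = w.1
  iseqv := by
    constructor
    · exact fun v => ⟨1, one_ne_zero, one_smul _ _⟩
    · rintro v w ⟨c, hc, h⟩
      exact ⟨c⁻¹, inv_ne_zero hc, by rw [← h, smul_smul, inv_mul_cancel₀ hc, one_smul]⟩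
    · rintro u v w ⟨c, hc, h⟩ ⟨d, hd, h'⟩
      exact ⟨d * c, mul_ne_zero hd hc, by rw [← h', ← h, smul_smul]⟩

/-- The real projective plane, as the quotient of `ℝ³ \ {0}` by nonzero scaling. -/
def RP2 : Type := Quotient projSetoid

instance : TopologicalSpace RP2 := instTopologicalSpaceQuotient

/-- The standard affine embedding of the plane in the projective plane. -/
def planeToRP2 (p : Plane) : RP2 :=
  Quotient.mk projSetoid ⟨![p.1, p.2, 1], by
    intro h
    simpa using congrFun h 2⟩

/-- A pseudoline: a simple closed curve in the projective plane that does not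
disconnect it. -/
def IsPseudoline (L : Set RP2) : Prop :=
  ∃ f : AddCircle (1 : ℝ) → RP2,
    Continuous f ∧ Function.Injective f ∧ Set.range f = L ∧ IsConnected Lᶜ

/-- A drawing of a graph in the plane: vertices are distinct points, each edge is a
simple arc (parametrized on `[0,1]`) joining its endpoints, and no arc passes
through a vertex other than its endpoints. -/
structure Drawing {V : Type*} (G : SimpleGraph V) where
  vert : V → Plane
  vert_inj : Function.Injective vert
  arc : G.edgeSet → ℝ → Plane
  arc_cont : ∀ e, ContinuousOn (arc e) (Icc 0 1)
  arc_injOn : ∀ e, InjOn (arc e) (Icc 0 1)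
  arc_ends : ∀ e : G.edgeSet, ∃ x y : V,
    (e : Sym2 V) = s(x, y) ∧ arc e 0 = vert x ∧ arc e 1 = vert y
  arc_avoid : ∀ (e : G.edgeSet) (t : ℝ), t ∈ Icc (0:ℝ) 1 →
    (∃ v, arc e t = vert v) → t = 0 ∨ t = 1

namespace Drawing

variable {V : Type*} {G : SimpleGraph V} (D : Drawing G)

/-- The interior (relative to its endpoints) of the arc of an edge. -/
def interOf (e : G.edgeSet) : Set Plane := D.arc e '' Ioo 0 1

/-- The set of crossings of a drawing: pairs consisting of a point of the plane
together with an (unordered) pair of distinct edges whose interiors both pass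
through the point. -/
def CrossSet : Set (Plane × Sym2 G.edgeSet) :=
  { x | ∃ e f : G.edgeSet, e ≠ f ∧ x.2 = s(e, f) ∧
      x.1 ∈ D.interOf e ∧ x.1 ∈ D.interOf f }

/-- The weighted number of crossings of a drawing: each crossing of a pair of
edges `e`, `f` contributes `w e * w f`. -/
def wcount (w : Sym2 V → ℕ) : ℕ :=
  ∑ᶠ x ∈ D.CrossSet,
    Sym2.lift ⟨fun e f : G.edgeSet => w e * w f, fun e f => mul_comm _ _⟩ x.2

/-- A drawing is pseudolinear if each edge can be extended to a pseudoline of the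
projective plane (via the standard affine embedding of the plane in the projective
plane) so that the extensions form a pseudoline arrangement: any two of the
pseudolines extending distinct edges meet in exactly one point. -/
def IsPseudolinear : Prop :=
  ∃ L : G.edgeSet → Set RP2,
    (∀ e, IsPseudoline (L e)) ∧
    (∀ e, ∀ t ∈ Icc (0:ℝ) 1, planeToRP2 (D.arc e t) ∈ L e) ∧
    (∀ e f, e ≠ f → ∃! p, p ∈ L e ∧ p ∈ L f)

/-- A drawing is rectilinear if every edge is drawn as a straight line segment. -/
def IsRectilinear : Prop :=
  ∀ e, ∀ t ∈ Icc (0:ℝ) 1, D.arc e t = (1 - t) • D.arc e 0 + t • D.arc e 1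

/-- A drawing is x-monotone if every edge meets every vertical line in at most one
point. -/
def IsMonotone : Prop :=
  ∀ e, InjOn (fun t => (D.arc e t).1) (Icc 0 1)

end Drawing

/-- The crossing number of `G` relative to a class of drawings `P`: the minimum
number of crossings in a drawing of `G` satisfying `P` (with finitely many
crossings). -/
def crNumP {V : Type*} (G : SimpleGraph V) (P : Drawing G → Prop) : ℕ :=
  sInf { n | ∃ D : Drawing G, P D ∧ D.CrossSet.Finite ∧ D.CrossSet.ncard = n }

/-- The crossing number `cr G`. -/
def crNum {V : Type*} (G : SimpleGraph V) : ℕ := crNumP G fun _ => True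

/-- The pseudolinear crossing number `pcr G`. -/
def pcrNum {V : Type*} (G : SimpleGraph V) : ℕ := crNumP G Drawing.IsPseudolinear

/-- The rectilinear crossing number `rcr G`. -/
def rcrNum {V : Type*} (G : SimpleGraph V) : ℕ := crNumP G Drawing.IsRectilinear

/-- The monotone crossing number `mon-cr G`. -/
def moncrNum {V : Type*} (G : SimpleGraph V) : ℕ := crNumP G Drawing.IsMonotone

/-- The weighted crossing number of `(G, w)` relative to a class of drawings. -/
def wcrNumP {V : Type*} (G : SimpleGraph V) (w : Sym2 V → ℕ) (P : Drawing G → Prop) : ℕ :=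
  sInf { n | ∃ D : Drawing G, P D ∧ D.CrossSet.Finite ∧ D.wcount w = n }

/-- The weighted crossing number `cr (G, w)`. -/
def wcrNum {V : Type*} (G : SimpleGraph V) (w : Sym2 V → ℕ) : ℕ :=
  wcrNumP G w fun _ => True

/-- The weighted pseudolinear crossing number `pcr (G, w)`. -/
def wpcrNum {V : Type*} (G : SimpleGraph V) (w : Sym2 V → ℕ) : ℕ :=
  wcrNumP G w Drawing.IsPseudolinear

/-- The weighted rectilinear crossing number `rcr (G, w)`. -/
def wrcrNum {V : Type*} (G : SimpleGraph V) (w : Sym2 V → ℕ) : ℕ :=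
  wcrNumP G w Drawing.IsRectilinear

/-- The graph obtained from `G` by subdividing each edge `e` a total of `c e`
times: the edge `e`, with endpoints `fst e` and `snd e`, is replaced by the path
`fst e, (e,0), (e,1), …, (e, c e - 1), snd e` through `c e` new degree-2
vertices (if `c e = 0` the edge is kept as it is). -/
def subdivideGraph {V : Type*} (G : SimpleGraph V) (c : G.edgeSet → ℕ)
    (fst snd : G.edgeSet → V) :
    SimpleGraph (V ⊕ Σ e : G.edgeSet, Fin (c e)) :=
  SimpleGraph.fromRel fun x y =>
    (∃ e : G.edgeSet, c e = 0 ∧ x = Sum.inl (fst e) ∧ y = Sum.inl (snd e)) ∨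
    (∃ (e : G.edgeSet) (i : Fin (c e)),
      x = Sum.inl (fst e) ∧ y = Sum.inr ⟨e, i⟩ ∧ i.val = 0) ∨
    (∃ (e : G.edgeSet) (i : Fin (c e)),
      x = Sum.inl (snd e) ∧ y = Sum.inr ⟨e, i⟩ ∧ i.val = c e - 1) ∨
    (∃ (e : G.edgeSet) (i j : Fin (c e)),
      x = Sum.inr ⟨e, i⟩ ∧ y = Sum.inr ⟨e, j⟩ ∧ j.val = i.val + 1)

open Filter Topology

/-! ### Reachability inside a set -/

/-- `a` and `b` are joined by a walk of `G` all of whose vertices lie in `S`. -/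
def ReachIn {V : Type*} (G : SimpleGraph V) (S : Set V) (a b : V) : Prop :=
  ∃ w : G.Walk a b, ∀ x ∈ w.support, x ∈ S

namespace ReachIn

variable {V : Type*} {G : SimpleGraph V} {S T : Set V} {a b c : V}

theorem refl (h : a ∈ S) : ReachIn G S a a :=
  ⟨.nil, by simpa using h⟩

theorem symm (h : ReachIn G S a b) : ReachIn G S b a := by
  obtain ⟨w, hw⟩ := h
  exact ⟨w.reverse, by simpa using hw⟩

theorem trans (h : ReachIn G S a b) (h' : ReachIn G S b c) : ReachIn G S a c := by
  obtain ⟨w, hw⟩ := h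
  obtain ⟨w', hw'⟩ := h'
  refine ⟨w.append w', fun x hx => ?_⟩
  rcases (SimpleGraph.Walk.mem_support_append_iff _ _).1 hx with h | h
  · exact hw x h
  · exact hw' x h

theorem mono (hST : S ⊆ T) (h : ReachIn G S a b) : ReachIn G T a b := by
  obtain ⟨w, hw⟩ := h
  exact ⟨w, fun x hx => hST (hw x hx)⟩

theorem of_adj (h : G.Adj a b) (ha : a ∈ S) (hb : b ∈ S) : ReachIn G S a b :=
  ⟨.cons h .nil, by simp [ha, hb]⟩

theorem tail (h : ReachIn G S a b) (h' : G.Adj b c) (hc : c ∈ S) : ReachIn G S a c := by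
  refine h.trans (of_adj h' ?_ hc)
  obtain ⟨w, hw⟩ := h
  exact hw _ w.end_mem_support

theorem left_mem (h : ReachIn G S a b) : a ∈ S := by
  obtain ⟨w, hw⟩ := h
  exact hw _ w.start_mem_support

theorem right_mem (h : ReachIn G S a b) : b ∈ S := h.symm.left_mem

/-- A property that holds at `a` and propagates along edges inside `S` holds at `b`. -/
theorem induct {P : V → Prop} (h : ReachIn G S a b) (ha : P a)
    (step : ∀ x y, G.Adj x y → x ∈ S → y ∈ S → P x → P y) : P b := by
  obtain ⟨w, hw⟩ := h
  induction w with
  | nil => exact ha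
  | cons hadj w ih =>
    refine ih (step _ _ hadj ?_ ?_ ha) fun x hx => hw x (by simp [hx])
    · exact hw _ (by simp)
    · exact hw _ (by simp)

/-- Reachability transported along a map that sends edges to reachable pairs. -/
theorem map {W : Type*} {H : SimpleGraph W} {R : Set W} (f : V → W) (h : ReachIn G S a b)
    (hf : ∀ x ∈ S, f x ∈ R)
    (step : ∀ x y, G.Adj x y → x ∈ S → y ∈ S → ReachIn H R (f x) (f y)) :
    ReachIn H R (f a) (f b) :=
  h.induct (P := fun z => ReachIn H R (f a) (f z)) (refl (hf _ h.left_mem))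
    fun x y hxy hx hy hax => hax.trans (step x y hxy hx hy)

theorem mono_graph {H : SimpleGraph V} (hGH : G ≤ H) (h : ReachIn G S a b) : ReachIn H S a b :=
  h.map id (fun _ hx => hx) fun _ _ hxy hx hy => of_adj (hGH hxy) hx hy

end ReachIn

/-- The set `S` induces a connected (possibly empty) subgraph. -/
def ConnOn {V : Type*} (G : SimpleGraph V) (S : Set V) : Prop :=
  ∀ a ∈ S, ∀ b ∈ S, ReachIn G S a b

theorem ReachIn.trans_disjoint_union {V : Type*} {G : SimpleGraph V} {S T : Set V} {a b x y : V}
    (hS : ConnOn G S) (hT : ConnOn G T) (ha : a ∈ S) (hb : b ∈ T) (hx : x ∈ S) (hy : y ∈ T)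
    (hxy : G.Adj x y) : ReachIn G (S ∪ T) a b :=
  (((hS a ha x hx).mono subset_union_left).tail hxy (Or.inr hy)).trans
    ((hT y hy b hb).mono subset_union_right)

theorem connOn_singleton {V : Type*} (G : SimpleGraph V) (a : V) : ConnOn G {a} := by
  rintro x rfl y rfl
  exact .refl rfl

/-! ### The algebraic Hanani–Tutte condition -/

/-- The indicator of `a < b`, modulo two. -/
def ltInd (a b : ℝ) : ZMod 2 := if a < b then 1 else 0

theorem ltInd_swap {a b : ℝ} (h : a ≠ b) : ltInd b a = 1 + ltInd a b := by
  unfold ltInd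
  rcases lt_or_gt_of_ne h with h | h
  · simp [h, h.not_gt]; decide
  · simp [h, h.not_gt]

/-- The parity of interleaving of two pairs of reals. -/
def inter {V : Type*} (y : V → ℝ) (a b c d : V) : ZMod 2 :=
  ltInd (y a) (y c) + ltInd (y a) (y d) + ltInd (y b) (y c) + ltInd (y b) (y d)

/-- The data `y`, `m` satisfy the Hanani–Tutte relations of the graph `G`. -/
def HTData {V : Type*} (G : SimpleGraph V) (y : V → ℝ) (m : V → V → V → ZMod 2) : Prop :=
  ∀ a b c d, G.Adj a b → G.Adj c d → a ≠ c → a ≠ d → b ≠ c → b ≠ d →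
    inter y a b c d = m a b c + m a b d + m c d a + m c d b

/-- The algebraic Hanani–Tutte condition on a graph. -/
def HT {V : Type*} (G : SimpleGraph V) : Prop :=
  ∃ y : V → ℝ, Function.Injective y ∧ ∃ m : V → V → V → ZMod 2, HTData G y m

/-- Sum along a walk. -/
def walkSum {V : Type*} {G : SimpleGraph V} (m : V → V → V → ZMod 2) (x : V) :
    {a b : V} → G.Walk a b → ZMod 2
  | _, _, .nil => 0
  | _, _, .cons (u := u) (v := v) _ w => m u v x + walkSum m x w

theorem zmod2_add_self (x : ZMod 2) : x + x = 0 := CharTwo.add_self_eq_zero x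

theorem HTData.walk_edge {V : Type*} {G : SimpleGraph V} {y : V → ℝ} {m : V → V → V → ZMod 2}
    (h : HTData G y m) {c d : V} (hcd : G.Adj c d) {p p' : V} (w : G.Walk p p')
    (hc : c ∉ w.support) (hd : d ∉ w.support) :
    inter y p p' c d = walkSum m c w + walkSum m d w + m c d p + m c d p' := by
  induction w with
  | nil =>
    simp only [inter, walkSum]
    linear_combination (ltInd (y _) (y c) + ltInd (y _) (y d) - m c d _) * (zmod2_add_self 1)
  | @cons u v z hadj w ih =>
    have hv : v ∈ w.support := w.start_mem_support
    simp only [SimpleGraph.Walk.support_cons, List.mem_cons, not_or] at hc hd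
    have h1 := ih hc.2 hd.2
    have h2 := h u v c d hadj hcd (Ne.symm hc.1) (Ne.symm hd.1)
      (fun e => hc.2 (e ▸ hv)) (fun e => hd.2 (e ▸ hv))
    simp only [inter, walkSum] at *
    linear_combination h1 + h2 - (ltInd (y v) (y c) + ltInd (y v) (y d) - m c d v)
      * (zmod2_add_self 1)

theorem HTData.walk_walk {V : Type*} {G : SimpleGraph V} {y : V → ℝ} {m : V → V → V → ZMod 2}
    (h : HTData G y m) {p p' : V} (w : G.Walk p p') {q q' : V} (u : G.Walk q q')
    (hd : ∀ x ∈ w.support, x ∉ u.support) :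
    inter y p p' q q' = walkSum m q w + walkSum m q' w + walkSum m p u + walkSum m p' u := by
  induction u with
  | nil =>
    simp only [inter, walkSum]
    linear_combination (ltInd (y p) (y _) + ltInd (y p') (y _) - walkSum m _ w)
      * (zmod2_add_self 1)
  | @cons a b z hadj u ih =>
    have hv : b ∈ u.support := u.start_mem_support
    simp only [SimpleGraph.Walk.support_cons, List.mem_cons, not_or] at hd
    have h1 := ih fun x hx => (hd x hx).2
    have h2 := h.walk_edge hadj w (fun e => (hd _ e).1 rfl) (fun e => (hd _ e).2 hv)
    simp only [inter, walkSum] at *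
    linear_combination h1 + h2 - (ltInd (y p) (y b) + ltInd (y p') (y b) - walkSum m b w)
      * (zmod2_add_self 1)

/-- The Hanani–Tutte condition passes to minors, given by branch sets `B` with roots `r`. -/
theorem HT.minor {V W : Type*} {G : SimpleGraph V} {H : SimpleGraph W} (h : HT G)
    (B : W → Set V) (r : W → V) (hr : ∀ i, r i ∈ B i)
    (hB : ∀ i j, i ≠ j → ∀ x, x ∈ B i → x ∉ B j)
    (hH : ∀ i j, H.Adj i j → ReachIn G (B i ∪ B j) (r i) (r j)) : HT H := by
  classical
  obtain ⟨y, hy, m, hm⟩ := h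
  choose w hw using hH
  have hri : Function.Injective r := by
    intro i j hij
    by_contra hne
    exact hB i j hne (r i) (hr i) (hij ▸ hr j)
  refine ⟨y ∘ r, hy.comp hri,
    fun i j k => if h : H.Adj i j then walkSum m (r k) (w i j h) else 0, ?_⟩
  intro a b c d hab hcd hac had hbc hbd
  simp only [hab, hcd, dif_pos]
  refine hm.walk_walk (w a b hab) (w c d hcd) fun x hx hx' => ?_
  rcases hw a b hab x hx with h1 | h1 <;> rcases hw c d hcd x hx' with h2 | h2
  · exact hB _ _ hac _ h1 h2
  · exact hB _ _ had _ h1 h2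
  · exact hB _ _ hbc _ h1 h2
  · exact hB _ _ hbd _ h1 h2

theorem HT.minor_of_connOn {V W : Type*} {G : SimpleGraph V} {H : SimpleGraph W} (h : HT G)
    (B : W → Set V) (hr : ∀ i, (B i).Nonempty)
    (hB : ∀ i j, i ≠ j → ∀ x, x ∈ B i → x ∉ B j) (hconn : ∀ i, ConnOn G (B i))
    (hH : ∀ i j, H.Adj i j → ∃ x ∈ B i, ∃ y ∈ B j, G.Adj x y) : HT H := by
  choose r hr using hr
  refine h.minor B r hr hB fun i j hij => ?_
  obtain ⟨x, hx, y, hy, hxy⟩ := hH i j hij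
  exact .trans_disjoint_union (hconn i) (hconn j) (hr i) (hr j) hx hy hxy

theorem not_HT_K5 : ¬ HT (⊤ : SimpleGraph (Fin 5)) := by
  rintro ⟨y, hy, m, hm⟩
  have sw : ∀ i j : Fin 5, i < j → ltInd (y j) (y i) = 1 + ltInd (y i) (y j) :=
    fun i j hij => ltInd_swap fun e => hij.ne (hy e)
  have R : ∀ a b c d : Fin 5, a ≠ b ∧ c ≠ d ∧ a ≠ c ∧ a ≠ d ∧ b ≠ c ∧ b ≠ d →
      inter y a b c d = m a b c + m a b d + m c d a + m c d b :=
    fun a b c d ⟨h1, h2, h3, h4, h5, h6⟩ => hm a b c d h1 h2 h3 h4 h5 h6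
  have e1 := R 0 1 2 3 (by decide)
  have e2 := R 0 2 1 3 (by decide)
  have e3 := R 0 3 1 2 (by decide)
  have e4 := R 0 1 2 4 (by decide)
  have e5 := R 0 2 1 4 (by decide)
  have e6 := R 0 4 1 2 (by decide)
  have e7 := R 0 1 3 4 (by decide)
  have e8 := R 0 3 1 4 (by decide)
  have e9 := R 0 4 1 3 (by decide)
  have e10 := R 0 2 3 4 (by decide)
  have e11 := R 0 3 2 4 (by decide)
  have e12 := R 0 4 2 3 (by decide)
  have e13 := R 1 2 3 4 (by decide)
  have e14 := R 1 3 2 4 (by decide)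
  have e15 := R 1 4 2 3 (by decide)
  simp only [inter] at e1 e2 e3 e4 e5 e6 e7 e8 e9 e10 e11 e12 e13 e14 e15
  have key := congrArg₂ (· + ·) e1 (congrArg₂ (· + ·) e2 (congrArg₂ (· + ·) e3
    (congrArg₂ (· + ·) e4 (congrArg₂ (· + ·) e5 (congrArg₂ (· + ·) e6 (congrArg₂ (· + ·) e7
    (congrArg₂ (· + ·) e8 (congrArg₂ (· + ·) e9 (congrArg₂ (· + ·) e10 (congrArg₂ (· + ·) e11
    (congrArg₂ (· + ·) e12 (congrArg₂ (· + ·) e13 (congrArg₂ (· + ·) e14 e15)))))))))))))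
  simp only [sw 1 2 (by decide), sw 1 3 (by decide), sw 2 3 (by decide),
    sw 1 4 (by decide), sw 2 4 (by decide), sw 3 4 (by decide)] at key
  ring_nf at key
  reduce_mod_char at key
  exact absurd key (by decide)

/-- The complete bipartite graph `K_{3,3}` on `Fin 3 ⊕ Fin 3`. -/
theorem not_HT_K33 : ¬ HT (completeBipartiteGraph (Fin 3) (Fin 3)) := by
  rintro ⟨y, hy, m, hm⟩
  set a : Fin 3 → Fin 3 ⊕ Fin 3 := Sum.inl
  set b : Fin 3 → Fin 3 ⊕ Fin 3 := Sum.inr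
  have sa : ∀ i j : Fin 3, i < j → ltInd (y (a j)) (y (a i)) = 1 + ltInd (y (a i)) (y (a j)) :=
    fun i j hij => ltInd_swap fun e => hij.ne (by simpa [a] using hy e)
  have sb : ∀ i j : Fin 3, i < j → ltInd (y (b j)) (y (b i)) = 1 + ltInd (y (b i)) (y (b j)) :=
    fun i j hij => ltInd_swap fun e => hij.ne (by simpa [b] using hy e)
  have sab : ∀ i j : Fin 3, ltInd (y (b j)) (y (a i)) = 1 + ltInd (y (a i)) (y (b j)) :=
    fun i j => ltInd_swap fun e => by simpa [a, b] using hy e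
  have R : ∀ i j k l : Fin 3, i ≠ k ∧ j ≠ l →
      inter y (a i) (b j) (a k) (b l) =
        m (a i) (b j) (a k) + m (a i) (b j) (b l) + m (a k) (b l) (a i) + m (a k) (b l) (b j) :=
    fun i j k l ⟨h1, h2⟩ => hm _ _ _ _ (by simp [a, b]) (by simp [a, b])
      (by simpa [a] using h1) (by simp [a, b]) (by simp [a, b]) (by simpa [b] using h2)
  have e1 := R 0 0 1 1 (by decide)
  have e2 := R 0 1 1 0 (by decide)
  have e3 := R 0 0 1 2 (by decide)
  have e4 := R 0 2 1 0 (by decide)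
  have e5 := R 0 1 1 2 (by decide)
  have e6 := R 0 2 1 1 (by decide)
  have e7 := R 0 0 2 1 (by decide)
  have e8 := R 0 1 2 0 (by decide)
  have e9 := R 0 0 2 2 (by decide)
  have e10 := R 0 2 2 0 (by decide)
  have e11 := R 0 1 2 2 (by decide)
  have e12 := R 0 2 2 1 (by decide)
  have e13 := R 1 0 2 1 (by decide)
  have e14 := R 1 1 2 0 (by decide)
  have e15 := R 1 0 2 2 (by decide)
  have e16 := R 1 2 2 0 (by decide)
  have e17 := R 1 1 2 2 (by decide)
  have e18 := R 1 2 2 1 (by decide)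
  simp only [inter] at e1 e2 e3 e4 e5 e6 e7 e8 e9 e10 e11 e12 e13 e14 e15 e16 e17 e18
  have key := congrArg₂ (· + ·) e1 (congrArg₂ (· + ·) e2 (congrArg₂ (· + ·) e3
    (congrArg₂ (· + ·) e4 (congrArg₂ (· + ·) e5 (congrArg₂ (· + ·) e6 (congrArg₂ (· + ·) e7
    (congrArg₂ (· + ·) e8 (congrArg₂ (· + ·) e9 (congrArg₂ (· + ·) e10 (congrArg₂ (· + ·) e11
    (congrArg₂ (· + ·) e12 (congrArg₂ (· + ·) e13 (congrArg₂ (· + ·) e14 (congrArg₂ (· + ·) e15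
    (congrArg₂ (· + ·) e16 (congrArg₂ (· + ·) e17 e18))))))))))))))))
  simp only [sb 0 1 (by decide), sb 0 2 (by decide), sb 1 2 (by decide), sab] at key
  ring_nf at key
  reduce_mod_char at key
  exact absurd key (by decide)

/-! ### Orientation and the parity identity for segments -/

/-- The orientation determinant of a triple of points. -/
def det3 (a b c : Plane) : ℝ := (b.1 - a.1) * (c.2 - a.2) - (b.2 - a.2) * (c.1 - a.1)

/-- The segments `ab` and `cd` cross properly. -/
def SegCross (a b c d : Plane) : Prop :=
  det3 a b c * det3 a b d < 0 ∧ det3 c d a * det3 c d b < 0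

theorem det3_swap (a b c : Plane) : det3 b a c = - det3 a b c := by unfold det3; ring

theorem det3_rot (a b c : Plane) : det3 b c a = det3 a b c := by unfold det3; ring

/-- The indicator that the horizontal ray to the right of `c` hits the segment `ab`. -/
def rayInd (a b c : Plane) : ZMod 2 :=
  open Classical in
  if (a.2 < c.2 ∧ c.2 < b.2 ∧ 0 < det3 a b c) ∨ (b.2 < c.2 ∧ c.2 < a.2 ∧ det3 a b c < 0)
    then 1 else 0

theorem rayInd_symm (a b c : Plane) : rayInd b a c = rayInd a b c := by
  unfold rayInd
  simp only [det3_swap a b, neg_pos, neg_lt_zero]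
  congr 1
  exact propext or_comm

/-- The parity identity of two segments. -/
def SegRel (a b c d : Plane) : Prop :=
  ltInd a.2 c.2 + ltInd a.2 d.2 + ltInd b.2 c.2 + ltInd b.2 d.2 =
    rayInd a b c + rayInd a b d + rayInd c d a + rayInd c d b

/-- The first coordinate of the point of the line `ab` at height `y`. -/
def lineX (a b : Plane) (y : ℝ) : ℝ := a.1 + (y - a.2) / (b.2 - a.2) * (b.1 - a.1)

theorem lineX_mem {a b : Plane} {y : ℝ} (h : a.2 < b.2) (h1 : a.2 ≤ y) (h2 : y ≤ b.2) :
    ((lineX a b y, y) : Plane) ∈ segment ℝ a b := by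
  have h0 : 0 < b.2 - a.2 := sub_pos.2 h
  rw [segment_eq_image]
  refine ⟨(y - a.2) / (b.2 - a.2), ⟨div_nonneg (by linarith) h0.le, ?_⟩, ?_⟩
  · rw [div_le_one h0]; linarith
  · ext
    · simp [lineX]; ring
    · simp; field_simp; ring

theorem det3_eq_lineX {a b c : Plane} (h : a.2 < b.2) :
    det3 a b c = (b.2 - a.2) * (lineX a b c.2 - c.1) := by
  have h0 : b.2 - a.2 ≠ 0 := (sub_pos.2 h).ne'
  simp only [det3, lineX]; field_simp; ring

theorem lineX_sign {a b c d : Plane} (hab : a.2 < b.2) (hcd : c.2 < d.2)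
    (hd : Disjoint (segment ℝ a b) (segment ℝ c d)) {y y' : ℝ} (hyy : y ≤ y')
    (h1 : a.2 ≤ y) (h2 : y' ≤ b.2) (h3 : c.2 ≤ y) (h4 : y' ≤ d.2) :
    lineX a b y < lineX c d y ↔ lineX a b y' < lineX c d y' := by
  have hne : ∀ u ∈ Icc y y', lineX a b u - lineX c d u ≠ 0 := by
    intro u hu h0
    have e : lineX a b u = lineX c d u := sub_eq_zero.1 h0
    exact Set.disjoint_left.1 hd (lineX_mem hab (h1.trans hu.1) (hu.2.trans h2))
      (e ▸ lineX_mem hcd (h3.trans hu.1) (hu.2.trans h4))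
  have hcont : ContinuousOn (fun u => lineX a b u - lineX c d u) (Icc y y') := by
    unfold lineX; fun_prop
  constructor
  · intro h
    by_contra h'
    obtain ⟨u, hu, hu0⟩ := intermediate_value_Icc hyy hcont
      (show (0:ℝ) ∈ Icc _ _ from ⟨by linarith, by linarith [not_lt.1 h']⟩)
    exact hne u hu hu0
  · intro h
    by_contra h'
    obtain ⟨u, hu, hu0⟩ := intermediate_value_Icc' hyy hcont
      (show (0:ℝ) ∈ Icc _ _ from ⟨by linarith, by linarith [not_lt.1 h']⟩)
    exact hne u hu hu0

theorem rayInd_of_lt {a b c : Plane} (h : a.2 < b.2) (h1 : a.2 < c.2) (h2 : c.2 < b.2) :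
    rayInd a b c = if c.1 < lineX a b c.2 then 1 else 0 := by
  unfold rayInd
  have e : 0 < det3 a b c ↔ c.1 < lineX a b c.2 := by
    rw [det3_eq_lineX h, mul_pos_iff_of_pos_left (sub_pos.2 h), sub_pos]
  by_cases hc : c.1 < lineX a b c.2
  · rw [if_pos (Or.inl ⟨h1, h2, e.2 hc⟩), if_pos hc]
  · rw [if_neg, if_neg hc]
    rintro (⟨-, -, h⟩ | ⟨h, -⟩)
    · exact hc (e.1 h)
    · linarith

theorem rayInd_outside {a b c : Plane} (h : a.2 < b.2) (h1 : c.2 < a.2 ∨ b.2 < c.2) :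
    rayInd a b c = 0 := by
  unfold rayInd
  rw [if_neg]
  rintro (⟨h2, h3, -⟩ | ⟨h2, h3, -⟩) <;> rcases h1 with h1 | h1 <;> linarith

theorem lineX_left {a b : Plane} : lineX a b a.2 = a.1 := by simp [lineX]

theorem lineX_right {a b : Plane} (h : a.2 < b.2) : lineX a b b.2 = b.1 := by
  have h0 : b.2 - a.2 ≠ 0 := (sub_pos.2 h).ne'
  simp [lineX, h0]

theorem segRel_aux {a b c d : Plane} (hab : a.2 < b.2) (hcd : c.2 < d.2) (hac : a.2 < c.2)
    (hbc : b.2 ≠ c.2) (hbd : b.2 ≠ d.2)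
    (hd : Disjoint (segment ℝ a b) (segment ℝ c d)) : SegRel a b c d := by
  unfold SegRel
  have had : a.2 < d.2 := hac.trans hcd
  have z1 : rayInd c d a = 0 := rayInd_outside hcd (Or.inl hac)
  rcases lt_or_gt_of_ne hbc with h | h
  · rw [rayInd_outside hab (Or.inr h), rayInd_outside hab (Or.inr (h.trans hcd)), z1,
      rayInd_outside hcd (Or.inl h)]
    simp [ltInd, hac, had, h, h.trans hcd]
    decide
  rcases lt_or_gt_of_ne hbd with h' | h'
  · have key := lineX_sign hab hcd hd h.le hac.le le_rfl le_rfl h'.le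
    have hne : c.1 ≠ lineX a b c.2 := by
      intro e
      refine Set.disjoint_left.1 hd (lineX_mem hab hac.le h.le) ?_
      rw [← e]; exact left_mem_segment ℝ c d
    rw [lineX_left, lineX_right hab] at key
    rw [rayInd_of_lt hab hac h, rayInd_outside hab (Or.inr h'), z1, rayInd_of_lt hcd h h']
    simp only [← key]
    rcases lt_or_gt_of_ne hne with h3 | h3 <;>
    · simp [ltInd, hac, had, h', h.not_gt, h3, h3.not_gt]
      try decide
  · have hadd : d.2 < b.2 := h'
    have key := lineX_sign hab hcd hd hcd.le hac.le h'.le le_rfl le_rfl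
    have hne : c.1 ≠ lineX a b c.2 := by
      intro e
      refine Set.disjoint_left.1 hd (lineX_mem hab hac.le h.le) ?_
      rw [← e]; exact left_mem_segment ℝ c d
    have hne' : d.1 ≠ lineX a b d.2 := by
      intro e
      refine Set.disjoint_left.1 hd (lineX_mem hab had.le h'.le) ?_
      rw [← e]; exact right_mem_segment ℝ c d
    rw [lineX_left, lineX_right hcd] at key
    rw [rayInd_of_lt hab hac h, rayInd_of_lt hab had h', z1, rayInd_outside hcd (Or.inr h')]
    rcases lt_or_gt_of_ne hne with h3 | h3
    · have h4 : d.1 < lineX a b d.2 := by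
        by_contra h5
        exact h3.not_gt (key.2 (lt_of_le_of_ne (not_lt.1 h5) hne'.symm))
      simp [ltInd, hac, had, h.not_gt, h'.not_gt, h3, h4]
    · have h4 : ¬ d.1 < lineX a b d.2 := (key.1 h3).not_gt
      simp [ltInd, hac, had, h.not_gt, h'.not_gt, h3.not_gt, h4]
      decide

theorem SegRel.swap_left {a b c d : Plane} (h : SegRel a b c d) : SegRel b a c d := by
  unfold SegRel at *
  rw [rayInd_symm b a c, rayInd_symm b a d] at h
  linear_combination h

theorem SegRel.swap_right {a b c d : Plane} (h : SegRel a b c d) : SegRel a b d c := by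
  unfold SegRel at *
  rw [rayInd_symm d c a, rayInd_symm d c b] at h
  linear_combination h

theorem SegRel.symm {a b c d : Plane} (hac : a.2 ≠ c.2) (had : a.2 ≠ d.2) (hbc : b.2 ≠ c.2)
    (hbd : b.2 ≠ d.2) (h : SegRel a b c d) : SegRel c d a b := by
  unfold SegRel at *
  rw [ltInd_swap hac, ltInd_swap had, ltInd_swap hbc, ltInd_swap hbd]
  linear_combination h + 2 * zmod2_add_self 1

theorem segRel_of_disjoint {a b c d : Plane} (hab : a.2 ≠ b.2) (hcd : c.2 ≠ d.2)
    (hac : a.2 ≠ c.2) (had : a.2 ≠ d.2) (hbc : b.2 ≠ c.2) (hbd : b.2 ≠ d.2)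
    (hd : Disjoint (segment ℝ a b) (segment ℝ c d)) : SegRel a b c d := by
  wlog h1 : a.2 < b.2 generalizing a b
  · exact (this hab.symm hbc hbd hac had (segment_symm ℝ a b ▸ hd)
      (lt_of_le_of_ne (not_lt.1 h1) hab.symm)).swap_left
  wlog h2 : c.2 < d.2 generalizing c d
  · exact (this hcd.symm had hac hbd hbc (segment_symm ℝ c d ▸ hd)
      (lt_of_le_of_ne (not_lt.1 h2) hcd.symm)).swap_right
  wlog h3 : a.2 < c.2 generalizing a b c d
  · refine SegRel.symm hac.symm hbc.symm had.symm hbd.symm (this (a := c) (b := d) (c := a)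
      (d := b) ?_ ?_ ?_ ?_ ?_ ?_ ?_ ?_ ?_ ?_)
    all_goals first | assumption | (symm; assumption) |
      exact lt_of_le_of_ne (not_lt.1 h3) hac.symm
  exact segRel_aux h1 h2 h3 hbc hbd hd

/-! ### Polygonal arcs -/

theorem polyline_rel_right {P : ℕ → Plane} {c d : Plane} (N : ℕ)
    (h : ∀ i < N, SegRel (P i) (P (i + 1)) c d) :
    ltInd (P 0).2 c.2 + ltInd (P 0).2 d.2 + ltInd (P N).2 c.2 + ltInd (P N).2 d.2 =
      ∑ i ∈ Finset.range N, rayInd (P i) (P (i + 1)) c +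
      ∑ i ∈ Finset.range N, rayInd (P i) (P (i + 1)) d + rayInd c d (P 0) + rayInd c d (P N) := by
  induction N with
  | zero =>
    simp only [Finset.range_zero, Finset.sum_empty]
    linear_combination (ltInd (P 0).2 c.2 + ltInd (P 0).2 d.2 - rayInd c d (P 0)) *
      zmod2_add_self 1
  | succ N ih =>
    have h1 := ih fun i hi => h i (by omega)
    have h2 := h N (by omega)
    unfold SegRel at h2
    rw [Finset.sum_range_succ, Finset.sum_range_succ]
    linear_combination h1 + h2 - (ltInd (P N).2 c.2 + ltInd (P N).2 d.2 - rayInd c d (P N)) *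
      zmod2_add_self 1

theorem polyline_rel {P Q : ℕ → Plane} (N M : ℕ)
    (h : ∀ i < N, ∀ j < M, SegRel (P i) (P (i + 1)) (Q j) (Q (j + 1))) :
    ltInd (P 0).2 (Q 0).2 + ltInd (P 0).2 (Q M).2 + ltInd (P N).2 (Q 0).2 +
      ltInd (P N).2 (Q M).2 =
      ∑ i ∈ Finset.range N, rayInd (P i) (P (i + 1)) (Q 0) +
      ∑ i ∈ Finset.range N, rayInd (P i) (P (i + 1)) (Q M) +
      ∑ j ∈ Finset.range M, rayInd (Q j) (Q (j + 1)) (P 0) +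
      ∑ j ∈ Finset.range M, rayInd (Q j) (Q (j + 1)) (P N) := by
  induction M with
  | zero =>
    simp only [Finset.range_zero, Finset.sum_empty]
    linear_combination (ltInd (P 0).2 (Q 0).2 + ltInd (P N).2 (Q 0).2 -
      ∑ i ∈ Finset.range N, rayInd (P i) (P (i + 1)) (Q 0)) * zmod2_add_self 1
  | succ M ih =>
    have h1 := ih fun i hi j hj => h i hi j (by omega)
    have h2 := polyline_rel_right N fun i hi => h i hi M (by omega)
    rw [Finset.sum_range_succ, Finset.sum_range_succ]
    linear_combination h1 + h2 - (ltInd (P 0).2 (Q M).2 + ltInd (P N).2 (Q M).2 -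
      ∑ i ∈ Finset.range N, rayInd (P i) (P (i + 1)) (Q M)) * zmod2_add_self 1

/-! ### Generic small parameters -/

open Filter Topology

theorem eventually_affine_ne {a b : ℝ} (h : a ≠ 0 ∨ b ≠ 0) :
    ∀ᶠ τ in 𝓝[>] (0:ℝ), a + τ * b ≠ 0 := by
  by_cases ha : a = 0
  · filter_upwards [self_mem_nhdsWithin] with τ hτ
    rw [ha, zero_add]
    exact mul_ne_zero (ne_of_gt hτ) (h.resolve_left (by simpa using ha))
  · have hc : Continuous fun τ : ℝ => a + τ * b := by fun_prop
    have : ∀ᶠ τ in 𝓝 (0:ℝ), a + τ * b ≠ 0 := hc.continuousAt.eventually_ne (by simpa using ha)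
    exact this.filter_mono nhdsWithin_le_nhds

theorem eventually_pos_of_continuous {f : ℝ → ℝ} (hf : Continuous f) (h : 0 < f 0) :
    ∀ᶠ τ in 𝓝[>] (0:ℝ), 0 < f τ :=
  (hf.continuousAt.eventually_const_lt h).filter_mono nhdsWithin_le_nhds

theorem exists_injective_near {J : Type*} [Finite J] (y : J → ℝ) {η : ℝ} (hη : 0 < η) :
    ∃ y' : J → ℝ, Function.Injective y' ∧ ∀ j, |y' j - y j| < η := by
  obtain ⟨n, ⟨e⟩⟩ := Finite.exists_equiv_fin J
  set r : J → ℝ := fun j => (e j : ℕ)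
  have hr : Function.Injective r := fun i j h => e.injective (Fin.ext (Nat.cast_injective (R := ℝ) h))
  have h1 : ∀ᶠ τ in 𝓝[>] (0:ℝ), ∀ p : J × J, p.1 ≠ p.2 →
      (y p.1 - y p.2) + τ * (r p.1 - r p.2) ≠ 0 := by
    rw [eventually_all]
    intro p
    by_cases hp : p.1 = p.2
    · exact Eventually.of_forall fun τ h => absurd hp h
    · filter_upwards [eventually_affine_ne (a := y p.1 - y p.2) (b := r p.1 - r p.2)
        (Or.inr (sub_ne_zero.2 (hr.ne hp)))] with τ hτ _ using hτ
  have h2 : ∀ᶠ τ in 𝓝[>] (0:ℝ), ∀ j, 0 < η - |τ * r j| := by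
    rw [eventually_all]
    intro j
    exact eventually_pos_of_continuous (f := fun τ => η - |τ * r j|) (by fun_prop) (by simpa)
  obtain ⟨τ, hτ1, hτ2⟩ := (h1.and h2).exists
  refine ⟨fun j => y j + τ * r j, fun i j hij => ?_, fun j => ?_⟩
  · by_contra hne
    apply hτ1 (i, j) hne
    have : y i + τ * r i = y j + τ * r j := hij
    linear_combination this
  · have := hτ2 j
    simp only [add_sub_cancel_left]
    linarith

/-! ### Drawings whose independent edges are disjoint satisfy the Hanani–Tutte condition -/

theorem HT.of_arcs {V : Type*} [Finite V] {G : SimpleGraph V} (z : V → Plane)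
    (γ : V → V → ℝ → Plane)
    (hγ : ∀ a b, G.Adj a b → ContinuousOn (γ a b) (Icc 0 1) ∧ γ a b 0 = z a ∧ γ a b 1 = z b)
    (hd : ∀ a b c d, G.Adj a b → G.Adj c d → a ≠ c → a ≠ d → b ≠ c → b ≠ d →
      ∀ s ∈ Icc (0:ℝ) 1, ∀ t ∈ Icc (0:ℝ) 1, γ a b s ≠ γ c d t) : HT G := by
  classical
  -- a common separation of independent arcs
  have h1 : ∀ᶠ ε in 𝓝[>] (0:ℝ), ∀ q : V × V × V × V, G.Adj q.1 q.2.1 →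
      G.Adj q.2.2.1 q.2.2.2 → q.1 ≠ q.2.2.1 → q.1 ≠ q.2.2.2 → q.2.1 ≠ q.2.2.1 →
      q.2.1 ≠ q.2.2.2 →
      ∀ s ∈ Icc (0:ℝ) 1, ∀ t ∈ Icc (0:ℝ) 1, ε ≤ dist (γ q.1 q.2.1 s) (γ q.2.2.1 q.2.2.2 t) := by
    rw [eventually_all]
    rintro ⟨a, b, c, d⟩
    by_cases hq : G.Adj a b ∧ G.Adj c d ∧ a ≠ c ∧ a ≠ d ∧ b ≠ c ∧ b ≠ d
    · obtain ⟨hab, hcd, h3, h4, h5, h6⟩ := hq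
      have hc : ContinuousOn (fun x : ℝ × ℝ => dist (γ a b x.1) (γ c d x.2))
          (Icc (0:ℝ) 1 ×ˢ Icc (0:ℝ) 1) :=
        continuous_dist.comp_continuousOn (.prodMk
          (ContinuousOn.comp (g := γ a b) (f := Prod.fst) (hγ a b hab).1 continuousOn_fst
            fun (x : ℝ × ℝ) hx => hx.1)
          (ContinuousOn.comp (g := γ c d) (f := Prod.snd) (hγ c d hcd).1 continuousOn_snd
            fun (x : ℝ × ℝ) hx => hx.2))
      obtain ⟨x, hx, hmin⟩ := (isCompact_Icc.prod isCompact_Icc).exists_isMinOn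
        ⟨((0:ℝ), (0:ℝ)), by simp⟩ hc
      have hpos : 0 < dist (γ a b x.1) (γ c d x.2) :=
        dist_pos.2 (hd a b c d hab hcd h3 h4 h5 h6 _ hx.1 _ hx.2)
      filter_upwards [Ioo_mem_nhdsGT hpos] with ε hε _ _ _ _ _ _ s hs t ht
      exact hε.2.le.trans (hmin (show (s, t) ∈ _ from ⟨hs, ht⟩))
    · refine Eventually.of_forall fun ε h1 h2 h3 h4 h5 h6 => absurd ⟨h1, h2, h3, h4, h5, h6⟩ hq
  obtain ⟨ε, hε, hε0⟩ := (h1.and self_mem_nhdsWithin).exists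
  replace hε0 : 0 < ε := hε0
  -- a common modulus of continuity
  have h2 : ∀ᶠ δ in 𝓝[>] (0:ℝ), ∀ q : V × V, G.Adj q.1 q.2 →
      ∀ s ∈ Icc (0:ℝ) 1, ∀ t ∈ Icc (0:ℝ) 1, dist s t ≤ δ →
        dist (γ q.1 q.2 s) (γ q.1 q.2 t) < ε / 4 := by
    rw [eventually_all]
    rintro ⟨a, b⟩
    by_cases hab : G.Adj a b
    · have hu := isCompact_Icc.uniformContinuousOn_of_continuous (hγ a b hab).1
      rw [Metric.uniformContinuousOn_iff] at hu
      obtain ⟨δ, hδ, H⟩ := hu (ε / 4) (by positivity)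
      filter_upwards [Ioo_mem_nhdsGT hδ] with δ' hδ' _ s hs t ht hst
      exact H s hs t ht (hst.trans_lt hδ'.2)
    · exact Eventually.of_forall fun δ h => absurd h hab
  obtain ⟨δ, hδ, hδ0⟩ := (h2.and self_mem_nhdsWithin).exists
  obtain ⟨n, hn⟩ := exists_nat_one_div_lt (show (0:ℝ) < δ from hδ0)
  set N := n + 1 with hN
  have hN0 : (0:ℝ) < N := by positivity
  have hN1 : (1:ℝ) / N < δ := by rw [hN]; push_cast; exact hn
  -- the perturbed points
  let q : V ⊕ (V × V × Fin (N + 1)) → Plane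
    | .inl v => z v
    | .inr (a, b, k) => γ a b ((k : ℕ) / N)
  let idx : V → V → ℕ → V ⊕ (V × V × Fin (N + 1)) := fun a b k =>
    if k = 0 then .inl a else if k = N then .inl b else .inr (a, b, Fin.ofNat (N + 1) k)
  have hidx0 : ∀ a b, idx a b 0 = .inl a := fun a b => by simp [idx]
  have hidxN : ∀ a b, idx a b N = .inl b := fun a b => by simp [idx, hN]
  have hidx : ∀ a b k, k ≠ 0 → k ≠ N → idx a b k = .inr (a, b, Fin.ofNat (N + 1) k) :=
    fun a b k h h' => by simp [idx, h, h']
  have hq : ∀ a b, G.Adj a b → ∀ k ≤ N, q (idx a b k) = γ a b ((k : ℕ) / N) := by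
    intro a b hab k hk
    by_cases h0 : k = 0
    · subst h0; rw [hidx0]; simp [q, (hγ a b hab).2.1]
    by_cases h0' : k = N
    · rw [h0', hidxN]; simp [q, (hγ a b hab).2.2]
    · rw [hidx a b k h0 h0']
      simp only [q, Fin.val_ofNat]
      rw [Nat.mod_eq_of_lt (by omega)]
  obtain ⟨y', hy', hyε⟩ := exists_injective_near (fun j => (q j).2)
    (show 0 < ε / 8 by positivity)
  let q' : V ⊕ (V × V × Fin (N + 1)) → Plane := fun j => ((q j).1, y' j)
  have hq' : ∀ j, dist (q' j) (q j) < ε / 8 := by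
    intro j
    rw [Prod.dist_eq]
    simp only [q', dist_self, Real.dist_eq]
    exact max_lt (by positivity) (hyε j)
  have hne : ∀ i j, i ≠ j → (q' i).2 ≠ (q' j).2 := fun i j hij h => hij (hy' h)
  refine ⟨fun v => y' (.inl v), fun a b h => by simpa using hy' h,
    fun a b c => ∑ i ∈ Finset.range N, rayInd (q' (idx a b i)) (q' (idx a b (i + 1)))
      (q' (.inl c)), ?_⟩
  intro a b c d hab hcd hac had hbc hbd
  have key := polyline_rel (P := fun i => q' (idx a b i)) (Q := fun i => q' (idx c d i)) N N ?_
  · simp only [hidx0, hidxN] at key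
    exact key
  intro i hi j hj
  have hstep : ∀ a b, a ≠ b → ∀ k < N, idx a b k ≠ idx a b (k + 1) := by
    intro a b hab k hk
    by_cases h0 : k = 0
    · subst h0
      rw [hidx0]
      by_cases h1 : 0 + 1 = N
      · rw [h1, hidxN]; simpa using hab
      · rw [hidx _ _ _ (by omega) h1]; simp
    · rw [hidx _ _ _ h0 (by omega)]
      by_cases h1 : k + 1 = N
      · rw [h1, hidxN]; simp
      · rw [hidx _ _ _ (by omega) h1]
        simp only [ne_eq, Sum.inr.injEq, Prod.mk.injEq, true_and, Fin.ext_iff, Fin.val_ofNat]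
        rw [Nat.mod_eq_of_lt (by omega), Nat.mod_eq_of_lt (by omega)]
        omega
  have hcross : ∀ k l, idx a b k ≠ idx c d l := by
    intro k l h
    have hf : ∀ a b k, idx a b k = .inl a ∨ idx a b k = .inl b ∨
        idx a b k = .inr (a, b, Fin.ofNat (N + 1) k) := by
      intro a b k
      simp only [idx]
      split_ifs
      · exact Or.inl rfl
      · exact Or.inr (Or.inl rfl)
      · exact Or.inr (Or.inr rfl)
    rcases hf a b k with h1 | h1 | h1 <;> rcases hf c d l with h2 | h2 | h2 <;>
      rw [h1, h2] at h <;> simp [hac, had, hbc, hbd] at h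
  have hball : ∀ a b, G.Adj a b → ∀ k < N,
      segment ℝ (q' (idx a b k)) (q' (idx a b (k + 1))) ⊆
        Metric.ball (γ a b ((k : ℕ) / N)) (3 * ε / 8) := by
    intro a b hab k hk
    apply (convex_ball _ _).segment_subset
    · rw [Metric.mem_ball, ← hq a b hab k hk.le]
      exact (hq' _).trans (by linarith)
    · rw [Metric.mem_ball]
      refine (dist_triangle _ (q (idx a b (k + 1))) _).trans_lt ?_
      rw [hq a b hab (k + 1) hk]
      have e1 := hq' (idx a b (k + 1))
      rw [hq a b hab (k + 1) hk] at e1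
      have hk' : (k : ℝ) + 1 ≤ N := by exact_mod_cast hk
      have e2 := hδ (a, b) hab (((k + 1 : ℕ) : ℝ) / N)
        ⟨by positivity, by rw [div_le_one hN0]; push_cast; exact hk'⟩ ((k : ℕ) / N)
        ⟨by positivity, by rw [div_le_one hN0]; linarith⟩ (by
          rw [Real.dist_eq, ← sub_div]
          push_cast
          rw [add_sub_cancel_left, abs_of_pos (by positivity)]
          exact hN1.le)
      simp only at e2
      linarith
  refine segRel_of_disjoint (hne _ _ (hstep a b hab.ne i hi)) (hne _ _ (hstep c d hcd.ne j hj))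
    (hne _ _ (hcross _ _)) (hne _ _ (hcross _ _)) (hne _ _ (hcross _ _)) (hne _ _ (hcross _ _)) ?_
  rw [Set.disjoint_left]
  intro x hx hx'
  have e1 := hball a b hab i hi hx
  have e2 := hball c d hcd j hj hx'
  rw [Metric.mem_ball] at e1 e2
  have hi' : (i : ℝ) ≤ N := by exact_mod_cast hi.le
  have hj' : (j : ℝ) ≤ N := by exact_mod_cast hj.le
  have e3 := hε (a, b, c, d) hab hcd hac had hbc hbd ((i : ℕ) / N)
    ⟨by positivity, by rw [div_le_one hN0]; exact hi'⟩ ((j : ℕ) / N)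
    ⟨by positivity, by rw [div_le_one hN0]; exact hj'⟩
  have e4 := dist_triangle_left (γ a b ((i : ℕ) / N)) (γ c d ((j : ℕ) / N)) x
  simp only at e3
  linarith

/-! ### Straight line drawings -/

/-- A straight line drawing in general position. -/
structure IsSL {V : Type*} (G : SimpleGraph V) (p : V → Plane) : Prop where
  inj : Function.Injective p
  gen : ∀ a b c, a ≠ b → a ≠ c → b ≠ c → det3 (p a) (p b) (p c) ≠ 0
  nocross : ∀ a b c d, G.Adj a b → G.Adj c d → a ≠ c → a ≠ d → b ≠ c → b ≠ d →
    ¬ SegCross (p a) (p b) (p c) (p d)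

theorem det3_combo (a b c d : Plane) (t : ℝ) :
    det3 a b ((1 - t) • c + t • d) = (1 - t) * det3 a b c + t * det3 a b d := by
  simp only [det3, Prod.fst_add, Prod.snd_add, Prod.smul_fst, Prod.smul_snd, smul_eq_mul]; ring

theorem det3_mul_neg_of_mem {a b c d x : Plane} (hx : x ∈ segment ℝ a b)
    (hx' : x ∈ segment ℝ c d) (h1 : det3 a b c ≠ 0) (h2 : det3 a b d ≠ 0) :
    det3 a b c * det3 a b d < 0 := by
  rw [segment_eq_image] at hx hx'
  obtain ⟨s, hs, rfl⟩ := hx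
  obtain ⟨t, ht, he⟩ := hx'
  have e1 : det3 a b ((1 - s) • a + s • b) = 0 := by
    rw [det3_combo]; simp only [det3]; ring
  simp only at he
  rw [← he, det3_combo] at e1
  by_contra hcon
  have hpos : 0 < det3 a b c * det3 a b d :=
    lt_of_le_of_ne (not_lt.1 hcon) (mul_ne_zero h1 h2).symm
  rcases mul_pos_iff.1 hpos with ⟨h3, h4⟩ | ⟨h3, h4⟩
  · rcases eq_or_lt_of_le ht.1 with h | h
    · rw [← h] at e1; linarith
    · nlinarith [mul_pos h h4, mul_nonneg (sub_nonneg.2 ht.2) h3.le]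
  · rcases eq_or_lt_of_le ht.1 with h | h
    · rw [← h] at e1; linarith
    · nlinarith [mul_neg_of_pos_of_neg h h4, mul_nonpos_of_nonneg_of_nonpos (sub_nonneg.2 ht.2) h3.le]

theorem disjoint_of_not_segCross {a b c d : Plane} (h1 : det3 a b c ≠ 0) (h2 : det3 a b d ≠ 0)
    (h3 : det3 c d a ≠ 0) (h4 : det3 c d b ≠ 0) (h : ¬ SegCross a b c d) :
    Disjoint (segment ℝ a b) (segment ℝ c d) := by
  rw [Set.disjoint_left]
  intro x hx hx'
  exact h ⟨det3_mul_neg_of_mem hx hx' h1 h2, det3_mul_neg_of_mem hx' hx h3 h4⟩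

theorem IsSL.disjoint {V : Type*} {G : SimpleGraph V} {p : V → Plane} (hp : IsSL G p)
    {a b c d : V} (hab : G.Adj a b) (hcd : G.Adj c d) (hac : a ≠ c) (had : a ≠ d) (hbc : b ≠ c)
    (hbd : b ≠ d) : Disjoint (segment ℝ (p a) (p b)) (segment ℝ (p c) (p d)) :=
  disjoint_of_not_segCross (hp.gen _ _ _ hab.ne hac hbc) (hp.gen _ _ _ hab.ne had hbd)
    (hp.gen _ _ _ hcd.ne hac.symm had.symm) (hp.gen _ _ _ hcd.ne hbc.symm hbd.symm)
    (hp.nocross _ _ _ _ hab hcd hac had hbc hbd)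

/-- The parity data of a straight line drawing with distinct heights. -/
theorem IsSL.htData {V : Type*} {G : SimpleGraph V} {p : V → Plane} (hp : IsSL G p)
    (hy : Function.Injective fun v => (p v).2) :
    HTData G (fun v => (p v).2) fun a b c => rayInd (p a) (p b) (p c) := by
  intro a b c d hab hcd hac had hbc hbd
  exact segRel_of_disjoint (hy.ne hab.ne) (hy.ne hcd.ne) (hy.ne hac) (hy.ne had) (hy.ne hbc)
    (hy.ne hbd) (hp.disjoint hab hcd hac had hbc hbd)

theorem IsSL.ht {V : Type*} [Finite V] {G : SimpleGraph V} {p : V → Plane} (hp : IsSL G p) :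
    HT G := by
  refine HT.of_arcs p (fun a b t => (1 - t) • p a + t • p b) (fun a b _ => ⟨?_, by simp, by simp⟩) ?_
  · fun_prop
  intro a b c d hab hcd hac had hbc hbd s hs t ht he
  refine Set.disjoint_left.1 (hp.disjoint hab hcd hac had hbc hbd)
    (show (1 - s) • p a + s • p b ∈ _ from ?_) ?_
  · rw [segment_eq_image]; exact ⟨s, hs, rfl⟩
  · rw [he, segment_eq_image]; exact ⟨t, ht, rfl⟩

/-! ### Connectivity and contractions -/

/-- The neighbours of `C` lie in `C ∪ S`. -/
def ClosedIn {V : Type*} (G : SimpleGraph V) (C S : Set V) : Prop :=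
  ∀ x ∈ C, ∀ y, G.Adj x y → y ∈ C ∨ y ∈ S

/-- Two-connectedness. -/
def Conn2 {V : Type*} (G : SimpleGraph V) : Prop :=
  3 ≤ Nat.card V ∧ ∀ (C : Set V) (s : V), C.Nonempty → s ∉ C → ClosedIn G C {s} →
    ∀ v, v ∈ C ∨ v = s

/-- Three-connectedness. -/
def Conn3 {V : Type*} (G : SimpleGraph V) : Prop :=
  4 ≤ Nat.card V ∧ ∀ (C : Set V) (s t : V), C.Nonempty → s ∉ C → t ∉ C → ClosedIn G C {s, t} →
    ∀ v, v ∈ C ∨ v = s ∨ v = t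

theorem ClosedIn.compl {V : Type*} {G : SimpleGraph V} {C S : Set V} (h : ClosedIn G C S) :
    ClosedIn G (C ∪ S)ᶜ S := by
  intro x hx y hxy
  by_contra hc
  simp only [mem_compl_iff, mem_union, not_or] at hx hc
  rcases h y (by tauto) x hxy.symm with h | h <;> tauto

/-- The contraction of `v` into `u`. -/
def contr {V : Type*} (G : SimpleGraph V) (u v : V) : SimpleGraph {w : V // w ≠ v} where
  Adj a b := a ≠ b ∧ (G.Adj a b ∨ (a.1 = u ∧ G.Adj v b) ∨ (b.1 = u ∧ G.Adj v a))
  symm := ⟨fun a b h => ⟨h.1.symm, by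
    rcases h.2 with h | h | h
    · exact Or.inl h.symm
    · exact Or.inr (Or.inr h)
    · exact Or.inr (Or.inl h)⟩⟩
  loopless := ⟨fun a h => h.1 rfl⟩

theorem contr_adj_of_adj {V : Type*} {G : SimpleGraph V} {u v : V} {a b : {w : V // w ≠ v}}
    (h : G.Adj a b) : (contr G u v).Adj a b :=
  ⟨fun e => h.ne (congrArg _ e), Or.inl h⟩

theorem card_ne_lt {V : Type*} [Finite V] (v : V) :
    Nat.card {w : V // w ≠ v} + 1 = Nat.card V := by
  have h := ncard_sdiff_singleton_add_one (mem_univ v) (toFinite _)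
  rw [ncard_univ] at h
  rw [← h, ← Nat.card_coe_set_eq]
  congr 1
  exact Nat.card_congr (Equiv.subtypeEquivRight fun w => by simp)

theorem HT.contr {V : Type*} {G : SimpleGraph V} (h : HT G) {u v : V} (huv : G.Adj u v) :
    HT (contr G u v) := by
  refine h.minor_of_connOn (fun i => {x | x = i.1 ∨ (i.1 = u ∧ x = v)}) (fun i => ⟨i, Or.inl rfl⟩)
    ?_ ?_ ?_
  · rintro i j hij x hx hx'
    have h1 := i.2
    have h2 := j.2
    apply hij
    ext
    rcases hx with hx | hx <;> rcases hx' with hx' | hx'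
    · rw [← hx, hx']
    · exact absurd (hx.symm.trans hx'.2) h1
    · exact absurd (hx'.symm.trans hx.2) h2
    · rw [hx.1, hx'.1]
  · intro i a ha b hb
    rcases ha with rfl | ⟨hi, rfl⟩ <;> rcases hb with rfl | ⟨hi', rfl⟩
    · exact .refl (Or.inl rfl)
    · exact .of_adj (hi' ▸ huv) (Or.inl rfl) (Or.inr ⟨hi', rfl⟩)
    · exact .of_adj (hi ▸ huv.symm) (Or.inr ⟨hi, rfl⟩) (Or.inl rfl)
    · exact .refl (Or.inr ⟨hi, rfl⟩)
  · rintro i j ⟨-, h | ⟨h1, h2⟩ | ⟨h1, h2⟩⟩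
    · exact ⟨i, Or.inl rfl, j, Or.inl rfl, h⟩
    · exact ⟨v, Or.inr ⟨h1, rfl⟩, j, Or.inl rfl, h2⟩
    · exact ⟨i, Or.inl rfl, v, Or.inr ⟨h1, rfl⟩, h2.symm⟩

/-- A set of at most two vertices is not the whole of a large type. -/
theorem exists_ne_pair {V : Type*} [Finite V] (h : 3 ≤ Nat.card V) (a b : V) :
    ∃ c, c ≠ a ∧ c ≠ b := by
  by_contra hc
  push Not at hc
  have h1 : (univ : Set V) ⊆ {a, b} := fun x _ => by
    by_cases hx : x = a
    · exact Or.inl hx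
    · exact Or.inr (hc x hx)
  have h2 := ncard_le_ncard h1 (toFinite _)
  rw [ncard_univ] at h2
  have h3 : ({a, b} : Set V).ncard ≤ 1 + 1 := by
    simpa using ncard_insert_le a {b}
  omega

theorem exists_ne_triple {V : Type*} [Finite V] (h : 4 ≤ Nat.card V) (a b c : V) :
    ∃ d, d ≠ a ∧ d ≠ b ∧ d ≠ c := by
  by_contra hc
  push Not at hc
  have h1 : (univ : Set V) ⊆ {a, b, c} := fun x _ => by
    by_cases hx : x = a
    · exact Or.inl hx
    by_cases hx' : x = b
    · exact Or.inr (Or.inl hx')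
    · exact Or.inr (Or.inr (hc x hx hx'))
  have h2 := ncard_le_ncard h1 (toFinite _)
  rw [ncard_univ] at h2
  have h3 : ({a, b, c} : Set V).ncard ≤ 3 := by
    refine (ncard_insert_le _ _).trans ?_
    have : ({b, c} : Set V).ncard ≤ 1 + 1 := by
      simpa using ncard_insert_le b {c}
    omega
  omega

theorem Conn2.exists_adj {V : Type*} [Finite V] {G : SimpleGraph V} (h : Conn2 G) (w s : V)
    (hs : s ≠ w) : ∃ x, x ≠ s ∧ G.Adj w x := by
  by_contra hc
  push Not at hc
  obtain ⟨c, hc1, hc2⟩ := exists_ne_pair h.1 w s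
  rcases h.2 {w} s ⟨w, rfl⟩ hs (fun x hx y hxy => Or.inr (by
    by_contra hy
    exact hc y hy (hx ▸ hxy))) c with h | h
  · exact hc1 h
  · exact hc2 h

theorem Conn2.edge_dichotomy {V : Type*} [Finite V] {K : SimpleGraph V} (h : Conn2 K) {w x : V}
    (hwx : K.Adj w x) (hcard : 4 ≤ Nat.card V) :
    Conn2 (K.deleteEdges {s(w, x)}) ∨ Conn2 (contr K x w) := by
  by_contra hcon
  obtain ⟨hA, hB⟩ := not_or.1 hcon
  have hcw := card_ne_lt w
  -- a cut `{w, x}`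
  have h1 : ∃ C : Set V, C.Nonempty ∧ w ∉ C ∧ x ∉ C ∧ ClosedIn K C {w, x} ∧
      ∃ v, v ∉ C ∧ v ≠ w ∧ v ≠ x := by
    unfold Conn2 at hB
    simp only [not_and_or, not_forall, not_or] at hB
    rcases hB with hB | ⟨C, s, hC, hs, hcl, v, hv, hvs⟩
    · omega
    have hxw : x ≠ w := hwx.ne'
    by_cases hsx : s.1 = x
    · refine ⟨Subtype.val '' C, hC.image _, ?_, ?_, ?_, v.1, ?_, v.2, ?_⟩
      · rintro ⟨a, -, ha⟩; exact a.2 ha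
      · rintro ⟨a, ha, ha'⟩
        exact hs ((Subtype.ext (ha'.trans hsx.symm) : a = s) ▸ ha)
      · rintro _ ⟨a, ha, rfl⟩ y hay
        by_cases hyw : y = w
        · exact Or.inr (Or.inl hyw)
        rcases hcl a ha ⟨y, hyw⟩ (contr_adj_of_adj hay) with h | h
        · exact Or.inl ⟨_, h, rfl⟩
        · exact Or.inr (Or.inr ((congrArg Subtype.val h).trans hsx))
      · rintro ⟨a, ha, ha'⟩; exact hv (Subtype.ext ha' ▸ ha)
      · exact fun e => hvs (Subtype.ext (e.trans hsx.symm))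
    exfalso
    by_cases hxC : (⟨x, hxw⟩ : {z // z ≠ w}) ∈ C
    · have hor := h.2 (insert w (Subtype.val '' C)) s.1 ⟨w, mem_insert _ _⟩ ?_ ?_ v.1
      rcases hor with h' | h'
      · rcases h' with h' | ⟨a, ha, ha'⟩
        · exact v.2 h'
        · exact hv (Subtype.ext ha' ▸ ha)
      · exact hvs (Subtype.ext h')
      · rintro (h' | ⟨a, ha, ha'⟩)
        · exact s.2 h'
        · exact hs (Subtype.ext ha' ▸ ha)
      · rintro a ha y hay
        by_cases hyw : y = w
        · exact Or.inl (Or.inl hyw)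
        have : (⟨y, hyw⟩ : {z // z ≠ w}) ∈ C ∨ (⟨y, hyw⟩ : {z // z ≠ w}) ∈ ({s} : Set _) := by
          rcases ha with rfl | ⟨a, ha, rfl⟩
          · by_cases hyx : y = x
            · subst hyx; exact Or.inl hxC
            · exact hcl _ hxC ⟨y, hyw⟩ ⟨fun e => hyx (congrArg Subtype.val e).symm,
                Or.inr (Or.inl ⟨rfl, hay⟩)⟩
          · exact hcl a ha ⟨y, hyw⟩ (contr_adj_of_adj hay)
        rcases this with h | h
        · exact Or.inl (Or.inr ⟨_, h, rfl⟩)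
        · exact Or.inr (congrArg Subtype.val h)
    · have hor := h.2 (Subtype.val '' C) s.1 (hC.image _) ?_ ?_ v.1
      rcases hor with h' | h'
      · obtain ⟨a, ha, ha'⟩ := h'
        exact hv (Subtype.ext ha' ▸ ha)
      · exact hvs (Subtype.ext h')
      · rintro ⟨a, ha, ha'⟩
        exact hs (Subtype.ext ha' ▸ ha)
      · rintro _ ⟨a, ha, rfl⟩ y hay
        by_cases hyw : y = w
        · exfalso
          subst hyw
          rcases hcl a ha ⟨x, hxw⟩ ⟨fun e => hxC (e ▸ ha), Or.inr (Or.inr ⟨rfl, hay.symm⟩)⟩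
            with h | h
          · exact hxC h
          · exact hsx (congrArg Subtype.val h).symm
        rcases hcl a ha ⟨y, hyw⟩ (contr_adj_of_adj hay) with h | h
        · exact Or.inl ⟨_, h, rfl⟩
        · exact Or.inr (congrArg Subtype.val h)
  -- a cut vertex `q` after deleting the edge
  have h2 : ∃ (P : Set V) (q : V), q ∉ P ∧ ClosedIn (K.deleteEdges {s(w, x)}) P {q} ∧
      ((w ∈ P ∧ x ∉ P ∧ x ≠ q) ∨ (x ∈ P ∧ w ∉ P ∧ w ≠ q)) := by
    unfold Conn2 at hA
    simp only [not_and_or, not_forall, not_or] at hA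
    rcases hA with hA | ⟨P, q, hP, hq, hcl, v, hv, hvq⟩
    · exact absurd h.1 hA
    refine ⟨P, q, hq, hcl, ?_⟩
    by_contra hno
    have hor := h.2 P q hP hq (fun a ha y hay => ?_) v
    rcases hor with h | h
    · exact hv h
    · exact hvq h
    by_cases he : s(a, y) = s(w, x)
    · rcases Sym2.eq_iff.1 he with ⟨rfl, rfl⟩ | ⟨rfl, rfl⟩ <;>
      · simp only [mem_singleton_iff]
        tauto
    · exact hcl a ha y (by simp [hay, he])
  obtain ⟨C, hC, hwC, hxC, hCcl, v, hvC, hvw, hvx⟩ := h1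
  obtain ⟨P, q, hqP, hPcl, hwx'⟩ := h2
  have hqw : q ≠ w := by
    rintro rfl
    rcases hwx' with h | h
    · exact hqP h.1
    · exact h.2.2 rfl
  have hqx : q ≠ x := by
    rintro rfl
    rcases hwx' with h | h
    · exact h.2.2 rfl
    · exact hqP h.1
  -- one side of the cut avoids `q`
  obtain ⟨X, hX, hwX, hxX, hqX, hXcl⟩ : ∃ X : Set V, X.Nonempty ∧ w ∉ X ∧ x ∉ X ∧ q ∉ X ∧
      ClosedIn K X {w, x} := by
    by_cases hqC : q ∈ C
    · exact ⟨(C ∪ {w, x})ᶜ, ⟨v, by simp [hvC, hvw, hvx]⟩, by simp, by simp, by simp [hqC],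
        hCcl.compl⟩
    · exact ⟨C, hC, hwC, hxC, hqC, hCcl⟩
  have hdel : ∀ a ∈ X, ∀ y, K.Adj a y → (K.deleteEdges {s(w, x)}).Adj a y := by
    intro a ha y hay
    simp only [SimpleGraph.deleteEdges_adj, hay, mem_singleton_iff, true_and]
    intro he
    rcases Sym2.eq_iff.1 he with ⟨rfl, rfl⟩ | ⟨rfl, rfl⟩
    · exact hwX ha
    · exact hxX ha
  have hPcl' := hPcl.compl
  obtain ⟨b, hb⟩ := hX
  have fin : ∀ (P' : Set V) (a : V), b ∈ P' → a ∉ X → a ≠ q → q ∉ P' →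
      ClosedIn (K.deleteEdges {s(w, x)}) P' {q} →
      (∀ y, y = w ∨ y = x → y ∈ P' → y = a) → False := by
    intro P' a hbP haX haq hqP' hcl hside
    have hor := h.2 (X ∩ P') a ⟨b, hb, hbP⟩ (fun h => haX h.1) (fun z hz y hzy => ?_) q
    rcases hor with h | h
    · exact hqX h.1
    · exact haq h.symm
    have e1 := hXcl z hz.1 y hzy
    have e2 := hcl z hz.2 y (hdel z hz.1 y hzy)
    simp only [mem_singleton_iff, mem_insert_iff] at e1 e2 ⊢
    rcases e2 with e2 | rfl
    · rcases e1 with e1 | e1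
      · exact Or.inl ⟨e1, e2⟩
      · exact Or.inr (hside y e1 e2)
    · rcases e1 with e1 | e1 | e1
      · exact absurd e1 hqX
      · exact absurd e1 hqw
      · exact absurd e1 hqx
  have hbq : b ≠ q := fun e => hqX (e ▸ hb)
  have hmem : ∀ y, y ∈ (P ∪ {q})ᶜ ↔ y ∉ P ∧ y ≠ q := fun y => by simp [and_comm]
  by_cases hbP : b ∈ P
  · rcases hwx' with ⟨h1, h2, -⟩ | ⟨h1, h2, -⟩
    · refine fin P w hbP hwX hqw.symm hqP hPcl ?_
      rintro y (rfl | rfl) hy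
      · rfl
      · exact absurd hy h2
    · refine fin P x hbP hxX hqx.symm hqP hPcl ?_
      rintro y (rfl | rfl) hy
      · exact absurd hy h2
      · rfl
  · rcases hwx' with ⟨h1, h2, -⟩ | ⟨h1, h2, -⟩
    · refine fin (P ∪ {q})ᶜ x ((hmem b).2 ⟨hbP, hbq⟩) hxX hqx.symm (by simp) hPcl' ?_
      rintro y (rfl | rfl) hy
      · exact absurd h1 ((hmem _).1 hy).1
      · rfl
    · refine fin (P ∪ {q})ᶜ w ((hmem b).2 ⟨hbP, hbq⟩) hwX hqw.symm (by simp) hPcl' ?_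
      rintro y (rfl | rfl) hy
      · rfl
      · exact absurd h1 ((hmem _).1 hy).1

/-- A two-connected graph retracts onto any set `T` of at least three vertices, with connected
fibres and a two-connected quotient. -/
theorem Conn2.exists_retraction {V : Type*} [Finite V] {K : SimpleGraph V} (h : Conn2 K)
    (T : Set V) (hT : 3 ≤ T.ncard) :
    ∃ f : V → V, (∀ v, f v ∈ T) ∧ (∀ t ∈ T, f t = t) ∧
      (∀ v, ReachIn K {x | f x = f v} v (f v)) ∧
      ∀ (C : Set V) (s : V), (∃ t, f t ∈ C) → s ∈ T → s ∉ C →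
        (∀ x y, K.Adj x y → f x ∈ C → f y ∈ C ∨ f y = s) → ∀ v, f v ∈ C ∨ f v = s := by
  induction hn : Nat.card V using Nat.strong_induction_on generalizing V with
  | _ n ih =>
  induction hm : K.edgeSet.ncard using Nat.strong_induction_on generalizing K with
  | _ m ih' =>
    by_cases hTu : ∀ w, w ∈ T
    · refine ⟨id, hTu, fun _ _ => rfl, fun v => .refl rfl, ?_⟩
      rintro C s ⟨t, ht⟩ - hs hC v
      exact h.2 C s ⟨t, ht⟩ hs (fun x hx y hxy => hC x y hxy hx) v
    push Not at hTu
    obtain ⟨w, hw⟩ := hTu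
    obtain ⟨s, hs, -⟩ := exists_ne_pair h.1 w w
    obtain ⟨x, -, hwx⟩ := h.exists_adj w s hs
    have hcard : 4 ≤ Nat.card V := by
      have h1 : (insert w T).ncard = T.ncard + 1 := ncard_insert_of_notMem hw (toFinite _)
      have h2 : (insert w T).ncard ≤ Nat.card V := by
        rw [← ncard_univ]; exact ncard_le_ncard (subset_univ _) (toFinite _)
      omega
    rcases h.edge_dichotomy hwx hcard with h1 | h1
    · have hlt : (K.deleteEdges {s(w, x)}).edgeSet.ncard < m := by
        rw [← hm]
        apply ncard_lt_ncard _ (toFinite _)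
        rw [SimpleGraph.edgeSet_deleteEdges]
        exact ⟨sdiff_subset, fun hsub => (hsub (show s(w, x) ∈ K.edgeSet from hwx)).2 rfl⟩
      obtain ⟨f, hf1, hf2, hf3, hf4⟩ := ih' _ hlt h1 rfl
      refine ⟨f, hf1, hf2, fun v => (hf3 v).mono_graph (SimpleGraph.deleteEdges_le _), ?_⟩
      intro C s hC hsT hs hcl
      exact hf4 C s hC hsT hs fun a b hab => hcl a b (SimpleGraph.deleteEdges_le _ hab)
    · have hxw : x ≠ w := hwx.ne'
      have e1 := card_ne_lt w
      have hT' : 3 ≤ (Subtype.val ⁻¹' T : Set {z // z ≠ w}).ncard := by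
        rw [ncard_preimage_of_injective_subset_range Subtype.val_injective]
        · exact hT
        · intro t ht
          exact ⟨⟨t, fun e => hw (e ▸ ht)⟩, rfl⟩
      obtain ⟨f, hf1, hf2, hf3, hf4⟩ := ih _ (by omega) h1 _ hT' rfl
      classical
      let F : V → V := fun v => if hv : v = w then (f ⟨x, hxw⟩).1 else (f ⟨v, hv⟩).1
      have Fw : F w = F x := by simp [F, hxw]
      have Fs : ∀ v : {z // z ≠ w}, F v.1 = (f v).1 := fun v => by simp [F, v.2]
      have hadj : ∀ a b, (contr K x w).Adj a b → K.Adj a b ∨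
          (K.Adj a w ∧ K.Adj w b ∧ F a.1 = F w) ∨ (K.Adj a w ∧ K.Adj w b ∧ F b.1 = F w) := by
        rintro a b ⟨-, h | ⟨h, h'⟩ | ⟨h, h'⟩⟩
        · exact Or.inl h
        · exact Or.inr (Or.inl ⟨h ▸ hwx.symm, h', by rw [Fw, h]⟩)
        · exact Or.inr (Or.inr ⟨h'.symm, h ▸ hwx, by rw [Fw, h]⟩)
      have hreach : ∀ v : {z // z ≠ w}, ReachIn K {y | F y = F v.1} v.1 (F v.1) := by
        intro v
        have hmem : ∀ y : {z // z ≠ w}, f y = f v → y.1 ∈ {y | F y = F v.1} := by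
          intro y hy
          change F y = F v.1
          rw [Fs, Fs, hy]
        have := (hf3 v).map (H := K) (R := {y | F y = F v.1}) Subtype.val (fun y hy => hmem y hy) ?_
        · rw [← Fs] at this; exact this
        · rintro a b hab ha hb
          have ha' := hmem a ha
          have hb' := hmem b hb
          rcases hadj a b hab with h | ⟨h, h', h3⟩ | ⟨h, h', h3⟩
          · exact .of_adj h ha' hb'
          · exact (ReachIn.of_adj h ha' (show F w = _ from h3 ▸ ha')).tail h' hb'
          · exact (ReachIn.of_adj h ha' (show F w = _ from h3 ▸ hb')).tail h' hb'
      refine ⟨F, ?_, ?_, ?_, ?_⟩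
      · intro v
        by_cases hv : v = w
        · rw [hv, Fw, Fs ⟨x, hxw⟩]; exact hf1 _
        · rw [Fs ⟨v, hv⟩]; exact hf1 _
      · intro t ht
        have htw : t ≠ w := fun e => hw (e ▸ ht)
        rw [Fs ⟨t, htw⟩, hf2 ⟨t, htw⟩ ht]
      · intro v
        by_cases hv : v = w
        · subst hv
          have := hreach ⟨x, hxw⟩
          simp only [← Fw] at this
          exact (ReachIn.of_adj hwx (show F v = F v from rfl) (show F x = F v from Fw.symm)).trans
            this
        · exact hreach ⟨v, hv⟩
      · intro C s hC hsT hs hcl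
        have hsw : s ≠ w := fun e => hw (e ▸ hsT)
        have key : ∀ v : {z // z ≠ w}, F v.1 ∈ C ∨ F v.1 = s := by
          intro v
          have hor := hf4 (Subtype.val ⁻¹' C) ⟨s, hsw⟩ ?_ hsT hs ?_ v
          rcases hor with h | h
          · rw [Fs]; exact Or.inl h
          · rw [Fs, h]; exact Or.inr rfl
          · obtain ⟨t, ht⟩ := hC
            by_cases htw : t = w
            · refine ⟨⟨x, hxw⟩, ?_⟩
              rw [htw, Fw, Fs ⟨x, hxw⟩] at ht
              exact ht
            · refine ⟨⟨t, htw⟩, ?_⟩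
              rw [Fs ⟨t, htw⟩] at ht
              exact ht
          · intro a b hab ha
            have ha' : F a.1 ∈ C := by rw [Fs]; exact ha
            have hb' : F b.1 ∈ C ∨ F b.1 = s := by
              rcases hadj a b hab with h | ⟨h, h', h3⟩ | ⟨h, h', h3⟩
              · exact hcl _ _ h ha'
              · exact hcl _ _ h' (h3 ▸ ha')
              · rw [h3]; exact hcl _ _ h ha'
            rw [Fs] at hb'
            exact hb'.imp id Subtype.ext
        intro v
        by_cases hv : v = w
        · rw [hv, Fw]; exact key ⟨x, hxw⟩
        · exact key ⟨v, hv⟩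

/-- Two fibres of `f` are joined by an edge. -/
def FibAdj {V : Type*} (K : SimpleGraph V) (f : V → V) (s t : V) : Prop :=
  ∃ x y, K.Adj x y ∧ f x = s ∧ f y = t

theorem FibAdj.symm {V : Type*} {K : SimpleGraph V} {f : V → V} {s t : V}
    (h : FibAdj K f s t) : FibAdj K f t s := by
  obtain ⟨x, y, h, h1, h2⟩ := h
  exact ⟨y, x, h.symm, h2, h1⟩

theorem exists_retraction_degree {V : Type*} [Finite V] {K : SimpleGraph V} (h : Conn2 K)
    (T : Set V) (hT : 3 ≤ T.ncard) :
    ∃ f : V → V, (∀ t ∈ T, f t = t) ∧ (∀ v, ReachIn K {x | f x = f v} v (f v)) ∧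
      ∀ t ∈ T, ∀ s ∈ T, s ≠ t → ∃ t' ∈ T, t' ≠ t ∧ t' ≠ s ∧ FibAdj K f t t' := by
  obtain ⟨f, hf1, hf2, hf3, hf4⟩ := h.exists_retraction T hT
  refine ⟨f, hf2, hf3, fun t ht s hs hst => ?_⟩
  by_contra hcon
  push Not at hcon
  have hall := hf4 {t} s ⟨t, hf2 t ht⟩ hs hst fun x y hxy hx => by
    by_contra hy
    rw [not_or] at hy
    exact hcon (f y) (hf1 y) hy.1 hy.2 ⟨x, y, hxy, hx, rfl⟩
  have hsub : T ⊆ {t, s} := by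
    intro z hz
    have := hall z
    rwa [hf2 z hz] at this
  have e1 := ncard_le_ncard hsub (toFinite _)
  have e2 : ({t, s} : Set V).ncard ≤ 1 + 1 := by
    simpa using ncard_insert_le t {s}
  omega

theorem exists_retraction_three {V : Type*} [Finite V] {K : SimpleGraph V} (h : Conn2 K)
    {a b c : V} (hab : a ≠ b) (hac : a ≠ c) (hbc : b ≠ c) :
    ∃ f : V → V, f a = a ∧ f b = b ∧ f c = c ∧ (∀ v, ReachIn K {x | f x = f v} v (f v)) ∧
      FibAdj K f a b ∧ FibAdj K f a c ∧ FibAdj K f b c := by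
  have hT : ({a, b, c} : Set V).ncard = 3 := by
    rw [ncard_eq_three]; exact ⟨a, b, c, hab, hac, hbc, rfl⟩
  obtain ⟨f, h1, h2, h3⟩ := exists_retraction_degree h {a, b, c} hT.ge
  refine ⟨f, h1 a (by simp), h1 b (by simp), h1 c (by simp), h2, ?_, ?_, ?_⟩
  · obtain ⟨t, ht, h4, h5, h6⟩ := h3 a (by simp) c (by simp) hac.symm
    rcases ht with rfl | rfl | rfl <;> tauto
  · obtain ⟨t, ht, h4, h5, h6⟩ := h3 a (by simp) b (by simp) hab.symm
    rcases ht with rfl | rfl | rfl <;> tauto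
  · obtain ⟨t, ht, h4, h5, h6⟩ := h3 b (by simp) a (by simp) hab
    rcases ht with rfl | rfl | rfl <;> tauto

theorem exists_retraction_four {V : Type*} [Finite V] {K : SimpleGraph V} (h : Conn2 K)
    {a b c d : V} (hab : a ≠ b) (hac : a ≠ c) (had : a ≠ d) (hbc : b ≠ c) (hbd : b ≠ d)
    (hcd : c ≠ d) :
    ∃ f : V → V, f a = a ∧ f b = b ∧ f c = c ∧ f d = d ∧
      (∀ v, ReachIn K {x | f x = f v} v (f v)) ∧
      ((FibAdj K f a b ∧ FibAdj K f c d) ∨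
        (FibAdj K f a c ∧ FibAdj K f a d ∧ FibAdj K f b c ∧ FibAdj K f b d)) := by
  have hT : ({a, b, c, d} : Set V).ncard = 4 := by
    rw [ncard_insert_of_notMem (by simp [hab, hac, had]) (toFinite _)]
    have : ({b, c, d} : Set V).ncard = 3 := by
      rw [ncard_eq_three]; exact ⟨b, c, d, hbc, hbd, hcd, rfl⟩
    omega
  obtain ⟨f, h1, h2, h3⟩ := exists_retraction_degree h {a, b, c, d} (by omega)
  refine ⟨f, h1 a (by simp), h1 b (by simp), h1 c (by simp), h1 d (by simp), h2, ?_⟩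
  have sy : ∀ {s t}, FibAdj K f s t → FibAdj K f t s := fun h => h.symm
  have key : ∀ t ∈ ({a, b, c, d} : Set V), ∀ s ∈ ({a, b, c, d} : Set V), s ≠ t →
      (a ≠ t ∧ a ≠ s ∧ FibAdj K f t a) ∨ (b ≠ t ∧ b ≠ s ∧ FibAdj K f t b) ∨
      (c ≠ t ∧ c ≠ s ∧ FibAdj K f t c) ∨ (d ≠ t ∧ d ≠ s ∧ FibAdj K f t d) := by
    intro t ht s hs hst
    obtain ⟨t', ht', h4, h5, h6⟩ := h3 t ht s hs hst
    rcases ht' with rfl | rfl | rfl | rfl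
    · exact Or.inl ⟨h4, h5, h6⟩
    · exact Or.inr (Or.inl ⟨h4, h5, h6⟩)
    · exact Or.inr (Or.inr (Or.inl ⟨h4, h5, h6⟩))
    · exact Or.inr (Or.inr (Or.inr ⟨h4, h5, h6⟩))
  by_cases hAB : FibAdj K f a b
  · by_cases hCD : FibAdj K f c d
    · exact Or.inl ⟨hAB, hCD⟩
    · right
      have k1 := key c (by simp) a (by simp) hac
      have k2 := key c (by simp) b (by simp) hbc
      have k3 := key d (by simp) a (by simp) had
      have k4 := key d (by simp) b (by simp) hbd
      have hDC : ¬ FibAdj K f d c := fun h => hCD h.symm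
      clear h3 h2 h1 key h hT 
      refine ⟨sy ?_, sy ?_, sy ?_, sy ?_⟩
      · clear k1 k3 k4; simp_all
      · clear k1 k2 k3; simp_all
      · clear k2 k3 k4; simp_all
      · clear k1 k2 k4; simp_all
  · right
    have k1 := key a (by simp) c (by simp) hac.symm
    have k2 := key a (by simp) d (by simp) had.symm
    have k3 := key b (by simp) c (by simp) hbc.symm
    have k4 := key b (by simp) d (by simp) hbd.symm
    have hBA : ¬ FibAdj K f b a := fun h => hAB h.symm
    clear h3 h2 h1 key h hT
    refine ⟨?_, ?_, ?_, ?_⟩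
    · clear k1 k3 k4; simp_all
    · clear k2 k3 k4; simp_all
    · clear k1 k2 k3; simp_all
    · clear k1 k2 k4; simp_all

/-! ### The rotation at a vertex -/

/-- The angle of a vector. -/
def ang (q : Plane) : ℝ := Complex.arg ⟨q.1, q.2⟩

theorem ang_spec {q : Plane} (h : q ≠ 0) :
    ∃ r : ℝ, 0 < r ∧ q = (r * Real.cos (ang q), r * Real.sin (ang q)) := by
  have h0 : (⟨q.1, q.2⟩ : ℂ) ≠ 0 := by
    intro e
    exact h (Prod.ext (congrArg Complex.re e) (congrArg Complex.im e))
  refine ⟨‖(⟨q.1, q.2⟩ : ℂ)‖, norm_pos_iff.2 h0, ?_⟩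
  unfold ang
  rw [Complex.norm_mul_cos_arg, Complex.norm_mul_sin_arg]

theorem ang_mem (q : Plane) : -Real.pi < ang q ∧ ang q ≤ Real.pi :=
  ⟨Complex.neg_pi_lt_arg _, Complex.arg_le_pi _⟩

/-- The determinant of two vectors. -/
def det2 (q q' : Plane) : ℝ := q.1 * q'.2 - q.2 * q'.1

theorem det3_eq_det2 (a b c : Plane) : det3 a b c = det2 (b - a) (c - a) := by
  simp [det3, det2]

theorem det2_polar (r r' θ θ' : ℝ) :
    det2 (r * Real.cos θ, r * Real.sin θ) (r' * Real.cos θ', r' * Real.sin θ') =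
      r * r' * Real.sin (θ' - θ) := by
  rw [Real.sin_sub]; simp only [det2]; ring

theorem ang_ne {q q' : Plane} (h : det2 q q' ≠ 0) : ang q ≠ ang q' := by
  intro e
  have hq : q ≠ 0 := by rintro rfl; simp [det2] at h
  have hq' : q' ≠ 0 := by rintro rfl; simp [det2] at h
  obtain ⟨r, hr, e1⟩ := ang_spec hq
  obtain ⟨r', hr', e2⟩ := ang_spec hq'
  rw [e1, e2, det2_polar, e] at h
  simp at h

theorem det2_pos_iff_ang {q q' : Plane} (h : det2 q q' ≠ 0) (hs : |ang q' - ang q| < Real.pi) :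
    0 < det2 q q' ↔ ang q < ang q' := by
  have hq : q ≠ 0 := by rintro rfl; simp [det2] at h
  have hq' : q' ≠ 0 := by rintro rfl; simp [det2] at h
  obtain ⟨r, hr, e1⟩ := ang_spec hq
  obtain ⟨r', hr', e2⟩ := ang_spec hq'
  have e : det2 q q' = r * r' * Real.sin (ang q' - ang q) := by
    conv_lhs => rw [e1, e2]
    exact det2_polar _ _ _ _
  rw [abs_lt] at hs
  rw [e, mul_pos_iff_of_pos_left (mul_pos hr hr')]
  constructor
  · intro h1
    by_contra h2
    exact absurd (Real.sin_nonpos_of_nonpos_of_neg_pi_le (by linarith) hs.1.le) (not_le.2 h1)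
  · intro h1
    exact Real.sin_pos_of_pos_of_lt_pi (by linarith) hs.2

theorem ang_pos {q : Plane} (h : 0 < q.2) : 0 < ang q ∧ ang q < Real.pi := by
  have h0 : q ≠ 0 := by rintro rfl; simp at h
  obtain ⟨r, hr, e⟩ := ang_spec h0
  have e2 : q.2 = r * Real.sin (ang q) := congrArg Prod.snd e
  have hs : 0 < Real.sin (ang q) := by
    rw [e2] at h; exact (mul_pos_iff_of_pos_left hr).1 h
  have hm := ang_mem q
  constructor
  · by_contra hc
    exact absurd (Real.sin_nonpos_of_nonpos_of_neg_pi_le (not_lt.1 hc) hm.1.le) (not_le.2 hs)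
  · refine lt_of_le_of_ne hm.2 fun e => ?_
    rw [e, Real.sin_pi] at hs
    exact lt_irrefl _ hs

theorem ang_neg {q : Plane} (h : q.2 < 0) : ang q < 0 := by
  have h0 : q ≠ 0 := by rintro rfl; simp at h
  obtain ⟨r, hr, e⟩ := ang_spec h0
  have e2 : q.2 = r * Real.sin (ang q) := congrArg Prod.snd e
  by_contra hc
  have := Real.sin_nonneg_of_nonneg_of_le_pi (not_lt.1 hc) (ang_mem q).2
  have := mul_nonneg hr.le this
  linarith

theorem ltInd_add_rayInd {z p q : Plane} (hp : p.2 ≠ z.2) (hq : q.2 ≠ z.2) (hpq : p.2 ≠ q.2)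
    (h : det3 z p q ≠ 0) :
    ltInd p.2 q.2 + rayInd z p q + rayInd z q p = ltInd (ang (p - z)) (ang (q - z)) := by
  have hsw : det3 z q p = - det3 z p q := by unfold det3; ring
  have hd : det2 (p - z) (q - z) ≠ 0 := by rwa [← det3_eq_det2]
  have hne := ang_ne hd
  have hmp := ang_mem (p - z)
  have hmq := ang_mem (q - z)
  have s1 : ∀ x : Plane, z.2 < x.2 → 0 < (x - z).2 := fun x hx => by simpa using hx
  have s2 : ∀ x : Plane, x.2 < z.2 → (x - z).2 < 0 := fun x hx => by simpa using hx
  have one : (1 : ZMod 2) + 1 = 0 := by decide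
  rcases lt_or_gt_of_ne hp with hp | hp <;> rcases lt_or_gt_of_ne hq with hq | hq
  · have a1 := ang_neg (s2 _ hp)
    have a2 := ang_neg (s2 _ hq)
    have key := det2_pos_iff_ang hd (abs_lt.2 ⟨by linarith, by linarith⟩)
    rw [← det3_eq_det2] at key
    unfold ltInd rayInd
    rcases lt_or_gt_of_ne h with h | h <;> rcases lt_or_gt_of_ne hpq with hpq | hpq <;>
    simp [hsw, ← key, h, hpq, hp, hq, hp.not_gt, hq.not_gt, h.not_gt, hpq.not_gt, one]
  · have a1 := ang_neg (s2 _ hp)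
    have a2 := ang_pos (s1 _ hq)
    have a3 : ang (p - z) < ang (q - z) := by linarith
    have a4 : p.2 < q.2 := by linarith
    unfold ltInd rayInd
    simp [hp, hq, hp.not_gt, hq.not_gt, a3, a4, a4.not_gt]
  · have a1 := ang_pos (s1 _ hp)
    have a2 := ang_neg (s2 _ hq)
    have a3 : ang (q - z) < ang (p - z) := by linarith
    have a4 : q.2 < p.2 := by linarith
    unfold ltInd rayInd
    simp [hp, hq, hp.not_gt, hq.not_gt, a3.not_gt, a4, a4.not_gt]
  · have a1 := ang_pos (s1 _ hp)
    have a2 := ang_pos (s1 _ hq)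
    have key := det2_pos_iff_ang hd (abs_lt.2 ⟨by linarith, by linarith⟩)
    rw [← det3_eq_det2] at key
    unfold ltInd rayInd
    rcases lt_or_gt_of_ne h with h | h <;> rcases lt_or_gt_of_ne hpq with hpq | hpq <;>
    simp [hsw, ← key, h, hpq, hp, hq, hp.not_gt, hq.not_gt, h.not_gt, hpq.not_gt, one]

theorem HTData.star_walks {V : Type*} {G : SimpleGraph V} {y : V → ℝ} (hy : Function.Injective y)
    {m : V → V → V → ZMod 2} (h : HTData G y m) {z a b c d : V} (ha : G.Adj z a) (hb : G.Adj z b)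
    (hc : G.Adj z c) (hd : G.Adj z d) (P : G.Walk a b) (Q : G.Walk c d)
    (hPQ : ∀ x ∈ P.support, x ∉ Q.support) (hP : z ∉ P.support) (hQ : z ∉ Q.support) :
    inter y a b c d = (m z a c + m z c a) + (m z a d + m z d a) + (m z b c + m z c b) +
      (m z b d + m z d b) := by
  have cP : c ∉ P.support := fun e => hPQ _ e Q.start_mem_support
  have dP : d ∉ P.support := fun e => hPQ _ e Q.end_mem_support
  have aQ : a ∉ Q.support := fun e => hPQ _ P.start_mem_support e
  have bQ : b ∉ Q.support := fun e => hPQ _ P.end_mem_support e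
  have ac : a ≠ c := fun e => cP (e ▸ P.start_mem_support)
  have ad : a ≠ d := fun e => dP (e ▸ P.start_mem_support)
  have bc : b ≠ c := fun e => cP (e ▸ P.end_mem_support)
  have bd : b ≠ d := fun e => dP (e ▸ P.end_mem_support)
  have R1 := h.walk_walk P Q hPQ
  have R2 := h.walk_edge hc P hP cP
  have R3 := h.walk_edge hd P hP dP
  have R4 := h.walk_edge ha Q hQ aQ
  have R5 := h.walk_edge hb Q hQ bQ
  simp only [inter] at *
  rw [ltInd_swap (hy.ne ac), ltInd_swap (hy.ne ad)] at *
  rw [ltInd_swap (hy.ne bc), ltInd_swap (hy.ne bd)] at R5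
  have z2 : (2 : ZMod 2) = 0 := by decide
  generalize walkSum m c P = w1 at *
  generalize walkSum m d P = w2 at *
  generalize walkSum m a Q = w3 at *
  generalize walkSum m b Q = w4 at *
  generalize walkSum m z P = w5 at *
  generalize walkSum m z Q = w6 at *
  linear_combination R1 + R2 + R3 + R4 + R5 + (-2 - ltInd (y a) (y c) - ltInd (y a) (y d) -
    ltInd (y b) (y c) - ltInd (y b) (y d) + w1 + w2 + w3 + w4 + w5 + w6 - ltInd (y a) (y z) -
    ltInd (y b) (y z) - ltInd (y c) (y z) - ltInd (y d) (y z)) * z2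

/-- Two pairs of neighbours of `z` joined by disjoint walks do not alternate around `z`. -/
theorem IsSL.not_alternate {V : Type*} {G : SimpleGraph V} {p : V → Plane} (hp : IsSL G p)
    (hy : Function.Injective fun v => (p v).2) {z a b c d : V} (ha : G.Adj z a) (hb : G.Adj z b)
    (hc : G.Adj z c) (hd : G.Adj z d) {S T : Set V} (hS : ReachIn G S a b) (hT : ReachIn G T c d)
    (hST : ∀ x ∈ S, x ∉ T) (hzS : z ∉ S) (hzT : z ∉ T) :
    ltInd (ang (p a - p z)) (ang (p c - p z)) + ltInd (ang (p a - p z)) (ang (p d - p z)) +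
      ltInd (ang (p b - p z)) (ang (p c - p z)) + ltInd (ang (p b - p z)) (ang (p d - p z)) = 0 := by
  have hac : a ≠ c := fun e => hST _ hS.left_mem (e ▸ hT.left_mem)
  have had : a ≠ d := fun e => hST _ hS.left_mem (e ▸ hT.right_mem)
  have hbc : b ≠ c := fun e => hST _ hS.right_mem (e ▸ hT.left_mem)
  have hbd : b ≠ d := fun e => hST _ hS.right_mem (e ▸ hT.right_mem)
  obtain ⟨P, hP⟩ := hS
  obtain ⟨Q, hQ⟩ := hT
  have key := (hp.htData hy).star_walks hy ha hb hc hd P Q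
    (fun x hx hx' => hST x (hP x hx) (hQ x hx')) (fun h => hzS (hP _ h)) (fun h => hzT (hQ _ h))
  rw [← ltInd_add_rayInd (hy.ne ha.ne') (hy.ne hc.ne') (hy.ne hac)
      (hp.gen _ _ _ ha.ne hc.ne hac),
    ← ltInd_add_rayInd (hy.ne ha.ne') (hy.ne hd.ne') (hy.ne had)
      (hp.gen _ _ _ ha.ne hd.ne had),
    ← ltInd_add_rayInd (hy.ne hb.ne') (hy.ne hc.ne') (hy.ne hbc)
      (hp.gen _ _ _ hb.ne hc.ne hbc),
    ← ltInd_add_rayInd (hy.ne hb.ne') (hy.ne hd.ne') (hy.ne hbd)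
      (hp.gen _ _ _ hb.ne hd.ne hbd)]
  simp only [inter] at key
  generalize hM : (rayInd (p z) (p a) (p c) + rayInd (p z) (p c) (p a) +
    (rayInd (p z) (p a) (p d) + rayInd (p z) (p d) (p a)) + (rayInd (p z) (p b) (p c) +
    rayInd (p z) (p c) (p b)) + (rayInd (p z) (p b) (p d) + rayInd (p z) (p d) (p b))) = M at key
  linear_combination key + hM + zmod2_add_self M

/-! ### The neighbourhoods of a contracted edge -/

theorem HT.no_K5 {V : Type*} {G : SimpleGraph V} (h : HT G) (B : Fin 5 → Set V)
    (hr : ∀ i, (B i).Nonempty) (hB : ∀ i j, i < j → ∀ x, x ∈ B i → x ∉ B j)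
    (hconn : ∀ i, ConnOn G (B i)) (hH : ∀ i j, i < j → ∃ x ∈ B i, ∃ y ∈ B j, G.Adj x y) :
    False := by
  refine not_HT_K5 (h.minor_of_connOn B hr (fun i j hij x hx hx' => ?_) hconn fun i j hij => ?_)
  · rcases lt_or_gt_of_ne hij with hij | hij
    · exact hB _ _ hij x hx hx'
    · exact hB _ _ hij x hx' hx
  · rcases lt_or_gt_of_ne hij.ne with hij | hij
    · exact hH _ _ hij
    · obtain ⟨x, hx, y, hy, hxy⟩ := hH _ _ hij
      exact ⟨y, hy, x, hx, hxy.symm⟩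

theorem HT.no_K33 {V : Type*} {G : SimpleGraph V} (h : HT G) (B C : Fin 3 → Set V)
    (hr : ∀ i, (B i).Nonempty) (hr' : ∀ i, (C i).Nonempty)
    (hB : ∀ i j, i < j → ∀ x, x ∈ B i → x ∉ B j) (hC : ∀ i j, i < j → ∀ x, x ∈ C i → x ∉ C j)
    (hBC : ∀ i j, ∀ x, x ∈ B i → x ∉ C j)
    (hconn : ∀ i, ConnOn G (B i)) (hconn' : ∀ i, ConnOn G (C i))
    (hH : ∀ i j, ∃ x ∈ B i, ∃ y ∈ C j, G.Adj x y) :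
    False := by
  refine not_HT_K33 (h.minor_of_connOn (Sum.elim B C) ?_ ?_ ?_ ?_)
  · rintro (i | i)
    · exact hr i
    · exact hr' i
  · rintro (i | i) (j | j) hij x hx hx'
    · rcases lt_or_gt_of_ne (fun e => hij (congrArg _ e) : i ≠ j) with hij | hij
      · exact hB _ _ hij x hx hx'
      · exact hB _ _ hij x hx' hx
    · exact hBC i j x hx hx'
    · exact hBC j i x hx' hx
    · rcases lt_or_gt_of_ne (fun e => hij (congrArg _ e) : i ≠ j) with hij | hij
      · exact hC _ _ hij x hx hx'
      · exact hC _ _ hij x hx' hx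
  · rintro (i | i)
    · exact hconn i
    · exact hconn' i
  · rintro (i | i) (j | j) hij
    · simp at hij
    · exact hH i j
    · obtain ⟨x, hx, y, hy, hxy⟩ := hH j i
      exact ⟨y, hy, x, hx, hxy.symm⟩
    · simp at hij

/-- The graph with two vertices deleted. -/
abbrev del2 {V : Type*} (G : SimpleGraph V) (u v : V) : SimpleGraph {w : V // w ≠ u ∧ w ≠ v} :=
  G.comap Subtype.val

theorem Conn3.conn2_del2 {V : Type*} [Finite V] {G : SimpleGraph V} {u v : V} (huv : u ≠ v)
    (h : Conn3 (contr G u v)) : Conn2 (del2 G u v) := by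
  constructor
  · have h1 := card_ne_lt v
    have h2 := h.1
    have h3 : Nat.card {w : V // w ≠ u ∧ w ≠ v} + 2 = Nat.card V := by
      have h := ncard_add_ncard_compl ({u, v} : Set V)
      rw [ncard_pair huv] at h
      rw [← h, add_comm, ← Nat.card_coe_set_eq]
      congr 1
      exact Nat.card_congr (Equiv.subtypeEquivRight fun w => by simp)
    omega
  · intro C s hC hs hcl w
    have hor := h.2 {x | ∃ h : x.1 ≠ u, ⟨x.1, h, x.2⟩ ∈ C} ⟨s, s.2.2⟩ ⟨u, huv⟩ ?_ ?_ ?_ ?_ ⟨w, w.2.2⟩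
    · rcases hor with ⟨_, h⟩ | h | h
      · exact Or.inl h
      · exact Or.inr (Subtype.ext (congrArg (fun t : {w : V // w ≠ v} => t.1) h))
      · exact absurd (congrArg Subtype.val h) w.2.1
    · obtain ⟨x, hx⟩ := hC
      exact ⟨⟨x, x.2.2⟩, x.2.1, hx⟩
    · rintro ⟨_, h⟩; exact hs h
    · rintro ⟨h, -⟩; exact h rfl
    · rintro x ⟨hxu, hx⟩ y hxy
      by_cases hyu : y.1 = u
      · exact Or.inr (Or.inr (Subtype.ext hyu))
      rcases hxy.2 with hxy | hxy | hxy
      · rcases hcl _ hx ⟨y, hyu, y.2⟩ hxy with h | h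
        · exact Or.inl ⟨hyu, h⟩
        · exact Or.inr (Or.inl (Subtype.ext (congrArg (fun t : {w : V // w ≠ u ∧ w ≠ v} => t.1) h)))
      · exact absurd hxy.1 hxu
      · exact absurd hxy.1 hyu

section Struct

variable {V : Type*} {G : SimpleGraph V} {u v : V}

theorem connOn_fibre {X : Type*} {K : SimpleGraph X} (g : X → V)
    (hg : ∀ a b, K.Adj a b → G.Adj (g a) (g b)) {f : X → X}
    (hf : ∀ x, ReachIn K {y | f y = f x} x (f x)) {a : X} (ha : f a = a) :
    ConnOn G (g '' {x | f x = a}) := by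
  have key : ∀ x, f x = a → ReachIn G (g '' {x | f x = a}) (g x) (g a) := by
    intro x hx
    have := hf x
    rw [hx] at this
    exact this.map g (fun y hy => ⟨y, hy, rfl⟩)
      fun y z hyz hy hz => .of_adj (hg _ _ hyz) ⟨y, hy, rfl⟩ ⟨z, hz, rfl⟩
  rintro _ ⟨x, hx, rfl⟩ _ ⟨y, hy, rfl⟩
  exact (key x hx).trans (key y hy).symm

/-- The ends of a contracted edge do not have three common neighbours. -/
theorem HT.not_three_common [Finite V] (hG : HT G) (huv : G.Adj u v) (hH : Conn3 (_root_.contr G u v))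
    {a b c : V} (hab : a ≠ b) (hac : a ≠ c) (hbc : b ≠ c) (hua : G.Adj u a) (hub : G.Adj u b)
    (huc : G.Adj u c) (hva : G.Adj v a) (hvb : G.Adj v b) (hvc : G.Adj v c) : False := by
  obtain ⟨f, fa, fb, fc, hf, ab, ac, bc⟩ := exists_retraction_three (hH.conn2_del2 huv.ne)
    (a := ⟨a, hua.ne', hva.ne'⟩) (b := ⟨b, hub.ne', hvb.ne'⟩) (c := ⟨c, huc.ne', hvc.ne'⟩)
    (by simpa using hab) (by simpa using hac) (by simpa using hbc)
  set F : {w : V // w ≠ u ∧ w ≠ v} → Set V := fun i => Subtype.val '' {x | f x = i} with hF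
  have hFd : ∀ i j, i ≠ j → ∀ x, x ∈ F i → x ∉ F j := by
    rintro i j hij _ ⟨x, hx, rfl⟩ ⟨y, hy, e⟩
    rw [Subtype.ext e] at hy
    exact hij (hx.symm.trans hy)
  have hFu : ∀ i, ∀ x ∈ F i, x ≠ u ∧ x ≠ v := by
    rintro i _ ⟨x, hx, rfl⟩; exact x.2
  have hFm : ∀ i, f i = i → i.1 ∈ F i := fun i hi => ⟨i, hi, rfl⟩
  have hFc : ∀ i, f i = i → ConnOn G (F i) := fun i hi => connOn_fibre Subtype.val (fun _ _ h => h) hf hi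
  have hFA : ∀ i j, FibAdj (del2 G u v) f i j → ∃ x ∈ F i, ∃ y ∈ F j, G.Adj x y := by
    rintro i j ⟨x, y, hxy, hx, hy⟩
    exact ⟨x, ⟨x, hx, rfl⟩, y, ⟨y, hy, rfl⟩, hxy⟩
  have ma := hFm _ fa
  have mb := hFm _ fb
  have mc := hFm _ fc
  have ca := hFc _ fa
  have cb := hFc _ fb
  have cc := hFc _ fc
  have dab := hFd ⟨a, hua.ne', hva.ne'⟩ ⟨b, hub.ne', hvb.ne'⟩ (by simpa using hab)
  have dac := hFd ⟨a, hua.ne', hva.ne'⟩ ⟨c, huc.ne', hvc.ne'⟩ (by simpa using hac)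
  have dbc := hFd ⟨b, hub.ne', hvb.ne'⟩ ⟨c, huc.ne', hvc.ne'⟩ (by simpa using hbc)
  have xa := hFu ⟨a, hua.ne', hva.ne'⟩
  have xb := hFu ⟨b, hub.ne', hvb.ne'⟩
  have xc := hFu ⟨c, huc.ne', hvc.ne'⟩
  have eab := hFA _ _ ab
  have eac := hFA _ _ ac
  have ebc := hFA _ _ bc
  generalize F ⟨a, hua.ne', hva.ne'⟩ = A at *
  generalize F ⟨b, hub.ne', hvb.ne'⟩ = B at *
  generalize F ⟨c, huc.ne', hvc.ne'⟩ = C at *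
  refine hG.no_K5 ![{u}, {v}, A, B, C] ?_ ?_ ?_ ?_
  · intro i; fin_cases i
    exacts [⟨u, rfl⟩, ⟨v, rfl⟩, ⟨_, ma⟩, ⟨_, mb⟩, ⟨_, mc⟩]
  · intro i j hij x hx hx'
    fin_cases i <;> fin_cases j <;> first | (exact absurd hij (by decide)) | skip
    · exact huv.ne (hx.symm.trans hx')
    · exact (xa x hx').1 hx
    · exact (xb x hx').1 hx
    · exact (xc x hx').1 hx
    · exact (xa x hx').2 hx
    · exact (xb x hx').2 hx
    · exact (xc x hx').2 hx
    · exact dab x hx hx'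
    · exact dac x hx hx'
    · exact dbc x hx hx'
  · intro i; fin_cases i
    exacts [connOn_singleton _ _, connOn_singleton _ _, ca, cb, cc]
  · intro i j hij
    fin_cases i <;> fin_cases j <;> first | (exact absurd hij (by decide)) | skip
    · exact ⟨u, rfl, v, rfl, huv⟩
    · exact ⟨u, rfl, a, ma, hua⟩
    · exact ⟨u, rfl, b, mb, hub⟩
    · exact ⟨u, rfl, c, mc, huc⟩
    · exact ⟨v, rfl, a, ma, hva⟩
    · exact ⟨v, rfl, b, mb, hvb⟩
    · exact ⟨v, rfl, c, mc, hvc⟩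
    · exact eab
    · exact eac
    · exact ebc

/-- The neighbourhoods of the two ends of a contracted edge do not alternate. -/
theorem HT.not_alternate [Finite V] (hG : HT G) (huv : G.Adj u v) (hH : Conn3 (_root_.contr G u v))
    {p : {w : V // w ≠ v} → Plane} (hp : IsSL (_root_.contr G u v) p)
    (hy : Function.Injective fun w => (p w).2)
    {a b c d : {w : V // w ≠ v}} (hab : a ≠ b) (hac : a ≠ c) (had : a ≠ d) (hbc : b ≠ c)
    (hbd : b ≠ d) (hcd : c ≠ d) (hua : G.Adj u a) (hub : G.Adj u b) (hvc : G.Adj v c)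
    (hvd : G.Adj v d) (hcu : c.1 ≠ u) (hdu : d.1 ≠ u) :
    ltInd (ang (p a - p ⟨u, huv.ne⟩)) (ang (p c - p ⟨u, huv.ne⟩)) +
      ltInd (ang (p a - p ⟨u, huv.ne⟩)) (ang (p d - p ⟨u, huv.ne⟩)) +
      ltInd (ang (p b - p ⟨u, huv.ne⟩)) (ang (p c - p ⟨u, huv.ne⟩)) +
      ltInd (ang (p b - p ⟨u, huv.ne⟩)) (ang (p d - p ⟨u, huv.ne⟩)) = 0 := by
  obtain ⟨f, fa, fb, fc, fd, hf, hor⟩ := exists_retraction_four (hH.conn2_del2 huv.ne)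
    (a := ⟨a, hua.ne', a.2⟩) (b := ⟨b, hub.ne', b.2⟩) (c := ⟨c, hcu, c.2⟩) (d := ⟨d, hdu, d.2⟩)
    (by simpa [Subtype.ext_iff] using hab) (by simpa [Subtype.ext_iff] using hac)
    (by simpa [Subtype.ext_iff] using had) (by simpa [Subtype.ext_iff] using hbc)
    (by simpa [Subtype.ext_iff] using hbd) (by simpa [Subtype.ext_iff] using hcd)
  have nab : (⟨a, hua.ne', a.2⟩ : {w : V // w ≠ u ∧ w ≠ v}) ≠ ⟨b, hub.ne', b.2⟩ := by
    simpa [Subtype.ext_iff] using hab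
  have nac : (⟨a, hua.ne', a.2⟩ : {w : V // w ≠ u ∧ w ≠ v}) ≠ ⟨c, hcu, c.2⟩ := by
    simpa [Subtype.ext_iff] using hac
  have nad : (⟨a, hua.ne', a.2⟩ : {w : V // w ≠ u ∧ w ≠ v}) ≠ ⟨d, hdu, d.2⟩ := by
    simpa [Subtype.ext_iff] using had
  have nbc : (⟨b, hub.ne', b.2⟩ : {w : V // w ≠ u ∧ w ≠ v}) ≠ ⟨c, hcu, c.2⟩ := by
    simpa [Subtype.ext_iff] using hbc
  have nbd : (⟨b, hub.ne', b.2⟩ : {w : V // w ≠ u ∧ w ≠ v}) ≠ ⟨d, hdu, d.2⟩ := by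
    simpa [Subtype.ext_iff] using hbd
  have ncd : (⟨c, hcu, c.2⟩ : {w : V // w ≠ u ∧ w ≠ v}) ≠ ⟨d, hdu, d.2⟩ := by
    simpa [Subtype.ext_iff] using hcd
  rcases hor with ⟨AB, CD⟩ | ⟨AC, AD, BC, BD⟩
  · set g : {w : V // w ≠ u ∧ w ≠ v} → {w : V // w ≠ v} := fun x => ⟨x, x.2.2⟩ with hg
    set F : {w : V // w ≠ u ∧ w ≠ v} → Set {w : V // w ≠ v} := fun i => g '' {x | f x = i} with hF
    have hgadj : ∀ x y, (del2 G u v).Adj x y → (_root_.contr G u v).Adj (g x) (g y) :=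
      fun x y h => contr_adj_of_adj h
    have hFc : ∀ i, f i = i → ConnOn (_root_.contr G u v) (F i) := fun i hi => connOn_fibre g hgadj hf hi
    have hFm : ∀ i, f i = i → g i ∈ F i := fun i hi => ⟨i, hi, rfl⟩
    have hgu : ∀ x, g x ≠ ⟨u, huv.ne⟩ := fun x e => x.2.1 (congrArg Subtype.val e)
    have hFd : ∀ i j, i ≠ j → ∀ x, x ∈ F i → x ∉ F j := by
      rintro i j hij _ ⟨x, hx, rfl⟩ ⟨y, hy, e⟩
      have e' : y = x := Subtype.ext (congrArg (fun t : {w : V // w ≠ v} => t.1) e)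
      rw [e'] at hy
      exact hij (hx.symm.trans hy)
    obtain ⟨x1, y1, e1, hx1, hy1⟩ := AB
    obtain ⟨x2, y2, e2, hx2, hy2⟩ := CD
    have adjU : ∀ w : {w : V // w ≠ v}, G.Adj u w → (_root_.contr G u v).Adj ⟨u, huv.ne⟩ w :=
      fun w h => contr_adj_of_adj h
    have adjV : ∀ w : {w : V // w ≠ v}, w.1 ≠ u → G.Adj v w → (_root_.contr G u v).Adj ⟨u, huv.ne⟩ w :=
      fun w h h' => ⟨fun e => h (congrArg Subtype.val e).symm, Or.inr (Or.inl ⟨rfl, h'⟩)⟩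
    refine hp.not_alternate hy (adjU a hua) (adjU b hub) (adjV c hcu hvc) (adjV d hdu hvd)
      (ReachIn.trans_disjoint_union (hFc _ fa) (hFc _ fb) (hFm _ fa) (hFm _ fb)
        ⟨x1, hx1, rfl⟩ ⟨y1, hy1, rfl⟩ (hgadj _ _ e1))
      (ReachIn.trans_disjoint_union (hFc _ fc) (hFc _ fd) (hFm _ fc) (hFm _ fd)
        ⟨x2, hx2, rfl⟩ ⟨y2, hy2, rfl⟩ (hgadj _ _ e2)) ?_ ?_ ?_
    · rintro x (hx | hx) (hx' | hx')
      · exact hFd _ _ nac x hx hx'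
      · exact hFd _ _ nad x hx hx'
      · exact hFd _ _ nbc x hx hx'
      · exact hFd _ _ nbd x hx hx'
    · rintro (⟨x, -, hx⟩ | ⟨x, -, hx⟩) <;> exact hgu x hx
    · rintro (⟨x, -, hx⟩ | ⟨x, -, hx⟩) <;> exact hgu x hx
  · exfalso
    set F : {w : V // w ≠ u ∧ w ≠ v} → Set V := fun i => Subtype.val '' {x | f x = i} with hF
    have hFd : ∀ i j, i ≠ j → ∀ x, x ∈ F i → x ∉ F j := by
      rintro i j hij _ ⟨x, hx, rfl⟩ ⟨y, hy, e⟩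
      rw [Subtype.ext e] at hy
      exact hij (hx.symm.trans hy)
    have hFu : ∀ i, ∀ x ∈ F i, x ≠ u ∧ x ≠ v := by
      rintro i _ ⟨x, hx, rfl⟩; exact x.2
    have hFm : ∀ i, f i = i → i.1 ∈ F i := fun i hi => ⟨i, hi, rfl⟩
    have hFc : ∀ i, f i = i → ConnOn G (F i) :=
      fun i hi => connOn_fibre Subtype.val (fun _ _ h => h) hf hi
    have hFA : ∀ i j, FibAdj (del2 G u v) f i j → ∃ x ∈ F i, ∃ y ∈ F j, G.Adj x y := by
      rintro i j ⟨x, y, hxy, hx, hy⟩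
      exact ⟨x, ⟨x, hx, rfl⟩, y, ⟨y, hy, rfl⟩, hxy⟩
    refine hG.no_K33 ![{u}, F ⟨c, hcu, c.2⟩, F ⟨d, hdu, d.2⟩]
      ![{v}, F ⟨a, hua.ne', a.2⟩, F ⟨b, hub.ne', b.2⟩] ?_ ?_ ?_ ?_ ?_ ?_ ?_ ?_
    · intro i; fin_cases i
      exacts [⟨u, rfl⟩, ⟨_, hFm _ fc⟩, ⟨_, hFm _ fd⟩]
    · intro i; fin_cases i
      exacts [⟨v, rfl⟩, ⟨_, hFm _ fa⟩, ⟨_, hFm _ fb⟩]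
    · intro i j hij x hx hx'
      fin_cases i <;> fin_cases j <;> first | (exact absurd hij (by decide)) | skip
      · exact (hFu _ x hx').1 hx
      · exact (hFu _ x hx').1 hx
      · exact hFd _ _ ncd x hx hx'
    · intro i j hij x hx hx'
      fin_cases i <;> fin_cases j <;> first | (exact absurd hij (by decide)) | skip
      · exact (hFu _ x hx').2 hx
      · exact (hFu _ x hx').2 hx
      · exact hFd _ _ nab x hx hx'
    · intro i j x hx hx'
      fin_cases i <;> fin_cases j
      · exact huv.ne (hx.symm.trans hx')
      · exact (hFu _ x hx').1 hx
      · exact (hFu _ x hx').1 hx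
      · exact (hFu _ x hx).2 hx'
      · exact hFd _ _ nac x hx' hx
      · exact hFd _ _ nbc x hx' hx
      · exact (hFu _ x hx).2 hx'
      · exact hFd _ _ nad x hx' hx
      · exact hFd _ _ nbd x hx' hx
    · intro i; fin_cases i
      exacts [connOn_singleton _ _, hFc _ fc, hFc _ fd]
    · intro i; fin_cases i
      exacts [connOn_singleton _ _, hFc _ fa, hFc _ fb]
    · intro i j
      fin_cases i <;> fin_cases j
      · exact ⟨u, rfl, v, rfl, huv⟩
      · exact ⟨u, rfl, a, hFm _ fa, hua⟩
      · exact ⟨u, rfl, b, hFm _ fb, hub⟩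
      · exact ⟨c, hFm _ fc, v, rfl, hvc.symm⟩
      · exact hFA _ _ AC.symm
      · exact hFA _ _ BC.symm
      · exact ⟨d, hFm _ fd, v, rfl, hvd.symm⟩
      · exact hFA _ _ AD.symm
      · exact hFA _ _ BD.symm

end Struct

/-! ### Splitting a vertex of a straight-line drawing -/

/-- The placement of `v` at `p u + ε • d`. -/
def splitPos {V : Type*} {v : V} (p : {w : V // w ≠ v} → Plane) (u : {w : V // w ≠ v}) (d : Plane)
    (ε : ℝ) (w : V) : Plane :=
  open Classical in if h : w ≠ v then p ⟨w, h⟩ else p u + ε • d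

section Split

variable {V : Type*} {G : SimpleGraph V} {u v : V} {p : {w : V // w ≠ v} → Plane}
  {u' : {w : V // w ≠ v}} {d : Plane} {ε : ℝ}

theorem splitPos_self : splitPos p u' d ε v = p u' + ε • d := by simp [splitPos]

theorem splitPos_coe (w : {w : V // w ≠ v}) : splitPos p u' d ε w = p w := by
  simp [splitPos, w.2]

theorem splitPos_of_ne {w : V} (h : w ≠ v) : splitPos p u' d ε w = p ⟨w, h⟩ :=
  splitPos_coe (⟨w, h⟩ : {w : V // w ≠ v})

theorem det3_split (a b d : Plane) : det3 a (a + ε • d) b = ε * det2 d (b - a) := by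
  simp only [det3, det2, Prod.fst_add, Prod.snd_add, Prod.smul_fst, Prod.smul_snd, smul_eq_mul,
    Prod.fst_sub, Prod.snd_sub]; ring

theorem split_eventually [Finite V] {H : SimpleGraph {w : V // w ≠ v}} (hp : IsSL H p) (d : Plane) :
    ∀ᶠ ε in 𝓝[>] (0:ℝ), ∀ a b, a ≠ b → a ≠ u' → b ≠ u' →
      0 < det3 (p a) (p b) (p u') * det3 (p a) (p b) (p u' + ε • d) := by
  rw [eventually_all]; intro a
  rw [eventually_all]; intro b
  by_cases h : a ≠ b ∧ a ≠ u' ∧ b ≠ u'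
  · obtain ⟨h1, h2, h3⟩ := h
    have := eventually_pos_of_continuous
      (f := fun ε => det3 (p a) (p b) (p u') * det3 (p a) (p b) (p u' + ε • d))
      (by simp only [det3, Prod.fst_add, Prod.snd_add, Prod.smul_fst, Prod.smul_snd, smul_eq_mul]
          fun_prop)
      (by simpa using hp.gen a b u' h1 h2 h3)
    filter_upwards [this] with ε hε _ _ _ using hε
  · exact Eventually.of_forall fun ε h1 h2 h3 => absurd ⟨h1, h2, h3⟩ h

theorem mul_pos_trans {x y z : ℝ} (h : 0 < x * y) (h' : 0 < y * z) : 0 < x * z := by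
  by_contra hc
  have h1 := mul_pos h h'
  have h2 : x * y * (y * z) = y ^ 2 * (x * z) := by ring
  rw [h2] at h1
  exact absurd (mul_nonpos_of_nonneg_of_nonpos (sq_nonneg y) (not_lt.1 hc)) (not_le.2 h1)

theorem mul_neg_of_mul_pos_right {x y z : ℝ} (h : x * y < 0) (h' : 0 < z * y) : x * z < 0 := by
  have := mul_pos_trans (x := -x) (y := y) (z := z) (by linarith) (by linarith)
  linarith

theorem SegCross.swap_right {a b c d : Plane} (h : SegCross a b c d) : SegCross a b d c := by
  obtain ⟨h1, h2⟩ := h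
  refine ⟨by linarith, ?_⟩
  rw [det3_swap c d, det3_swap c d]; linarith

theorem SegCross.symm {a b c d : Plane} (h : SegCross a b c d) : SegCross c d a b := ⟨h.2, h.1⟩

theorem SegCross.swap_left {a b c d : Plane} (h : SegCross a b c d) : SegCross b a c d :=
  h.symm.swap_right.symm

theorem split_isSL_of_sign (huv : G.Adj u v) (hp : IsSL (contr G u v) p) (hd0 : d ≠ 0) (hε : 0 < ε)
    (hu' : u'.1 = u)
    (hd : ∀ w, w ≠ u' → det2 d (p w - p u') ≠ 0)
    (hnc : ∀ a b : {w : V // w ≠ v}, a ≠ u' → b ≠ u' → a ≠ b → G.Adj u a → G.Adj v b →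
      ¬ (0 < det2 (p a - p u') (p b - p u') * det2 d (p a - p u') ∧
        0 < det2 (p a - p u') (p b - p u') * det2 d (p b - p u')))
    (hs : ∀ a b, a ≠ b → a ≠ u' → b ≠ u' →
      0 < det3 (p a) (p b) (p u') * det3 (p a) (p b) (p u' + ε • d)) :
    IsSL G (splitPos p u' d ε) := by
  subst hu'
  have hv : ∀ a b : {w : V // w ≠ v}, a ≠ b → det3 (p a) (p b) (p u' + ε • d) ≠ 0 := by
    intro a b hab
    by_cases ha : a = u'
    · subst ha
      have e : det3 (p a) (p b) (p a + ε • d) = - det3 (p a) (p a + ε • d) (p b) := by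
        unfold det3; ring
      rw [e, det3_split]
      exact neg_ne_zero.2 (mul_ne_zero hε.ne' (hd b hab.symm))
    by_cases hb : b = u'
    · subst hb
      rw [← det3_rot, det3_split]
      exact mul_ne_zero hε.ne' (hd a hab)
    exact fun e => by have := hs a b hab ha hb; rw [e] at this; simp at this
  have hgen : ∀ a b c, a ≠ b → a ≠ c → b ≠ c →
      det3 (splitPos p u' d ε a) (splitPos p u' d ε b) (splitPos p u' d ε c) ≠ 0 := by
    intro a b c hab hac hbc
    by_cases hc : c = v
    · subst hc
      rw [splitPos_of_ne hac, splitPos_of_ne hbc, splitPos_self]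
      exact hv _ _ (by simpa using hab)
    by_cases hb : b = v
    · subst hb
      rw [splitPos_of_ne hab, splitPos_of_ne hc, splitPos_self, ← det3_rot, ← det3_rot]
      exact hv _ _ (by simpa using hac.symm)
    by_cases ha : a = v
    · subst ha
      rw [splitPos_of_ne hb, splitPos_of_ne hc, splitPos_self, ← det3_rot]
      exact hv _ _ (by simpa using hbc)
    rw [splitPos_of_ne ha, splitPos_of_ne hb, splitPos_of_ne hc]
    exact hp.gen _ _ _ (by simpa using hab) (by simpa using hac) (by simpa using hbc)
  have inj_v : ∀ a : {w : V // w ≠ v}, p a ≠ p u' + ε • d := by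
    intro a e
    by_cases ha : a = u'
    · subst ha
      exact (smul_ne_zero hε.ne' hd0) (by simpa using e)
    · have := hv a u' ha
      rw [← e] at this
      simp [det3] at this
  have core : ∀ a b c, G.Adj a b → G.Adj c v → a ≠ c → a ≠ v → b ≠ c → b ≠ v →
      ¬ SegCross (splitPos p u' d ε a) (splitPos p u' d ε b) (splitPos p u' d ε c)
        (splitPos p u' d ε v) := by
    intro a b c hab hcv hac hav hbc hbv
    rw [splitPos_of_ne hav, splitPos_of_ne hbv, splitPos_of_ne hcv.ne, splitPos_self]
    have huse : ∀ a b c : {w : V // w ≠ v}, G.Adj a b → G.Adj c v → a ≠ c → b ≠ c → b ≠ u' →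
        a = u' → ¬ SegCross (p a) (p b) (p c) (p u' + ε • d) := by
      rintro a b c hab hcv hac hbc hb rfl ⟨h1, h2⟩
      refine hnc b c hb hac.symm hbc hab hcv.symm ?_
      have e1 := det3_split (ε := ε) (p a) (p b) d
      have e2 := det3_split (ε := ε) (p a) (p c) d
      have e3 := hs b c hbc hb hac.symm
      have f1 : det3 (p a) (p b) (p a + ε • d) = - det3 (p a) (p a + ε • d) (p b) := by
        unfold det3; ring
      have f2 : det3 (p c) (p a + ε • d) (p a) = - det3 (p a) (p a + ε • d) (p c) := by
        unfold det3; ring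
      have f3 : det3 (p c) (p a + ε • d) (p b) = det3 (p b) (p c) (p a + ε • d) := det3_rot _ _ _
      have f4 : det3 (p b) (p c) (p a) = det3 (p a) (p b) (p c) := det3_rot _ _ _
      rw [f1, e1] at h1
      rw [f2, f3, e2] at h2
      rw [f4] at e3
      rw [← det3_eq_det2]
      generalize det3 (p a) (p b) (p c) = D at *
      generalize det3 (p b) (p c) (p a + ε • d) = D' at *
      generalize det2 d (p b - p a) = x at *
      generalize det2 d (p c - p a) = y at *
      have h3 : 0 < D * x := by
        have : 0 < ε * (D * x) := by linarith
        exact (mul_pos_iff_of_pos_left hε).1 this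
      have h4 : 0 < D' * y := by
        have : 0 < ε * (D' * y) := by linarith
        exact (mul_pos_iff_of_pos_left hε).1 this
      exact ⟨h3, mul_pos_trans e3 h4⟩
    by_cases hcu : c = u'
    · subst hcu
      rintro ⟨h1, -⟩
      have := hs ⟨a, hav⟩ ⟨b, hbv⟩ (by simpa using hab.ne) (by simpa [Subtype.ext_iff] using hac) (by simpa [Subtype.ext_iff] using hbc)
      exact lt_asymm h1 this
    by_cases hau : a = u'
    · exact huse ⟨a, hav⟩ ⟨b, hbv⟩ ⟨c, hcv.ne⟩ hab hcv (by simpa using hac) (by simpa using hbc)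
        (fun e => hab.ne (hau.trans (congrArg Subtype.val e).symm)) (Subtype.ext hau)
    by_cases hbu : b = u'
    · exact fun h => huse ⟨b, hbv⟩ ⟨a, hav⟩ ⟨c, hcv.ne⟩ hab.symm hcv (by simpa using hbc)
        (by simpa using hac) (fun e => hau (congrArg Subtype.val e)) (Subtype.ext hbu) h.swap_left
    have na : (⟨a, hav⟩ : {w : V // w ≠ v}) ≠ u' := fun e => hau (congrArg Subtype.val e)
    have nb : (⟨b, hbv⟩ : {w : V // w ≠ v}) ≠ u' := fun e => hbu (congrArg Subtype.val e)
    have nc : (⟨c, hcv.ne⟩ : {w : V // w ≠ v}) ≠ u' := fun e => hcu (congrArg Subtype.val e)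
    have nab : (⟨a, hav⟩ : {w : V // w ≠ v}) ≠ ⟨b, hbv⟩ := by simpa using hab.ne
    have nac : (⟨a, hav⟩ : {w : V // w ≠ v}) ≠ ⟨c, hcv.ne⟩ := by simpa using hac
    have nbc : (⟨b, hbv⟩ : {w : V // w ≠ v}) ≠ ⟨c, hcv.ne⟩ := by simpa using hbc
    have nx := hp.nocross ⟨a, hav⟩ ⟨b, hbv⟩ ⟨c, hcv.ne⟩ u' (contr_adj_of_adj hab)
      ⟨nc, Or.inr (Or.inr ⟨rfl, hcv.symm⟩)⟩ nac na nbc nb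
    rintro ⟨h1, h2⟩
    apply nx
    have g1 := hs _ _ nab na nb
    have g2 := hs _ _ nac na nc
    have g3 := hs _ _ nbc nb nc
    rw [det3_rot, det3_rot (p ⟨b, hbv⟩)] at h2
    unfold SegCross
    rw [det3_rot (p ⟨a, hav⟩), det3_rot (p ⟨b, hbv⟩)]
    generalize p ⟨a, hav⟩ = A at *
    generalize p ⟨b, hbv⟩ = B at *
    generalize p ⟨c, hcv.ne⟩ = C at *
    constructor
    · exact mul_neg_of_mul_pos_right h1 g1
    · rw [mul_comm]
      refine mul_neg_of_mul_pos_right (y := det3 A C (p u' + ε • d)) ?_ ?_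
      · rw [mul_comm]
        refine mul_neg_of_mul_pos_right (y := det3 B C (p u' + ε • d)) ?_ ?_
        · exact h2
        · exact g3
      · exact g2
  refine ⟨fun a b e => ?_, hgen, fun a b c d' hab hcd hac had hbc hbd h => ?_⟩
  · by_cases ha : a = v
    · by_cases hb : b = v
      · rw [ha, hb]
      · subst ha
        rw [splitPos_self, splitPos_of_ne hb] at e
        exact absurd e.symm (inj_v _)
    · by_cases hb : b = v
      · subst hb
        rw [splitPos_self, splitPos_of_ne ha] at e
        exact absurd e (inj_v _)
      · rw [splitPos_of_ne ha, splitPos_of_ne hb] at e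
        exact congrArg Subtype.val (hp.inj e)
  · by_cases hd' : d' = v
    · subst hd'; exact core a b c hab hcd hac had hbc hbd h
    by_cases hc : c = v
    · subst hc; exact core a b d' hab hcd.symm had hac hbd hbc h.swap_right
    by_cases hb : b = v
    · subst hb; exact core c d' a hcd hab hac.symm (Ne.symm hbc) had.symm (Ne.symm hbd) h.symm
    by_cases ha : a = v
    · subst ha
      exact core c d' b hcd hab.symm hbc.symm hac.symm hbd.symm had.symm h.symm.swap_right
    rw [splitPos_of_ne ha, splitPos_of_ne hb, splitPos_of_ne hc, splitPos_of_ne hd'] at h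
    exact hp.nocross _ _ _ _ (contr_adj_of_adj hab) (contr_adj_of_adj hcd) (by simpa using hac)
      (by simpa using had) (by simpa using hbc) (by simpa using hbd) h

end Split

theorem split_isSL {V : Type*} [Finite V] {G : SimpleGraph V} {u v : V}
    {p : {w : V // w ≠ v} → Plane} {u' : {w : V // w ≠ v}} {d : Plane} (huv : G.Adj u v)
    (hp : IsSL (contr G u v) p) (hd0 : d ≠ 0) (hu' : u'.1 = u)
    (hd : ∀ w, w ≠ u' → det2 d (p w - p u') ≠ 0)
    (hnc : ∀ a b : {w : V // w ≠ v}, a ≠ u' → b ≠ u' → a ≠ b → G.Adj u a → G.Adj v b →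
      ¬ (0 < det2 (p a - p u') (p b - p u') * det2 d (p a - p u') ∧
        0 < det2 (p a - p u') (p b - p u') * det2 d (p b - p u'))) :
    ∀ᶠ ε in 𝓝[>] (0:ℝ), IsSL G (splitPos p u' d ε) := by
  filter_upwards [split_eventually (u' := u') hp d, self_mem_nhdsWithin] with ε h1 h2
  exact split_isSL_of_sign huv hp hd0 h2 hu' hd hnc h1

theorem arc_dichotomy {X : Type*} (θ : X → ℝ) (U W : Set X)
    (inj : ∀ a ∈ U ∪ W, ∀ b ∈ U ∪ W, θ a = θ b → a = b)
    (nalt : ∀ a ∈ U, ∀ b ∈ U, ∀ c ∈ W, ∀ d ∈ W, a ≠ b → a ≠ c → a ≠ d → b ≠ c → b ≠ d → c ≠ d →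
      ltInd (θ a) (θ c) + ltInd (θ a) (θ d) + ltInd (θ b) (θ c) + ltInd (θ b) (θ d) = 0)
    (n3 : ∀ a b c, a ∈ U → b ∈ U → c ∈ U → a ∈ W → b ∈ W → c ∈ W → a ≠ b → a ≠ c → b ≠ c → False)
    {w₁ w₂ u₁ u₂ : X} (hw₁ : w₁ ∈ W) (hw₂ : w₂ ∈ W) (hu₁ : u₁ ∈ U) (hu₂ : u₂ ∈ U)
    (bW : ∀ w ∈ W, θ w₁ ≤ θ w ∧ θ w ≤ θ w₂) (bU : ∀ w ∈ U, θ u₁ ≤ θ w ∧ θ w ≤ θ u₂) :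
    (∀ a ∈ U, ¬ (θ w₁ < θ a ∧ θ a < θ w₂)) ∨ (∀ c ∈ W, ¬ (θ u₁ < θ c ∧ θ c < θ u₂)) := by
  have ne : ∀ {a b}, θ a < θ b → a ≠ b := fun h e => h.ne (congrArg θ e)
  have p1 : ∀ a ∈ U, ∀ b ∈ U, ∀ c ∈ W, ∀ d ∈ W, θ a < θ c → θ c < θ b → θ b < θ d → False := by
    intro a ha b hb c hc d hd h1 h2 h3
    have := nalt a ha b hb c hc d hd (ne (h1.trans h2)) (ne h1) (ne (h1.trans (h2.trans h3)))
      (ne h2).symm (ne h3) (ne (h2.trans h3))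
    simp only [ltInd, h1, h1.trans (h2.trans h3), h2.not_gt, h3, if_true, if_false] at this
    exact absurd this (by decide)
  have p2 : ∀ a ∈ U, ∀ b ∈ U, ∀ c ∈ W, ∀ d ∈ W, θ c < θ a → θ a < θ d → θ d < θ b → False := by
    intro a ha b hb c hc d hd h1 h2 h3
    have := nalt a ha b hb c hc d hd (ne (h2.trans h3)) (ne h1).symm (ne h2)
      (ne (h1.trans (h2.trans h3))).symm (ne h3).symm (ne (h1.trans h2))
    simp only [ltInd, h1.not_gt, (h1.trans (h2.trans h3)).not_gt, h2, h3.not_gt, if_true,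
      if_false] at this
    exact absurd this (by decide)
  by_contra hcon
  push Not at hcon
  obtain ⟨⟨a, ha, ha1, ha2⟩, ⟨c, hc, hc1, hc2⟩⟩ := hcon
  have e1 : θ u₁ = θ w₁ := by
    rcases lt_trichotomy (θ u₁) (θ w₁) with h | h | h
    · exact (p1 _ hu₁ a ha _ hw₁ _ hw₂ h ha1 ha2).elim
    · exact h
    · exact (p2 _ hu₁ _ hu₂ _ hw₁ _ hc h hc1 hc2).elim
  have e2 : θ u₂ = θ w₂ := by
    rcases lt_trichotomy (θ u₂) (θ w₂) with h | h | h
    · exact (p1 _ hu₁ _ hu₂ _ hc _ hw₂ hc1 hc2 h).elim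
    · exact h
    · exact (p2 a ha _ hu₂ _ hw₁ _ hw₂ ha1 ha2 h).elim
  rcases lt_trichotomy (θ a) (θ c) with h | h | h
  · exact p2 a ha _ hu₂ _ hw₁ c hc ha1 h hc2
  · have hac := inj a (Or.inl ha) c (Or.inr hc) h
    have hu1 := inj _ (Or.inl hu₁) _ (Or.inr hw₁) e1
    have hu2 := inj _ (Or.inl hu₂) _ (Or.inr hw₂) e2
    exact n3 u₁ a u₂ hu₁ ha hu₂ (hu1 ▸ hw₁) (hac ▸ hc) (hu2 ▸ hw₂) (ne (h ▸ hc1))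
      (ne (hc1.trans hc2)) (ne (h ▸ hc2))
  · exact p1 _ hu₁ a ha c hc _ hw₂ hc1 h ha2

/-- A generic direction inside an arc `[θ₁, θ₂]` that contains all of `W` and has no member of `U`
in its interior. -/
theorem exists_direction {X : Type*} [Finite X] (q : X → Plane) (U W : Set X) {θ₁ θ₂ : ℝ}
    (h12 : θ₁ < θ₂) (h1 : -Real.pi < θ₁) (h2 : θ₂ ≤ Real.pi)
    (hq : ∀ a ∈ U ∪ W, q a ≠ 0)
    (hW : ∀ b ∈ W, θ₁ ≤ ang (q b) ∧ ang (q b) ≤ θ₂)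
    (hU : ∀ a ∈ U, ang (q a) ≤ θ₁ ∨ θ₂ ≤ ang (q a)) :
    ∃ μ, θ₁ < μ ∧ μ < θ₂ ∧ θ₂ - Real.pi < μ ∧ μ < θ₁ + Real.pi ∧
      (∀ w, q w ≠ 0 → det2 (Real.cos μ, Real.sin μ) (q w) ≠ 0) ∧
      ∀ a ∈ U, ∀ b ∈ W,
        ¬ (0 < det2 (q a) (q b) * det2 (Real.cos μ, Real.sin μ) (q a) ∧
          0 < det2 (q a) (q b) * det2 (Real.cos μ, Real.sin μ) (q b)) := by
  have hpi := Real.pi_pos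
  have hdense : Dense (Set.range fun z : X × ℤ => ang (q z.1) + z.2 * Real.pi)ᶜ :=
    (Set.countable_range _).dense_compl ℝ
  obtain ⟨μ, hμ, hμ1, hμ2⟩ := hdense.exists_between
    (show max θ₁ (θ₂ - Real.pi) < min θ₂ (θ₁ + Real.pi) by
      rw [max_lt_iff, lt_min_iff, lt_min_iff]
      refine ⟨⟨h12, by linarith⟩, by linarith, by linarith⟩)
  rw [max_lt_iff] at hμ1
  rw [lt_min_iff] at hμ2
  have hdet : ∀ w, q w ≠ 0 → ∃ r, 0 < r ∧
      q w = (r * Real.cos (ang (q w)), r * Real.sin (ang (q w))) ∧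
      det2 (Real.cos μ, Real.sin μ) (q w) = r * Real.sin (ang (q w) - μ) := by
    intro w hw
    obtain ⟨r, hr, e⟩ := ang_spec hw
    refine ⟨r, hr, e, ?_⟩
    have := det2_polar 1 r μ (ang (q w))
    simp only [one_mul] at this
    rw [← this, ← e]
  refine ⟨μ, hμ1.1, hμ2.1, hμ1.2, hμ2.2, fun w hw => ?_, fun a ha b hb => ?_⟩
  · obtain ⟨r, hr, -, e⟩ := hdet w hw
    rw [e]
    refine mul_ne_zero hr.ne' fun h0 => ?_
    rw [Real.sin_eq_zero_iff] at h0
    obtain ⟨n, hn⟩ := h0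
    exact hμ ⟨(w, -n), by simp only [Int.cast_neg]; linarith⟩
  · obtain ⟨r, hr, ea, e⟩ := hdet a (hq a (Or.inl ha))
    obtain ⟨r', hr', eb, e'⟩ := hdet b (hq b (Or.inr hb))
    have ed : det2 (q a) (q b) = r * r' * Real.sin (ang (q b) - ang (q a)) := by
      conv_lhs => rw [ea, eb]
      exact det2_polar _ _ _ _
    rw [ed, e, e']
    have ma := ang_mem (q a)
    have hWb := hW b hb
    have hUa := hU a ha
    generalize ang (q a) = α at *
    generalize ang (q b) = β at *
    rintro ⟨k1, k2⟩
    have k1' : 0 < Real.sin (β - α) * Real.sin (α - μ) := by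
      have : 0 < (r * r' * r) * (Real.sin (β - α) * Real.sin (α - μ)) := by linarith
      exact (mul_pos_iff_of_pos_left (by positivity)).1 this
    have k2' : 0 < Real.sin (β - α) * Real.sin (β - μ) := by
      have : 0 < (r * r' * r') * (Real.sin (β - α) * Real.sin (β - μ)) := by linarith
      exact (mul_pos_iff_of_pos_left (by positivity)).1 this
    have neg : ∀ x, -Real.pi ≤ x → x ≤ 0 → Real.sin x ≤ 0 := fun x h h' =>
      Real.sin_nonpos_of_nonpos_of_neg_pi_le h' h
    have pos : ∀ x, 0 ≤ x → x ≤ Real.pi → 0 ≤ Real.sin x := fun x h h' =>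
      Real.sin_nonneg_of_nonneg_of_le_pi h h'
    have neg' : ∀ x, Real.pi ≤ x → x ≤ 2 * Real.pi → Real.sin x ≤ 0 := fun x h h' => by
      have := pos (x - Real.pi) (by linarith) (by linarith)
      rw [Real.sin_sub_pi] at this; linarith
    have pos' : ∀ x, -(2 * Real.pi) ≤ x → x ≤ -Real.pi → 0 ≤ Real.sin x := fun x h h' => by
      have := neg (x + Real.pi) (by linarith) (by linarith)
      rw [Real.sin_add_pi] at this; linarith
    rcases pos_and_pos_or_neg_and_neg_of_mul_pos k1' with ⟨s1, s2⟩ | ⟨s1, s2⟩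
    · have s3 : 0 < Real.sin (β - μ) := (mul_pos_iff_of_pos_left s1).1 k2'
      have g1 : μ < β := by
        by_contra hc
        exact absurd (neg (β - μ) (by linarith) (by linarith)) (not_le.2 s3)
      rcases hUa with hUa | hUa
      · by_cases hc : α ≤ μ - Real.pi
        · exact absurd (neg' (β - α) (by linarith) (by linarith)) (not_le.2 s1)
        · exact absurd (neg (α - μ) (by linarith) (by linarith)) (not_le.2 s2)
      · have hc : α < μ + Real.pi := by
          by_contra hc
          exact absurd (neg' (α - μ) (by linarith) (by linarith)) (not_le.2 s2)
        exact absurd (neg (β - α) (by linarith) (by linarith)) (not_le.2 s1)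
    · have s3 : Real.sin (β - μ) < 0 := by
        by_contra hc
        exact absurd (mul_nonpos_of_nonpos_of_nonneg s1.le (not_lt.1 hc)) (not_le.2 k2')
      have g1 : β < μ := by
        by_contra hc
        exact absurd (pos (β - μ) (by linarith) (by linarith)) (not_le.2 s3)
      rcases hUa with hUa | hUa
      · have hc : μ - Real.pi < α := by
          by_contra hc
          exact absurd (pos' (α - μ) (by linarith) (by linarith)) (not_le.2 s2)
        exact absurd (pos (β - α) (by linarith) (by linarith)) (not_le.2 s1)
      · by_cases hc : μ + Real.pi ≤ α
        · exact absurd (pos' (β - α) (by linarith) (by linarith)) (not_le.2 s1)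
        · exact absurd (pos (α - μ) (by linarith) (by linarith)) (not_le.2 s2)

/-! ### Contractible edges -/

/-- The triple `a, b, z` separates the set `C` from a nonempty remainder. -/
structure TripleCut {V : Type*} (G : SimpleGraph V) (a b z : V) (C : Set V) : Prop where
  ne : C.Nonempty
  ha : a ∉ C
  hb : b ∉ C
  hz : z ∉ C
  closed : ClosedIn G C {a, b, z}
  rest : ∃ w, w ∉ C ∧ w ≠ a ∧ w ≠ b ∧ w ≠ z

theorem TripleCut.compl {V : Type*} {G : SimpleGraph V} {a b z : V} {C : Set V}
    (h : TripleCut G a b z C) : TripleCut G a b z (C ∪ {a, b, z})ᶜ := by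
  obtain ⟨w, h1, h2, h3, h4⟩ := h.rest
  obtain ⟨x, hx⟩ := h.ne
  refine ⟨⟨w, by simp [h1, h2, h3, h4]⟩, by simp, by simp, by simp, h.closed.compl, x,
    by simp [hx], ?_, ?_, ?_⟩
  · rintro rfl; exact h.ha hx
  · rintro rfl; exact h.hb hx
  · rintro rfl; exact h.hz hx

theorem Conn3.not_closed_pair {V : Type*} {G : SimpleGraph V} (h : Conn3 G) {C : Set V} {s t w : V}
    (hC : C.Nonempty) (hs : s ∉ C) (ht : t ∉ C) (hw : w ∉ C) (hws : w ≠ s) (hwt : w ≠ t) :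
    ∃ x ∈ C, ∃ y, G.Adj x y ∧ y ∉ C ∧ y ≠ s ∧ y ≠ t := by
  by_contra hcon
  push Not at hcon
  rcases h.2 C s t hC hs ht (fun x hx y hxy => by
    by_cases hy : y ∈ C
    · exact Or.inl hy
    · by_cases hys : y = s
      · exact Or.inr (Or.inl hys)
      · exact Or.inr (Or.inr (hcon x hx y hxy hy hys))) w with h | h | h
  · exact hw h
  · exact hws h
  · exact hwt h

theorem TripleCut.of_not_conn3 {V : Type*} [Finite V] {G : SimpleGraph V} (h : Conn3 G)
    (h5 : 5 ≤ Nat.card V) {u v : V} (huv : G.Adj u v) (hn : ¬ Conn3 (contr G u v)) :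
    ∃ z C, TripleCut G u v z C := by
  have hcard := card_ne_lt v
  have hn' : ∃ (C : Set {w : V // w ≠ v}) (s t : {w : V // w ≠ v}), C.Nonempty ∧ s ∉ C ∧ t ∉ C ∧
      ClosedIn (contr G u v) C {s, t} ∧ ∃ w, w ∉ C ∧ w ≠ s ∧ w ≠ t := by
    by_contra hcon
    push Not at hcon
    refine hn ⟨by omega, fun C s t hC hs ht hcl w => ?_⟩
    have := hcon C s t hC hs ht hcl w
    tauto
  obtain ⟨C, s, t, hC, hs, ht, hcl, w, hw, hws, hwt⟩ := hn'
  set C' : Set V := Subtype.val '' C with hC'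
  have mem' : ∀ x : {w : V // w ≠ v}, x.1 ∈ C' ↔ x ∈ C := fun x => by simp [hC', x.2]
  have ne' : ∀ {x y : {w : V // w ≠ v}}, x ≠ y → x.1 ≠ y.1 := fun h e => h (Subtype.ext e)
  have hvC : v ∉ C' := by rintro ⟨x, -, hx⟩; exact x.2 hx
  have cut : ∀ z : {w : V // w ≠ v}, z ∉ C → (⟨u, huv.ne⟩ : {w : V // w ≠ v}) ∉ C →
      ClosedIn (contr G u v) C {⟨u, huv.ne⟩, z} → w ≠ ⟨u, huv.ne⟩ → w ≠ z →
      ∃ z C, TripleCut G u v z C := by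
    intro z hz hu hcl hwu hwz
    refine ⟨z, C', hC.image _, fun h => hu ((mem' ⟨u, huv.ne⟩).1 h), hvC,
      fun h => hz ((mem' _).1 h), ?_, w, fun h => hw ((mem' _).1 h), ne' hwu, w.2, ne' hwz⟩
    rintro _ ⟨x, hx, rfl⟩ y hxy
    by_cases hyv : y = v
    · exact Or.inr (Or.inr (Or.inl hyv))
    rcases hcl x hx ⟨y, hyv⟩ (contr_adj_of_adj hxy) with h | h | h
    · exact Or.inl ⟨_, h, rfl⟩
    · exact Or.inr (Or.inl (congrArg Subtype.val h))
    · exact Or.inr (Or.inr (Or.inr (congrArg Subtype.val h)))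
  by_cases hsu : s = ⟨u, huv.ne⟩
  · subst hsu; exact cut t ht hs hcl hws hwt
  by_cases htu : t = ⟨u, huv.ne⟩
  · subst htu; exact cut s hs ht (by rwa [pair_comm]) hwt hws
  exfalso
  by_cases hu : (⟨u, huv.ne⟩ : {w : V // w ≠ v}) ∈ C
  · obtain ⟨x, hx, y, hxy, hy, hys, hyt⟩ := h.not_closed_pair (C := insert v C') (s := s) (t := t)
      (w := w) ⟨v, mem_insert _ _⟩ (fun h => h.elim s.2 fun h => hs ((mem' _).1 h))
      (fun h => h.elim t.2 fun h => ht ((mem' _).1 h))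
      (fun h => h.elim w.2 fun h => hw ((mem' _).1 h)) (ne' hws) (ne' hwt)
    have hyv : y ≠ v := fun e => hy (Or.inl e)
    have hyC : (⟨y, hyv⟩ : {w : V // w ≠ v}) ∉ C := fun h => hy (Or.inr ((mem' ⟨y, hyv⟩).2 h))
    have hyu : y ≠ u := by rintro rfl; exact hyC hu
    have : (⟨y, hyv⟩ : {w : V // w ≠ v}) ∈ C ∨ (⟨y, hyv⟩ : {w : V // w ≠ v}) ∈ ({s, t} : Set _) := by
      rcases hx with rfl | ⟨x, hx, rfl⟩
      · exact hcl _ hu ⟨y, hyv⟩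
          ⟨fun e => hyu (congrArg Subtype.val e).symm, Or.inr (Or.inl ⟨rfl, hxy⟩)⟩
      · exact hcl x hx ⟨y, hyv⟩ (contr_adj_of_adj hxy)
    rcases this with h | h | h
    · exact hyC h
    · exact hys (congrArg Subtype.val h)
    · exact hyt (congrArg Subtype.val h)
  · obtain ⟨_, ⟨x, hx, rfl⟩, y, hxy, hy, hys, hyt⟩ := h.not_closed_pair (C := C') (s := s) (t := t)
      (w := w) (hC.image _) (fun h => hs ((mem' _).1 h)) (fun h => ht ((mem' _).1 h))
      (fun h => hw ((mem' _).1 h)) (ne' hws) (ne' hwt)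
    by_cases hyv : y = v
    · subst hyv
      rcases hcl x hx ⟨u, huv.ne⟩ ⟨fun e => hu (e ▸ hx), Or.inr (Or.inr ⟨rfl, hxy.symm⟩)⟩ with h | h | h
      · exact hu h
      · exact hsu h.symm
      · exact htu h.symm
    rcases hcl x hx ⟨y, hyv⟩ (contr_adj_of_adj hxy) with h | h | h
    · exact hy ⟨_, h, rfl⟩
    · exact hys (congrArg Subtype.val h)
    · exact hyt (congrArg Subtype.val h)

theorem Conn3.exists_contractible {V : Type*} [Finite V] {G : SimpleGraph V} (h : Conn3 G)
    (h5 : 5 ≤ Nat.card V) (T : Set V) (hT : ∀ s ∈ T, ∀ t ∈ T, s ≠ t → G.Adj s t)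
    (hT' : ∃ v, v ∉ T) : ∃ u v, G.Adj u v ∧ v ∉ T ∧ Conn3 (contr G u v) := by
  by_contra hcon
  push Not at hcon
  have hcut : ∀ u v, G.Adj u v → v ∉ T → ∃ z C, TripleCut G u v z C :=
    fun u v huv hv => TripleCut.of_not_conn3 h h5 huv (hcon u v huv hv)
  have hmin : ∀ n a b z C, C.ncard = n → G.Adj a b → TripleCut G a b z C → (∀ t ∈ T, t ∉ C) →
      False := by
    intro n
    induction n using Nat.strong_induction_on with
    | _ n ih =>
    intro a b z C hn hab hC hCT
    obtain ⟨w, hw, hwa, hwb, hwz⟩ := hC.rest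
    obtain ⟨v₀, hv₀, y, hvy, hy, hya, hyb⟩ := h.not_closed_pair hC.ne hC.ha hC.hb hw hwa hwb
    have hyz : y = z := by
      rcases hC.closed v₀ hv₀ y hvy with h | h | h | h
      exacts [absurd h hy, absurd h hya, absurd h hyb, h]
    subst hyz
    have hvT : v₀ ∉ T := fun h => hCT _ h hv₀
    obtain ⟨z', E, hE⟩ := hcut y v₀ hvy.symm hvT
    have main : ∀ E, TripleCut G y v₀ z' E → a ∉ E → b ∉ E → False := by
      intro E hE ha hb
      obtain ⟨w', hw', hwy', hwv', hwz'⟩ := hE.rest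
      obtain ⟨x, hx, x', hxx, hx1, hx2, hx3⟩ := h.not_closed_pair hE.ne hE.ha hE.hz hw' hwy' hwz'
      have hxv : x' = v₀ := by
        rcases hE.closed x hx x' hxx with h | h | h | h
        exacts [absurd h hx1, absurd h hx2, h, absurd h hx3]
      subst hxv
      have hxC : x ∈ C := by
        rcases hC.closed x' hv₀ x hxx.symm with h | h | h | h
        · exact h
        · exact absurd hx (h ▸ ha)
        · exact absurd hx (h ▸ hb)
        · exact absurd hx (h ▸ hE.ha)
      refine ih (C ∩ E).ncard ?_ y x' z' (C ∩ E) rfl hvy.symm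
        ⟨⟨x, hxC, hx⟩, fun h => hE.ha h.2, fun h => hE.hb h.2, fun h => hE.hz h.2, ?_, w',
          fun h => hw' h.2, hwy', hwv', hwz'⟩ fun t ht h => hCT t ht h.1
      · rw [← hn]
        exact ncard_lt_ncard ⟨inter_subset_left, fun h => hE.hb (h hv₀).2⟩ (toFinite _)
      · rintro q ⟨hq, hq'⟩ r hqr
        rcases hE.closed q hq' r hqr with h | h
        · rcases hC.closed q hq r hqr with h' | h' | h' | h'
          · exact Or.inl ⟨h', h⟩
          · exact absurd h (h' ▸ ha)
          · exact absurd h (h' ▸ hb)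
          · exact Or.inr (Or.inl h')
        · exact Or.inr h
    by_cases haE : a ∈ E
    · refine main _ hE.compl (fun h => h (Or.inl haE)) fun h => ?_
      exact h (hE.closed a haE b hab)
    · by_cases hbE : b ∈ E
      · refine main _ hE.compl (fun h => ?_) fun h => h (Or.inl hbE)
        exact h (hE.closed b hbE a hab.symm)
      · exact main E hE haE hbE
  obtain ⟨v, hv⟩ := hT'
  obtain ⟨w, hwv, -, -⟩ := exists_ne_triple h.1 v v v
  obtain ⟨w', hwv', hww', -⟩ := exists_ne_triple h.1 v w w
  obtain ⟨x, rfl, u, hvu, -⟩ := h.not_closed_pair (C := {v}) (s := w) (t := w) (w := w') ⟨v, rfl⟩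
    hwv hwv hwv' hww' hww'
  obtain ⟨z, C, hC⟩ := hcut u x hvu.symm hv
  by_cases hTC : ∀ t ∈ T, t ∉ C
  · exact hmin _ _ _ _ C rfl hvu.symm hC hTC
  · push Not at hTC
    obtain ⟨t, ht, htC⟩ := hTC
    refine hmin _ _ _ _ _ rfl hvu.symm hC.compl fun s hs hsC => hsC ?_
    by_cases hst : s = t
    · exact Or.inl (hst ▸ htC)
    · exact hC.closed t htC s (hT t ht s hs (Ne.symm hst))

theorem Conn3.exists_nbr {V : Type*} [Finite V] {G : SimpleGraph V} (h : Conn3 G) {v s t : V}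
    (hs : s ≠ v) (ht : t ≠ v) : ∃ y, G.Adj v y ∧ y ≠ s ∧ y ≠ t := by
  obtain ⟨w, hwv, hws, hwt⟩ := exists_ne_triple h.1 v s t
  obtain ⟨x, rfl, y, hy, -, hys, hyt⟩ := h.not_closed_pair (C := {v}) ⟨v, rfl⟩ hs ht hwv hws hwt
  exact ⟨y, hy, hys, hyt⟩

theorem det2_neg_left (d q : Plane) : det2 (-d) q = - det2 d q := by
  simp [det2]; ring

theorem det2_swap (q q' : Plane) : det2 q q' = - det2 q' q := by
  simp [det2]; ring

theorem IsSL.det2_ne {V : Type*} {G : SimpleGraph V} {p : V → Plane} (hp : IsSL G p) {a b c : V}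
    (hab : a ≠ b) (hac : a ≠ c) (hbc : b ≠ c) : det2 (p b - p a) (p c - p a) ≠ 0 := by
  rw [← det3_eq_det2]
  exact hp.gen _ _ _ hab hac hbc

theorem HT.split_cases {V : Type*} [Finite V] {G : SimpleGraph V} {u v : V} (hG : HT G)
    (h3 : Conn3 G) (huv : G.Adj u v) (hH : Conn3 (_root_.contr G u v))
    {p : {w : V // w ≠ v} → Plane} (hp : IsSL (_root_.contr G u v) p)
    (hy : Function.Injective fun w => (p w).2) {u' : {w : V // w ≠ v}} (hu' : u'.1 = u)
    (θ : {w : V // w ≠ v} → ℝ) (hθ : ∀ w, θ w = ang (p w - p u')) :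
    ∃ w₁ w₂ u₁ u₂ : {w : V // w ≠ v}, (G.Adj v w₁ ∧ w₁ ≠ u') ∧ (G.Adj v w₂ ∧ w₂ ≠ u') ∧
      G.Adj u u₁ ∧ G.Adj u u₂ ∧
      (∀ w : {w : V // w ≠ v}, G.Adj v w → w ≠ u' → θ w₁ ≤ θ w ∧ θ w ≤ θ w₂) ∧
      (∀ w : {w : V // w ≠ v}, G.Adj u w → θ u₁ ≤ θ w ∧ θ w ≤ θ u₂) ∧
      ((∃ μ, θ w₁ < μ ∧ μ < θ w₂ ∧
          ∀ᶠ ε in 𝓝[>] (0:ℝ), IsSL G (splitPos p u' (Real.cos μ, Real.sin μ) ε)) ∨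
        ((∀ c : {w : V // w ≠ v}, G.Adj v c → c ≠ u' → ¬ (θ u₁ < θ c ∧ θ c < θ u₂)) ∧
          ∃ μ, θ u₁ < μ ∧ μ < θ u₂ ∧
          ∀ᶠ ε in 𝓝[>] (0:ℝ), IsSL G (splitPos p u' (-(Real.cos μ, Real.sin μ)) ε))) := by
  subst hu'
  set W : Set {w : V // w ≠ v} := {w | G.Adj v w ∧ w ≠ u'} with hW
  set U : Set {w : V // w ≠ v} := {w | G.Adj u' w} with hU
  have hθinj : ∀ a b, a ≠ u' → b ≠ u' → θ a = θ b → a = b := by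
    intro a b ha hb hab
    by_contra hne
    rw [hθ, hθ] at hab
    exact ang_ne (hp.det2_ne ha.symm hb.symm hne) hab
  have hUne : ∀ a ∈ U, a ≠ u' := fun a ha e => (ha : G.Adj u'.1 a.1).ne (congrArg _ e.symm)
  have hmem : ∀ a ∈ U ∪ W, a ≠ u' := by
    rintro a (ha | ha)
    exacts [hUne a ha, ha.2]
  obtain ⟨y₁, hy₁, hy₁u, -⟩ := h3.exists_nbr huv.ne huv.ne
  obtain ⟨y₂, hy₂, hy₂u, hy₂₁⟩ := h3.exists_nbr huv.ne hy₁.ne'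
  obtain ⟨z₁, hz₁, hz₁v, -⟩ := h3.exists_nbr huv.ne' huv.ne'
  obtain ⟨z₂, hz₂, hz₂v, hz₂₁⟩ := h3.exists_nbr huv.ne' hz₁.ne'
  have hy₁W : (⟨y₁, hy₁.ne'⟩ : {w : V // w ≠ v}) ∈ W := ⟨hy₁, fun e => hy₁u (congrArg Subtype.val e)⟩
  have hy₂W : (⟨y₂, hy₂.ne'⟩ : {w : V // w ≠ v}) ∈ W := ⟨hy₂, fun e => hy₂u (congrArg Subtype.val e)⟩
  have hz₁U : (⟨z₁, hz₁v⟩ : {w : V // w ≠ v}) ∈ U := hz₁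
  have hz₂U : (⟨z₂, hz₂v⟩ : {w : V // w ≠ v}) ∈ U := hz₂
  obtain ⟨w₁, hw₁, hw₁'⟩ := exists_min_image W θ (toFinite _) ⟨_, hy₁W⟩
  obtain ⟨w₂, hw₂, hw₂'⟩ := exists_max_image W θ (toFinite _) ⟨_, hy₁W⟩
  obtain ⟨u₁, hu₁, hu₁'⟩ := exists_min_image U θ (toFinite _) ⟨_, hz₁U⟩
  obtain ⟨u₂, hu₂, hu₂'⟩ := exists_max_image U θ (toFinite _) ⟨_, hz₁U⟩
  have hltW : θ w₁ < θ w₂ := by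
    refine lt_of_le_of_ne (hw₁' _ hw₂) fun e => hy₂₁ ?_
    have e1 := hθinj _ _ hy₁W.2 hy₂W.2 (le_antisymm ((hw₂' _ hy₁W).trans (e ▸ hw₁' _ hy₂W))
      ((hw₂' _ hy₂W).trans (e ▸ hw₁' _ hy₁W)))
    exact (congrArg Subtype.val e1).symm
  have hltU : θ u₁ < θ u₂ := by
    refine lt_of_le_of_ne (hu₁' _ hu₂) fun e => hz₂₁ ?_
    have e1 := hθinj _ _ (hUne _ hz₁U) (hUne _ hz₂U)
      (le_antisymm ((hu₂' _ hz₁U).trans (e ▸ hu₁' _ hz₂U))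
      ((hu₂' _ hz₂U).trans (e ▸ hu₁' _ hz₁U)))
    exact (congrArg Subtype.val e1).symm
  have hq : ∀ w, w ≠ u' → p w - p u' ≠ 0 := fun w hw e => hw (hp.inj (sub_eq_zero.1 e))
  have hbd : ∀ w, -Real.pi < θ w ∧ θ w ≤ Real.pi := fun w => by
    rw [hθ]; exact ang_mem _
  have hne : ∀ μ, (Real.cos μ, Real.sin μ) ≠ (0 : Plane) := by
    intro μ h
    have h1 := congrArg Prod.fst h
    have h2 := congrArg Prod.snd h
    simp only [Prod.fst_zero, Prod.snd_zero] at h1 h2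
    have := Real.sin_sq_add_cos_sq μ
    rw [h1, h2] at this
    norm_num at this
  refine ⟨w₁, w₂, u₁, u₂, hw₁, hw₂, hu₁, hu₂, fun w h h' => ⟨hw₁' w ⟨h, h'⟩, hw₂' w ⟨h, h'⟩⟩,
    fun w h => ⟨hu₁' w h, hu₂' w h⟩, ?_⟩
  have hu'eq : (⟨u'.1, huv.ne⟩ : {w : V // w ≠ v}) = u' := rfl
  have hdich := arc_dichotomy θ U W (fun a ha b hb => hθinj a b (hmem a ha) (hmem b hb))
    (fun a ha b hb c hc d hd hab hac had hbc hbd hcd => by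
      have := hG.not_alternate huv hH hp hy hab hac had hbc hbd hcd ha hb hc.1 hd.1
        (fun e => hc.2 (Subtype.ext e)) (fun e => hd.2 (Subtype.ext e))
      simpa only [hu'eq, ← hθ] using this)
    (fun a b c ha hb hc ha' hb' hc' hab hac hbc =>
      hG.not_three_common huv hH (fun e => hab (Subtype.ext e)) (fun e => hac (Subtype.ext e))
        (fun e => hbc (Subtype.ext e)) ha hb hc ha'.1 hb'.1 hc'.1)
    hw₁ hw₂ hu₁ hu₂ (fun w h => ⟨hw₁' w h, hw₂' w h⟩) (fun w h => ⟨hu₁' w h, hu₂' w h⟩)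
  rcases hdich with hd | hd
  · left
    obtain ⟨μ, h1, h2, -, -, h5, h6⟩ := exists_direction (fun w => p w - p u') U W hltW (hbd w₁).1
      (hbd w₂).2 (fun a ha => hq a (hmem a ha))
      (fun b hb => by rw [← hθ]; exact ⟨hw₁' b hb, hw₂' b hb⟩)
      (fun a ha => by
        rw [← hθ]
        by_contra hc
        push Not at hc
        exact hd a ha hc)
    refine ⟨μ, h1, h2, split_isSL huv hp (hne μ) rfl (fun w hw => h5 w (hq w hw)) ?_⟩
    intro a b ha hb hab hua hvb
    exact h6 a hua b ⟨hvb, hb⟩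
  · right
    refine ⟨fun c h h' => hd c ⟨h, h'⟩, ?_⟩
    obtain ⟨μ, h1, h2, -, -, h5, h6⟩ := exists_direction (fun w => p w - p u') W U hltU (hbd u₁).1
      (hbd u₂).2 (fun a ha => hq a (hmem a ha.symm))
      (fun b hb => by rw [← hθ]; exact ⟨hu₁' b hb, hu₂' b hb⟩)
      (fun a ha => by
        rw [← hθ]
        by_contra hc
        push Not at hc
        exact hd a ha hc)
    refine ⟨μ, h1, h2, split_isSL huv hp (neg_ne_zero.2 (hne μ)) rfl (fun w hw => ?_) ?_⟩
    · rw [det2_neg_left]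
      exact neg_ne_zero.2 (h5 w (hq w hw))
    intro a b ha hb hab hua hvb hc
    refine h6 b ⟨hvb, hb⟩ a hua ?_
    rw [det2_neg_left, det2_neg_left] at hc
    rw [det2_swap (p b - p u') (p a - p u')]
    constructor
    · nlinarith [hc.2]
    · nlinarith [hc.1]

/-- The point `w` lies strictly inside the triangle `a b c`. -/
def InTri (a b c w : Plane) : Prop :=
  0 < det3 a b c * det3 a b w ∧ 0 < det3 a b c * det3 b c w ∧ 0 < det3 a b c * det3 c a w

theorem InTri.rot {a b c w : Plane} (h : InTri a b c w) : InTri b c a w := by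
  obtain ⟨h1, h2, h3⟩ := h
  unfold InTri
  rw [det3_rot]
  exact ⟨h2, h3, h1⟩

theorem SegCross.of_det3 {a b c d a' b' c' d' : Plane} {k : ℝ} (hk : k ≠ 0)
    (h1 : det3 a' b' c' = k * det3 a b c) (h2 : det3 a' b' d' = k * det3 a b d)
    (h3 : det3 c' d' a' = k * det3 c d a) (h4 : det3 c' d' b' = k * det3 c d b)
    (h : SegCross a' b' c' d') : SegCross a b c d := by
  have hk2 : 0 < k ^ 2 := by positivity
  unfold SegCross at h
  rw [h1, h2, h3, h4] at h
  constructor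
  · by_contra hc
    nlinarith [mul_nonneg hk2.le (not_lt.1 hc), h.1]
  · by_contra hc
    nlinarith [mul_nonneg hk2.le (not_lt.1 hc), h.2]

/-- An affine change of coordinates, described by its effect on determinants. -/
def DetScale {V : Type*} (p q : V → Plane) (k : ℝ) : Prop :=
  ∀ a b c, det3 (q a) (q b) (q c) = k * det3 (p a) (p b) (p c)

theorem IsSL.of_detScale {V : Type*} {G : SimpleGraph V} {p q : V → Plane} (hp : IsSL G p) {k : ℝ}
    (hk : k ≠ 0) (h : DetScale p q k) (hq : Function.Injective q) : IsSL G q where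
  inj := hq
  gen a b c hab hac hbc := by
    rw [h]
    exact mul_ne_zero hk (hp.gen a b c hab hac hbc)
  nocross a b c d hab hcd h1 h2 h3 h4 hc :=
    hp.nocross a b c d hab hcd h1 h2 h3 h4
      (hc.of_det3 hk (h _ _ _) (h _ _ _) (h _ _ _) (h _ _ _))

theorem DetScale.inTri {V : Type*} {p q : V → Plane} {k : ℝ} (hk : k ≠ 0) (h : DetScale p q k)
    {a b c w : V} (hw : InTri (p a) (p b) (p c) (p w)) : InTri (q a) (q b) (q c) (q w) := by
  have hk2 : 0 < k ^ 2 := by positivity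
  obtain ⟨h1, h2, h3⟩ := hw
  unfold InTri
  rw [h, h, h, h]
  refine ⟨?_, ?_, ?_⟩
  · nlinarith [mul_pos hk2 h1]
  · nlinarith [mul_pos hk2 h2]
  · nlinarith [mul_pos hk2 h3]

theorem IsSL.comp {V W : Type*} {G : SimpleGraph V} {H : SimpleGraph W} {p : V → Plane}
    (hp : IsSL G p) {f : W → V} (hf : Function.Injective f)
    (h : ∀ a b, H.Adj a b → G.Adj (f a) (f b)) : IsSL H (p ∘ f) where
  inj := hp.inj.comp hf
  gen a b c hab hac hbc := hp.gen _ _ _ (hf.ne hab) (hf.ne hac) (hf.ne hbc)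
  nocross a b c d hab hcd h1 h2 h3 h4 :=
    hp.nocross _ _ _ _ (h _ _ hab) (h _ _ hcd) (hf.ne h1) (hf.ne h2) (hf.ne h3) (hf.ne h4)

theorem exists_small_ne {J : Type*} [Finite J] (a b : J → ℝ) (h : ∀ j, a j ≠ 0 ∨ b j ≠ 0) :
    ∃ κ : ℝ, 0 < κ ∧ ∀ j, a j + κ * b j ≠ 0 := by
  have h1 : ∀ᶠ κ in 𝓝[>] (0:ℝ), ∀ j, a j + κ * b j ≠ 0 :=
    eventually_all.2 fun j => eventually_affine_ne (h j)
  obtain ⟨κ, hκ, hκ0⟩ := (h1.and self_mem_nhdsWithin).exists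
  exact ⟨κ, hκ0, hκ⟩

/-- A drawing with pairwise distinct heights, affinely equivalent to the given one. -/
theorem IsSL.exists_heights {V : Type*} [Finite V] {G : SimpleGraph V} {p : V → Plane}
    (hp : IsSL G p) : ∃ q, IsSL G q ∧ (Function.Injective fun w => (q w).2) ∧ DetScale p q 1 := by
  obtain ⟨κ, -, hκ⟩ := exists_small_ne (J := {x : V × V // x.1 ≠ x.2})
    (fun x => (p x.1.1).2 - (p x.1.2).2) (fun x => (p x.1.1).1 - (p x.1.2).1) fun x => by
      by_contra hc
      push Not at hc
      exact x.2 (hp.inj (Prod.ext (sub_eq_zero.1 hc.2) (sub_eq_zero.1 hc.1)))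
  have hinj : Function.Injective fun w => (p w).2 + κ * (p w).1 := by
    intro a b hab
    by_contra hne
    refine hκ ⟨(a, b), hne⟩ ?_
    simp only at hab ⊢
    linarith
  have hs : DetScale p (fun w => ((p w).1, (p w).2 + κ * (p w).1)) 1 := by
    intro a b c
    simp only [det3]
    ring
  exact ⟨_, hp.of_detScale one_ne_zero hs fun a b hab => hinj (congrArg Prod.snd hab), hinj, hs⟩

/-- Four points in general position, the last one inside the triangle of the others. -/
def fourPosInt : Fin 4 → ℤ × ℤ := ![(0, 0), (8, 0), (4, 8), (5, 2)]

/-- Determinants of the four integer points. -/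
def fourDet (a b c : Fin 4) : ℤ :=
  ((fourPosInt b).1 - (fourPosInt a).1) * ((fourPosInt c).2 - (fourPosInt a).2) -
    ((fourPosInt b).2 - (fourPosInt a).2) * ((fourPosInt c).1 - (fourPosInt a).1)

/-- The four points, in the real plane. -/
def fourPos (i : Fin 4) : Plane := ((fourPosInt i).1, (fourPosInt i).2)

theorem det3_fourPos (a b c : Fin 4) : det3 (fourPos a) (fourPos b) (fourPos c) = fourDet a b c := by
  simp only [det3, fourPos, fourDet]
  push_cast
  ring

theorem fourPos_isSL : IsSL (⊤ : SimpleGraph (Fin 4)) fourPos where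
  inj a b h := by
    have h1 : (fourPosInt a).1 = (fourPosInt b).1 := by
      have h2 : (((fourPosInt a).1 : ℤ) : ℝ) = (fourPosInt b).1 := congrArg Prod.fst h
      exact_mod_cast h2
    clear h
    revert a b
    decide
  gen a b c hab hac hbc := by
    rw [det3_fourPos]
    have : fourDet a b c ≠ 0 := by
      revert a b c
      decide
    exact_mod_cast this
  nocross a b c d hab hcd h1 h2 h3 h4 := by
    unfold SegCross
    simp only [det3_fourPos]
    have hab := hab.ne
    have hcd := hcd.ne
    have : ¬ (fourDet a b c * fourDet a b d < 0 ∧ fourDet c d a * fourDet c d b < 0) := by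
      clear * - hab hcd h1 h2 h3 h4
      revert a b c d
      decide
    exact_mod_cast this

theorem exists_to_four {V : Type*} [Finite V] (h : Nat.card V ≤ 4) {a b c : V} (hab : a ≠ b)
    (hac : a ≠ c) (hbc : b ≠ c) :
    ∃ f : V → Fin 4, Function.Injective f ∧ f a = 0 ∧ f b = 1 ∧ f c = 2 := by
  have := Fintype.ofFinite V
  rw [Nat.card_eq_fintype_card] at h
  obtain ⟨e⟩ := Function.Embedding.nonempty_of_card_le (α := V) (β := Fin 4) (by simpa using h)
  have key : ∀ i j k : Fin 4, i ≠ j → i ≠ k → j ≠ k →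
      ∃ σ : Equiv.Perm (Fin 4), σ i = 0 ∧ σ j = 1 ∧ σ k = 2 := by
    intro i j k hij hik hjk
    refine ⟨Equiv.swap (Equiv.swap (Equiv.swap i 0 j) 1 (Equiv.swap i 0 k)) 2 *
      (Equiv.swap (Equiv.swap i 0 j) 1 * Equiv.swap i 0), ?_⟩
    revert i j k
    decide
  obtain ⟨σ, h0, h1, h2⟩ := key (e a) (e b) (e c) (e.injective.ne hab) (e.injective.ne hac)
    (e.injective.ne hbc)
  exact ⟨σ ∘ e, σ.injective.comp e.injective, h0, h1, h2⟩

/-- Graphs on at most four vertices can be drawn with a prescribed hull triangle. -/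
theorem exists_isSL_of_card_le_four {V : Type*} [Finite V] (G : SimpleGraph V)
    (h : Nat.card V ≤ 4) {a b c : V} (hab : a ≠ b) (hac : a ≠ c) (hbc : b ≠ c) :
    ∃ p, IsSL G p ∧ (p a = (0, 0) ∧ p b = (8, 0) ∧ p c = (4, 8)) ∧
      ∀ w, w ≠ a → w ≠ b → w ≠ c → p w = (5, 2) := by
  obtain ⟨f, hf, ha, hb, hc⟩ := exists_to_four h hab hac hbc
  refine ⟨fourPos ∘ f, fourPos_isSL.comp hf fun x y hxy => hf.ne hxy.ne, ⟨?_, ?_, ?_⟩, ?_⟩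
  · simp [ha, fourPos, fourPosInt]
  · simp [hb, fourPos, fourPosInt]
  · simp [hc, fourPos, fourPosInt]
  · intro w hwa hwb hwc
    have h0 : f w ≠ 0 := ha ▸ hf.ne hwa
    have h1 : f w ≠ 1 := hb ▸ hf.ne hwb
    have h2 : f w ≠ 2 := hc ▸ hf.ne hwc
    have h3 : f w = 3 := by
      revert h0 h1 h2
      generalize f w = i
      revert i
      decide
    simp [h3, fourPos, fourPosInt]

/-- A 3-connected graph in the Hanani–Tutte class has a straight-line drawing. -/
theorem HT.exists_isSL_of_conn3 (n : ℕ) : ∀ {V : Type*} [Finite V] {G : SimpleGraph V},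
    Nat.card V = n → HT G → Conn3 G → ∃ p, IsSL G p := by
  induction n with
  | zero =>
    intro V _ G hn hG h3
    have := h3.1
    omega
  | succ n ih =>
    intro V _ G hn hG h3
    rcases Nat.lt_or_ge 4 (Nat.card V) with h5 | h4
    · have hne : Nonempty V := (Nat.card_pos_iff.1 (by omega)).1
      obtain ⟨u, v, huv, -, hH⟩ := h3.exists_contractible h5 ∅ (fun s hs => hs.elim)
        ⟨hne.some, fun h => h⟩
      obtain ⟨p, hp⟩ := ih (by have := card_ne_lt v; omega) (hG.contr huv) hH
      obtain ⟨q, hq, hy, -⟩ := hp.exists_heights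
      obtain ⟨w₁, w₂, u₁, u₂, -, -, -, -, -, -, hc⟩ := hG.split_cases h3 huv hH hq hy
        (u' := ⟨u, huv.ne⟩) rfl _ fun _ => rfl
      rcases hc with ⟨μ, -, -, h⟩ | ⟨-, μ, -, -, h⟩
      · exact ⟨_, h.exists.choose_spec⟩
      · exact ⟨_, h.exists.choose_spec⟩
    · have hne : Nonempty V := (Nat.card_pos_iff.1 (by have := h3.1; omega)).1
      obtain ⟨a⟩ := hne
      obtain ⟨b, hb, -⟩ := exists_ne_triple h3.1 a a a
      obtain ⟨c, hca, hcb, -⟩ := exists_ne_triple h3.1 a b b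
      obtain ⟨p, hp, -⟩ := exists_isSL_of_card_le_four G h4 hb.symm hca.symm hcb.symm
      exact ⟨p, hp⟩

theorem exists_corner_frame {V : Type*} [Finite V] {G : SimpleGraph V} {p : V → Plane}
    (hp : IsSL G p) {a b c : V} (hab : a ≠ b) (hac : a ≠ c) (hbc : b ≠ c)
    (hin : ∀ w, w ≠ a → w ≠ b → w ≠ c → InTri (p a) (p b) (p c) (p w)) :
    ∃ q k, k ≠ 0 ∧ DetScale p q k ∧ IsSL G q ∧ (Function.Injective fun w => (q w).2) ∧ q a = 0 ∧
      0 < det2 (q b) (q c) ∧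
      ∀ w, w ≠ a → 0 < (q w).2 ∧ ang (q b) ≤ ang (q w) ∧ ang (q w) ≤ ang (q c) := by
  set D := det3 (p a) (p b) (p c) with hD
  have hD0 : D ≠ 0 := hp.gen _ _ _ hab hac hbc
  set l : V → ℝ := fun w => det3 (p a) (p w) (p c) / D with hl
  set m : V → ℝ := fun w => det3 (p a) (p b) (p w) / D with hm
  have hident : ∀ x y z, (l y - l x) * (m z - m x) - (m y - m x) * (l z - l x) =
      det3 (p x) (p y) (p z) / D := by
    intro x y z
    rw [eq_div_iff hD0]
    simp only [hl, hm]
    field_simp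
    simp only [hD, det3]
    ring
  have hla : l a = 0 := by simp [hl, det3]
  have hma : m a = 0 := by simp [hm, det3]
  have hlb : l b = 1 := by simp only [hl, ← hD]; field_simp
  have hmb : m b = 0 := by simp only [hm, det3]; ring
  have hlc : l c = 0 := by simp only [hl, det3]; ring
  have hmc : m c = 1 := by simp only [hm, ← hD]; field_simp
  have hpos : ∀ w, w ≠ a → w ≠ b → w ≠ c → 0 < l w ∧ 0 < m w := by
    intro w hwa hwb hwc
    obtain ⟨h1, -, h3⟩ := hin w hwa hwb hwc
    have hD2 : 0 < D ^ 2 := by positivity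
    have e1 : l w = D * det3 (p c) (p a) (p w) / D ^ 2 := by
      simp only [hl]
      field_simp
      simp only [det3]
      ring
    have e2 : m w = D * det3 (p a) (p b) (p w) / D ^ 2 := by
      simp only [hm]
      field_simp
    rw [e1, e2]
    exact ⟨div_pos h3 hD2, div_pos h1 hD2⟩
  have hnn : ∀ w, w ≠ a → 0 ≤ l w ∧ 0 ≤ m w ∧ 0 < l w + m w := by
    intro w hwa
    by_cases hwb : w = b
    · rw [hwb, hlb, hmb]; norm_num
    by_cases hwc : w = c
    · rw [hwc, hlc, hmc]; norm_num
    obtain ⟨h1, h2⟩ := hpos w hwa hwb hwc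
    exact ⟨h1.le, h2.le, by linarith⟩
  have hinjlm : ∀ x y, l x = l y → m x = m y → x = y := by
    intro x y h1 h2
    by_contra hne
    have key : ∀ z, z ≠ x → z ≠ y → False := by
      intro z hzx hzy
      have := hident x y z
      rw [h1, h2] at this
      simp only [sub_self, zero_mul] at this
      exact div_ne_zero (hp.gen x y z hne hzx.symm hzy.symm) hD0 this.symm
    by_cases hax : a = x
    · by_cases hby : b = y
      · exact key c (hax ▸ hac.symm) (hby ▸ hbc.symm)
      · exact key b (hax ▸ hab.symm) hby
    · by_cases hay : a = y
      · by_cases hbx : b = x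
        · exact key c (hbx ▸ hbc.symm) (hay ▸ hac.symm)
        · exact key b hbx (hay ▸ hab.symm)
      · exact key a hax hay
  obtain ⟨κ, hκ0, hκ⟩ := exists_small_ne (J := {x : V × V // x.1 ≠ x.2})
    (fun x => (l x.1.1 + m x.1.1) - (l x.1.2 + m x.1.2)) (fun x => m x.1.1 - m x.1.2) fun x => by
      by_contra hc
      push Not at hc
      exact x.2 (hinjlm _ _ (by linarith [hc.1, hc.2]) (by linarith [hc.2]))
  have hinj : Function.Injective fun w => l w + (1 + κ) * m w := by
    intro x y hxy
    by_contra hne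
    refine hκ ⟨(x, y), hne⟩ ?_
    simp only at hxy ⊢
    linarith
  have hk : (2 + κ) / D ≠ 0 := div_ne_zero (by positivity) hD0
  have hs : DetScale p (fun w => (l w - m w, l w + (1 + κ) * m w)) ((2 + κ) / D) := by
    intro x y z
    have h1 := hident x y z
    calc det3 _ _ _ = (2 + κ) * ((l y - l x) * (m z - m x) - (m y - m x) * (l z - l x)) := by
          simp only [det3]; ring
      _ = _ := by rw [h1]; ring
  have hheight : ∀ w, w ≠ a → 0 < l w + (1 + κ) * m w := by
    intro w hw
    obtain ⟨h1, h2, h3⟩ := hnn w hw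
    nlinarith
  have hQ := hp.of_detScale hk hs fun x y hxy => hinj (congrArg Prod.snd hxy)
  have hang : ∀ x y, x ≠ a → y ≠ a → x ≠ y → 0 ≤ l x * m y - m x * l y →
      ang (l x - m x, l x + (1 + κ) * m x) ≤ ang (l y - m y, l y + (1 + κ) * m y) := by
    intro x y hx hy hxy h0
    have e : det2 (l x - m x, l x + (1 + κ) * m x) (l y - m y, l y + (1 + κ) * m y) =
      (2 + κ) * (l x * m y - m x * l y) := by simp only [det2]; ring
    have hne : det2 (l x - m x, l x + (1 + κ) * m x) (l y - m y, l y + (1 + κ) * m y) ≠ 0 := by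
      have := hQ.det2_ne hx.symm hy.symm hxy
      simpa [hla, hma] using this
    have hx' := ang_pos (q := (l x - m x, l x + (1 + κ) * m x)) (hheight x hx)
    have hy' := ang_pos (q := (l y - m y, l y + (1 + κ) * m y)) (hheight y hy)
    refine ((det2_pos_iff_ang hne (abs_lt.2 ⟨by linarith [hx'.2, hy'.1], by linarith [hx'.1, hy'.2]⟩)).1
      (lt_of_le_of_ne ?_ hne.symm)).le
    rw [e]
    positivity
  refine ⟨_, _, hk, hs, hQ, hinj, by simp [hla, hma], ?_, fun w hw => ⟨hheight w hw, ?_, ?_⟩⟩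
  · simp only [hlb, hmb, hlc, hmc, det2]
    nlinarith
  · by_cases h : w = b
    · rw [h]
    · refine hang b w hab.symm hw (Ne.symm h) ?_
      rw [hlb, hmb]
      simpa using (hnn w hw).2.1
  · by_cases h : w = c
    · rw [h]
    · refine hang w c hw hac.symm h ?_
      rw [hlc, hmc]
      simpa using (hnn w hw).1

theorem det2_pos_of_ang {q : Plane} (hq : q ≠ 0) {μ : ℝ} (h1 : ang q < μ) (h2 : μ < ang q + Real.pi) :
    0 < det2 q (Real.cos μ, Real.sin μ) := by
  obtain ⟨r, hr, e⟩ := ang_spec hq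
  have h := det2_polar r 1 (ang q) μ
  rw [← e, one_mul, one_mul, mul_one] at h
  rw [h]
  exact mul_pos hr (Real.sin_pos_of_pos_of_lt_pi (by linarith) (by linarith))

theorem continuous_det3_right (a b c d : Plane) : Continuous fun ε : ℝ => det3 a b (c + ε • d) := by
  unfold det3
  simp only [Prod.fst_add, Prod.snd_add, Prod.smul_fst, Prod.smul_snd, smul_eq_mul]
  fun_prop

/-- Splitting off a vertex at a corner of the outer triangle. -/
theorem HT.split_corner {V : Type*} [Finite V] {G : SimpleGraph V} {u v : V} (hG : HT G)
    (h3 : Conn3 G) (huv : G.Adj u v) (hH : Conn3 (_root_.contr G u v))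
    {p : {w : V // w ≠ v} → Plane} (hp : IsSL (_root_.contr G u v) p)
    {a b c : {w : V // w ≠ v}} (hau : a.1 = u) (hab : G.Adj a b) (hac : G.Adj a c) (hbc : b ≠ c)
    (hin : ∀ w, w ≠ a → w ≠ b → w ≠ c → InTri (p a) (p b) (p c) (p w))
    {y : {w : V // w ≠ v}} (hvy : G.Adj v y) (hya : y ≠ a) (hyb : y ≠ b) (hyc : y ≠ c) :
    ∃ q, IsSL G q ∧ ∀ w, w ≠ a.1 → w ≠ b.1 → w ≠ c.1 → InTri (q a) (q b) (q c) (q w) := by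
  have hab' : a ≠ b := fun e => hab.ne (congrArg _ e)
  have hac' : a ≠ c := fun e => hac.ne (congrArg _ e)
  obtain ⟨q, k, hk, hs, hq, hy, ha0, hbcpos, hw⟩ := exists_corner_frame hp hab' hac' hbc hin
  have hin' : ∀ w, w ≠ a → w ≠ b → w ≠ c → InTri (q a) (q b) (q c) (q w) :=
    fun w h1 h2 h3 => hs.inTri hk (hin w h1 h2 h3)
  have hθinj : ∀ x y, x ≠ a → y ≠ a → ang (q x) = ang (q y) → x = y := by
    intro x y hx hy hxy
    by_contra hne
    have := hq.det2_ne hx.symm hy.symm hne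
    rw [ha0, sub_zero, sub_zero] at this
    exact ang_ne this hxy
  obtain ⟨w₁, w₂, u₁, u₂, hw₁, hw₂, hu₁, hu₂, bW, bU, hc⟩ := hG.split_cases h3 huv hH hq hy hau
    (fun w => ang (q w)) fun w => by rw [ha0, sub_zero]
  rw [← hau] at bU
  have hb2 := hw b hab'.symm
  have hc2 := hw c hac'.symm
  have hb0 : q b ≠ 0 := fun e => by rw [e] at hb2; exact lt_irrefl _ hb2.1
  have hc0 : q c ≠ 0 := fun e => by rw [e] at hc2; exact lt_irrefl _ hc2.1
  have hbπ := ang_pos hb2.1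
  have hcπ := ang_pos hc2.1
  rcases hc with ⟨μ, h1, h2, hev⟩ | ⟨hno, -⟩
  · have hμ1 : ang (q b) < μ := (hw w₁ hw₁.2).2.1.trans_lt h1
    have hμ2 : μ < ang (q c) := h2.trans_le (hw w₂ hw₂.2).2.2
    set d : Plane := (Real.cos μ, Real.sin μ) with hd
    have hbd : 0 < det2 (q b) d := det2_pos_of_ang hb0 hμ1 (by linarith [hcπ.2, hbπ.1])
    have hdc : 0 < det2 d (q c) := by
      obtain ⟨r, hr, e⟩ := ang_spec hc0
      have h := det2_polar 1 r μ (ang (q c))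
      rw [← e, one_mul, one_mul, one_mul] at h
      rw [h]
      exact mul_pos hr (Real.sin_pos_of_pos_of_lt_pi (by linarith) (by linarith [hbπ.1, hcπ.2]))
    have hev2 : ∀ᶠ ε in 𝓝[>] (0:ℝ), 0 < det3 (q b) (q c) (q a + ε • d) := by
      refine eventually_pos_of_continuous (continuous_det3_right _ _ _ _) ?_
      rw [zero_smul, add_zero, det3_rot, ha0, det3_eq_det2, sub_zero, sub_zero]
      exact hbcpos
    obtain ⟨ε, ⟨hε1, hε2⟩, hε0⟩ := ((hev.and hev2).and self_mem_nhdsWithin).exists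
    refine ⟨_, hε1, fun w hwa hwb hwc => ?_⟩
    rw [splitPos_coe, splitPos_coe, splitPos_coe]
    by_cases hwv : w = v
    · subst hwv
      rw [splitPos_self]
      have hD : 0 < det3 (q a) (q b) (q c) := by
        rw [ha0, det3_eq_det2, sub_zero, sub_zero]; exact hbcpos
      have hε0' : (0:ℝ) < ε := hε0
      refine ⟨mul_pos hD ?_, mul_pos hD hε2, mul_pos hD ?_⟩
      · have : det3 (q a) (q b) (q a + ε • d) = ε * det2 (q b) d := by
          rw [det3_eq_det2, ha0]
          simp [det2]; ring
        rw [this]; positivity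
      · have : det3 (q c) (q a) (q a + ε • d) = ε * det2 d (q c) := by
          rw [det3_eq_det2, ha0]
          simp [det2]; ring
        rw [this]; positivity
    · rw [splitPos_of_ne hwv]
      exact hin' _ (fun e => hwa (congrArg Subtype.val e)) (fun e => hwb (congrArg Subtype.val e))
        (fun e => hwc (congrArg Subtype.val e))
  · exfalso
    have hn := hno y hvy hya
    have hy' := hw y hya
    rcases lt_or_ge (ang (q u₁)) (ang (q y)) with h | h
    · have h' : ang (q u₂) ≤ ang (q y) := not_lt.1 fun h' => hn ⟨h, h'⟩
      exact hyc (hθinj _ _ hya hac'.symm (le_antisymm hy'.2.2 ((bU c hac).2.trans h')))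
    · exact hyb (hθinj _ _ hya hab'.symm (le_antisymm (h.trans (bU b hab).1) hy'.2.1))

/-- Deleting `T` does not disconnect the graph. -/
def NonSep {V : Type*} (G : SimpleGraph V) (T : Set V) : Prop :=
  ∀ C : Set V, C.Nonempty → (∀ x ∈ C, x ∉ T) → ClosedIn G C T → ∀ w, w ∈ C ∨ w ∈ T

/-- The component of `x₀` inside a closed set. -/
theorem ClosedIn.component {V : Type*} {G : SimpleGraph V} {C S : Set V} (h : ClosedIn G C S) {x₀ : V} :
    ConnOn G {y | ReachIn G C x₀ y} ∧ ClosedIn G {y | ReachIn G C x₀ y} S := by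
  have key : ∀ y, ReachIn G C x₀ y → ReachIn G {y | ReachIn G C x₀ y} x₀ y := by
    intro y hy
    refine ReachIn.induct (P := fun z => ReachIn G {y | ReachIn G C x₀ y} x₀ z) hy
      (.refl (.refl hy.left_mem)) fun x z hxz hx hz hP => hP.tail hxz ?_
    have : ReachIn G C x₀ x := hP.right_mem
    exact this.tail hxz hz
  refine ⟨fun a ha b hb => (key a ha).symm.trans (key b hb), fun x hx y hxy => ?_⟩
  rcases h x hx.right_mem y hxy with h | h
  · exact Or.inl (hx.tail hxy h)
  · exact Or.inr h

theorem NonSep.contr_corner {V : Type*} [Finite V] {G : SimpleGraph V} {u v b c : V} (hG : HT G)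
    (huv : G.Adj u v) (hH : Conn3 (contr G u v)) (hub : G.Adj u b) (huc : G.Adj u c)
    (hbc : G.Adj b c) (hbv : b ≠ v) (hcv : c ≠ v)
    (h : NonSep G {u, b, c}) : NonSep (contr G u v) {⟨u, huv.ne⟩, ⟨b, hbv⟩, ⟨c, hcv⟩} := by
  have claim : ∀ C : Set V, v ∉ C → u ∉ C → b ∉ C → c ∉ C → C.Nonempty →
      ClosedIn G C {u, b, c, v} → (∃ z, z ∉ C ∧ z ≠ u ∧ z ≠ b ∧ z ≠ c ∧ z ≠ v) →
      ∃ B ⊆ C, B.Nonempty ∧ ConnOn G B ∧ (∃ x ∈ B, G.Adj v x) ∧ (∃ x ∈ B, G.Adj b x) ∧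
        (∃ x ∈ B, G.Adj c x) := by
    rintro C hv hu hb hc hne hcl ⟨z, hz, hzu, hzb, hzc, hzv⟩
    have hx₀ : ∃ x ∈ C, G.Adj v x := by
      by_contra hcon
      push Not at hcon
      rcases h C hne (by rintro x hx (rfl | rfl | rfl) <;> contradiction) (fun x hx y hxy => by
        rcases hcl x hx y hxy with h | h | h | h | h
        · exact Or.inl h
        · exact Or.inr (Or.inl h)
        · exact Or.inr (Or.inr (Or.inl h))
        · exact Or.inr (Or.inr (Or.inr h))
        · exact absurd (h ▸ hxy.symm) (hcon x hx)) z with h | h | h | h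
      exacts [hz h, hzu h, hzb h, hzc h]
    obtain ⟨x₀, hx₀, hvx₀⟩ := hx₀
    obtain ⟨hconn, hclB⟩ := hcl.component (x₀ := x₀)
    set B := {y | ReachIn G C x₀ y} with hB
    have hBC : B ⊆ C := fun y hy => hy.right_mem
    have hx₀B : x₀ ∈ B := .refl hx₀
    have adj : ∀ s t : V, ({u, s, t, v} : Set V) = {u, b, c, v} → s ∉ C → s ≠ u → s ≠ v → t ≠ v →
        s ≠ t → t ∉ C → ∃ x ∈ B, G.Adj s x := by
      intro s t hst hs hsu hsv htv hsnt ht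
      by_contra hcon
      push Not at hcon
      rw [← hst] at hclB
      have hor := hH.2 {y | y.1 ∈ B} ⟨u, huv.ne⟩ ⟨t, htv⟩ ⟨⟨x₀, fun e => hv (e ▸ hx₀)⟩, hx₀B⟩
        (fun h => hu (hBC h)) (fun h => ht (hBC h)) ?_ ⟨s, hsv⟩
      · rcases hor with h | h | h
        · exact hs (hBC h)
        · exact hsu (congrArg Subtype.val h)
        · exact hsnt (congrArg Subtype.val h)
      · rintro x hx y ⟨hxy, h | ⟨h, -⟩ | ⟨h, -⟩⟩
        · rcases hclB x.1 hx y.1 h with h' | h' | h' | h' | h'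
          · exact Or.inl h'
          · exact Or.inr (Or.inl (Subtype.ext h'))
          · exact absurd (h' ▸ h.symm) (hcon _ hx)
          · exact Or.inr (Or.inr (Subtype.ext h'))
          · exact absurd h' y.2
        · exact absurd (hBC hx) (h ▸ hu)
        · exact Or.inr (Or.inl (Subtype.ext h))
    exact ⟨B, hBC, ⟨x₀, hx₀B⟩, hconn, ⟨x₀, hx₀B, hvx₀⟩,
      adj b c rfl hb hub.ne' hbv hcv hbc.ne hc,
      adj c b (by ext x; simp only [mem_insert_iff, mem_singleton_iff]; tauto) hc huc.ne' hcv hbv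
        hbc.ne' hb⟩
  intro C hne hCT hcl w
  by_contra hcon
  simp only [mem_insert_iff, mem_singleton_iff, not_or] at hcon hCT
  obtain ⟨hwC, hwu, hwb, hwc⟩ := hcon
  set C' : Set V := Subtype.val '' C with hC'
  have hvC : v ∉ C' := by rintro ⟨x, -, h⟩; exact x.2 h
  have huC : u ∉ C' := by rintro ⟨x, hx, h⟩; exact (hCT x hx).1 (Subtype.ext h)
  have hbC : b ∉ C' := by rintro ⟨x, hx, h⟩; exact (hCT x hx).2.1 (Subtype.ext h)
  have hcC : c ∉ C' := by rintro ⟨x, hx, h⟩; exact (hCT x hx).2.2 (Subtype.ext h)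
  have hclC : ClosedIn G C' {u, b, c, v} := by
    rintro _ ⟨x, hx, rfl⟩ y hxy
    by_cases hyv : y = v
    · exact Or.inr (Or.inr (Or.inr (Or.inr hyv)))
    rcases hcl x hx ⟨y, hyv⟩ (contr_adj_of_adj hxy) with h | h | h | h
    · exact Or.inl ⟨_, h, rfl⟩
    · exact Or.inr (Or.inl (congrArg Subtype.val h))
    · exact Or.inr (Or.inr (Or.inl (congrArg Subtype.val h)))
    · exact Or.inr (Or.inr (Or.inr (Or.inl (congrArg Subtype.val h))))
  have hwC' : w.1 ∉ C' := by rintro ⟨x, hx, h⟩; exact hwC (Subtype.ext h ▸ hx)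
  have hwu' : w.1 ≠ u := fun e => hwu (Subtype.ext e)
  have hwb' : w.1 ≠ b := fun e => hwb (Subtype.ext e)
  have hwc' : w.1 ≠ c := fun e => hwc (Subtype.ext e)
  obtain ⟨z, hz⟩ := hne
  have hzC : z.1 ∈ C' := ⟨z, hz, rfl⟩
  obtain ⟨B, hBC, hBne, hBconn, hBv, hBb, hBc⟩ := claim C' hvC huC hbC hcC ⟨z, hzC⟩ hclC
    ⟨w, hwC', hwu', hwb', hwc', w.2⟩
  set R : Set V := (C' ∪ {u, b, c, v})ᶜ with hR
  have hRmem : ∀ x, x ∈ R ↔ x ∉ C' ∧ x ≠ u ∧ x ≠ b ∧ x ≠ c ∧ x ≠ v := by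
    intro x
    simp only [hR, mem_compl_iff, mem_union, mem_insert_iff, mem_singleton_iff]
    tauto
  obtain ⟨E, hER, hEne, hEconn, hEv, hEb, hEc⟩ := claim R (fun h => ((hRmem _).1 h).2.2.2.2 rfl)
    (fun h => ((hRmem _).1 h).2.1 rfl) (fun h => ((hRmem _).1 h).2.2.1 rfl)
    (fun h => ((hRmem _).1 h).2.2.2.1 rfl) ⟨w, (hRmem _).2 ⟨hwC', hwu', hwb', hwc', w.2⟩⟩ hclC.compl
    ⟨z, fun h => ((hRmem _).1 h).1 hzC, fun e => huC (e ▸ hzC), fun e => hbC (e ▸ hzC),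
      fun e => hcC (e ▸ hzC), z.2⟩
  have sB : ∀ s, s ∉ C' → s ∉ B := fun s hs h => hs (hBC h)
  have sE : ∀ s, s ∉ R → s ∉ E := fun s hs h => hs (hER h)
  have hvR : v ∉ R := fun h => ((hRmem _).1 h).2.2.2.2 rfl
  have huR : u ∉ R := fun h => ((hRmem _).1 h).2.1 rfl
  have hbR : b ∉ R := fun h => ((hRmem _).1 h).2.2.1 rfl
  have hcR : c ∉ R := fun h => ((hRmem _).1 h).2.2.2.1 rfl
  refine hG.no_K33 ![{v}, {b}, {c}] ![B, E, {u}] ?_ ?_ ?_ ?_ ?_ ?_ ?_ ?_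
  · intro i; fin_cases i <;> simp
  · intro i; fin_cases i <;> simp [hBne, hEne]
  · intro i j hij x
    fin_cases i <;> fin_cases j <;> simp at hij ⊢ <;> rintro rfl
    exacts [hbv.symm, hcv.symm, hbc.ne]
  · intro i j hij x
    fin_cases i <;> fin_cases j <;> simp at hij ⊢ <;> intro hx
    · exact fun h => ((hRmem _).1 (hER h)).1 (hBC hx)
    · rintro rfl; exact huC (hBC hx)
    · rintro rfl; exact huR (hER hx)
  · intro i j x
    fin_cases i <;> fin_cases j <;> simp <;> rintro rfl
    exacts [sB _ hvC, sE _ hvR, huv.ne', sB _ hbC, sE _ hbR, hub.ne', sB _ hcC, sE _ hcR, huc.ne']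
  · intro i; fin_cases i <;> exact connOn_singleton _ _
  · intro i
    fin_cases i
    exacts [hBconn, hEconn, connOn_singleton _ _]
  · intro i j
    fin_cases i <;> fin_cases j <;> simp
    exacts [hBv, hEv, huv.symm, hBb, hEb, hub.symm, hBc, hEc, huc.symm]

theorem NonSep.contr_of_not_mem {V : Type*} {G : SimpleGraph V} {u v : V} {T : Set V}
    (hv : v ∉ T) (hu : u ∉ T) (huv : u ≠ v) (h : NonSep G T) :
    NonSep (contr G u v) (Subtype.val ⁻¹' T) := by
  intro C hne hCT hcl w
  by_cases huC : (⟨u, huv⟩ : {w // w ≠ v}) ∈ C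
  · have hor := h (Subtype.val '' C ∪ {v}) ⟨v, Or.inr rfl⟩ ?_ ?_ w
    · rcases hor with (⟨x, hx, h⟩ | h) | h
      · exact Or.inl (Subtype.ext h ▸ hx)
      · exact absurd h w.2
      · exact Or.inr h
    · rintro x (⟨x, hx, rfl⟩ | rfl)
      exacts [hCT x hx, hv]
    · rintro x (⟨x, hx, rfl⟩ | rfl) y hxy
      · by_cases hyv : y = v
        · exact Or.inl (Or.inr hyv)
        rcases hcl x hx ⟨y, hyv⟩ (contr_adj_of_adj hxy) with h | h
        · exact Or.inl (Or.inl ⟨_, h, rfl⟩)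
        · exact Or.inr h
      · by_cases hyu : y = u
        · exact Or.inl (Or.inl ⟨_, huC, hyu.symm⟩)
        rcases hcl _ huC ⟨y, hxy.ne'⟩ ⟨fun e => hyu (congrArg Subtype.val e).symm,
          Or.inr (Or.inl ⟨rfl, hxy⟩)⟩ with h | h
        · exact Or.inl (Or.inl ⟨_, h, rfl⟩)
        · exact Or.inr h
  · exfalso
    obtain ⟨z, hz⟩ := hne
    have hor := h (Subtype.val '' C) ⟨z, z, hz, rfl⟩ ?_ ?_ v
    · rcases hor with ⟨x, -, h⟩ | h
      · exact x.2 h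
      · exact hv h
    · rintro _ ⟨x, hx, rfl⟩
      exact hCT x hx
    · rintro _ ⟨x, hx, rfl⟩ y hxy
      by_cases hyv : y = v
      · subst hyv
        rcases hcl x hx ⟨u, huv⟩ ⟨fun e => huC (e ▸ hx), Or.inr (Or.inr ⟨rfl, hxy.symm⟩)⟩ with h | h
        · exact absurd h huC
        · exact absurd h hu
      · rcases hcl x hx ⟨y, hyv⟩ (contr_adj_of_adj hxy) with h | h
        · exact Or.inl ⟨_, h, rfl⟩
        · exact Or.inr h

theorem NonSep.exists_nbr {V : Type*} [Finite V] {G : SimpleGraph V} {a b c v : V}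
    (h : NonSep G {a, b, c}) (h5 : 5 ≤ Nat.card V) (hva : v ≠ a) (hvb : v ≠ b) (hvc : v ≠ c) :
    ∃ y, G.Adj v y ∧ y ≠ a ∧ y ≠ b ∧ y ≠ c := by
  by_contra hcon
  push Not at hcon
  have h1 := h {v} ⟨v, rfl⟩ (by rintro x rfl (h | h | h) <;> contradiction) (by
    rintro x rfl y hxy
    by_cases hya : y = a
    · exact Or.inr (Or.inl hya)
    by_cases hyb : y = b
    · exact Or.inr (Or.inr (Or.inl hyb))
    · exact Or.inr (Or.inr (Or.inr (hcon y hxy hya hyb))))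
  have h2 : (univ : Set V) ⊆ {v, a, b, c} := fun w _ => h1 w
  have h3 := ncard_le_ncard h2 (toFinite _)
  rw [ncard_univ] at h3
  have h4 : ({v, a, b, c} : Set V).ncard ≤ 4 := by
    refine (ncard_insert_le _ _).trans (Nat.succ_le_succ ?_)
    refine (ncard_insert_le _ _).trans (Nat.succ_le_succ ?_)
    refine (ncard_insert_le _ _).trans (Nat.succ_le_succ ?_)
    exact (ncard_singleton _).le
  omega

/-- A 3-connected graph in the Hanani–Tutte class has a straight-line drawing whose outer
triangle is a prescribed nonseparating triangle. -/
theorem HT.exists_isSL_triangle (n : ℕ) : ∀ {V : Type*} [Finite V] {G : SimpleGraph V},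
    Nat.card V = n → HT G → Conn3 G → ∀ {a b c : V}, G.Adj a b → G.Adj a c → G.Adj b c →
    NonSep G {a, b, c} →
    ∃ p, IsSL G p ∧ ∀ w, w ≠ a → w ≠ b → w ≠ c → InTri (p a) (p b) (p c) (p w) := by
  induction n with
  | zero =>
    intro V _ G hn hG h3
    have := h3.1
    omega
  | succ n ih =>
    intro V _ G hn hG h3 a b c hab hac hbc hsep
    rcases Nat.lt_or_ge 4 (Nat.card V) with h5 | h4
    · obtain ⟨w, hwa, hwb, hwc⟩ := exists_ne_triple h3.1 a b c
      obtain ⟨u, v, huv, hvT, hH⟩ := h3.exists_contractible h5 {a, b, c} (by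
        rintro s (rfl | rfl | rfl) t (rfl | rfl | rfl) hst
        exacts [absurd rfl hst, hab, hac, hab.symm, absurd rfl hst, hbc, hac.symm, hbc.symm,
          absurd rfl hst]) ⟨w, by rintro (h | h | h) <;> contradiction⟩
      simp only [mem_insert_iff, mem_singleton_iff, not_or] at hvT
      have hcard : Nat.card {w : V // w ≠ v} = n := by have := card_ne_lt v; omega
      obtain ⟨y, hvy, hya, hyb, hyc⟩ := hsep.exists_nbr h5 hvT.1 hvT.2.1 hvT.2.2
      have corner : ∀ {a b c : V}, u = a → G.Adj a b → G.Adj a c → G.Adj b c →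
          NonSep G {a, b, c} → v ≠ a → v ≠ b → v ≠ c → y ≠ a → y ≠ b → y ≠ c →
          ∃ p, IsSL G p ∧ ∀ w, w ≠ a → w ≠ b → w ≠ c → InTri (p a) (p b) (p c) (p w) := by
        rintro a b c rfl hab hac hbc hsep hva hvb hvc hya hyb hyc
        obtain ⟨p, hp, hin⟩ := ih hcard (hG.contr huv) hH (a := ⟨u, huv.ne⟩) (b := ⟨b, hvb.symm⟩)
          (c := ⟨c, hvc.symm⟩) (contr_adj_of_adj hab) (contr_adj_of_adj hac) (contr_adj_of_adj hbc)
          (hsep.contr_corner hG huv hH hab hac hbc hvb.symm hvc.symm)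
        exact hG.split_corner h3 huv hH hp (a := ⟨u, huv.ne⟩) (b := ⟨b, hvb.symm⟩)
          (c := ⟨c, hvc.symm⟩) rfl hab hac (fun e => hbc.ne (congrArg Subtype.val e)) hin
          (y := ⟨y, hvy.ne'⟩) hvy (fun e => hya (congrArg Subtype.val e))
          (fun e => hyb (congrArg Subtype.val e)) (fun e => hyc (congrArg Subtype.val e))
      have rot : ∀ {a b c : V}, ({a, b, c} : Set V) = {b, c, a} := by
        intro a b c
        ext x
        simp only [mem_insert_iff, mem_singleton_iff]
        tauto
      by_cases hua : u = a
      · exact corner hua hab hac hbc hsep hvT.1 hvT.2.1 hvT.2.2 hya hyb hyc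
      by_cases hub : u = b
      · obtain ⟨p, hp, hin⟩ := corner hub hbc hab.symm hac.symm (rot ▸ hsep) hvT.2.1 hvT.2.2 hvT.1
          hyb hyc hya
        exact ⟨p, hp, fun w h1 h2 h3 => (hin w h2 h3 h1).rot.rot⟩
      by_cases huc : u = c
      · obtain ⟨p, hp, hin⟩ := corner huc hac.symm hbc.symm hab (rot ▸ rot ▸ hsep) hvT.2.2 hvT.1
          hvT.2.1 hyc hya hyb
        exact ⟨p, hp, fun w h1 h2 h3 => (hin w h3 h1 h2).rot⟩
      · have hva' : a ≠ v := hvT.1 ∘ Eq.symm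
        have hvb' : b ≠ v := hvT.2.1 ∘ Eq.symm
        have hvc' : c ≠ v := hvT.2.2 ∘ Eq.symm
        have hpre : (Subtype.val ⁻¹' {a, b, c} : Set {w // w ≠ v}) =
            {⟨a, hva'⟩, ⟨b, hvb'⟩, ⟨c, hvc'⟩} := by
          ext x
          simp [Subtype.ext_iff]
        have hsepH := hsep.contr_of_not_mem (u := u) (v := v)
          (by simp only [mem_insert_iff, mem_singleton_iff, not_or]; exact hvT)
          (by simp only [mem_insert_iff, mem_singleton_iff, not_or]; exact ⟨hua, hub, huc⟩) huv.ne
        rw [hpre] at hsepH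
        obtain ⟨p, hp, hin⟩ := ih hcard (hG.contr huv) hH (contr_adj_of_adj hab)
          (contr_adj_of_adj hac) (contr_adj_of_adj hbc) hsepH
        obtain ⟨q, hq, hy, hs⟩ := hp.exists_heights
        have hin' := fun w h1 h2 h3 => hs.inTri one_ne_zero (hin w h1 h2 h3)
        obtain ⟨w₁, w₂, u₁, u₂, -, -, -, -, -, -, hc⟩ := hG.split_cases h3 huv hH hq hy
          (u' := ⟨u, huv.ne⟩) rfl _ fun _ => rfl
        have hd : ∃ d, ∀ᶠ ε in 𝓝[>] (0:ℝ), IsSL G (splitPos q ⟨u, huv.ne⟩ d ε) := by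
          rcases hc with ⟨μ, -, -, h⟩ | ⟨-, μ, -, -, h⟩
          exacts [⟨_, h⟩, ⟨_, h⟩]
        obtain ⟨d, hd⟩ := hd
        have hu0 := hin' ⟨u, huv.ne⟩ (fun e => hua (congrArg Subtype.val e))
          (fun e => hub (congrArg Subtype.val e)) (fun e => huc (congrArg Subtype.val e))
        have hev : ∀ᶠ ε in 𝓝[>] (0:ℝ), InTri (q ⟨a, hva'⟩) (q ⟨b, hvb'⟩) (q ⟨c, hvc'⟩)
            (q ⟨u, huv.ne⟩ + ε • d) := by
          refine (eventually_pos_of_continuous (continuous_const.mul (continuous_det3_right _ _ _ _))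
            ?_).and ((eventually_pos_of_continuous (continuous_const.mul
              (continuous_det3_right _ _ _ _)) ?_).and (eventually_pos_of_continuous
              (continuous_const.mul (continuous_det3_right _ _ _ _)) ?_))
          · simpa using hu0.1
          · simpa using hu0.2.1
          · simpa using hu0.2.2
        obtain ⟨ε, h1, h2⟩ := (hd.and hev).exists
        refine ⟨_, h1, fun w hwa hwb hwc => ?_⟩
        rw [splitPos_of_ne hva', splitPos_of_ne hvb', splitPos_of_ne hvc']
        by_cases hwv : w = v
        · subst hwv
          rwa [splitPos_self]
        · rw [splitPos_of_ne hwv]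
          exact hin' _ (fun e => hwa (congrArg Subtype.val e)) (fun e => hwb (congrArg Subtype.val e))
            (fun e => hwc (congrArg Subtype.val e))
    · obtain ⟨p, hp, ⟨ha, hb, hc⟩, hw⟩ := exists_isSL_of_card_le_four G h4 hab.ne hac.ne hbc.ne
      refine ⟨p, hp, fun w h1 h2 h3 => ?_⟩
      rw [ha, hb, hc, hw w h1 h2 h3]
      norm_num [InTri, det3]

/-- Adding a new vertex joined to `x`, `y` and `c`. -/
def addTri {V : Type*} (G : SimpleGraph V) (x y c : V) : SimpleGraph (Option V) where
  Adj
    | none, none => False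
    | none, some a => a = x ∨ a = y ∨ a = c
    | some a, none => a = x ∨ a = y ∨ a = c
    | some a, some b => G.Adj a b
  symm := ⟨by
    rintro (_ | a) (_ | b) h
    exacts [h, h, h, h.symm]⟩
  loopless := ⟨by
    rintro (_ | a) h
    exacts [h, h.ne rfl]⟩

theorem addTri_some {V : Type*} {G : SimpleGraph V} {x y c a b : V} :
    (addTri G x y c).Adj (some a) (some b) ↔ G.Adj a b := Iff.rfl

theorem addTri_none {V : Type*} {G : SimpleGraph V} {x y c a : V} :
    (addTri G x y c).Adj none (some a) ↔ a = x ∨ a = y ∨ a = c := Iff.rfl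

theorem addTri_none' {V : Type*} {G : SimpleGraph V} {x y c a : V} :
    (addTri G x y c).Adj (some a) none ↔ a = x ∨ a = y ∨ a = c := Iff.rfl

theorem Conn3.addTri {V : Type*} [Finite V] {G : SimpleGraph V} (h : Conn3 G) {x y c : V}
    (hxy : x ≠ y) (hxc : x ≠ c) (hyc : y ≠ c) : Conn3 (addTri G x y c) := by
  classical
  have h4 := h.1
  refine ⟨by rw [Finite.card_option]; omega, ?_⟩
  intro C s t hne hs ht hcl
  have hcl0 : ∀ a b, some a ∈ C → G.Adj a b → some b ∈ C ∨ some b = s ∨ some b = t :=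
    fun a b ha hab => hcl (some a) ha (some b) (addTri_some.2 hab)
  by_cases hC0 : ∃ a, some a ∈ C
  · obtain ⟨a₀, ha₀⟩ := hC0
    have hV : ∀ a, some a ∈ C ∨ some a = s ∨ some a = t := by
      have pair : ∀ s' t' : V, some s' ∉ C → some t' ∉ C → (∀ b, some b = s ∨ some b = t →
          b = s' ∨ b = t') → ∀ a, some a ∈ C ∨ a = s' ∨ a = t' := by
        intro s' t' hs' ht' hst a
        exact h.2 {a | some a ∈ C} s' t' ⟨a₀, ha₀⟩ hs' ht' (fun u hu b hub => by
          rcases hcl0 u b hu hub with h | h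
          · exact Or.inl h
          · exact Or.inr (hst b h)) a
      rcases s with _ | s' <;> rcases t with _ | t'
      · intro a
        left
        by_contra ha
        obtain ⟨b, hab, -⟩ := h.exists_nbr (v := a) (s := if x = a then y else x)
          (t := if x = a then y else x) (by split_ifs with e; exacts [e ▸ hxy.symm, e])
          (by split_ifs with e; exacts [e ▸ hxy.symm, e])
        rcases pair a a ha ha (by simp) b with hb | hb | hb
        · rcases hcl0 b a hb hab.symm with h | h | h
          · exact ha h
          · cases h
          · cases h
        · exact hab.ne' hb
        · exact hab.ne' hb
      · intro a
        rcases pair t' t' ht ht (by simp) a with h | h | h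
        exacts [Or.inl h, Or.inr (Or.inr (congrArg _ h)), Or.inr (Or.inr (congrArg _ h))]
      · intro a
        rcases pair s' s' hs hs (by simp) a with h | h | h
        exacts [Or.inl h, Or.inr (Or.inl (congrArg _ h)), Or.inr (Or.inl (congrArg _ h))]
      · intro a
        rcases pair s' t' hs ht (by simp) a with h | h | h
        exacts [Or.inl h, Or.inr (Or.inl (congrArg _ h)), Or.inr (Or.inr (congrArg _ h))]
    rintro (_ | a)
    · by_contra hcon
      have hx : ∀ a, a = x ∨ a = y ∨ a = c → some a = s ∨ some a = t := fun a ha => by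
        rcases hV a with h | h
        · exact absurd (hcl (some a) h none (addTri_none'.2 ha)) hcon
        · exact h
      have h1 := hx x (Or.inl rfl)
      have h2 := hx y (Or.inr (Or.inl rfl))
      have h3 := hx c (Or.inr (Or.inr rfl))
      grind
    · exact hV a
  · push Not at hC0
    exfalso
    have hn : none ∈ C := by
      obtain ⟨_ | a, h⟩ := hne
      exacts [h, absurd h (hC0 a)]
    have hx : ∀ a, a = x ∨ a = y ∨ a = c → some a = s ∨ some a = t := fun a ha =>
      (hcl none hn (some a) (addTri_none.2 ha)).resolve_left (hC0 a)
    have h1 := hx x (Or.inl rfl)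
    have h2 := hx y (Or.inr (Or.inl rfl))
    have h3 := hx c (Or.inr (Or.inr rfl))
    grind

theorem Conn3.nonSep_addTri {V : Type*} {G : SimpleGraph V} (h : Conn3 G) {x y c : V} :
    NonSep (_root_.addTri G x y c) {some x, some y, none} := by
  intro C hne hCT hcl
  have hn : none ∉ C := fun h => hCT _ h (by simp)
  have hV := h.2 {a | some a ∈ C} x y (by
    obtain ⟨_ | a, h⟩ := hne
    exacts [absurd h hn, ⟨a, h⟩]) (fun h => hCT _ h (by simp)) (fun h => hCT _ h (by simp))
    (fun a ha b hab => by
      rcases hcl (some a) ha (some b) (addTri_some.2 hab) with h | h | h | h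
      · exact Or.inl h
      · exact Or.inr (Or.inl (Option.some_injective _ h))
      · exact Or.inr (Or.inr (Option.some_injective _ h))
      · cases h)
  rintro (_ | a)
  · simp
  · rcases hV a with h | h | h
    · exact Or.inl h
    · simp [h]
    · simp [h]

/-- The neighbour of `x` next to `y` in angular order. -/
theorem exists_consecutive {X : Type*} [Finite X] (θ : X → ℝ) (U : Set X)
    (inj : ∀ a ∈ U, ∀ b ∈ U, θ a = θ b → a = b) {y z : X} (hy : y ∈ U) (hz : z ∈ U) (hzy : z ≠ y) :
    ∃ c ∈ U, c ≠ y ∧ ∃ θ₁ θ₂, θ₁ < θ₂ ∧ (θ₁ = θ y ∧ θ₂ = θ c ∨ θ₁ = θ c ∧ θ₂ = θ y) ∧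
      ∀ a ∈ U, θ a ≤ θ₁ ∨ θ₂ ≤ θ a := by
  by_cases h : ∃ w ∈ U, θ y < θ w
  · obtain ⟨c, ⟨hc, hyc⟩, hmin⟩ := exists_min_image {w | w ∈ U ∧ θ y < θ w} θ (toFinite _) h
    refine ⟨c, hc, fun e => hyc.ne (congrArg θ e.symm), θ y, θ c, hyc, Or.inl ⟨rfl, rfl⟩, ?_⟩
    intro a ha
    rcases le_or_gt (θ a) (θ y) with h | h
    exacts [Or.inl h, Or.inr (hmin a ⟨ha, h⟩)]
  · push Not at h
    obtain ⟨c, ⟨hc, hyc⟩, hmax⟩ := exists_max_image {w | w ∈ U ∧ θ w < θ y} θ (toFinite _)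
      ⟨z, hz, lt_of_le_of_ne (h z hz) fun e => hzy (inj _ hz _ hy e)⟩
    refine ⟨c, hc, fun e => hyc.ne (congrArg θ e), θ c, θ y, hyc, Or.inr ⟨rfl, rfl⟩, ?_⟩
    intro a ha
    rcases lt_or_ge (θ a) (θ y) with h | h
    exacts [Or.inl (hmax a ⟨ha, h⟩), Or.inr h]

theorem cos_sin_ne_zero (μ : ℝ) : (Real.cos μ, Real.sin μ) ≠ (0 : Plane) := by
  intro h
  have h1 := congrArg Prod.fst h
  have h2 := congrArg Prod.snd h
  simp only [Prod.fst_zero, Prod.snd_zero] at h1 h2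
  have := Real.sin_sq_add_cos_sq μ
  rw [h1, h2] at this
  norm_num at this

/-- A straight-line drawing extends to a new vertex attached to an edge and a suitable third
vertex. -/
theorem IsSL.exists_addTri {V : Type*} [Finite V] {G : SimpleGraph V} {p : V → Plane}
    (hp : IsSL G p) {x y z : V} (hxy : G.Adj x y) (hxz : G.Adj x z) (hzy : z ≠ y) :
    ∃ c, c ≠ x ∧ c ≠ y ∧ ∃ q, IsSL (addTri G x y c) q := by
  set θ : V → ℝ := fun w => ang (p w - p x) with hθ
  have hinj : ∀ a ∈ {a | G.Adj x a}, ∀ b ∈ {a | G.Adj x a}, θ a = θ b → a = b := by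
    intro a ha b hb hab
    by_contra hne
    exact ang_ne (hp.det2_ne (ha : G.Adj x a).ne (hb : G.Adj x b).ne hne) hab
  obtain ⟨c, hc, hcy, θ₁, θ₂, hlt, hor, hU⟩ := exists_consecutive θ {a | G.Adj x a} hinj hxy hxz hzy
  have hcx : c ≠ x := (hc : G.Adj x c).ne'
  refine ⟨c, hcx, hcy, ?_⟩
  have hθ1 : -Real.pi < θ₁ := by rcases hor with ⟨h, -⟩ | ⟨h, -⟩ <;> rw [h] <;> exact (ang_mem _).1
  have hθ2 : θ₂ ≤ Real.pi := by rcases hor with ⟨-, h⟩ | ⟨-, h⟩ <;> rw [h] <;> exact (ang_mem _).2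
  have hsub : ∀ a, a ≠ x → p a - p x ≠ 0 := fun a ha e => ha (hp.inj (sub_eq_zero.1 e))
  obtain ⟨μ, -, -, -, -, h5, h6⟩ := exists_direction (fun w => p w - p x) {a | G.Adj x a}
    {b | b = y ∨ b = c} hlt hθ1 hθ2 (by
      rintro a (ha | rfl | rfl)
      exacts [hsub _ (ha : G.Adj x a).ne', hsub _ hxy.ne', hsub _ hcx])
    (by
      rintro b (rfl | rfl) <;> change θ₁ ≤ θ _ ∧ θ _ ≤ θ₂ <;> rcases hor with ⟨h, h'⟩ | ⟨h, h'⟩ <;>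
        rw [h, h'] <;> rw [h, h'] at hlt <;> exact ⟨by linarith, by linarith⟩)
    hU
  have hg : ∀ w : {w : Option V // w ≠ none}, ∃ a, w.1 = some a := fun w =>
    Option.ne_none_iff_exists'.1 w.2
  choose g hg using hg
  have hginj : Function.Injective g := fun a b h => Subtype.ext (by rw [hg, hg, h])
  have hgsome : ∀ a (h : some a ≠ none), g ⟨some a, h⟩ = a := fun a h =>
    (Option.some_injective _ (hg ⟨some a, h⟩)).symm
  have huv : (addTri G x y c).Adj (some x) none := addTri_none'.2 (Or.inl rfl)
  have hnb : ∀ b : {w : Option V // w ≠ none}, g b ≠ x → (addTri G x y c).Adj none b →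
      g b = y ∨ g b = c := by
    intro b hb h
    rw [hg b, addTri_none] at h
    exact h.resolve_left hb
  have hq : IsSL (contr (addTri G x y c) (some x) none) (p ∘ g) := by
    refine hp.comp hginj fun a b hab => ?_
    have hne : g a ≠ g b := hginj.ne hab.1
    rcases hab.2 with h | ⟨h, h'⟩ | ⟨h, h'⟩
    · rwa [hg a, hg b, addTri_some] at h
    · rw [hg a] at h
      have hax : g a = x := Option.some_injective _ h
      rw [hax] at hne ⊢
      rcases hnb b hne.symm h' with h | h
      · rw [h]; exact hxy
      · rw [h]; exact hc
    · rw [hg b] at h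
      have hbx : g b = x := Option.some_injective _ h
      rw [hbx] at hne ⊢
      rcases hnb a hne h' with h | h
      · rw [h]; exact hxy.symm
      · rw [h]; exact (hc : G.Adj x c).symm
  have hgu : ∀ w : {w : Option V // w ≠ none}, w ≠ ⟨some x, huv.ne⟩ → g w ≠ x := fun w hw e =>
    hw (Subtype.ext (by rw [hg w, e]))
  have hev := split_isSL huv hq (d := (Real.cos μ, Real.sin μ)) (u' := ⟨some x, huv.ne⟩)
    (cos_sin_ne_zero μ) rfl (fun w hw => by
      simp only [Function.comp, hgsome]
      exact h5 _ (hsub _ (hgu w hw))) (fun a b ha hb hab hua hvb => by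
      simp only [Function.comp, hgsome]
      rw [hg a, addTri_some] at hua
      exact h6 _ hua _ (hnb b (hgu b hb) hvb))
  exact ⟨_, hev.exists.choose_spec⟩

/-- A 3-connected graph in the Hanani–Tutte class has a straight-line drawing in which a
prescribed edge is on the outer side. -/
theorem HT.exists_isSL_edge_of_conn3 {V : Type*} [Finite V] {G : SimpleGraph V} (hG : HT G)
    (h3 : Conn3 G) {x y : V} (hxy : G.Adj x y) :
    ∃ p τ, IsSL G p ∧ ∀ w, w ≠ x → w ≠ y → InTri (p x) (p y) τ (p w) := by
  obtain ⟨p, hp⟩ := HT.exists_isSL_of_conn3 _ rfl hG h3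
  obtain ⟨z, hxz, hzy, -⟩ := h3.exists_nbr hxy.ne' hxy.ne'
  obtain ⟨c, hcx, hcy, q, hq⟩ := hp.exists_addTri hxy hxz hzy
  obtain ⟨r, hr, hin⟩ := HT.exists_isSL_triangle _ rfl hq.ht (h3.addTri hxy.ne hcx.symm hcy.symm)
    (a := some x) (b := some y) (c := none) (addTri_some.2 hxy) (addTri_none'.2 (Or.inl rfl))
    (addTri_none'.2 (Or.inr (Or.inl rfl))) h3.nonSep_addTri
  exact ⟨r ∘ some, r none, hr.comp (Option.some_injective _) fun a b h => h, fun w hx hy =>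
    hin (some w) (fun e => hx (Option.some_injective _ e)) (fun e => hy (Option.some_injective _ e))
      (by simp)⟩

/-- The graph obtained from `G` by deleting `C` and joining `s` and `t`. -/
def sideGraph {V : Type*} (G : SimpleGraph V) (C : Set V) (s t : V) : SimpleGraph {v : V // v ∉ C} where
  Adj a b := a ≠ b ∧ (G.Adj a b ∨ (a.1 = s ∧ b.1 = t) ∨ (a.1 = t ∧ b.1 = s))
  symm := ⟨fun a b h => ⟨h.1.symm, by
    rcases h.2 with h | h | h
    · exact Or.inl h.symm
    · exact Or.inr (Or.inr h.symm)
    · exact Or.inr (Or.inl h.symm)⟩⟩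
  loopless := ⟨fun a h => h.1 rfl⟩

theorem sideGraph_adj_of_adj {V : Type*} {G : SimpleGraph V} {C : Set V} {s t a b : V}
    (h : G.Adj a b) (ha : a ∉ C) (hb : b ∉ C) : (sideGraph G C s t).Adj ⟨a, ha⟩ ⟨b, hb⟩ :=
  ⟨fun e => h.ne (congrArg Subtype.val e), Or.inl h⟩

theorem sideGraph_adj_self {V : Type*} {G : SimpleGraph V} {C : Set V} {s t : V}
    (h : s ≠ t) (hs : s ∉ C) (ht : t ∉ C) : (sideGraph G C s t).Adj ⟨s, hs⟩ ⟨t, ht⟩ :=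
  ⟨fun e => h (congrArg Subtype.val e), Or.inr (Or.inl ⟨rfl, rfl⟩)⟩

theorem HT.sideGraph {V : Type*} {G : SimpleGraph V} (hG : HT G) {C K : Set V} {s t k : V}
    (hK : K ⊆ C ∪ {s}) (hsK : s ∈ K) (hconn : ConnOn G K) (hk : k ∈ K) (hkt : G.Adj k t) :
    HT (_root_.sideGraph G C s t) := by
  classical
  have hB : ∀ i : {v : V // v ∉ C}, ∀ x, x ∈ (if i.1 = s then K else {i.1}) → x ∈ C ∧ i.1 = s ∨ x = i := by
    intro i x hx
    split_ifs at hx with h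
    · rcases hK hx with h' | h'
      · exact Or.inl ⟨h', h⟩
      · exact Or.inr (h'.trans h.symm)
    · exact Or.inr hx
  have hmem : ∀ i : {v : V // v ∉ C}, i.1 ∈ (if i.1 = s then K else {i.1}) := by
    intro i
    split_ifs with h
    · rwa [h]
    · rfl
  refine hG.minor_of_connOn (fun i => if i.1 = s then K else {i.1}) (fun i => ⟨_, hmem i⟩) ?_ ?_ ?_
  · intro i j hij x hx hx'
    rcases hB i x hx with h | h <;> rcases hB j x hx' with h' | h'
    · exact hij (Subtype.ext (h.2.trans h'.2.symm))
    · exact j.2 (h' ▸ h.1)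
    · exact i.2 (h ▸ h'.1)
    · exact hij (Subtype.ext (h.symm.trans h'))
  · intro i
    split_ifs
    · exact hconn
    · exact connOn_singleton _ _
  · rintro i j ⟨hij, h | h | h⟩
    · exact ⟨i, hmem i, j, hmem j, h⟩
    · refine ⟨k, by simpa [h.1] using hk, j, hmem j, ?_⟩
      rw [h.2]; exact hkt
    · refine ⟨i, hmem i, k, by simpa [h.2] using hk, ?_⟩
      rw [h.1]; exact hkt.symm

/-- The affine image of coordinates `w` in the frame with origin `S`, unit point `T` and second
axis `ε • n`. -/
def framePos (S T n : Plane) (ε : ℝ) (w : Plane) : Plane :=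
  S + w.1 • (T - S) + (ε * w.2) • n

theorem continuous_framePos (S T n w : Plane) : Continuous fun ε => framePos S T n ε w := by
  unfold framePos; fun_prop

theorem det3_framePos (S T n a b c : Plane) (ε : ℝ) :
    det3 (framePos S T n ε a) (framePos S T n ε b) (framePos S T n ε c)
      = ε * det3 S T (S + n) * det3 a b c := by
  simp only [det3, framePos, Prod.fst_add, Prod.snd_add, Prod.fst_sub, Prod.snd_sub,
    Prod.smul_fst, Prod.smul_snd, smul_eq_mul]; ring

theorem continuous_det3 {X : Type*} [TopologicalSpace X] {f g h : X → Plane} (hf : Continuous f)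
    (hg : Continuous g) (hh : Continuous h) : Continuous fun x => det3 (f x) (g x) (h x) := by
  unfold det3; fun_prop

theorem det3_frame_zero (S T n a b b' : Plane) :
    det3 (framePos S T n 0 b) (framePos S T n 0 b') a = (b'.1 - b.1) * det3 S T a := by
  simp only [det3, framePos, Prod.fst_add, Prod.snd_add, Prod.fst_sub, Prod.snd_sub,
    Prod.smul_fst, Prod.smul_snd, smul_eq_mul]; ring

theorem det3_frame_zero_right (S T n a a' b : Plane) :
    det3 a a' (framePos S T n 0 b) = (1 - b.1) * det3 a a' S + b.1 * det3 a a' T := by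
  simp only [det3, framePos, Prod.fst_add, Prod.snd_add, Prod.fst_sub, Prod.snd_sub,
    Prod.smul_fst, Prod.smul_snd, smul_eq_mul]; ring

theorem IsSL.of_gen {V : Type*} [Finite V] {G : SimpleGraph V} {p : V → Plane}
    (hV : 3 ≤ Nat.card V) (hgen : ∀ a b c, a ≠ b → a ≠ c → b ≠ c → det3 (p a) (p b) (p c) ≠ 0)
    (hn : ∀ a b c d, G.Adj a b → G.Adj c d → a ≠ c → a ≠ d → b ≠ c → b ≠ d →
      ¬ SegCross (p a) (p b) (p c) (p d)) : IsSL G p where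
  gen := hgen
  nocross := hn
  inj a b hab := by
    by_contra hne
    obtain ⟨c, hca, hcb⟩ := exists_ne_pair hV a b
    apply hgen a b c hne hca.symm hcb.symm
    rw [hab]; simp [det3]

theorem SegCross.not_of_pos_left {a b c d : Plane} (h : 0 < det3 a b c * det3 a b d) :
    ¬ SegCross a b c d := fun hc => lt_asymm h hc.1

theorem SegCross.not_of_pos_right {a b c d : Plane} (h : 0 < det3 c d a * det3 c d b) :
    ¬ SegCross a b c d := fun hc => lt_asymm h hc.2

theorem pos_of_same_sign {a b c d : ℝ} (h1 : 0 < a * c) (h2 : 0 < b * d) (h : 0 < c * d) :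
    0 < a * b := by
  have h3 : 0 < (a * b) * (c * d) := by nlinarith [mul_pos h1 h2]
  exact (pos_iff_pos_of_mul_pos h3).2 h

open Classical in
/-- Draw the vertices of `R` in a thin frame along the segment from `p s` to `p t`. -/
def gluePos {V : Type*} (R : Set V) (p q : V → Plane) (s t : V) (n : Plane) (ε : ℝ) (v : V) :
    Plane :=
  if v ∈ R then framePos (p s) (p t) n ε (q v) else p v

/-- A partition of the vertices into two sides without connecting edges and a pair. -/
structure IsSep {V : Type*} (G : SimpleGraph V) (C R : Set V) (s t : V) : Prop where
  ne : s ≠ t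
  cover : ∀ v, v ∈ C ∨ v ∈ R ∨ v = s ∨ v = t
  disj : ∀ v, v ∈ C → v ∉ R
  hsC : s ∉ C
  hsR : s ∉ R
  htC : t ∉ C
  htR : t ∉ R
  nadj : ∀ a ∈ C, ∀ b ∈ R, ¬ G.Adj a b

theorem IsSep.symm {V : Type*} {G : SimpleGraph V} {C R : Set V} {s t : V} (h : IsSep G C R s t) :
    IsSep G R C s t where
  ne := h.ne
  cover v := by have := h.cover v; tauto
  disj v hv hv' := h.disj v hv' hv
  hsC := h.hsR
  hsR := h.hsC
  htC := h.htR
  htR := h.htC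
  nadj a ha b hb hab := h.nadj b hb a ha hab.symm

theorem glue {V : Type*} [Finite V] {G : SimpleGraph V} {C R : Set V} {s t : V}
    (h : IsSep G C R s t) (hV : 3 ≤ Nat.card V) {p q : V → Plane} {n : Plane}
    (hn : det3 (p s) (p t) (p s + n) ≠ 0)
    (h1 : IsSL (sideGraph G R s t) fun v => p v) (h2 : IsSL (sideGraph G C s t) fun v => q v)
    (hqs : q s = (0, 0)) (hqt : q t = (1, 0)) (hq : ∀ b ∈ R, 0 < (q b).1 ∧ (q b).1 < 1)
    (hinj : ∀ b b', b ∉ C → b' ∉ C → b ≠ b' → (q b).1 ≠ (q b').1)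
    (hgen : ∀ a ∈ C, ∀ a' ∈ C, a ≠ a' → ∀ b ∉ C,
      (1 - (q b).1) * det3 (p a) (p a') (p s) + (q b).1 * det3 (p a) (p a') (p t) ≠ 0) :
    ∀ᶠ ε in 𝓝[>] (0:ℝ), IsSL G (gluePos R p q s t n ε) := by
  have hCR := h.disj
  have E1 : ∀ᶠ ε in 𝓝[>] (0:ℝ), ∀ b b' a : V, b ∉ C → b' ∉ C → b ≠ b' → a ∈ C →
      0 < det3 (framePos (p s) (p t) n ε (q b)) (framePos (p s) (p t) n ε (q b')) (p a) *
        (((q b').1 - (q b).1) * det3 (p s) (p t) (p a)) := by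
    simp only [eventually_all]
    intro b b' a hb hb' hne ha
    refine eventually_pos_of_continuous ?_ ?_
    · exact (continuous_det3 (continuous_framePos _ _ _ _) (continuous_framePos _ _ _ _)
        continuous_const).mul continuous_const
    · rw [det3_frame_zero]
      have ha' := h1.gen ⟨s, h.hsR⟩ ⟨t, h.htR⟩ ⟨a, hCR a ha⟩ (fun e => h.ne (congrArg Subtype.val e))
        (fun e => h.hsC (by rw [show s = a from congrArg Subtype.val e]; exact ha))
        (fun e => h.htC (by rw [show t = a from congrArg Subtype.val e]; exact ha))
      exact mul_self_pos.2 (mul_ne_zero (sub_ne_zero.2 (hinj b' b hb' hb hne.symm)) ha')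
  have E2 : ∀ᶠ ε in 𝓝[>] (0:ℝ), ∀ a a' b : V, a ∈ C → a' ∈ C → a ≠ a' → b ∉ C →
      0 < det3 (p a) (p a') (framePos (p s) (p t) n ε (q b)) *
        ((1 - (q b).1) * det3 (p a) (p a') (p s) + (q b).1 * det3 (p a) (p a') (p t)) := by
    simp only [eventually_all]
    intro a a' b ha ha' hne hb
    refine eventually_pos_of_continuous ?_ ?_
    · exact (continuous_det3 continuous_const continuous_const (continuous_framePos _ _ _ _)).mul
        continuous_const
    · rw [det3_frame_zero_right]
      exact mul_self_pos.2 (hgen a ha a' ha' hne b hb)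
  filter_upwards [E1, E2, self_mem_nhdsWithin] with ε E1 E2 hε
  have hε : 0 < ε := hε
  set g := gluePos R p q s t n ε with hg
  have gC : ∀ a, a ∉ R → g a = p a := fun a ha => if_neg ha
  have gR : ∀ b, b ∉ C → g b = framePos (p s) (p t) n ε (q b) := by
    intro b hb
    by_cases hbR : b ∈ R
    · exact if_pos hbR
    · rw [gC b hbR]
      have hor := h.cover b
      rcases hor with hor | hor | rfl | rfl
      · exact absurd hor hb
      · exact absurd hor hbR
      · simp [framePos, hqs]
      · simp [framePos, hqt]
  replace E1 : ∀ b b' a : V, b ∉ C → b' ∉ C → b ≠ b' → a ∈ C →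
      0 < det3 (g b) (g b') (g a) * (((q b').1 - (q b).1) * det3 (g s) (g t) (g a)) := by
    intro b b' a hb hb' hne ha
    rw [gR b hb, gR b' hb', gC a (hCR a ha), gC s h.hsR, gC t h.htR]
    exact E1 b b' a hb hb' hne ha
  replace E2 : ∀ a a' b : V, a ∈ C → a' ∈ C → a ≠ a' → b ∉ C →
      0 < det3 (g a) (g a') (g b) * ((1 - (q b).1) * det3 (g a) (g a') (g s) +
        (q b).1 * det3 (g a) (g a') (g t)) := by
    intro a a' b ha ha' hne hb
    rw [gR b hb, gC a (hCR a ha), gC a' (hCR a' ha'), gC s h.hsR, gC t h.htR]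
    exact E2 a a' b ha ha' hne hb
  have E3 : ∀ b b' b'', b ∉ C → b' ∉ C → b'' ∉ C →
      det3 (g b) (g b') (g b'') = ε * det3 (p s) (p t) (p s + n) * det3 (q b) (q b') (q b'') := by
    intro b b' b'' hb hb' hb''
    rw [gR b hb, gR b' hb', gR b'' hb'', det3_framePos]
  have hk : ε * det3 (p s) (p t) (p s + n) ≠ 0 := mul_ne_zero hε.ne' hn
  have gen2 : ∀ a a' b, a ∈ C → a' ∈ C → a ≠ a' → b ∉ C → det3 (g a) (g a') (g b) ≠ 0 :=
    fun a a' b ha ha' hne hb e => by have := E2 a a' b ha ha' hne hb; simp [e] at this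
  have gen1 : ∀ b b' a, b ∉ C → b' ∉ C → b ≠ b' → a ∈ C → det3 (g b) (g b') (g a) ≠ 0 :=
    fun a a' b ha ha' hne hb e => by have := E1 a a' b ha ha' hne hb; simp [e] at this
  have key : ∀ a b c d, G.Adj a b → G.Adj c d → a ≠ c → a ≠ d → b ≠ c → b ≠ d →
      a ∉ R → b ∉ R → (a ∈ C ∨ b ∈ C) → c ∉ C → d ∉ C →
      0 < det3 (g a) (g b) (g c) * det3 (g a) (g b) (g d) ∨
        0 < det3 (g c) (g d) (g a) * det3 (g c) (g d) (g b) := by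
    have q0 : ∀ c, c ∉ C → c ≠ s → 0 < (q c).1 := by
      intro c hc hcs
      rcases h.cover c with h' | h' | h' | h'
      · exact absurd h' hc
      · exact (hq c h').1
      · exact absurd h' hcs
      · rw [h', hqt]; norm_num
    have q1 : ∀ c, c ∉ C → c ≠ t → (q c).1 < 1 := by
      intro c hc hcs
      rcases h.cover c with h' | h' | h' | h'
      · exact absurd h' hc
      · exact (hq c h').2
      · rw [h', hqs]; norm_num
      · exact absurd h' hcs
    have q0' : ∀ c, c ∉ C → 0 ≤ (q c).1 := fun c hc => by
      by_cases e : c = s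
      · rw [e, hqs]
      · exact (q0 c hc e).le
    have q1' : ∀ c, c ∉ C → (q c).1 ≤ 1 := fun c hc => by
      by_cases e : c = t
      · rw [e, hqt]
      · exact (q1 c hc e).le
    have one : ∀ a b c d, c ≠ d → b ≠ c → b ≠ d → a ∈ C → b ∉ R → b ∉ C → c ∉ C → d ∉ C →
        0 < det3 (g b) (g c) (g a) * det3 (g b) (g d) (g a) := by
      intro a b c d hcd hbc hbd ha hbR hb hc hd
      have hD := E1 s t a h.hsC h.htC h.ne ha
      rw [hqs, hqt] at hD
      refine pos_of_same_sign (E1 b c a hb hc hbc ha) (E1 b d a hb hd hbd ha) ?_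
      have hD0 : 0 < det3 (g s) (g t) (g a) * det3 (g s) (g t) (g a) := by
        simpa using hD
      have : 0 < ((q c).1 - (q b).1) * ((q d).1 - (q b).1) := by
        have hor := h.cover b
        rcases hor with h' | h' | h' | h'
        · exact absurd h' hb
        · exact absurd h' hbR
        · rw [h'] at hbc hbd ⊢
          rw [hqs]
          have h3 := q0 c hc hbc.symm
          have h4 := q0 d hd hbd.symm
          simp only [sub_zero]
          positivity
        · rw [h'] at hbc hbd ⊢
          rw [hqt]
          have h3 := q1 c hc hbc.symm
          have h4 := q1 d hd hbd.symm
          exact mul_pos_of_neg_of_neg (by simpa using h3) (by simpa using h4)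
      calc 0 < _ := mul_pos this hD0
        _ = _ := by ring
    intro a b c d hab hcd hac had hbc hbd ha hb hor hc hd
    by_cases haC : a ∈ C
    · by_cases hbC : b ∈ C
      · have hns := h1.nocross ⟨a, ha⟩ ⟨b, hb⟩ ⟨s, h.hsR⟩ ⟨t, h.htR⟩
          (sideGraph_adj_of_adj hab ha hb) (sideGraph_adj_self h.ne h.hsR h.htR)
          (fun e => h.hsC (by rw [← show a = s from congrArg Subtype.val e]; exact haC))
          (fun e => h.htC (by rw [← show a = t from congrArg Subtype.val e]; exact haC))
          (fun e => h.hsC (by rw [← show b = s from congrArg Subtype.val e]; exact hbC))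
          (fun e => h.htC (by rw [← show b = t from congrArg Subtype.val e]; exact hbC))
        simp only [← gC a ha, ← gC b hb, ← gC s h.hsR, ← gC t h.htR, SegCross, not_and_or,
          not_lt] at hns
        rcases hns with hns | hns
        · left
          have hs := gen2 a b s haC hbC hab.ne h.hsC
          have ht := gen2 a b t haC hbC hab.ne h.htC
          have hpos := lt_of_le_of_ne hns (mul_ne_zero hs ht).symm
          refine pos_of_same_sign (E2 a b c haC hbC hab.ne hc) (E2 a b d haC hbC hab.ne hd) ?_
          have e : ∀ x : V, x ∉ C → 0 < det3 (g a) (g b) (g s) * ((1 - (q x).1) *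
              det3 (g a) (g b) (g s) + (q x).1 * det3 (g a) (g b) (g t)) := by
            intro x hx
            have h3 := mul_self_pos.2 hs
            rcases (q0' x hx).eq_or_lt with h4 | h4
            · rw [← h4]; simpa using h3
            · nlinarith [mul_pos h4 hpos, mul_nonneg (sub_nonneg.2 (q1' x hx)) h3.le]
          refine pos_of_same_sign (c := det3 (g a) (g b) (g s)) (d := det3 (g a) (g b) (g s))
            ?_ ?_ (mul_self_pos.2 hs)
          · rw [mul_comm]; exact e c hc
          · rw [mul_comm]; exact e d hd
        · right
          have h3 := gen1 s t a h.hsC h.htC h.ne haC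
          have h4 := gen1 s t b h.hsC h.htC h.ne hbC
          have hpos := lt_of_le_of_ne hns (mul_ne_zero h3 h4).symm
          refine pos_of_same_sign (E1 c d a hc hd hcd.ne haC) (E1 c d b hc hd hcd.ne hbC) ?_
          have h5 := mul_self_pos.2 (sub_ne_zero.2 (hinj d c hd hc hcd.ne'))
          calc 0 < _ := mul_pos h5 hpos
            _ = _ := by ring
      · left
        rw [← det3_rot (g a) (g b) (g c), ← det3_rot (g a) (g b) (g d)]
        exact one a b c d hcd.ne hbc hbd haC hb hbC hc hd
    · left
      have hbC := hor.resolve_left haC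
      have := one b a c d hcd.ne hac had hbC ha haC hc hd
      rw [det3_swap (g b) (g a) (g c), det3_swap (g b) (g a) (g d),
        ← det3_rot (g b) (g a) (g c), ← det3_rot (g b) (g a) (g d), neg_mul_neg]
      exact this
  have side : ∀ a b, G.Adj a b → (a ∉ C ∧ b ∉ C) ∨ (a ∉ R ∧ b ∉ R ∧ (a ∈ C ∨ b ∈ C)) := by
    intro a b hab
    have h3 := h.nadj a
    have h4 := h.nadj b
    by_cases haC : a ∈ C
    · exact Or.inr ⟨hCR a haC, fun hb => h3 haC b hb hab, Or.inl haC⟩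
    · by_cases hbC : b ∈ C
      · exact Or.inr ⟨fun ha => h4 hbC a ha hab.symm, hCR b hbC, Or.inr hbC⟩
      · exact Or.inl ⟨haC, hbC⟩
  refine IsSL.of_gen hV ?_ ?_
  · intro a b c hab hac hbc
    by_cases ha : a ∈ C <;> by_cases hb : b ∈ C <;> by_cases hc : c ∈ C
    · rw [gC a (hCR a ha), gC b (hCR b hb), gC c (hCR c hc)]
      exact h1.gen ⟨a, hCR a ha⟩ ⟨b, hCR b hb⟩ ⟨c, hCR c hc⟩ (fun e => hab (congrArg Subtype.val e))
        (fun e => hac (congrArg Subtype.val e)) (fun e => hbc (congrArg Subtype.val e))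
    · exact gen2 a b c ha hb hab hc
    · rw [← det3_rot, ← det3_rot]; exact gen2 c a b hc ha hac.symm hb
    · rw [← det3_rot]; exact gen1 b c a hb hc hbc ha
    · rw [← det3_rot]; exact gen2 b c a hb hc hbc ha
    · rw [← det3_rot, ← det3_rot]; exact gen1 c a b hc ha hac.symm hb
    · exact gen1 a b c ha hb hab hc
    · rw [E3 a b c ha hb hc]
      exact mul_ne_zero hk (h2.gen ⟨a, ha⟩ ⟨b, hb⟩ ⟨c, hc⟩ (fun e => hab (congrArg Subtype.val e))
        (fun e => hac (congrArg Subtype.val e)) (fun e => hbc (congrArg Subtype.val e)))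
  · intro a b c d hab hcd hac had hbc hbd
    have ne' : ∀ {P : V → Prop} {x y : V} (hx : P x) (hy : P y), x ≠ y →
        (⟨x, hx⟩ : {v // P v}) ≠ ⟨y, hy⟩ := fun hx hy hxy e => hxy (congrArg Subtype.val e)
    rcases side a b hab with ⟨ha, hb⟩ | ⟨ha, hb, hor⟩ <;>
      rcases side c d hcd with ⟨hc, hd⟩ | ⟨hc, hd, hor'⟩
    · intro hX
      refine h2.nocross ⟨a, ha⟩ ⟨b, hb⟩ ⟨c, hc⟩ ⟨d, hd⟩ (sideGraph_adj_of_adj hab ha hb)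
        (sideGraph_adj_of_adj hcd hc hd) (ne' ha hc hac) (ne' ha hd had) (ne' hb hc hbc)
        (ne' hb hd hbd) (hX.of_det3 hk (E3 _ _ _ ha hb hc) (E3 _ _ _ ha hb hd) (E3 _ _ _ hc hd ha)
          (E3 _ _ _ hc hd hb))
    · rcases key c d a b hcd hab hac.symm hbc.symm had.symm hbd.symm hc hd hor' ha hb with hX | hX
      · exact SegCross.not_of_pos_right hX
      · exact SegCross.not_of_pos_left hX
    · rcases key a b c d hab hcd hac had hbc hbd ha hb hor hc hd with hX | hX
      · exact SegCross.not_of_pos_left hX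
      · exact SegCross.not_of_pos_right hX
    · rw [gC a ha, gC b hb, gC c hc, gC d hd]
      exact h1.nocross ⟨a, ha⟩ ⟨b, hb⟩ ⟨c, hc⟩ ⟨d, hd⟩ (sideGraph_adj_of_adj hab ha hb)
        (sideGraph_adj_of_adj hcd hc hd) (ne' ha hc hac) (ne' ha hd had) (ne' hb hc hbc)
        (ne' hb hd hbd)

theorem card_le_four_of_cover {V : Type*} [Finite V] {a b c d : V}
    (h : ∀ v, v = a ∨ v = b ∨ v = c ∨ v = d) : Nat.card V ≤ 4 := by
  rw [← Set.ncard_univ]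
  have h1 : (univ : Set V) ⊆ {a, b, c, d} := fun v _ => by simpa using h v
  refine (Set.ncard_le_ncard h1).trans ?_
  have := Set.ncard_insert_le a {b, c, d}
  have := Set.ncard_insert_le b {c, d}
  have := Set.ncard_insert_le c {d}
  have := Set.ncard_singleton d
  omega

theorem isSep_of_closedIn {V : Type*} {G : SimpleGraph V} {C : Set V} {s t : V} (hst : s ≠ t) (hs : s ∉ C) (ht : t ∉ C)
    (hcl : ClosedIn G C {s, t}) : IsSep G C (C ∪ {s, t})ᶜ s t where
  ne := hst
  cover v := by
    simp only [mem_compl_iff, mem_union, mem_insert_iff, mem_singleton_iff]; tauto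
  disj v hv h := h (Or.inl hv)
  hsC := hs
  hsR h := h (by simp)
  htC := ht
  htR h := h (by simp)
  nadj a ha b hb hab := hb (hcl a ha b hab)

theorem IsSep.closedIn {V : Type*} {G : SimpleGraph V} {C R : Set V} {s t : V} (h : IsSep G C R s t) : ClosedIn G C {s, t} := by
  intro a ha b hab
  have h1 := h.nadj a ha b
  have h2 := h.cover b
  simp only [mem_insert_iff, mem_singleton_iff]
  tauto

section Separation

variable {V : Type*} [Finite V] {G : SimpleGraph V}

theorem no_closed_empty (hV : 5 ≤ Nat.card V) {x y : V} (hxy : G.Adj x y)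
    (hadj : ∀ a b, G.Adj a b → ∀ C : Set V, C.Nonempty → a ∉ C → b ∉ C → ClosedIn G C {a, b} →
      ∀ v, v ∈ C ∨ v = a ∨ v = b)
    {A : Set V} (hA : A.Nonempty) (hAc : Aᶜ.Nonempty) (hcl : ClosedIn G A ∅) : False := by
  have hcl' : ClosedIn G Aᶜ ∅ := by simpa using hcl.compl
  wlog hx : x ∈ A generalizing A
  · exact this hAc (by simpa using hA) hcl' (by simpa using hcl) hx
  have hy : y ∈ A := (hcl x hx y hxy).resolve_right (by simp)
  have h1 := hadj x y hxy Aᶜ hAc (by simpa using hx) (by simpa using hy)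
    fun u hu v huv => Or.inl ((hcl' u hu v huv).resolve_right (by simp))
  by_cases he : ∃ r r', r ∉ A ∧ G.Adj r r'
  · obtain ⟨r, r', hr, hrr⟩ := he
    have hr' : r' ∉ A := (hcl' r hr r' hrr).resolve_right (by simp)
    have h2 := hadj r r' hrr A hA hr hr'
      fun u hu v huv => Or.inl ((hcl u hu v huv).resolve_right (by simp))
    have := card_le_four_of_cover (a := x) (b := y) (c := r) (d := r') fun v => by
      rcases h1 v with h1 | h1
      · have := (h2 v).resolve_left h1; tauto
      · tauto
    omega
  · push Not at he
    obtain ⟨r, hr⟩ := hAc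
    have h2 := hadj x y hxy {r} ⟨r, rfl⟩ (fun e => hr ((show x = r from e) ▸ hx))
      (fun e => hr ((show y = r from e) ▸ hy)) fun u hu v huv => by
        rw [show u = r from hu] at huv
        exact absurd huv (he r v hr)
    have := card_le_four_of_cover (a := x) (b := y) (c := r) (d := r) fun v => by
      rcases h2 v with h2 | h2
      · have : v = r := h2
        tauto
      · tauto
    omega

theorem no_closed_singleton (hV : 5 ≤ Nat.card V) {x y : V} (hxy : G.Adj x y)
    (hadj : ∀ a b, G.Adj a b → ∀ C : Set V, C.Nonempty → a ∉ C → b ∉ C → ClosedIn G C {a, b} →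
      ∀ v, v ∈ C ∨ v = a ∨ v = b)
    {C : Set V} {s : V} (hC : C.Nonempty) (hs : s ∉ C) (hcl : ClosedIn G C {s}) (v : V) :
    v ∈ C ∨ v = s := by
  by_contra hv
  have hR : v ∈ (C ∪ {s})ᶜ := by simpa [and_comm] using hv
  have hclR := hcl.compl
  set R := (C ∪ {s})ᶜ with hRdef
  have hsR : s ∉ R := by simp [hRdef]
  have hmem : ∀ w, w ∉ C → w ≠ s → w ∈ R := fun w h1 h2 => by simp [hRdef, h1, h2]
  have hCR : ∀ w, w ∈ C → w ∉ R := fun w h1 h2 => by simp [hRdef, h1] at h2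
  by_cases h1 : ∃ c ∈ C, G.Adj s c
  · obtain ⟨c, hc, hsc⟩ := h1
    by_cases h2 : ∃ r ∈ R, G.Adj s r
    · obtain ⟨r, hr, hsr⟩ := h2
      have h3 := hadj s c hsc R ⟨v, hR⟩ hsR (hCR c hc) fun u hu w huw => by
        have := hclR u hu w huw
        simp only [mem_singleton_iff] at this
        simp only [mem_insert_iff, mem_singleton_iff]
        tauto
      have hrC : r ∉ C := fun h => hCR r h hr
      have h4 := hadj s r hsr C hC hs hrC fun u hu w huw => by
        have := hcl u hu w huw
        simp only [mem_singleton_iff] at this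
        simp only [mem_insert_iff, mem_singleton_iff]
        tauto
      have := card_le_four_of_cover (a := s) (b := c) (c := r) (d := r) fun w => by
        have h3 := h3 w
        have h4 := h4 w
        have := hCR w
        tauto
      omega
    · refine no_closed_empty hV hxy hadj ⟨v, hR⟩ ⟨s, hsR⟩ fun u hu w huw => ?_
      rcases hclR u hu w huw with h | h
      · exact Or.inl h
      · rw [show w = s from h] at huw
        exact absurd ⟨u, hu, huw.symm⟩ h2
  · refine no_closed_empty hV hxy hadj hC ⟨s, hs⟩ fun u hu w huw => ?_
    rcases hcl u hu w huw with h | h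
    · exact Or.inl h
    · rw [show w = s from h] at huw
      exact absurd ⟨u, hu, huw.symm⟩ h1

/-- A side of a separation, closed off by a virtual edge, is in the class when no smaller
separator exists. -/
theorem IsSep.ht_sideGraph (hG : HT G) {C R : Set V} {s t : V} (h : IsSep G C R s t)
    (hC : C.Nonempty) (hsing : ∀ (C : Set V) (s : V), C.Nonempty → s ∉ C → ClosedIn G C {s} →
      ∀ v, v ∈ C ∨ v = s) : HT (sideGraph G C s t) := by
  obtain ⟨x₀, hx₀⟩ := hC
  obtain ⟨hconn, hcl⟩ := h.closedIn.component (x₀ := x₀)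
  set C1 := {y | ReachIn G C x₀ y} with hC1
  have hx1 : x₀ ∈ C1 := .refl hx₀
  have hsub : C1 ⊆ C := fun y hy => hy.right_mem
  have hs1 : s ∉ C1 := fun h' => h.hsC (hsub h')
  have ht1 : t ∉ C1 := fun h' => h.htC (hsub h')
  have nbr : ∀ u w : V, u ≠ w → u ∉ C1 → w ∉ C1 → ClosedIn G C1 {u, w} → ∃ k ∈ C1, G.Adj k u := by
    intro u w huw hu hw hcl
    by_contra hc
    push Not at hc
    rcases hsing C1 w ⟨_, hx1⟩ hw (fun a ha b hab => by
      rcases hcl a ha b hab with h | h | h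
      · exact Or.inl h
      · exact absurd hab (h ▸ hc a ha)
      · exact Or.inr h) u with h | h
    · exact hu h
    · exact huw h
  obtain ⟨k, hk, hkt⟩ := nbr t s h.ne.symm ht1 hs1 (by rwa [pair_comm])
  obtain ⟨l, hl, hls⟩ := nbr s t h.ne hs1 ht1 hcl
  refine hG.sideGraph (K := C1 ∪ {s}) (s := s) (t := t) (k := k) ?_ (by simp) ?_ (Or.inl hk) hkt
  · exact union_subset_union_left _ hsub
  · have base : ∀ a ∈ C1 ∪ {s}, ReachIn G (C1 ∪ {s}) l a := by
      rintro a (ha | ha)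
      · exact (hconn l hl a ha).mono subset_union_left
      · rw [show a = s from ha]
        exact ReachIn.tail (G := G) (b := l) (c := s) (.refl (Or.inl hl)) hls (Or.inr rfl)
    exact fun a ha b hb => (base a ha).symm.trans (base b hb)

theorem HT.exists_sep (hG : HT G) (hV : 5 ≤ Nat.card V) (h3 : ¬ Conn3 G) {x y : V}
    (hxy : G.Adj x y) : ∃ C R s t, IsSep G C R s t ∧ C.Nonempty ∧ R.Nonempty ∧ x ∉ R ∧ y ∉ R ∧
      HT (_root_.sideGraph G R s t) ∧ HT (_root_.sideGraph G C s t) := by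
  suffices H : ∃ C R s t, IsSep G C R s t ∧ C.Nonempty ∧ R.Nonempty ∧
      HT (_root_.sideGraph G R s t) ∧ HT (_root_.sideGraph G C s t) by
    obtain ⟨C, R, s, t, h, hC, hR, h1, h2⟩ := H
    by_cases hx : x ∈ R ∨ y ∈ R
    · refine ⟨R, C, s, t, h.symm, hR, hC, fun hx' => ?_, fun hy' => ?_, h2, h1⟩
      · rcases hx with hx | hy
        · exact h.disj x hx' hx
        · exact h.nadj x hx' y hy hxy
      · rcases hx with hx | hy
        · exact h.nadj y hy' x hx hxy.symm
        · exact h.disj y hy' hy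
    · push Not at hx
      exact ⟨C, R, s, t, h, hC, hR, hx.1, hx.2, h1, h2⟩
  by_cases hadj : ∀ a b, G.Adj a b → ∀ C : Set V, C.Nonempty → a ∉ C → b ∉ C →
      ClosedIn G C {a, b} → ∀ v, v ∈ C ∨ v = a ∨ v = b
  · have hsing := fun C s h1 h2 h3 => no_closed_singleton hV hxy hadj (C := C) (s := s) h1 h2 h3
    unfold Conn3 at h3
    push Not at h3
    obtain ⟨C, s, t, hC, hs, ht, hcl, v, hvC, hvs, hvt⟩ := h3 (by omega)
    have hst : s ≠ t := by
      rintro rfl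
      rcases hsing C s hC hs (by simpa using hcl) v with h | h
      · exact hvC h
      · exact hvs h
    have hsep := isSep_of_closedIn hst hs ht hcl
    have hR : ((C ∪ {s, t})ᶜ).Nonempty := ⟨v, by simp [hvC, hvs, hvt]⟩
    exact ⟨C, _, s, t, hsep, hC, hR, hsep.symm.ht_sideGraph hG hR hsing,
      hsep.ht_sideGraph hG hC hsing⟩
  · push Not at hadj
    obtain ⟨a, b, hab, C, hC, ha, hb, hcl, v, hvC, hva, hvb⟩ := hadj
    have hsep := isSep_of_closedIn hab.ne ha hb hcl
    have hR : ((C ∪ {a, b})ᶜ).Nonempty := ⟨v, by simp [hvC, hva, hvb]⟩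
    exact ⟨C, _, a, b, hsep, hC, hR,
      hG.sideGraph (K := {a}) (k := a) (by simp) rfl (connOn_singleton _ _) rfl hab,
      hG.sideGraph (K := {a}) (k := a) (by simp) rfl (connOn_singleton _ _) rfl hab⟩

end Separation

/-- Coordinates of `v` in the affine frame with origin `S`, unit points `T` and `τ`. -/
def frameCoord (S T τ v : Plane) : Plane :=
  (det3 τ S v / det3 S T τ, det3 S T v / det3 S T τ)

theorem det3_frameCoord {S T τ : Plane} (h : det3 S T τ ≠ 0) (a b c : Plane) :
    det3 (frameCoord S T τ a) (frameCoord S T τ b) (frameCoord S T τ c)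
      = (det3 S T τ)⁻¹ * det3 a b c := by
  have key : det3 (det3 τ S a, det3 S T a) (det3 τ S b, det3 S T b) (det3 τ S c, det3 S T c)
      = det3 S T τ * det3 a b c := by
    simp only [det3]; ring
  have : det3 (frameCoord S T τ a) (frameCoord S T τ b) (frameCoord S T τ c) =
      det3 (det3 τ S a, det3 S T a) (det3 τ S b, det3 S T b) (det3 τ S c, det3 S T c)
        / (det3 S T τ * det3 S T τ) := by
    have aux : ∀ D x₁ y₁ x₂ y₂ x₃ y₃ : ℝ, det3 (x₁ / D, y₁ / D) (x₂ / D, y₂ / D) (x₃ / D, y₃ / D) =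
        det3 (x₁, y₁) (x₂, y₂) (x₃, y₃) / (D * D) := fun D x₁ y₁ x₂ y₂ x₃ y₃ => by
      simp only [det3, ← sub_div, div_mul_div_comm]
    exact aux _ _ _ _ _ _ _
  rw [this, key]
  field_simp

theorem frameCoord_injective {S T τ : Plane} (h : det3 S T τ ≠ 0) :
    Function.Injective (frameCoord S T τ) := by
  intro a b hab
  have h1 : det3 τ S a = det3 τ S b := by
    have := congrArg Prod.fst hab
    simpa [frameCoord, div_left_inj' h] using this
  have h2 : det3 S T a = det3 S T b := by
    have := congrArg Prod.snd hab
    simpa [frameCoord, div_left_inj' h] using this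
  have e1 : det3 S T τ * (a.1 - b.1) = 0 := by
    have : det3 S T τ * (a.1 - b.1) = (det3 τ S a - det3 τ S b) * (T.1 - S.1) +
      (det3 S T a - det3 S T b) * (τ.1 - S.1) := by simp only [det3]; ring
    rw [this, h1, h2]; ring
  have e2 : det3 S T τ * (a.2 - b.2) = 0 := by
    have : det3 S T τ * (a.2 - b.2) = (det3 τ S a - det3 τ S b) * (T.2 - S.2) +
      (det3 S T a - det3 S T b) * (τ.2 - S.2) := by simp only [det3]; ring
    rw [this, h1, h2]; ring
  exact Prod.ext (sub_eq_zero.1 ((mul_eq_zero.1 e1).resolve_left h))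
    (sub_eq_zero.1 ((mul_eq_zero.1 e2).resolve_left h))

theorem InTri.frameCoord_pos {S T τ v : Plane} (h : InTri S T τ v) :
    0 < (frameCoord S T τ v).1 ∧ 0 < (frameCoord S T τ v).2 ∧
      (frameCoord S T τ v).1 + (frameCoord S T τ v).2 < 1 := by
  obtain ⟨h1, h2, h3⟩ := h
  have hD : det3 S T τ ≠ 0 := fun e => by simp [e] at h1
  have hD2 : 0 < det3 S T τ * det3 S T τ := mul_self_pos.2 hD
  have e : ∀ z, z / det3 S T τ = (det3 S T τ * z) / (det3 S T τ * det3 S T τ) := fun z => by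
    field_simp
  have hs : det3 S T v + det3 T τ v + det3 τ S v = det3 S T τ := by simp only [det3]; ring
  refine ⟨?_, ?_, ?_⟩
  · simp only [frameCoord]; rw [e]; exact div_pos h3 hD2
  · simp only [frameCoord]; rw [e]; exact div_pos h1 hD2
  · simp only [frameCoord]
    rw [e, e, ← add_div, div_lt_one hD2]
    have := congrArg (det3 S T τ * ·) hs
    simp only [mul_add] at this
    linarith

theorem exists_extend_val {V : Type*} {C : Set V} (p : {v : V // v ∉ C} → Plane) :
    ∃ P : V → Plane, (fun v : {v : V // v ∉ C} => P v) = p := by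
  classical
  refine ⟨fun v => if h : v ∉ C then p ⟨v, h⟩ else 0, ?_⟩
  funext v
  simp [v.2]

/-- A drawing, together with a triangle over the edge `x y` enclosing everything else. -/
def OuterEdge {V : Type*} (p : V → Plane) (x y : V) (τ : Plane) : Prop :=
  det3 (p x) (p y) τ ≠ 0 ∧ ∀ w, w ≠ x → w ≠ y → InTri (p x) (p y) τ (p w)

/-- Coordinates of the inner side of a separation, in generic position. -/
theorem exists_coords {V : Type*} [Finite V] {G : SimpleGraph V} {C R : Set V} {s t : V}
    (h : IsSep G C R s t) {p q : V → Plane} {τ : Plane}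
    (h1 : IsSL (sideGraph G R s t) fun v => p v) (h2 : IsSL (sideGraph G C s t) fun v => q v)
    (hD : det3 (q s) (q t) τ ≠ 0) (hin : ∀ b ∈ R, InTri (q s) (q t) τ (q b)) :
    ∃ r : V → Plane, (IsSL (sideGraph G C s t) fun v => r v) ∧ r s = (0, 0) ∧ r t = (1, 0) ∧
      (∀ b ∈ R, 0 < (r b).1 ∧ (r b).1 < 1) ∧ (∀ b ∈ R, 0 < (r b).2) ∧
      (∀ b b', b ∉ C → b' ∉ C → b ≠ b' → (r b).1 ≠ (r b').1) ∧
      (∀ a ∈ C, ∀ a' ∈ C, a ≠ a' → ∀ b ∉ C,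
        (1 - (r b).1) * det3 (p a) (p a') (p s) + (r b).1 * det3 (p a) (p a') (p t) ≠ 0) := by
  set q0 : V → Plane := fun v => frameCoord (q s) (q t) τ (q v) with hq0
  have z1 : ∀ a b, det3 a b a = 0 := fun a b => by simp [det3]
  have z2 : ∀ a b, det3 a b b = 0 := fun a b => by simp only [det3]; ring
  have qs : q0 s = (0, 0) := by
    refine Prod.ext ?_ ?_ <;> simp [hq0, frameCoord, z1, z2]
  have qt : q0 t = (1, 0) := by
    have e : det3 τ (q s) (q t) = det3 (q s) (q t) τ := by rw [← det3_rot]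
    refine Prod.ext ?_ ?_
    · simp only [hq0, frameCoord, e, div_self hD]
    · simp [hq0, frameCoord, z2]
  have hpos : ∀ b ∈ R, 0 < (q0 b).1 ∧ 0 < (q0 b).2 ∧ (q0 b).1 + (q0 b).2 < 1 :=
    fun b hb => (hin b hb).frameCoord_pos
  have hinj : ∀ b b', b ∉ C → b' ∉ C → b ≠ b' → q0 b ≠ q0 b' := by
    intro b b' hb hb' hne e
    have h3 : (⟨b, hb⟩ : {v // v ∉ C}) = ⟨b', hb'⟩ := h2.inj (frameCoord_injective hD e)
    exact hne (congrArg Subtype.val h3)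
  have e1 : ∀ᶠ κ in 𝓝[>] (0:ℝ), ∀ b ∈ R, 0 < 1 - ((q0 b).1 + κ * (q0 b).2) := by
    simp only [eventually_all]
    intro b hb
    refine eventually_pos_of_continuous (by fun_prop) ?_
    have := hpos b hb
    linarith
  have e2 : ∀ᶠ κ in 𝓝[>] (0:ℝ), ∀ b b', b ∉ C → b' ∉ C → b ≠ b' →
      ((q0 b).1 - (q0 b').1) + κ * ((q0 b).2 - (q0 b').2) ≠ 0 := by
    simp only [eventually_all]
    intro b b' hb hb' hne
    refine eventually_affine_ne ?_
    by_contra hc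
    push Not at hc
    exact hinj b b' hb hb' hne (Prod.ext (sub_eq_zero.1 hc.1) (sub_eq_zero.1 hc.2))
  have e3 : ∀ᶠ κ in 𝓝[>] (0:ℝ), ∀ a ∈ C, ∀ a' ∈ C, a ≠ a' → ∀ b ∉ C,
      ((1 - (q0 b).1) * det3 (p a) (p a') (p s) + (q0 b).1 * det3 (p a) (p a') (p t)) +
        κ * ((q0 b).2 * (det3 (p a) (p a') (p t) - det3 (p a) (p a') (p s))) ≠ 0 := by
    simp only [eventually_all]
    intro a ha a' ha' hne b hb
    refine eventually_affine_ne ?_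
    have hg : ∀ z, z ∉ R → z ∉ C → det3 (p a) (p a') (p z) ≠ 0 := fun z hz hzC =>
      h1.gen ⟨a, h.disj a ha⟩ ⟨a', h.disj a' ha'⟩ ⟨z, hz⟩ (fun e => hne (congrArg Subtype.val e))
        (fun e => hzC (by rw [← show a = z from congrArg Subtype.val e]; exact ha))
        (fun e => hzC (by rw [← show a' = z from congrArg Subtype.val e]; exact ha'))
    have hs := hg s h.hsR h.hsC
    have ht := hg t h.htR h.htC
    have hor := h.cover b
    rcases hor with hor | hor | rfl | rfl
    · exact absurd hor hb
    · by_cases e : det3 (p a) (p a') (p t) = det3 (p a) (p a') (p s)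
      · left
        rw [e]
        convert hs using 1
        ring
      · exact Or.inr (mul_ne_zero (hpos b hor).2.1.ne' (sub_ne_zero.2 e))
    · left
      rw [qs]
      simpa using hs
    · left
      rw [qt]
      simpa using ht
  obtain ⟨κ, ⟨h4, h5, h6⟩, hκ⟩ := ((e1.and (e2.and e3)).and self_mem_nhdsWithin).exists
  have hκ : 0 < κ := hκ
  refine ⟨fun v => ((q0 v).1 + κ * (q0 v).2, (q0 v).2), ?_, ?_, ?_, ?_, ?_, ?_, ?_⟩
  · refine h2.of_detScale (inv_ne_zero hD) (fun a b c => ?_) fun a b hab => ?_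
    · have := det3_frameCoord hD (q a) (q b) (q c)
      rw [← this]
      simp only [hq0, det3]
      ring
    · have h7 := congrArg Prod.snd hab
      have h8 := congrArg Prod.fst hab
      simp only at h7 h8
      by_contra hne
      refine hinj a b a.2 b.2 (fun e => hne (Subtype.ext e)) (Prod.ext ?_ h7)
      rw [h7] at h8
      linarith
  · simp [qs]
  · simp [qt]
  · intro b hb
    have := hpos b hb
    have h7 := h4 b hb
    exact ⟨by have := mul_pos hκ this.2.1; simp only; linarith, by simp only; linarith⟩
  · exact fun b hb => (hpos b hb).2.1
  · intro b b' hb hb' hne e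
    refine h5 b b' hb hb' hne ?_
    simp only at e
    linarith
  · intro a ha a' ha' hne b hb e
    refine h6 a ha a' ha' hne b hb ?_
    rw [← e]
    ring

theorem glue_outer {V : Type*} [Finite V] {G : SimpleGraph V} {C R : Set V} {s t x y : V}
    (h : IsSep G C R s t) (hV : 3 ≤ Nat.card V) (hxR : x ∉ R) (hyR : y ∉ R) (hxy : x ≠ y)
    {p q : V → Plane} {τ τ' : Plane}
    (h1 : IsSL (sideGraph G R s t) fun v => p v) (h2 : IsSL (sideGraph G C s t) fun v => q v)
    (hD : det3 (p x) (p y) τ ≠ 0)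
    (hout : ∀ w ∉ R, w ≠ x → w ≠ y → InTri (p x) (p y) τ (p w))
    (hD' : det3 (q s) (q t) τ' ≠ 0) (hin : ∀ b ∈ R, InTri (q s) (q t) τ' (q b)) :
    ∃ P τ, IsSL G P ∧ OuterEdge P x y τ := by
  obtain ⟨r, hr, hrs, hrt, hr1, hr2, hr3, hr4⟩ := exists_coords h h1 h2 hD' hin
  have hST : p s ≠ p t := fun e => h.ne (congrArg Subtype.val
    (h1.inj (a₁ := ⟨s, h.hsR⟩) (a₂ := ⟨t, h.htR⟩) e))
  obtain ⟨n, hn, hnxy⟩ : ∃ n, det3 (p s) (p t) (p s + n) ≠ 0 ∧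
      ((s = x ∧ t = y) ∨ (s = y ∧ t = x) → p s + n = τ) := by
    by_cases hc : (s = x ∧ t = y) ∨ (s = y ∧ t = x)
    · refine ⟨τ - p s, ?_, fun _ => by abel⟩
      rw [add_sub_cancel]
      rcases hc with ⟨rfl, rfl⟩ | ⟨rfl, rfl⟩
      · exact hD
      · rw [det3_swap]; exact neg_ne_zero.2 hD
    · refine ⟨(-((p t).2 - (p s).2), (p t).1 - (p s).1), ?_, fun h => absurd h hc⟩
      simp only [det3, Prod.fst_add, Prod.snd_add]
      intro e
      have e' : ((p t).1 - (p s).1) * ((p t).1 - (p s).1) +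
        ((p t).2 - (p s).2) * ((p t).2 - (p s).2) = 0 := by linarith
      obtain ⟨e3, e4⟩ := mul_self_add_mul_self_eq_zero.1 e'
      exact hST (Prod.ext (by linarith) (by linarith))
  have hgl := glue h hV hn h1 hr hrs hrt hr1 hr3 hr4
  have hDD := mul_self_pos.2 hD
  have near : ∀ b ∈ R, ∀ u v : Plane,
      0 < det3 (p x) (p y) τ * det3 u v (p s) ∧ 0 ≤ det3 (p x) (p y) τ * det3 u v (p t) ∨
      0 ≤ det3 (p x) (p y) τ * det3 u v (p s) ∧ 0 < det3 (p x) (p y) τ * det3 u v (p t) →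
      ∀ᶠ ε in 𝓝[>] (0:ℝ), 0 < det3 (p x) (p y) τ * det3 u v (framePos (p s) (p t) n ε (r b)) := by
    intro b hb u v huv
    refine eventually_pos_of_continuous
      (continuous_const.mul (continuous_det3 continuous_const continuous_const
        (continuous_framePos _ _ _ _))) ?_
    rw [det3_frame_zero_right]
    obtain ⟨h3, h4⟩ := hr1 b hb
    have h4 : 0 < 1 - (r b).1 := by linarith
    have e : det3 (p x) (p y) τ * ((1 - (r b).1) * det3 u v (p s) + (r b).1 * det3 u v (p t)) =
      (1 - (r b).1) * (det3 (p x) (p y) τ * det3 u v (p s)) +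
        (r b).1 * (det3 (p x) (p y) τ * det3 u v (p t)) := by ring
    rw [e]
    rcases huv with ⟨h5, h6⟩ | ⟨h5, h6⟩
    · exact add_pos_of_pos_of_nonneg (mul_pos h4 h5) (mul_nonneg h3.le h6)
    · exact add_pos_of_nonneg_of_pos (mul_nonneg h4.le h5) (mul_pos h3 h6)
  have weak : ∀ z ∉ R, (0 ≤ det3 (p x) (p y) τ * det3 (p x) (p y) (p z) ∧
      0 ≤ det3 (p x) (p y) τ * det3 (p y) τ (p z) ∧ 0 ≤ det3 (p x) (p y) τ * det3 τ (p x) (p z)) ∧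
      (z ≠ x → z ≠ y → 0 < det3 (p x) (p y) τ * det3 (p x) (p y) (p z)) ∧
      (z ≠ y → 0 < det3 (p x) (p y) τ * det3 (p y) τ (p z)) ∧
      (z ≠ x → 0 < det3 (p x) (p y) τ * det3 τ (p x) (p z)) := by
    intro z hz
    have z1 : ∀ a b, det3 a b a = 0 := fun a b => by simp [det3]
    have z2 : ∀ a b, det3 a b b = 0 := fun a b => by simp only [det3]; ring
    by_cases hzx : z = x
    · rw [hzx, det3_rot (p x) (p y) τ, z1, z2]
      simp [hxy, hDD, hDD.le]
    · by_cases hzy : z = y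
      · rw [hzy, ← det3_rot τ (p x) (p y), z1, z2]
        simp [hxy.symm, hDD, hDD.le]
      · obtain ⟨h3, h4, h5⟩ := hout z hz hzx hzy
        exact ⟨⟨h3.le, h4.le, h5.le⟩, fun _ _ => h3, fun _ => h4, fun _ => h5⟩
  obtain ⟨⟨s1, s2, s3⟩, s4, s5, s6⟩ := weak s h.hsR
  obtain ⟨⟨t1, t2, t3⟩, t4, t5, t6⟩ := weak t h.htR
  have inside : ∀ᶠ ε in 𝓝[>] (0:ℝ), ∀ b ∈ R,
      InTri (p x) (p y) τ (framePos (p s) (p t) n ε (r b)) := by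
    simp only [eventually_all]
    intro b hb
    have i2 := near b hb (p y) τ (by
      by_cases e : s = y
      · exact Or.inr ⟨s2, t5 fun e' => h.ne (e.trans e'.symm)⟩
      · exact Or.inl ⟨s5 e, t2⟩)
    have i3 := near b hb τ (p x) (by
      by_cases e : s = x
      · exact Or.inr ⟨s3, t6 fun e' => h.ne (e.trans e'.symm)⟩
      · exact Or.inl ⟨s6 e, t3⟩)
    have i1 : ∀ᶠ ε in 𝓝[>] (0:ℝ),
        0 < det3 (p x) (p y) τ * det3 (p x) (p y) (framePos (p s) (p t) n ε (r b)) := by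
      by_cases hc : (s = x ∧ t = y) ∨ (s = y ∧ t = x)
      · have hn' := hnxy hc
        filter_upwards [self_mem_nhdsWithin] with ε hε
        have hε : 0 < ε := hε
        have e : ∀ S T w : Plane, det3 S T (framePos S T n ε w) = ε * w.2 * det3 S T (S + n) := by
          intro S T w
          simp only [det3, framePos, Prod.fst_add, Prod.snd_add, Prod.fst_sub, Prod.snd_sub,
            Prod.smul_fst, Prod.smul_snd, smul_eq_mul]
          ring
        have h5 := mul_pos (mul_pos hε (hr2 b hb)) hDD
        rcases hc with ⟨rfl, rfl⟩ | ⟨rfl, rfl⟩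
        · rw [e, hn']
          nlinarith
        · rw [det3_swap (p s) (p t) (framePos _ _ _ _ _), e, hn', det3_swap (p t) (p s) τ]
          nlinarith
      · refine near b hb _ _ ?_
        by_cases e : s = x ∨ s = y
        · refine Or.inr ⟨s1, t4 (fun e' => ?_) fun e' => ?_⟩
          · rcases e with e | e
            · exact h.ne (e.trans e'.symm)
            · exact hc (Or.inr ⟨e, e'⟩)
          · rcases e with e | e
            · exact hc (Or.inl ⟨e, e'⟩)
            · exact h.ne (e.trans e'.symm)
        · push Not at e
          exact Or.inl ⟨s4 e.1 e.2, t1⟩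
    filter_upwards [i1, i2, i3] with ε i1 i2 i3 using ⟨i1, i2, i3⟩
  obtain ⟨ε, h3, h4⟩ := (hgl.and inside).exists
  have gx : gluePos R p r s t n ε x = p x := if_neg hxR
  have gy : gluePos R p r s t n ε y = p y := if_neg hyR
  refine ⟨_, τ, h3, by rwa [gx, gy], fun w hwx hwy => ?_⟩
  rw [gx, gy]
  by_cases hw : w ∈ R
  · rw [show gluePos R p r s t n ε w = _ from if_pos hw]
    exact h4 w hw
  · rw [show gluePos R p r s t n ε w = _ from if_neg hw]
    exact hout w hw hwx hwy

theorem card_subtype_not_mem_lt {V : Type*} [Finite V] {C : Set V} (hC : C.Nonempty) :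
    Nat.card {v : V // v ∉ C} < Nat.card V := by
  obtain ⟨c, hc⟩ := hC
  exact Finite.card_subtype_lt (x := c) (by simpa using hc)

/-- Every graph in the Hanani-Tutte class has a straight-line drawing enclosed in a triangle over
a prescribed edge. -/
theorem HT.exists_isSL_outerEdge (n : ℕ) : ∀ {V : Type*} [Finite V] {G : SimpleGraph V},
    Nat.card V = n → HT G → ∀ {x y : V}, G.Adj x y → ∃ p τ, IsSL G p ∧ OuterEdge p x y τ := by
  induction n using Nat.strong_induction_on with
  | _ n ih =>
  intro V _ G hn hG x y hxy
  by_cases hV : Nat.card V ≤ 4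
  · by_cases hz : ∃ z, z ≠ x ∧ z ≠ y
    · obtain ⟨z, hzx, hzy⟩ := hz
      obtain ⟨p, hp, ⟨hx, hy, hz⟩, hw⟩ :=
        exists_isSL_of_card_le_four G hV hxy.ne hzx.symm hzy.symm
      refine ⟨p, (4, 100), hp, ?_, ?_⟩
      · rw [hx, hy]; norm_num [det3]
      · intro w hwx hwy
        rw [hx, hy]
        by_cases hwz : w = z
        · rw [hwz, hz]; norm_num [InTri, det3]
        · rw [hw w hwx hwy hwz]; norm_num [InTri, det3]
    · push Not at hz
      classical
      have hy : ∀ w, w ≠ x → w = y := hz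
      have hg : ∀ a b c : V, a ≠ b → a ≠ c → b ≠ c → False := by
        intro a b c hab hac hbc
        by_cases ha : a = x
        · exact hbc ((hy b (fun e => hab (ha.trans e.symm))).trans
            (hy c (fun e => hac (ha.trans e.symm))).symm)
        · by_cases hb : b = x
          · exact hac ((hy a ha).trans (hy c (fun e => hbc (hb.trans e.symm))).symm)
          · exact hab ((hy a ha).trans (hy b hb).symm)
      refine ⟨fun w => if w = x then (0, 0) else (1, 0), (0, 1), ⟨?_, ?_, ?_⟩, ?_, ?_⟩
      · intro a b hab
        by_cases ha : a = x <;> by_cases hb : b = x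
        · rw [ha, hb]
        · simp [ha, hb] at hab
        · simp [ha, hb] at hab
        · rw [hy a ha, hy b hb]
      · exact fun a b c hab hac hbc => (hg a b c hab hac hbc).elim
      · exact fun a b c d hab hcd hac had hbc hbd => (hg a b c hab.ne hac hbc).elim
      · simp [hxy.ne', det3]
      · exact fun w hwx hwy => absurd (hz w hwx) hwy
  push Not at hV
  by_cases h3 : Conn3 G
  · obtain ⟨p, τ, hp, hin⟩ := HT.exists_isSL_edge_of_conn3 hG h3 hxy
    obtain ⟨z, hzx, hzy⟩ := exists_ne_pair (by omega : 3 ≤ Nat.card V) x y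
    exact ⟨p, τ, hp, fun e => by have := (hin z hzx hzy).1; simp [e] at this, hin⟩
  · obtain ⟨C, R, s, t, h, hC, hR, hxR, hyR, hg1, hg2⟩ := hG.exists_sep (by omega) h3 hxy
    obtain ⟨p1, τ1, hp1, ho1⟩ := ih _ (hn ▸ card_subtype_not_mem_lt hR) rfl hg1
      (sideGraph_adj_of_adj hxy hxR hyR)
    obtain ⟨p2, τ2, hp2, ho2⟩ := ih _ (hn ▸ card_subtype_not_mem_lt hC) rfl hg2
      (sideGraph_adj_self h.ne h.hsC h.htC)
    obtain ⟨P1, rfl⟩ := exists_extend_val p1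
    obtain ⟨P2, rfl⟩ := exists_extend_val p2
    refine glue_outer h (by omega) hxR hyR hxy.ne hp1 hp2 ho1.1 (fun w hw hwx hwy => ?_) ho2.1
      fun b hb => ?_
    · exact ho1.2 ⟨w, hw⟩ (fun e => hwx (congrArg Subtype.val e))
        (fun e => hwy (congrArg Subtype.val e))
    · exact ho2.2 ⟨b, h.symm.disj b hb⟩
        (fun e => h.hsR (by rw [← show b = s from congrArg Subtype.val e]; exact hb))
        (fun e => h.htR (by rw [← show b = t from congrArg Subtype.val e]; exact hb))

section Subdivision

variable {V : Type*} {G : SimpleGraph V} {c : G.edgeSet → ℕ} {fst snd : G.edgeSet → V}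

/-- The vertices along the path that replaces the edge `e`. -/
def subNode (c : G.edgeSet → ℕ) (fst snd : G.edgeSet → V) (e : G.edgeSet) (k : ℕ) :
    V ⊕ Σ e : G.edgeSet, Fin (c e) :=
  if k = 0 then Sum.inl (fst e)
  else if h : k - 1 < c e then Sum.inr ⟨e, ⟨k - 1, h⟩⟩ else Sum.inl (snd e)

theorem subNode_zero (e : G.edgeSet) : subNode c fst snd e 0 = Sum.inl (fst e) := if_pos rfl

theorem subNode_inr (e : G.edgeSet) {k : ℕ} (h : k < c e) :
    subNode c fst snd e (k + 1) = Sum.inr ⟨e, ⟨k, h⟩⟩ := by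
  simp [subNode, h]

theorem subNode_last (e : G.edgeSet) : subNode c fst snd e (c e + 1) = Sum.inl (snd e) := by
  simp [subNode]

theorem subNode_cases (e : G.edgeSet) {k : ℕ} (hk : k ≤ c e + 1) :
    (k = 0 ∧ subNode c fst snd e k = Sum.inl (fst e)) ∨
    (k = c e + 1 ∧ subNode c fst snd e k = Sum.inl (snd e)) ∨
    ∃ i : Fin (c e), k = i + 1 ∧ subNode c fst snd e k = Sum.inr ⟨e, i⟩ := by
  rcases Nat.eq_zero_or_pos k with rfl | h
  · exact Or.inl ⟨rfl, subNode_zero e⟩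
  · obtain ⟨k, rfl⟩ := Nat.exists_eq_succ_of_ne_zero h.ne'
    rcases Nat.lt_or_ge k (c e) with h | h
    · exact Or.inr (Or.inr ⟨⟨k, h⟩, rfl, subNode_inr e h⟩)
    · obtain rfl : k = c e := by omega
      exact Or.inr (Or.inl ⟨rfl, subNode_last e⟩)

theorem fst_ne_snd (hfs : ∀ e : G.edgeSet, (e : Sym2 V) = s(fst e, snd e)) (e : G.edgeSet) :
    fst e ≠ snd e := by
  have := e.2
  rw [hfs e] at this
  exact (G.mem_edgeSet.1 this).ne

theorem subNode_inj (hfs : ∀ e : G.edgeSet, (e : Sym2 V) = s(fst e, snd e)) {e : G.edgeSet}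
    {k l : ℕ} (hk : k ≤ c e + 1) (hl : l ≤ c e + 1)
    (h : subNode c fst snd e k = subNode c fst snd e l) : k = l := by
  have hne := fst_ne_snd hfs e
  have h1 := subNode_cases (c := c) (fst := fst) (snd := snd) e hk
  have h2 := subNode_cases (c := c) (fst := fst) (snd := snd) e hl
  rcases h1 with ⟨h1, h1'⟩ | ⟨h1, h1'⟩ | ⟨i, h1, h1'⟩ <;>
    rcases h2 with ⟨h2, h2'⟩ | ⟨h2, h2'⟩ | ⟨j, h2, h2'⟩ <;> rw [h1', h2'] at h <;>
    simp_all

theorem subNode_slot (hfs : ∀ e : G.edgeSet, (e : Sym2 V) = s(fst e, snd e)) {e f : G.edgeSet}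
    {k l : ℕ} (hk : k ≤ c e) (hl : l ≤ c f)
    (h : s(subNode c fst snd e k, subNode c fst snd e (k + 1)) =
      s(subNode c fst snd f l, subNode c fst snd f (l + 1))) : e = f ∧ k = l := by
  have own : ∀ {e f : G.edgeSet} {k l : ℕ} (_ : k ≤ c e) (_ : l ≤ c f) (_ : 0 < c e)
      (_ : s(subNode c fst snd e k, subNode c fst snd e (k + 1)) =
        s(subNode c fst snd f l, subNode c fst snd f (l + 1))), e = f := by
    intro e f k l hk hl hc h
    obtain ⟨i, hi⟩ : ∃ i : Fin (c e), Sum.inr ⟨e, i⟩ ∈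
        s(subNode c fst snd e k, subNode c fst snd e (k + 1)) := by
      rcases Nat.lt_or_ge k (c e) with h1 | h1
      · exact ⟨⟨k, h1⟩, by rw [subNode_inr e h1]; exact Sym2.mem_mk_right _ _⟩
      · obtain ⟨j, rfl⟩ := Nat.exists_eq_succ_of_ne_zero (by omega : k ≠ 0)
        exact ⟨⟨j, hk⟩, by rw [Nat.succ_eq_add_one, subNode_inr e hk]; exact Sym2.mem_mk_left _ _⟩
    rw [h, Sym2.mem_iff] at hi
    have h1 := subNode_cases (c := c) (fst := fst) (snd := snd) f (by omega : l ≤ c f + 1)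
    have h2 := subNode_cases (c := c) (fst := fst) (snd := snd) f (by omega : l + 1 ≤ c f + 1)
    rcases hi with hi | hi
    · rcases h1 with ⟨_, h1⟩ | ⟨_, h1⟩ | ⟨j, _, h1⟩ <;> rw [h1] at hi
      · cases hi
      · cases hi
      · exact congrArg Sigma.fst (Sum.inr.inj hi)
    · rcases h2 with ⟨_, h1⟩ | ⟨_, h1⟩ | ⟨j, _, h1⟩ <;> rw [h1] at hi
      · cases hi
      · cases hi
      · exact congrArg Sigma.fst (Sum.inr.inj hi)
  have hef : e = f := by
    rcases Nat.eq_zero_or_pos (c e) with h1 | h1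
    · rcases Nat.eq_zero_or_pos (c f) with h2 | h2
      · obtain rfl : k = 0 := by omega
        obtain rfl : l = 0 := by omega
        have e1 : subNode c fst snd e (0 + 1) = Sum.inl (snd e) := by rw [← subNode_last, h1]
        have e2 : subNode c fst snd f (0 + 1) = Sum.inl (snd f) := by rw [← subNode_last, h2]
        rw [subNode_zero, subNode_zero, e1, e2] at h
        have h3 : Sym2.map (Sum.inl (β := Σ e : G.edgeSet, Fin (c e))) s(fst e, snd e) =
            Sym2.map Sum.inl s(fst f, snd f) := h
        have h4 := Sym2.map.injective Sum.inl_injective h3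
        exact Subtype.ext (by rw [hfs e, hfs f, h4])
      · exact (own hl hk h2 h.symm).symm
    · exact own hk hl h1 h
  subst hef
  refine ⟨rfl, ?_⟩
  rw [Sym2.eq_iff] at h
  rcases h with ⟨h1, -⟩ | ⟨h1, h2⟩
  · exact subNode_inj hfs (by omega) (by omega) h1
  · have := subNode_inj hfs (by omega) (by omega) h1
    have := subNode_inj hfs (by omega) (by omega) h2
    omega

theorem subNode_adj (hfs : ∀ e : G.edgeSet, (e : Sym2 V) = s(fst e, snd e)) (e : G.edgeSet)
    {k : ℕ} (hk : k ≤ c e) : (subdivideGraph G c fst snd).Adj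
      (subNode c fst snd e k) (subNode c fst snd e (k + 1)) := by
  rw [subdivideGraph, SimpleGraph.fromRel_adj]
  refine ⟨fun h => by have := subNode_inj hfs (by omega) (by omega) h; omega, ?_⟩
  rcases Nat.eq_zero_or_pos k with rfl | h0
  · rw [subNode_zero]
    rcases Nat.eq_zero_or_pos (c e) with h1 | h1
    · have e1 : subNode c fst snd e (0 + 1) = Sum.inl (snd e) := by rw [← subNode_last, h1]
      exact Or.inl (Or.inl ⟨e, h1, rfl, e1⟩)
    · exact Or.inl (Or.inr (Or.inl ⟨e, ⟨0, h1⟩, rfl, subNode_inr e h1, rfl⟩))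
  · obtain ⟨k, rfl⟩ := Nat.exists_eq_succ_of_ne_zero h0.ne'
    rw [Nat.succ_eq_add_one, subNode_inr e hk]
    rcases Nat.lt_or_ge (k + 1) (c e) with h1 | h1
    · exact Or.inl (Or.inr (Or.inr (Or.inr ⟨e, ⟨k, hk⟩, ⟨k + 1, h1⟩, rfl, subNode_inr e h1, rfl⟩)))
    · have hk' : k + 1 = c e := by omega
      refine Or.inr (Or.inr (Or.inr (Or.inl ⟨e, ⟨k, hk⟩, ?_, rfl, ?_⟩)))
      · rw [hk', subNode_last]
      · simp only; omega

theorem exists_slot_of_adj {x y : V ⊕ Σ e : G.edgeSet, Fin (c e)}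
    (h : (subdivideGraph G c fst snd).Adj x y) :
    ∃ e k, k ≤ c e ∧ s(x, y) = s(subNode c fst snd e k, subNode c fst snd e (k + 1)) := by
  rw [subdivideGraph, SimpleGraph.fromRel_adj] at h
  have key : ∀ x y, ((∃ e : G.edgeSet, c e = 0 ∧ x = Sum.inl (fst e) ∧ y = Sum.inl (snd e)) ∨
    (∃ (e : G.edgeSet) (i : Fin (c e)),
      x = Sum.inl (fst e) ∧ y = Sum.inr ⟨e, i⟩ ∧ i.val = 0) ∨
    (∃ (e : G.edgeSet) (i : Fin (c e)),
      x = Sum.inl (snd e) ∧ y = Sum.inr ⟨e, i⟩ ∧ i.val = c e - 1) ∨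
    (∃ (e : G.edgeSet) (i j : Fin (c e)),
      x = Sum.inr ⟨e, i⟩ ∧ y = Sum.inr ⟨e, j⟩ ∧ j.val = i.val + 1)) →
      ∃ e k, k ≤ c e ∧ s(x, y) = s(subNode c fst snd e k, subNode c fst snd e (k + 1)) := by
    rintro x y (⟨e, h1, rfl, rfl⟩ | ⟨e, i, rfl, rfl, h1⟩ | ⟨e, i, rfl, rfl, h1⟩ |
      ⟨e, i, j, rfl, rfl, h1⟩)
    · refine ⟨e, 0, by omega, ?_⟩
      have e1 : subNode c fst snd e (0 + 1) = Sum.inl (snd e) := by rw [← subNode_last, h1]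
      rw [subNode_zero, e1]
    · have hi : 0 < c e := by have := i.2; omega
      obtain rfl : i = ⟨0, hi⟩ := Fin.ext h1
      refine ⟨e, 0, by omega, ?_⟩
      rw [subNode_zero, subNode_inr e hi]
    · have hi := i.2
      refine ⟨e, i + 1, hi, ?_⟩
      have : (i : ℕ) + 1 = c e := by omega
      rw [subNode_inr e hi, show (i : ℕ) + 1 + 1 = c e + 1 by omega, subNode_last, Sym2.eq_swap]
    · have hi := i.2
      have hj := j.2
      refine ⟨e, i + 1, hi, ?_⟩
      rw [subNode_inr e hi, ← h1, subNode_inr e hj]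
  rcases h.2 with h | h
  · exact key x y h
  · obtain ⟨e, k, hk, h⟩ := key y x h
    exact ⟨e, k, hk, by rw [← h, Sym2.eq_swap]⟩

end Subdivision

/-! ### Concatenating arcs -/

/-- There is a simple arc from `p` to `q` inside `K`. -/
def ArcIn (p q : Plane) (K : Set Plane) : Prop :=
  ∃ γ : ℝ → Plane, ContinuousOn γ (Icc 0 1) ∧ InjOn γ (Icc 0 1) ∧ γ 0 = p ∧ γ 1 = q ∧
    ∀ t ∈ Icc (0:ℝ) 1, γ t ∈ K

theorem ArcIn.mono {p q : Plane} {K K' : Set Plane} (h : ArcIn p q K) (hK : K ⊆ K') :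
    ArcIn p q K' := by
  obtain ⟨γ, h1, h2, h3, h4, h5⟩ := h
  exact ⟨γ, h1, h2, h3, h4, fun t ht => hK (h5 t ht)⟩

theorem ArcIn.symm {p q : Plane} {K : Set Plane} (h : ArcIn p q K) : ArcIn q p K := by
  obtain ⟨γ, h1, h2, h3, h4, h5⟩ := h
  have hm : ∀ t ∈ Icc (0:ℝ) 1, 1 - t ∈ Icc (0:ℝ) 1 := fun t ht =>
    ⟨by linarith [ht.2], by linarith [ht.1]⟩
  refine ⟨fun t => γ (1 - t), h1.comp (by fun_prop) hm, ?_, by simpa using h4, by simpa using h3,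
    fun t ht => h5 _ (hm t ht)⟩
  intro s hs t ht hst
  have := h2 (hm s hs) (hm t ht) hst
  linarith

theorem ArcIn.trans {p q r : Plane} {K K' : Set Plane} (h : ArcIn p q K) (h' : ArcIn q r K')
    (hpr : p ≠ r) : ArcIn p r (K ∪ K') := by
  obtain ⟨γ, h1, h2, rfl, h4, h5⟩ := h
  obtain ⟨γ', h1', h2', h3', rfl, h5'⟩ := h'
  have hc : IsCompact (γ' '' Icc 0 1) := isCompact_Icc.image_of_continuousOn h1'
  have hS : IsCompact (Icc (0:ℝ) 1 ∩ γ ⁻¹' (γ' '' Icc 0 1)) :=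
    isCompact_Icc.of_isClosed_subset
      (h1.preimage_isClosed_of_isClosed isClosed_Icc hc.isClosed) inter_subset_left
  obtain ⟨t0, ht0, hmin⟩ := hS.exists_isLeast
    ⟨1, by simp, 0, by simp, by rw [h3', h4]⟩
  obtain ⟨ht0, s0, hs0, he⟩ := ht0
  have hfirst : ∀ t ∈ Icc (0:ℝ) 1, ∀ s ∈ Icc (0:ℝ) 1, γ t = γ' s → t0 ≤ t :=
    fun t ht s hs hts => hmin ⟨ht, s, hs, hts.symm⟩
  have hm1 : ∀ u ∈ Icc (0:ℝ) 1, u * t0 ∈ Icc (0:ℝ) 1 := fun u hu =>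
    ⟨mul_nonneg hu.1 ht0.1, by nlinarith [hu.1, hu.2, ht0.1, ht0.2]⟩
  have hm2 : ∀ u ∈ Icc (0:ℝ) 1, s0 + u * (1 - s0) ∈ Icc (0:ℝ) 1 := fun u hu =>
    ⟨by nlinarith [hu.1, hu.2, hs0.1, hs0.2], by nlinarith [hu.1, hu.2, hs0.1, hs0.2]⟩
  have c1 : ContinuousOn (fun u => γ (u * t0)) (Icc 0 1) := h1.comp (by fun_prop) hm1
  have c2 : ContinuousOn (fun u => γ' (s0 + u * (1 - s0))) (Icc 0 1) := h1'.comp (by fun_prop) hm2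
  rcases ht0.1.eq_or_lt with h0 | h0
  · have hs1 : s0 ≠ 1 := by
      rintro rfl
      exact hpr (by rw [he, ← h0])
    refine ⟨_, c2, ?_, by simp [he, ← h0], by simp, fun t ht => Or.inr (h5' _ (hm2 t ht))⟩
    intro s hs t ht hst
    have := h2' (hm2 s hs) (hm2 t ht) hst
    exact mul_right_cancel₀ (sub_ne_zero.2 hs1.symm) (by linarith)
  rcases hs0.2.eq_or_lt with h00 | h00
  · refine ⟨_, c1, ?_, by simp, by simp [← he, h00], fun t ht => Or.inl (h5 _ (hm1 t ht))⟩
    intro s hs t ht hst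
    exact mul_right_cancel₀ h0.ne' (h2 (hm1 s hs) (hm1 t ht) hst)
  have hl : ∀ u ∈ Icc (0:ℝ) (1/2), 2 * u ∈ Icc (0:ℝ) 1 := fun u hu =>
    ⟨by linarith [hu.1], by linarith [hu.2]⟩
  have hr : ∀ u ∈ Icc (1/2:ℝ) 1, 2 * u - 1 ∈ Icc (0:ℝ) 1 := fun u hu =>
    ⟨by linarith [hu.1], by linarith [hu.2]⟩
  have hunion : Icc (0:ℝ) 1 = Icc 0 (1/2) ∪ Icc (1/2) 1 :=
    (Icc_union_Icc_eq_Icc (by norm_num) (by norm_num)).symm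
  set δ : ℝ → Plane := fun u => if u ≤ 1/2 then γ (2 * u * t0)
    else γ' (s0 + (2 * u - 1) * (1 - s0)) with hδ
  have e1 : ∀ u ∈ Icc (0:ℝ) (1/2), δ u = γ (2 * u * t0) := fun u hu => if_pos hu.2
  have e2 : ∀ u ∈ Icc (1/2:ℝ) 1, δ u = γ' (s0 + (2 * u - 1) * (1 - s0)) := by
    intro u hu
    rcases hu.1.eq_or_lt with rfl | h
    · rw [e1 _ ⟨by norm_num, le_rfl⟩]
      norm_num [he]
    · exact if_neg h.not_ge
  have e3 : ∀ u ∈ Icc (0:ℝ) 1, 1/2 < u → δ u = γ' (s0 + (2 * u - 1) * (1 - s0)) :=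
    fun u hu h => e2 u ⟨h.le, hu.2⟩
  refine ⟨δ, ?_, ?_, by rw [e1 0 (by norm_num)]; simp, by rw [e2 1 (by norm_num)]; norm_num, ?_⟩
  · rw [hunion]
    refine ContinuousOn.union_of_isClosed ?_ ?_ isClosed_Icc isClosed_Icc
    · exact (c1.comp (f := fun u : ℝ => 2 * u) (by fun_prop) hl).congr e1
    · exact (c2.comp (f := fun u : ℝ => 2 * u - 1) (by fun_prop) hr).congr e2
  · have mixed : ∀ s ∈ Icc (0:ℝ) 1, ∀ t ∈ Icc (0:ℝ) 1, s ≤ 1/2 → 1/2 < t → δ s ≠ δ t := by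
      intro s hs t ht hs2 ht2 h
      rw [e1 s ⟨hs.1, hs2⟩, e3 t ht ht2] at h
      have h6 := hm1 _ (hl s ⟨hs.1, hs2⟩)
      have h7 := hm2 _ (hr t ⟨ht2.le, ht.2⟩)
      have h8 := hfirst _ h6 _ h7 h
      have h9 : 2 * s * t0 = t0 := le_antisymm (by nlinarith) h8
      rw [h9, ← he] at h
      have := h2' hs0 h7 h
      nlinarith
    intro s hs t ht h
    rcases le_or_gt s (1/2) with a | a <;> rcases le_or_gt t (1/2) with b | b
    · rw [e1 s ⟨hs.1, a⟩, e1 t ⟨ht.1, b⟩] at h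
      have := mul_right_cancel₀ h0.ne' (h2 (hm1 _ (hl s ⟨hs.1, a⟩)) (hm1 _ (hl t ⟨ht.1, b⟩)) h)
      linarith
    · exact absurd h (mixed s hs t ht a b)
    · exact absurd h.symm (mixed t ht s hs b a)
    · rw [e3 s hs a, e3 t ht b] at h
      have := h2' (hm2 _ (hr s ⟨a.le, hs.2⟩)) (hm2 _ (hr t ⟨b.le, ht.2⟩)) h
      have := mul_right_cancel₀ (b := 1 - s0) (a := 2 * s - 1) (c := 2 * t - 1) (by linarith)
        (by linarith)
      linarith
  · intro u hu
    rw [hunion] at hu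
    rcases hu with hu | hu
    · rw [e1 u hu]; exact Or.inl (h5 _ (hm1 _ (hl u hu)))
    · rw [e2 u hu]; exact Or.inr (h5' _ (hm2 _ (hr u hu)))

/-! ### From a drawing of a subdivision to a drawing of the graph -/

theorem Drawing.arcIn {V : Type*} {G : SimpleGraph V} (D : Drawing G) {x y : V}
    (h : G.Adj x y) : ArcIn (D.vert x) (D.vert y) (D.arc ⟨s(x, y), h⟩ '' Icc 0 1) := by
  have key : ArcIn (D.arc ⟨s(x, y), h⟩ 0) (D.arc ⟨s(x, y), h⟩ 1) (D.arc ⟨s(x, y), h⟩ '' Icc 0 1) :=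
    ⟨_, D.arc_cont _, D.arc_injOn _, rfl, rfl, fun t ht => ⟨t, ht, rfl⟩⟩
  obtain ⟨a, b, hab, h0, h1⟩ := D.arc_ends ⟨s(x, y), h⟩
  rw [h0, h1] at key
  rcases Sym2.eq_iff.1 hab with ⟨rfl, rfl⟩ | ⟨rfl, rfl⟩
  · exact key
  · exact key.symm

theorem Drawing.eq_vert_of_mem {V : Type*} {G : SimpleGraph V} (D : Drawing G) {x y : V}
    (h : G.Adj x y) {z : Plane} (hz : z ∈ D.arc ⟨s(x, y), h⟩ '' Icc 0 1) :
    z ∈ D.interOf ⟨s(x, y), h⟩ ∨ z = D.vert x ∨ z = D.vert y := by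
  obtain ⟨t, ht, rfl⟩ := hz
  obtain ⟨a, b, hab, h0, h1⟩ := D.arc_ends ⟨s(x, y), h⟩
  rcases ht.1.eq_or_lt with rfl | ht0
  · rw [h0]
    rcases Sym2.eq_iff.1 hab with ⟨rfl, rfl⟩ | ⟨rfl, rfl⟩ <;> simp
  rcases ht.2.eq_or_lt with rfl | ht1
  · rw [h1]
    rcases Sym2.eq_iff.1 hab with ⟨rfl, rfl⟩ | ⟨rfl, rfl⟩ <;> simp
  · exact Or.inl ⟨t, ⟨ht0, ht1⟩, rfl⟩

theorem Drawing.eq_of_vert_mem {V : Type*} {G : SimpleGraph V} (D : Drawing G) {x y v : V}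
    (h : G.Adj x y) (hv : D.vert v ∈ D.arc ⟨s(x, y), h⟩ '' Icc 0 1) : v = x ∨ v = y := by
  rcases D.eq_vert_of_mem h hv with ⟨t, ht, hz⟩ | hz | hz
  · rcases D.arc_avoid _ t ⟨ht.1.le, ht.2.le⟩ ⟨v, hz⟩ with rfl | rfl
    · exact absurd ht.1 (lt_irrefl _)
    · exact absurd ht.2 (lt_irrefl _)
  · exact Or.inl (D.vert_inj hz)
  · exact Or.inr (D.vert_inj hz)

section Subdivision

variable {V : Type*} {G : SimpleGraph V} {c : G.edgeSet → ℕ} {fst snd : G.edgeSet → V}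

theorem exists_drawing_of_subdivide (hfs : ∀ e : G.edgeSet, (e : Sym2 V) = s(fst e, snd e))
    (D' : Drawing (subdivideGraph G c fst snd)) (hfin : D'.CrossSet.Finite) :
    ∃ D : Drawing G, D.CrossSet.Finite ∧ D.CrossSet.ncard ≤ D'.CrossSet.ncard ∧
      ∀ e, D.arc e 0 = D.vert (fst e) ∧ D.arc e 1 = D.vert (snd e) := by
  classical
  set N := subNode c fst snd with hN
  have hadj : ∀ e k, k ≤ c e → (subdivideGraph G c fst snd).Adj (N e k) (N e (k + 1)) := fun e k hk => subNode_adj hfs e hk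
  set K : G.edgeSet → Set Plane := fun e =>
    {z | ∃ k, ∃ hk : k ≤ c e, z ∈ D'.arc ⟨s(N e k, N e (k + 1)), hadj e k hk⟩ '' Icc 0 1} with hK
  have step : ∀ e k, k ≤ c e → ArcIn (D'.vert (N e 0)) (D'.vert (N e (k + 1))) (K e) := by
    intro e k
    induction k with
    | zero => exact fun hk => (D'.arcIn (hadj e 0 hk)).mono fun z hz => ⟨0, hk, hz⟩
    | succ k ih =>
      intro hk
      refine ((ih (by omega)).trans (D'.arcIn (hadj e (k + 1) hk)) ?_).mono
        (union_subset le_rfl fun z hz => ⟨k + 1, hk, hz⟩)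
      intro h
      have := subNode_inj hfs (by omega) (by omega) (D'.vert_inj h)
      omega
  choose γ hγc hγi hγ0 hγ1 hγK using fun e => step e (c e) le_rfl
  have hz0 : ∀ e, N e 0 = Sum.inl (fst e) := subNode_zero
  have hz1 : ∀ e, N e (c e + 1) = Sum.inl (snd e) := subNode_last
  simp only [hz0, hz1] at hγ0 hγ1
  have hvert : ∀ e x, D'.vert x ∈ K e → ∃ k ≤ c e + 1, x = N e k := by
    rintro e x ⟨k, hk, hz⟩
    rcases D'.eq_of_vert_mem (hadj e k hk) hz with h | h
    · exact ⟨k, by omega, h⟩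
    · exact ⟨k + 1, by omega, h⟩
  have havoid : ∀ e, ∀ t ∈ Icc (0:ℝ) 1, ∀ v, γ e t = D'.vert (Sum.inl v) → t = 0 ∨ t = 1 := by
    intro e t ht v h
    obtain ⟨k, hk, hx⟩ := hvert e (Sum.inl v) (h ▸ hγK e t ht)
    rcases subNode_cases (c := c) (fst := fst) (snd := snd) e hk with
      ⟨-, h1⟩ | ⟨-, h1⟩ | ⟨i, -, h1⟩
    · rw [← hN, ← hx] at h1
      rw [h1, ← hγ0 e] at h
      exact Or.inl (hγi e ht (by simp) h)
    · rw [← hN, ← hx] at h1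
      rw [h1, ← hγ1 e] at h
      exact Or.inr (hγi e ht (by simp) h)
    · rw [← hN, ← hx] at h1
      cases h1
  let D : Drawing G :=
    { vert := fun v => D'.vert (Sum.inl v)
      vert_inj := fun a b h => Sum.inl_injective (D'.vert_inj h)
      arc := γ
      arc_cont := hγc
      arc_injOn := hγi
      arc_ends := fun e => ⟨fst e, snd e, hfs e, hγ0 e, hγ1 e⟩
      arc_avoid := fun e t ht ⟨v, hv⟩ => havoid e t ht v hv }
  have hslot : ∀ E : (subdivideGraph G c fst snd).edgeSet, ∃ e k, k ≤ c e ∧ (E : Sym2 _) = s(N e k, N e (k + 1)) := by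
    rintro ⟨E, hE⟩
    induction E using Sym2.ind with
    | h x y => exact exists_slot_of_adj hE
  choose owner oslot hos howner using hslot
  have hown : ∀ e k (hk : k ≤ c e), owner ⟨s(N e k, N e (k + 1)), hadj e k hk⟩ = e := by
    intro e k hk
    exact (subNode_slot hfs hk (hos _) (howner ⟨s(N e k, N e (k + 1)), hadj e k hk⟩)).1.symm
  have hinter : ∀ e f, e ≠ f → ∀ z, z ∈ D.interOf e → z ∈ D.interOf f → ∀ n, z ≠ D'.vert n := by
    rintro e f hef z ⟨t, ht, rfl⟩ ⟨t', ht', htt⟩ n hn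
    have ht2 := Ioo_subset_Icc_self ht
    have ht2' := Ioo_subset_Icc_self ht'
    obtain ⟨k, hk, hx⟩ := hvert e n (hn ▸ hγK e t ht2)
    obtain ⟨l, hl, hx'⟩ := hvert f n (hn ▸ htt ▸ hγK f t' ht2')
    have hnl : ∃ v, n = Sum.inl v := by
      rcases subNode_cases (c := c) (fst := fst) (snd := snd) e hk with
        ⟨-, h1⟩ | ⟨-, h1⟩ | ⟨i, -, h1⟩
      · exact ⟨_, hx.trans h1⟩
      · exact ⟨_, hx.trans h1⟩
      · rcases subNode_cases (c := c) (fst := fst) (snd := snd) f hl with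
          ⟨-, h2⟩ | ⟨-, h2⟩ | ⟨j, -, h2⟩
        · exact ⟨_, hx'.trans h2⟩
        · exact ⟨_, hx'.trans h2⟩
        · exact absurd (congrArg Sigma.fst (Sum.inr.inj ((hx.trans h1).symm.trans (hx'.trans h2))))
            hef
    obtain ⟨v, rfl⟩ := hnl
    rcases havoid e t ht2 v hn with rfl | rfl
    · exact lt_irrefl _ ht.1
    · exact lt_irrefl _ ht.2
  have hsub : D.CrossSet ⊆ (fun x => (x.1, Sym2.map owner x.2)) '' D'.CrossSet := by
    rintro ⟨z, q⟩ ⟨e, f, hef, rfl, hze, hzf⟩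
    have hn := hinter e f hef z hze hzf
    have lift : ∀ e, z ∈ D.interOf e → ∃ E, owner E = e ∧ z ∈ D'.interOf E := by
      rintro e ⟨t, ht, rfl⟩
      obtain ⟨k, hk, hz⟩ := hγK e t (Ioo_subset_Icc_self ht)
      refine ⟨_, hown e k hk, ?_⟩
      rcases D'.eq_vert_of_mem (hadj e k hk) hz with h | h | h
      · exact h
      · exact absurd h (hn _)
      · exact absurd h (hn _)
    obtain ⟨E, hE, hE'⟩ := lift e hze
    obtain ⟨F, hF, hF'⟩ := lift f hzf
    refine ⟨(z, s(E, F)), ⟨E, F, fun h => hef (by rw [← hE, ← hF, h]), rfl, hE', hF'⟩, ?_⟩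
    simp [hE, hF]
  exact ⟨D, (hfin.image _).subset hsub,
    (ncard_le_ncard hsub (hfin.image _)).trans (ncard_image_le hfin),
    fun e => ⟨hγ0 e, hγ1 e⟩⟩

end Subdivision

/-! ### Straight line drawings -/

theorem exists_straightDrawing {V : Type*} {G : SimpleGraph V} (q : V → Plane)
    (hq : Function.Injective q)
    (hav : ∀ x y v, G.Adj x y → q v ∉ openSegment ℝ (q x) (q y)) :
    ∃ D : Drawing G, D.IsRectilinear ∧ ∀ x y (h : G.Adj x y),
      D.interOf ⟨s(x, y), h⟩ = openSegment ℝ (q x) (q y) := by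
  have hout : ∀ e : G.edgeSet, (e : Sym2 V) = s((e : Sym2 V).out.1, (e : Sym2 V).out.2) :=
    fun e => (Quot.out_eq (e : Sym2 V)).symm
  have hadj : ∀ e : G.edgeSet, G.Adj (e : Sym2 V).out.1 (e : Sym2 V).out.2 := by
    intro e
    have := e.2
    rwa [hout e] at this
  let γ : G.edgeSet → ℝ → Plane := fun e t =>
    (1 - t) • q (e : Sym2 V).out.1 + t • q (e : Sym2 V).out.2
  have hinter : ∀ e, γ e '' Ioo 0 1 =
      openSegment ℝ (q (e : Sym2 V).out.1) (q (e : Sym2 V).out.2) :=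
    fun e => (openSegment_eq_image ℝ _ _).symm
  refine ⟨⟨q, hq, γ, fun e => ?_, fun e => ?_, fun e => ⟨_, _, hout e, ?_, ?_⟩,
    fun e t ht ⟨v, hv⟩ => ?_⟩, fun e t ht => ?_, fun x y h => ?_⟩
  · exact Continuous.continuousOn (by fun_prop)
  · intro s hs t ht hst
    have h1 : (s - t) • (q (e : Sym2 V).out.2 - q (e : Sym2 V).out.1) = 0 := by
      rw [← sub_eq_zero] at hst
      rw [← hst]
      simp only [γ]
      module
    rcases smul_eq_zero.1 h1 with h | h
    · linarith
    · exact absurd (hq (sub_eq_zero.1 h)).symm (hadj e).ne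
  · simp [γ]
  · simp [γ]
  · by_contra hne
    push Not at hne
    have h2 : q v ∈ γ e '' Ioo 0 1 :=
      ⟨t, ⟨lt_of_le_of_ne ht.1 (Ne.symm hne.1), lt_of_le_of_ne ht.2 hne.2⟩, hv⟩
    rw [hinter] at h2
    exact hav _ _ v (hadj e) h2
  · simp [γ]
  · change γ ⟨s(x, y), h⟩ '' Ioo 0 1 = _
    rw [hinter]
    have := hout ⟨s(x, y), h⟩
    rcases Sym2.eq_iff.1 this with ⟨h1, h2⟩ | ⟨h1, h2⟩
    · rw [← h1, ← h2]
    · rw [← h1, ← h2, openSegment_symm]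

/-! ### Points on a circle -/

/-- The square of the Euclidean length. -/
def nsq (z : Plane) : ℝ := z.1 ^ 2 + z.2 ^ 2

theorem nsq_nonneg (z : Plane) : 0 ≤ nsq z := by unfold nsq; positivity

theorem nsq_pos {z : Plane} (h : z ≠ 0) : 0 < nsq z := by
  refine lt_of_le_of_ne (nsq_nonneg z) fun h0 => h ?_
  unfold nsq at h0
  refine Prod.ext ?_ ?_ <;> simp only [Prod.fst_zero, Prod.snd_zero] <;> nlinarith

theorem nsq_smul (t : ℝ) (z : Plane) : nsq (t • z) = t ^ 2 * nsq z := by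
  simp only [nsq, Prod.smul_fst, Prod.smul_snd, smul_eq_mul]; ring

theorem nsq_sub_comm (x y : Plane) : nsq (x - y) = nsq (y - x) := by
  simp only [nsq, Prod.fst_sub, Prod.snd_sub]; ring

theorem nsq_sub_le (x y z : Plane) : nsq (x - y) ≤ 2 * (nsq (z - x) + nsq (z - y)) := by
  simp only [nsq, Prod.fst_sub, Prod.snd_sub]
  nlinarith [sq_nonneg (2 * z.1 - x.1 - y.1), sq_nonneg (2 * z.2 - x.2 - y.2)]

theorem continuous_nsq : Continuous nsq := by unfold nsq; fun_prop

/-- The unit vector in the direction from `u` to `v`. -/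
def unitDir (u v : Plane) : Plane := (√(nsq (v - u)))⁻¹ • (v - u)

theorem nsq_unitDir {u v : Plane} (h : u ≠ v) : nsq (unitDir u v) = 1 := by
  have := nsq_pos (sub_ne_zero.2 h.symm)
  rw [unitDir, nsq_smul, inv_pow, Real.sq_sqrt this.le, inv_mul_cancel₀ this.ne']

theorem unitDir_ne {w a b : Plane} (h : det3 w a b ≠ 0) : unitDir w a ≠ unitDir w b := by
  intro he
  have ha : w ≠ a := by rintro rfl; exact h (by simp only [det3]; ring)
  have hb : w ≠ b := by rintro rfl; exact h (by simp only [det3]; ring)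
  have pa := Real.sqrt_pos.2 (nsq_pos (sub_ne_zero.2 ha.symm))
  have pb := Real.sqrt_pos.2 (nsq_pos (sub_ne_zero.2 hb.symm))
  have h1 := congrArg Prod.fst he
  have h2 := congrArg Prod.snd he
  simp only [unitDir, Prod.smul_fst, Prod.smul_snd, Prod.fst_sub, Prod.snd_sub, smul_eq_mul] at h1 h2
  apply h
  have h3 : a.1 - w.1 = √(nsq (a - w)) * (√(nsq (b - w)))⁻¹ * (b.1 - w.1) := by
    rw [mul_assoc, ← h1, ← mul_assoc, mul_inv_cancel₀ pa.ne', one_mul]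
  have h4 : a.2 - w.2 = √(nsq (a - w)) * (√(nsq (b - w)))⁻¹ * (b.2 - w.2) := by
    rw [mul_assoc, ← h2, ← mul_assoc, mul_inv_cancel₀ pa.ne', one_mul]
  simp only [det3, h3, h4]; ring

theorem det3_circle_ne {a b c : Plane} (ha : nsq a = 1) (hb : nsq b = 1) (hc : nsq c = 1)
    (hab : a ≠ b) (hac : a ≠ c) (hbc : b ≠ c) : det3 a b c ≠ 0 := by
  intro h
  have h1 := nsq_pos (sub_ne_zero.2 hab)
  have h2 := nsq_pos (sub_ne_zero.2 hac)
  have h3 := nsq_pos (sub_ne_zero.2 hbc)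
  obtain ⟨a1, a2⟩ := a
  obtain ⟨b1, b2⟩ := b
  obtain ⟨c1, c2⟩ := c
  simp only [nsq, det3, Prod.fst_sub, Prod.snd_sub] at *
  set d := (b1 - a1) * (c1 - a1) + (b2 - a2) * (c2 - a2) with hd
  set r := (a1 - b1) ^ 2 + (a2 - b2) ^ 2 with hr
  set r' := (a1 - c1) ^ 2 + (a2 - c2) ^ 2 with hr'
  have k1 : d ^ 2 = r * r' := by
    rw [hd, hr, hr']
    linear_combination -((b1 - a1) * (c2 - a2) - (b2 - a2) * (c1 - a1)) * h
  have k2 : r * (c1 - a1) = d * (b1 - a1) := by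
    rw [hd, hr]; linear_combination -(b2 - a2) * h
  have k3 : r * (c2 - a2) = d * (b2 - a2) := by
    rw [hd, hr]; linear_combination (b1 - a1) * h
  have k4 : 2 * (a1 * (b1 - a1) + a2 * (b2 - a2)) = - r := by
    rw [hr]; linear_combination hb - ha
  have k5 : 2 * (a1 * (c1 - a1) + a2 * (c2 - a2)) = - r' := by
    rw [hr']; linear_combination hc - ha
  have k6 : r * (r' - d) = 0 := by
    linear_combination r * k5 - 2 * a1 * k2 - 2 * a2 * k3 - d * k4
  have k7 : r' = d := by
    rcases mul_eq_zero.1 k6 with h | h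
    · exact absurd h h1.ne'
    · linarith
  have k8 : d = r := by
    have : d * (d - r) = 0 := by rw [k7] at k1; linear_combination k1
    rcases mul_eq_zero.1 this with h | h
    · rw [← k7] at h; exact absurd h h2.ne'
    · linarith
  rw [k8] at k2 k3
  have m1 := mul_left_cancel₀ h1.ne' k2
  have m2 := mul_left_cancel₀ h1.ne' k3
  nlinarith

theorem nsq_combo_lt {a b : Plane} (ha : nsq a = 1) (hb : nsq b = 1) (hab : a ≠ b) {t : ℝ}
    (h0 : 0 < t) (h1 : t < 1) : nsq ((1 - t) • a + t • b) < 1 := by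
  have h2 := nsq_pos (sub_ne_zero.2 hab)
  have h3 := mul_pos (mul_pos h0 (sub_pos.2 h1)) h2
  simp only [nsq, Prod.fst_sub, Prod.snd_sub, Prod.fst_add, Prod.snd_add, Prod.smul_fst,
    Prod.smul_snd, smul_eq_mul] at *
  nlinarith

theorem det3_add_smul (w a b c : Plane) (δ : ℝ) :
    det3 (w + δ • a) (w + δ • b) (w + δ • c) = δ ^ 2 * det3 a b c := by
  simp only [det3, Prod.fst_add, Prod.snd_add, Prod.smul_fst, Prod.smul_snd, smul_eq_mul]; ring

theorem segCross_add_smul {w a b c d : Plane} {δ : ℝ} :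
    SegCross (w + δ • a) (w + δ • b) (w + δ • c) (w + δ • d) → SegCross a b c d := by
  simp only [SegCross, det3_add_smul]
  rintro ⟨h1, h2⟩
  constructor
  · by_contra h
    push Not at h
    nlinarith [mul_nonneg (sq_nonneg (δ ^ 2)) h]
  · by_contra h
    push Not at h
    nlinarith [mul_nonneg (sq_nonneg (δ ^ 2)) h]

theorem SegCross.not_swap {a b c d : Plane} (h : SegCross a b c d) : ¬ SegCross a d c b := by
  rintro ⟨h1, h2⟩
  obtain ⟨h3, h4⟩ := h
  have i1 : det3 a b c - det3 a b d + det3 a c d - det3 b c d = 0 := by simp only [det3]; ring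
  have i2 : det3 c d a = det3 a c d := by simp only [det3]; ring
  have i3 : det3 c d b = det3 b c d := by simp only [det3]; ring
  have i4 : det3 a d c = - det3 a c d := by simp only [det3]; ring
  have i5 : det3 a d b = - det3 a b d := by simp only [det3]; ring
  have i6 : det3 c b a = - det3 a b c := by simp only [det3]; ring
  have i7 : det3 c b d = - det3 b c d := by simp only [det3]; ring
  rw [i2, i3] at h4
  rw [i4, i5] at h1
  rw [i6, i7] at h2
  rcases lt_trichotomy (det3 a b c) 0 with h | h | h
  · have : 0 < det3 a b d := by nlinarith
    have : det3 a c d < 0 := by nlinarith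
    have : 0 < det3 b c d := by nlinarith
    linarith
  · rw [h] at h3; simp at h3
  · have : det3 a b d < 0 := by nlinarith
    have : 0 < det3 a c d := by nlinarith
    have : det3 b c d < 0 := by nlinarith
    linarith

theorem eq_of_mem_segments {a b c d z z' : Plane} (h : SegCross a b c d)
    (hz : z ∈ segment ℝ a b) (hz' : z' ∈ segment ℝ a b) (hw : z ∈ segment ℝ c d)
    (hw' : z' ∈ segment ℝ c d) : z = z' := by
  rw [segment_eq_image'] at hz hz' hw hw'
  obtain ⟨s, -, rfl⟩ := hz
  obtain ⟨s', -, rfl⟩ := hz'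
  obtain ⟨t, -, hw⟩ := hw
  obtain ⟨t', -, hw'⟩ := hw'
  have e1 := congrArg Prod.fst hw
  have e2 := congrArg Prod.snd hw
  have e3 := congrArg Prod.fst hw'
  have e4 := congrArg Prod.snd hw'
  simp only [Prod.fst_add, Prod.snd_add, Prod.smul_fst, Prod.smul_snd, smul_eq_mul,
    Prod.fst_sub, Prod.snd_sub] at e1 e2 e3 e4
  have hne : det3 a b c - det3 a b d ≠ 0 := by
    intro h0
    have := h.1
    rw [sub_eq_zero.1 h0] at this
    nlinarith [mul_self_nonneg (det3 a b d)]
  have : (s - s') * (det3 a b c - det3 a b d) = 0 := by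
    simp only [det3]
    linear_combination (d.2 - c.2) * (e1 - e3) - (d.1 - c.1) * (e2 - e4)
  rcases mul_eq_zero.1 this with h | h
  · rw [sub_eq_zero.1 h]
  · exact absurd h hne

/-! ### Bending at the nodes of a straight line drawing -/

/-- `δ` is so small that the discs of radius `δ` about the vertices are disjoint from each other
and from all nonincident edges. -/
structure SmallRadius {W : Type*} (H : SimpleGraph W) (p : W → Plane) (δ : ℝ) : Prop where
  pos : 0 < δ
  far : ∀ w w', w ≠ w' → 4 * δ ^ 2 < nsq (p w - p w')
  seg : ∀ a b w, H.Adj a b → w ≠ a → w ≠ b → ∀ z ∈ segment ℝ (p a) (p b), δ ^ 2 < nsq (z - p w)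

theorem det3_eq_zero_of_mem_segment {a b z : Plane} (h : z ∈ segment ℝ a b) : det3 a b z = 0 := by
  rw [segment_eq_image] at h
  obtain ⟨t, -, rfl⟩ := h
  simp only
  rw [det3_combo]
  simp only [det3]; ring

theorem IsSL.exists_smallRadius {W : Type*} [Finite W] {H : SimpleGraph W} {p : W → Plane}
    (hp : IsSL H p) : ∃ δ, SmallRadius H p δ := by
  have hsq : Tendsto (fun δ : ℝ => 4 * δ ^ 2) (𝓝[>] 0) (𝓝 0) := by
    have : Tendsto (fun δ : ℝ => 4 * δ ^ 2) (𝓝 0) (𝓝 (4 * 0 ^ 2)) :=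
      Continuous.tendsto (by fun_prop) 0
    simpa using this.mono_left nhdsWithin_le_nhds
  have h1 : ∀ᶠ δ : ℝ in 𝓝[>] 0, ∀ w w', w ≠ w' → 4 * δ ^ 2 < nsq (p w - p w') := by
    rw [eventually_all]; intro w
    rw [eventually_all]; intro w'
    by_cases h : w = w'
    · exact Eventually.of_forall fun _ h' => absurd h h'
    · filter_upwards [hsq.eventually (gt_mem_nhds (nsq_pos (sub_ne_zero.2 (hp.inj.ne h))))]
        with δ hδ _ using hδ
  have h2 : ∀ᶠ δ : ℝ in 𝓝[>] 0, ∀ a b w, H.Adj a b → w ≠ a → w ≠ b →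
      ∀ z ∈ segment ℝ (p a) (p b), 4 * δ ^ 2 < nsq (z - p w) := by
    rw [eventually_all]; intro a
    rw [eventually_all]; intro b
    rw [eventually_all]; intro w
    by_cases h : H.Adj a b ∧ w ≠ a ∧ w ≠ b
    · have hc : IsCompact (segment ℝ (p a) (p b)) := by
        rw [segment_eq_image]
        exact isCompact_Icc.image (by fun_prop)
      obtain ⟨z0, hz0, hmin⟩ := hc.exists_isMinOn ⟨p a, left_mem_segment ℝ _ _⟩
        (f := fun z => nsq (z - p w)) (continuous_nsq.comp (by fun_prop)).continuousOn
      have hz : z0 ≠ p w := by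
        rintro rfl
        exact hp.gen a b w h.1.ne h.2.1.symm h.2.2.symm (det3_eq_zero_of_mem_segment hz0)
      filter_upwards [hsq.eventually (gt_mem_nhds (nsq_pos (sub_ne_zero.2 hz)))]
        with δ hδ _ _ _ z hzm
      exact hδ.trans_le (hmin hzm)
    · exact Eventually.of_forall fun _ h1 h2 h3 => absurd ⟨h1, h2, h3⟩ h
  obtain ⟨δ, ⟨hδ1, hδ2⟩, hδ0⟩ := ((h1.and h2).and self_mem_nhdsWithin).exists
  exact ⟨δ, hδ0, hδ1, fun a b w h h1 h2 z hz => by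
    nlinarith [hδ2 a b w h h1 h2 z hz, sq_nonneg δ]⟩

section Bend

variable {W : Type*} {H : SimpleGraph W} {p : W → Plane} {δ : ℝ} {I : Set W}

open Classical in
/-- The point at distance `δ` from the vertex `w` on the edge towards `a`, or `w` itself if `w` is
one of the vertices in `I`. -/
def bend (p : W → Plane) (δ : ℝ) (I : Set W) (w a : W) : Plane :=
  if w ∈ I then p w else p w + δ • unitDir (p w) (p a)

theorem bend_of_mem {w : W} (h : w ∈ I) (a : W) : bend p δ I w a = p w := if_pos h

theorem bend_of_notMem {w : W} (h : w ∉ I) (a : W) :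
    bend p δ I w a = p w + δ • unitDir (p w) (p a) := if_neg h

theorem nsq_bend (hp : IsSL H p) {w a : W} (h : w ∉ I) (ha : w ≠ a) :
    nsq (bend p δ I w a - p w) = δ ^ 2 := by
  rw [bend_of_notMem h, add_sub_cancel_left, nsq_smul, nsq_unitDir (hp.inj.ne ha), mul_one]

theorem SmallRadius.bend_eq (hδ : SmallRadius H p δ) {a b : W} (hab : a ≠ b) :
    ∃ σ : ℝ, 0 ≤ σ ∧ σ < 1 / 2 ∧ bend p δ I a b = p a + σ • (p b - p a) ∧
      (a ∉ I → σ ^ 2 * nsq (p b - p a) = δ ^ 2) := by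
  by_cases h : a ∈ I
  · exact ⟨0, le_rfl, by norm_num, by simp [bend_of_mem h], fun h' => absurd h h'⟩
  · have h1 := hδ.far b a hab.symm
    have h0 : 0 < nsq (p b - p a) := lt_of_le_of_lt (by positivity) h1
    have hs := Real.sqrt_pos.2 h0
    have e : (δ * (√(nsq (p b - p a)))⁻¹) ^ 2 * nsq (p b - p a) = δ ^ 2 := by
      rw [mul_pow, inv_pow, Real.sq_sqrt h0.le, mul_assoc, inv_mul_cancel₀ h0.ne', mul_one]
    have hpos : 0 ≤ δ * (√(nsq (p b - p a)))⁻¹ := mul_nonneg hδ.pos.le (inv_nonneg.2 hs.le)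
    refine ⟨δ * (√(nsq (p b - p a)))⁻¹, hpos, ?_, ?_, fun _ => e⟩
    · by_contra hge
      push Not at hge
      have : (1 / 2 : ℝ) ^ 2 ≤ (δ * (√(nsq (p b - p a)))⁻¹) ^ 2 := by gcongr
      nlinarith
    · rw [bend_of_notMem h, unitDir, smul_smul]

theorem SmallRadius.slot_spec (hδ : SmallRadius H p δ) {a b : W} (hab : a ≠ b) {z : Plane}
    (hz : z ∈ openSegment ℝ (bend p δ I a b) (bend p δ I b a)) :
    z ∈ openSegment ℝ (p a) (p b) ∧ (a ∉ I → δ ^ 2 < nsq (z - p a)) ∧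
      (b ∉ I → δ ^ 2 < nsq (z - p b)) := by
  obtain ⟨σ, hσ0, hσ1, hσ, hσ'⟩ := hδ.bend_eq (I := I) hab
  obtain ⟨τ, hτ0, hτ1, hτ, hτ'⟩ := hδ.bend_eq (I := I) hab.symm
  have h0 : 0 < nsq (p b - p a) := lt_of_le_of_lt (by positivity) (hδ.far b a hab.symm)
  rw [openSegment_eq_image, hσ, hτ] at hz
  obtain ⟨t, ⟨ht0, ht1⟩, rfl⟩ := hz
  set l := (1 - t) * σ + t * (1 - τ) with hl
  have e : (1 - t) • (p a + σ • (p b - p a)) + t • (p b + τ • (p a - p b)) =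
      (1 - l) • p a + l • p b := by rw [hl]; module
  have l0 : σ < l := by nlinarith [mul_pos ht0 (by linarith : 0 < 1 - τ - σ)]
  have l1 : τ < 1 - l := by
    nlinarith [mul_pos (sub_pos.2 ht1) (by linarith : 0 < 1 - τ - σ)]
  simp only
  rw [e]
  refine ⟨?_, fun ha => ?_, fun hb => ?_⟩
  · rw [openSegment_eq_image]
    exact ⟨l, ⟨by linarith, by linarith⟩, rfl⟩
  · rw [show (1 - l) • p a + l • p b - p a = l • (p b - p a) by module, nsq_smul, ← hσ' ha]
    exact mul_lt_mul_of_pos_right (by nlinarith) h0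
  · rw [show (1 - l) • p a + l • p b - p b = (1 - l) • (p a - p b) by module, nsq_smul, ← hτ' hb]
    refine mul_lt_mul_of_pos_right (by nlinarith) ?_
    rwa [nsq_sub_comm]

/-- Points in the interior of a bent edge stay away from all the discs. -/
theorem SmallRadius.slot_far (hp : IsSL H p) (hδ : SmallRadius H p δ) {a b : W}
    (hab : H.Adj a b) {z : Plane}
    (hz : z ∈ openSegment ℝ (bend p δ I a b) (bend p δ I b a)) (w : W) :
    z ≠ p w ∧ (w ∉ I → δ ^ 2 < nsq (z - p w)) := by
  obtain ⟨h1, h2, h3⟩ := hδ.slot_spec hab.ne hz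
  by_cases ha : w = a
  · subst ha
    refine ⟨?_, h2⟩
    rintro rfl
    rw [left_mem_openSegment_iff] at h1
    exact hab.ne (hp.inj h1)
  by_cases hb : w = b
  · subst hb
    refine ⟨?_, h3⟩
    rintro rfl
    rw [right_mem_openSegment_iff] at h1
    exact hab.ne (hp.inj h1)
  have h4 := hδ.seg a b w hab ha hb z (openSegment_subset_segment ℝ _ _ h1)
  refine ⟨?_, fun _ => h4⟩
  rintro rfl
  rw [sub_self] at h4
  norm_num [nsq] at h4
  nlinarith [hδ.pos]

theorem slot_disjoint (hp : IsSL H p) (hδ : SmallRadius H p δ) {a b c d : W}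
    (hab : H.Adj a b) (hcd : H.Adj c d) (hne : s(a, b) ≠ s(c, d)) {z : Plane}
    (hz : z ∈ openSegment ℝ (bend p δ I a b) (bend p δ I b a))
    (hz' : z ∈ openSegment ℝ (bend p δ I c d) (bend p δ I d c)) : False := by
  have key : ∀ a b d, H.Adj a b → H.Adj a d → b ≠ d → z ∈ openSegment ℝ (p a) (p b) →
      z ∈ openSegment ℝ (p a) (p d) → False := by
    intro a b d hab had hbd h h'
    have hg := hp.gen a b d hab.ne had.ne hbd
    have e1 := det3_eq_zero_of_mem_segment (openSegment_subset_segment ℝ _ _ h)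
    rw [openSegment_eq_image] at h'
    obtain ⟨t, ht, rfl⟩ := h'
    simp only at e1
    rw [det3_combo] at e1
    rcases mul_eq_zero.1 (show t * det3 (p a) (p b) (p d) = 0 by
      rw [← e1]; simp only [det3]; ring) with h | h
    · exact ht.1.ne' h
    · exact hg h
  have h1 := (hδ.slot_spec hab.ne hz).1
  have h2 := (hδ.slot_spec hcd.ne hz').1
  by_cases hac : a = c
  · subst hac
    exact key a b d hab hcd (fun h => hne (by rw [h])) h1 h2
  by_cases had : a = d
  · subst had
    exact key a b c hab hcd.symm (fun h => hne (by rw [h, Sym2.eq_swap])) h1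
      (openSegment_symm ℝ (p c) (p a) ▸ h2)
  by_cases hbc : b = c
  · subst hbc
    exact key b a d hab.symm hcd (fun h => hne (by rw [h, Sym2.eq_swap]))
      (openSegment_symm ℝ (p a) (p b) ▸ h1) h2
  by_cases hbd : b = d
  · subst hbd
    exact key b a c hab.symm hcd.symm (fun h => hne (by rw [h]))
      (openSegment_symm ℝ (p a) (p b) ▸ h1) (openSegment_symm ℝ (p c) (p b) ▸ h2)
  exact Set.disjoint_left.1 (hp.disjoint hab hcd hac had hbc hbd)
    (openSegment_subset_segment ℝ _ _ h1) (openSegment_subset_segment ℝ _ _ h2)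

/-- Points in the interior of a chord lie inside the disc. -/
theorem chord_near (hp : IsSL H p) (hδ : SmallRadius H p δ) {w a b : W} (hw : w ∉ I)
    (ha : w ≠ a) (hb : w ≠ b) (hab : a ≠ b) {z : Plane}
    (hz : z ∈ openSegment ℝ (bend p δ I w a) (bend p δ I w b)) : nsq (z - p w) < δ ^ 2 := by
  rw [bend_of_notMem hw, bend_of_notMem hw, openSegment_eq_image] at hz
  obtain ⟨t, ht, rfl⟩ := hz
  have e : (1 - t) • (p w + δ • unitDir (p w) (p a)) + t • (p w + δ • unitDir (p w) (p b)) - p w =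
      δ • ((1 - t) • unitDir (p w) (p a) + t • unitDir (p w) (p b)) := by module
  simp only
  rw [e, nsq_smul]
  have := nsq_combo_lt (nsq_unitDir (hp.inj.ne ha)) (nsq_unitDir (hp.inj.ne hb))
    (unitDir_ne (hp.gen w a b ha hb hab)) ht.1 ht.2
  nlinarith [hδ.pos, mul_pos hδ.pos hδ.pos]

theorem SmallRadius.far_of_near (hδ : SmallRadius H p δ) {w w' : W} (h : w ≠ w') {z : Plane}
    (hz : nsq (z - p w) ≤ δ ^ 2) : δ ^ 2 < nsq (z - p w') := by
  have := nsq_sub_le (p w) (p w') z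
  linarith [hδ.far w w' h]

theorem chord_segCross (hp : IsSL H p) {w a b c d : W} (hδ : δ ≠ 0) (hw : w ∉ I)
    (ha : w ≠ a) (hb : w ≠ b) (hc : w ≠ c) (hd : w ≠ d) (hab : a ≠ b) (hac : a ≠ c) (had : a ≠ d)
    (hbc : b ≠ c) (hbd : b ≠ d) (hcd : c ≠ d) {z : Plane}
    (hz : z ∈ openSegment ℝ (bend p δ I w a) (bend p δ I w b))
    (hz' : z ∈ openSegment ℝ (bend p δ I w c) (bend p δ I w d)) :
    SegCross (bend p δ I w a) (bend p δ I w b) (bend p δ I w c) (bend p δ I w d) := by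
  have hne : ∀ x y u, w ≠ x → w ≠ y → w ≠ u → x ≠ y → x ≠ u → y ≠ u →
      det3 (bend p δ I w x) (bend p δ I w y) (bend p δ I w u) ≠ 0 := by
    intro x y u hx hy hu hxy hxu hyu
    rw [bend_of_notMem hw, bend_of_notMem hw, bend_of_notMem hw, det3_add_smul]
    exact mul_ne_zero (pow_ne_zero 2 hδ) (det3_circle_ne (nsq_unitDir (hp.inj.ne hx))
      (nsq_unitDir (hp.inj.ne hy)) (nsq_unitDir (hp.inj.ne hu))
      (unitDir_ne (hp.gen w x y hx hy hxy)) (unitDir_ne (hp.gen w x u hx hu hxu))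
      (unitDir_ne (hp.gen w y u hy hu hyu)))
  replace hz := openSegment_subset_segment ℝ _ _ hz
  replace hz' := openSegment_subset_segment ℝ _ _ hz'
  exact ⟨det3_mul_neg_of_mem hz hz' (hne a b c ha hb hc hab hac hbc)
    (hne a b d ha hb hd hab had hbd),
    det3_mul_neg_of_mem hz' hz (hne c d a hc hd ha hcd hac.symm had.symm)
    (hne c d b hc hd hb hcd hbc.symm hbd.symm)⟩

end Bend

/-! ### Systems of paths and the drawings they induce -/

/-- A system of paths (one for each edge of `G`) in a graph `H` containing the vertices of `G`;
no edge of `H` is used twice and only the endpoints of the paths are vertices of `G`. -/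
structure PathSystem {V W : Type*} (G : SimpleGraph V) (H : SimpleGraph W) (ι : V → W)
    (fst snd : G.edgeSet → V) where
  len : G.edgeSet → ℕ
  node : G.edgeSet → ℕ → W
  len_pos : ∀ e, 0 < len e
  node_zero : ∀ e, node e 0 = ι (fst e)
  node_len : ∀ e, node e (len e) = ι (snd e)
  node_inner : ∀ e k, 0 < k → k < len e → node e k ∉ range ι
  adj : ∀ e k, k < len e → H.Adj (node e k) (node e (k + 1))
  slot : ∀ e f k l, k < len e → l < len f →
    s(node e k, node e (k + 1)) = s(node f l, node f (l + 1)) → e = f ∧ k = l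

namespace PathSystem

variable {V W : Type*} {G : SimpleGraph V} {H : SimpleGraph W} {ι : V → W}
  {fst snd : G.edgeSet → V} (S : PathSystem G H ι fst snd)

/-- The passages of a system of paths: inner positions on the paths. -/
def IsPass (a : G.edgeSet × ℕ) : Prop := 0 < a.2 ∧ a.2 < S.len a.1

/-- The node at a position. -/
def loc (a : G.edgeSet × ℕ) : W := S.node a.1 a.2

/-- Two passages through the same node cross there, given that the nodes are placed by `p`. -/
def Crosses (p : W → Plane) (a b : G.edgeSet × ℕ) : Prop :=
  SegCross (unitDir (p (S.loc a)) (p (S.node a.1 (a.2 - 1))))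
    (unitDir (p (S.loc a)) (p (S.node a.1 (a.2 + 1))))
    (unitDir (p (S.loc a)) (p (S.node b.1 (b.2 - 1))))
    (unitDir (p (S.loc a)) (p (S.node b.1 (b.2 + 1))))

/-- The pairs of passages through a common node. -/
def meets : Set (Sym2 (G.edgeSet × ℕ)) :=
  {q | ∃ a b, a ≠ b ∧ S.IsPass a ∧ S.IsPass b ∧ S.loc a = S.loc b ∧ q = s(a, b)}

/-- The pairs of passages that cross at a common node. -/
def crossings (p : W → Plane) : Set (Sym2 (G.edgeSet × ℕ)) :=
  {q | ∃ a b, a ≠ b ∧ S.IsPass a ∧ S.IsPass b ∧ S.loc a = S.loc b ∧ S.Crosses p a b ∧ q = s(a, b)}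

theorem crossings_subset (p : W → Plane) : S.crossings p ⊆ S.meets := by
  rintro q ⟨a, b, h1, h2, h3, h4, -, h5⟩
  exact ⟨a, b, h1, h2, h3, h4, h5⟩

theorem finite_meets [Finite G.edgeSet] : S.meets.Finite := by
  have h1 : {a | S.IsPass a}.Finite := by
    refine (finite_range fun x : Σ e : G.edgeSet, Fin (S.len e) => (x.1, (x.2 : ℕ))).subset ?_
    rintro ⟨e, k⟩ h
    exact ⟨⟨e, ⟨k, h.2⟩⟩, rfl⟩
  refine ((h1.prod h1).image fun x => s(x.1, x.2)).subset ?_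
  rintro q ⟨a, b, -, ha, hb, -, rfl⟩
  exact ⟨(a, b), ⟨ha, hb⟩, rfl⟩

/-- The oriented edge of `H` that carries a bend. -/
def dart (e : G.edgeSet) (j : ℕ) : W × W :=
  if j % 2 = 0 then (S.node e (j / 2), S.node e (j / 2 + 1))
  else (S.node e (j / 2 + 1), S.node e (j / 2))

theorem dart_even (e : G.edgeSet) (i : ℕ) :
    S.dart e (2 * i) = (S.node e i, S.node e (i + 1)) := by
  rw [dart, if_pos (by omega), show 2 * i / 2 = i by omega]

theorem dart_odd (e : G.edgeSet) (i : ℕ) :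
    S.dart e (2 * i + 1) = (S.node e (i + 1), S.node e i) := by
  rw [dart, if_neg (by omega), show (2 * i + 1) / 2 = i by omega]

theorem dart_ne {e : G.edgeSet} {j : ℕ} (hj : j < 2 * S.len e) :
    (S.dart e j).1 ≠ (S.dart e j).2 := by
  have := (S.adj e (j / 2) (by omega)).ne
  rw [dart]
  split_ifs
  · exact this
  · exact this.symm

theorem dart_inj {e f : G.edgeSet} {j l : ℕ} (hj : j < 2 * S.len e) (hl : l < 2 * S.len f)
    (h : S.dart e j = S.dart f l) : e = f ∧ j = l := by
  have hs : ∀ (e : G.edgeSet) (j : ℕ), s((S.dart e j).1, (S.dart e j).2) =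
      s(S.node e (j / 2), S.node e (j / 2 + 1)) := by
    intro e j
    rw [dart]
    split_ifs
    · rfl
    · exact Sym2.eq_swap
  obtain ⟨rfl, h2⟩ := S.slot e f (j / 2) (l / 2) (by omega) (by omega)
    (by rw [← hs, ← hs, h])
  refine ⟨rfl, ?_⟩
  have hne := (S.adj e (j / 2) (by omega)).ne
  rw [dart, dart, ← h2] at h
  split_ifs at h with h3 h4 h4
  · omega
  · exact absurd (congrArg Prod.fst h) hne
  · exact absurd (congrArg Prod.fst h).symm hne
  · omega

/-- The bends along the path of an edge, including its endpoints. -/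
def bendAt (p : W → Plane) (δ : ℝ) (e : G.edgeSet) (j : ℕ) : Plane :=
  bend p δ (range ι) (S.dart e j).1 (S.dart e j).2

theorem mem_piece_cases {p : W → Plane} {δ : ℝ} {e : G.edgeSet} {j : ℕ}
    (hj : j ≤ 2 * (S.len e - 1)) {z : Plane}
    (hz : z ∈ openSegment ℝ (S.bendAt p δ e j) (S.bendAt p δ e (j + 1))) :
    (∃ i, j = 2 * i ∧ i < S.len e ∧
      z ∈ openSegment ℝ (bend p δ (range ι) (S.node e i) (S.node e (i + 1)))
        (bend p δ (range ι) (S.node e (i + 1)) (S.node e i))) ∨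
    ∃ k, j + 1 = 2 * k ∧ S.IsPass (e, k) ∧
      z ∈ openSegment ℝ (bend p δ (range ι) (S.node e k) (S.node e (k - 1)))
        (bend p δ (range ι) (S.node e k) (S.node e (k + 1))) := by
  have hl := S.len_pos e
  rcases Nat.even_or_odd' j with ⟨i, rfl | rfl⟩
  · refine Or.inl ⟨i, rfl, by omega, ?_⟩
    rwa [bendAt, bendAt, dart_even, dart_odd] at hz
  · refine Or.inr ⟨i + 1, by omega, ⟨by simp, by simp only; omega⟩, ?_⟩
    rwa [bendAt, bendAt, dart_odd, show 2 * i + 1 + 1 = 2 * (i + 1) by omega, dart_even] at hz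

theorem pass_ne (a : G.edgeSet × ℕ) (ha : S.IsPass a) :
    S.loc a ∉ range ι ∧ S.loc a ≠ S.node a.1 (a.2 - 1) ∧ S.loc a ≠ S.node a.1 (a.2 + 1) ∧
      S.node a.1 (a.2 - 1) ≠ S.node a.1 (a.2 + 1) := by
  obtain ⟨e, k⟩ := a
  obtain ⟨h0, h1⟩ := ha
  simp only [loc] at *
  obtain ⟨k, rfl⟩ := Nat.exists_eq_succ_of_ne_zero h0.ne'
  have h2 := S.adj e k (by omega)
  have h3 := S.adj e (k + 1) h1
  refine ⟨S.node_inner e _ h0 h1, h2.ne.symm, h3.ne, fun h => ?_⟩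
  have := (S.slot e e k (k + 1) (by omega) h1 (by
    simp only [Nat.succ_eq_add_one, add_tsub_cancel_right] at h
    rw [← h, Sym2.eq_swap])).2
  omega

theorem pass_nodes_ne {a b : G.edgeSet × ℕ} (hab : a ≠ b) (ha : S.IsPass a) (hb : S.IsPass b)
    (hl : S.loc a = S.loc b) :
    S.node a.1 (a.2 - 1) ≠ S.node b.1 (b.2 - 1) ∧ S.node a.1 (a.2 - 1) ≠ S.node b.1 (b.2 + 1) ∧
    S.node a.1 (a.2 + 1) ≠ S.node b.1 (b.2 - 1) ∧ S.node a.1 (a.2 + 1) ≠ S.node b.1 (b.2 + 1) := by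
  obtain ⟨e, k⟩ := a
  obtain ⟨f, l⟩ := b
  obtain ⟨hk0, hk1⟩ := ha
  obtain ⟨hl0, hl1⟩ := hb
  simp only [loc] at *
  obtain ⟨k, rfl⟩ := Nat.exists_eq_succ_of_ne_zero hk0.ne'
  obtain ⟨l, rfl⟩ := Nat.exists_eq_succ_of_ne_zero hl0.ne'
  simp only [Nat.succ_eq_add_one, add_tsub_cancel_right] at *
  refine ⟨fun h => ?_, fun h => ?_, fun h => ?_, fun h => ?_⟩
  · obtain ⟨rfl, h2⟩ := S.slot e f k l (by omega) (by omega) (by rw [h, hl])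
    exact hab (by rw [h2])
  · obtain ⟨rfl, h2⟩ := S.slot e f k (l + 1) (by omega) (by omega) (by rw [h, hl, Sym2.eq_swap])
    subst h2
    exact (S.adj e (l + 1) (by omega)).ne hl.symm
  · obtain ⟨rfl, h2⟩ := S.slot e f (k + 1) l (by omega) (by omega) (by rw [h, hl, Sym2.eq_swap])
    subst h2
    exact (S.adj e (k + 1) (by omega)).ne hl
  · obtain ⟨rfl, h2⟩ := S.slot e f (k + 1) (l + 1) (by omega) (by omega) (by rw [h, hl])
    exact hab (by rw [h2])

theorem exists_rectilinear [Finite V] [Finite W] (hι : Function.Injective ι)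
    (hfs : ∀ e : G.edgeSet, (e : Sym2 V) = s(fst e, snd e)) {p : W → Plane} (hp : IsSL H p) :
    ∃ D : Drawing (subdivideGraph G (fun e => 2 * (S.len e - 1)) fst snd),
      D.IsRectilinear ∧ D.CrossSet.Finite ∧ D.CrossSet.ncard ≤ (S.crossings p).ncard := by
  classical
  obtain ⟨δ, hδ⟩ := hp.exists_smallRadius
  have hX : (S.crossings p).Finite := S.finite_meets.subset (S.crossings_subset p)
  let c : G.edgeSet → ℕ := fun e => 2 * (S.len e - 1)
  let N := subNode c fst snd
  let I := range ι
  let q : (V ⊕ Σ e : G.edgeSet, Fin (c e)) → Plane :=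
    Sum.elim (fun v => p (ι v)) fun x => S.bendAt p δ x.1 (x.2 + 1)
  have hlen := S.len_pos
  have hqN : ∀ e j, j ≤ c e + 1 → q (N e j) = S.bendAt p δ e j := by
    intro e j hj
    have := hlen e
    rcases subNode_cases (c := c) (fst := fst) (snd := snd) e hj with
      ⟨h0, h1⟩ | ⟨h0, h1⟩ | ⟨i, h0, h1⟩
    · change q (subNode c fst snd e j) = _
      rw [h1, h0, bendAt, show (0 : ℕ) = 2 * 0 by rfl, dart_even, bend_of_mem]
      · rw [S.node_zero]; rfl
      · exact ⟨_, (S.node_zero e).symm⟩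
    · change q (subNode c fst snd e j) = _
      have h2 : j = 2 * (S.len e - 1) + 1 := h0
      have h3 : S.len e - 1 + 1 = S.len e := by omega
      rw [h1, h2, bendAt, dart_odd, h3, bend_of_mem]
      · rw [S.node_len]; rfl
      · exact ⟨_, (S.node_len e).symm⟩
    · change q (subNode c fst snd e j) = _
      rw [h1, h0]; rfl
  have hdart : ∀ (e : G.edgeSet) (i : Fin (c e)), (i : ℕ) + 1 < 2 * S.len e ∧
      (S.dart e (i + 1)).1 ∉ I := by
    intro e i
    have hi : (i : ℕ) < 2 * (S.len e - 1) := i.2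
    refine ⟨by omega, ?_⟩
    rcases Nat.even_or_odd' ((i : ℕ) + 1) with ⟨k, hk | hk⟩
    · rw [hk, dart_even]
      exact S.node_inner e k (by omega) (by omega)
    · rw [hk, dart_odd]
      exact S.node_inner e (k + 1) (by omega) (by omega)
  have hbendsq : ∀ (e : G.edgeSet) (i : Fin (c e)),
      nsq (q (Sum.inr ⟨e, i⟩) - p (S.dart e (i + 1)).1) = δ ^ 2 := by
    intro e i
    exact nsq_bend hp (hdart e i).2 (S.dart_ne (hdart e i).1)
  have hnsq0 : ∀ w, nsq (p w - p w) = 0 := by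
    intro w
    rw [sub_self]
    norm_num [nsq]
  have hδ2 : 0 < δ ^ 2 := pow_pos hδ.pos 2
  have hqinj : Function.Injective q := by
    have mixed : ∀ v (x : Σ e : G.edgeSet, Fin (c e)), q (Sum.inl v) ≠ q (Sum.inr x) := by
      rintro v ⟨e, i⟩ h
      have h1 := hbendsq e i
      rw [← h] at h1
      have h2 : (S.dart e (i + 1)).1 ≠ ι v := fun h => (hdart e i).2 ⟨v, h.symm⟩
      have h3 := hδ.far_of_near h2 h1.le
      change δ ^ 2 < nsq (p (ι v) - p (ι v)) at h3
      rw [hnsq0] at h3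
      linarith
    rintro (v | ⟨e, i⟩) (v' | ⟨e', i'⟩) h
    · exact congrArg _ (hι (hp.inj h))
    · exact absurd h (mixed _ _)
    · exact absurd h.symm (mixed _ _)
    · have h1 := hbendsq e i
      have h1' := hbendsq e' i'
      have hw : (S.dart e (i + 1)).1 = (S.dart e' (i' + 1)).1 := by
        by_contra hne
        have := hδ.far_of_near hne (z := q (Sum.inr ⟨e, i⟩)) h1.le
        rw [h] at this
        linarith
      have hx : (S.dart e (i + 1)).2 = (S.dart e' (i' + 1)).2 := by
        by_contra hne
        have d1 := S.dart_ne (hdart e i).1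
        have d2 := S.dart_ne (hdart e' i').1
        rw [← hw] at d2
        refine unitDir_ne (hp.gen _ _ _ d1 d2 hne) ?_
        change bend p δ I _ _ = bend p δ I _ _ at h
        rw [bend_of_notMem (hdart e i).2, bend_of_notMem (hdart e' i').2, ← hw] at h
        exact smul_right_injective _ hδ.pos.ne' (add_left_cancel h)
      obtain ⟨rfl, h3⟩ := S.dart_inj (hdart e i).1 (hdart e' i').1 (Prod.ext hw hx)
      have h4 : i = i' := Fin.ext (by omega)
      rw [h4]
  have hnear : ∀ e k z, S.IsPass (e, k) →
      z ∈ openSegment ℝ (bend p δ I (S.node e k) (S.node e (k - 1)))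
        (bend p δ I (S.node e k) (S.node e (k + 1))) → nsq (z - p (S.node e k)) < δ ^ 2 := by
    intro e k z hk hz
    obtain ⟨h1, h2, h3, h4⟩ := S.pass_ne (e, k) hk
    exact chord_near hp hδ h1 h2 h3 h4 hz
  have hav : ∀ e j v, j ≤ c e → q v ∉ openSegment ℝ (q (N e j)) (q (N e (j + 1))) := by
    intro e j v hj hz
    rw [hqN e j (by omega), hqN e (j + 1) (by omega)] at hz
    rcases S.mem_piece_cases hj hz with ⟨i, -, hi, hz⟩ | ⟨k, -, hk, hz⟩
    · have hfar := hδ.slot_far hp (S.adj e i hi) hz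
      rcases v with v | ⟨f, m⟩
      · exact (hfar (ι v)).1 rfl
      · exact ((hfar _).2 (hdart f m).2).ne' (hbendsq f m)
    · have hn := hnear e k _ hk hz
      rcases v with v | ⟨f, m⟩
      · have hne : S.node e k ≠ ι v := fun h => (S.pass_ne (e, k) hk).1 ⟨v, h.symm⟩
        have h3 := hδ.far_of_near hne hn.le
        change δ ^ 2 < nsq (p (ι v) - p (ι v)) at h3
        rw [hnsq0] at h3
        linarith
      · by_cases hw : S.node e k = (S.dart f (m + 1)).1
        · rw [hw, hbendsq] at hn
          exact lt_irrefl _ hn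
        · exact (hδ.far_of_near hw hn.le).ne' (hbendsq f m)
  obtain ⟨D, hD, hDint⟩ := exists_straightDrawing (G := subdivideGraph G c fst snd) q hqinj (by
    intro x y v hxy
    obtain ⟨e, j, hj, h⟩ := exists_slot_of_adj hxy
    rcases Sym2.eq_iff.1 h with ⟨rfl, rfl⟩ | ⟨rfl, rfl⟩
    · exact hav e j v hj
    · rw [openSegment_symm]
      exact hav e j v hj)
  have hslot : ∀ E : (subdivideGraph G c fst snd).edgeSet, ∃ e j, j ≤ c e ∧
      (E : Sym2 _) = s(N e j, N e (j + 1)) := by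
    rintro ⟨E, hE⟩
    induction E using Sym2.ind with
    | h x y => exact exists_slot_of_adj hE
  choose owner oslot hos howner using hslot
  have hpiece : ∀ E, D.interOf E =
      openSegment ℝ (S.bendAt p δ (owner E) (oslot E)) (S.bendAt p δ (owner E) (oslot E + 1)) := by
    intro E
    have h1 := hos E
    have h2 : E = ⟨s(N (owner E) (oslot E), N (owner E) (oslot E + 1)),
        subNode_adj hfs (owner E) h1⟩ := Subtype.ext (howner E)
    rw [← hqN _ _ (by omega), ← hqN _ _ (by omega), ← hDint _ _ (subNode_adj hfs (owner E) h1),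
      ← h2]
  let π : (subdivideGraph G c fst snd).edgeSet → G.edgeSet × ℕ :=
    fun E => (owner E, (oslot E + 1) / 2)
  have hEF : ∀ E F, owner E = owner F → oslot E = oslot F → E = F := by
    intro E F h1 h2
    exact Subtype.ext (by rw [howner E, howner F, h1, h2])
  have main : ∀ E F z, E ≠ F → z ∈ D.interOf E → z ∈ D.interOf F →
      Odd (oslot E) ∧ Odd (oslot F) ∧ π E ≠ π F ∧ S.IsPass (π E) ∧ S.IsPass (π F) ∧
      S.loc (π E) = S.loc (π F) ∧ S.Crosses p (π E) (π F) ∧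
      ∀ z', z' ∈ D.interOf E → z' ∈ D.interOf F → z = z' := by
    intro E F z hne hE hF
    have hE0 := hE
    have hF0 := hF
    rw [hpiece] at hE hF
    rcases S.mem_piece_cases (hos E) hE with ⟨i, hi, hi', hzE⟩ | ⟨k, hk, hk', hzE⟩
    · exfalso
      rcases S.mem_piece_cases (hos F) hF with ⟨i2, hi2, hi2', hzF⟩ | ⟨l, hl, hl', hzF⟩
      · refine slot_disjoint hp hδ (S.adj _ i hi') (S.adj _ i2 hi2') (fun h => ?_) hzE hzF
        obtain ⟨h1, h2⟩ := S.slot _ _ _ _ hi' hi2' h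
        exact hne (hEF E F h1 (by omega))
      · have h1 := hnear _ _ _ hl' hzF
        have h2 := (hδ.slot_far hp (S.adj _ i hi') hzE (S.node (owner F) l)).2
          (S.pass_ne _ hl').1
        linarith
    · rcases S.mem_piece_cases (hos F) hF with ⟨i2, hi2, hi2', hzF⟩ | ⟨l, hl, hl', hzF⟩
      · have h1 := hnear _ _ _ hk' hzE
        have h2 := (hδ.slot_far hp (S.adj _ i2 hi2') hzF (S.node (owner E) k)).2
          (S.pass_ne _ hk').1
        linarith
      · have eE : π E = (owner E, k) := by simp only [π, Prod.mk.injEq, true_and]; omega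
        have eF : π F = (owner F, l) := by simp only [π, Prod.mk.injEq, true_and]; omega
        have hpp : ((owner E, k) : G.edgeSet × ℕ) ≠ (owner F, l) := by
          intro h
          obtain ⟨h1, h2⟩ := Prod.mk.inj h
          exact hne (hEF E F h1 (by omega))
        have hw : S.loc (owner E, k) = S.loc (owner F, l) := by
          by_contra h
          have h1 := hnear _ _ _ hk' hzE
          have h2 := hnear _ _ _ hl' hzF
          have := hδ.far_of_near h h1.le
          exact lt_asymm this h2
        obtain ⟨w0, w1, w2, w3⟩ := S.pass_ne _ hk'
        obtain ⟨u0, u1, u2, u3⟩ := S.pass_ne _ hl'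
        obtain ⟨v1, v2, v3, v4⟩ := S.pass_nodes_ne hpp hk' hl' hw
        have hwn : S.node (owner E) k = S.node (owner F) l := hw
        rw [← hwn] at hzF
        rw [← hw] at u1 u2
        have hsc := chord_segCross hp hδ.pos.ne' w0 w1 w2 u1 u2 w3 v1 v2 v3 v4 u3 hzE hzF
        refine ⟨⟨k - 1, by have := hk'.1; simp only at this; omega⟩,
          ⟨l - 1, by have := hl'.1; simp only at this; omega⟩, ?_, ?_, ?_, ?_, ?_, ?_⟩
        · rwa [eE, eF]
        · rwa [eE]
        · rwa [eF]
        · rwa [eE, eF]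
        · rw [eE, eF]
          have w0' : S.node (owner E) k ∉ range ι := w0
          have hsc2 := hsc
          simp only [loc] at hsc2
          rw [bend_of_notMem w0', bend_of_notMem w0', bend_of_notMem w0', bend_of_notMem w0']
            at hsc2
          exact segCross_add_smul hsc2
        · intro z' hz' hz''
          have dE : D.interOf E = openSegment ℝ (bend p δ I (S.node (owner E) k)
              (S.node (owner E) (k - 1))) (bend p δ I (S.node (owner E) k)
              (S.node (owner E) (k + 1))) := by
            obtain ⟨m, rfl⟩ : ∃ m, k = m + 1 := ⟨k - 1, by have := hk'.1; simp only at this; omega⟩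
            rw [hpiece, show oslot E = 2 * m + 1 by omega, bendAt, bendAt, dart_odd,
              show 2 * m + 1 + 1 = 2 * (m + 1) by omega, dart_even]
            rfl
          have dF : D.interOf F = openSegment ℝ (bend p δ I (S.node (owner F) l)
              (S.node (owner F) (l - 1))) (bend p δ I (S.node (owner F) l)
              (S.node (owner F) (l + 1))) := by
            obtain ⟨m, rfl⟩ : ∃ m, l = m + 1 := ⟨l - 1, by have := hl'.1; simp only at this; omega⟩
            rw [hpiece, show oslot F = 2 * m + 1 by omega, bendAt, bendAt, dart_odd,
              show 2 * m + 1 + 1 = 2 * (m + 1) by omega, dart_even]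
            rfl
          rw [dE] at hz' hE0
          rw [dF, ← hwn] at hz'' hF0
          exact eq_of_mem_segments hsc (openSegment_subset_segment ℝ _ _ hE0)
            (openSegment_subset_segment ℝ _ _ hz') (openSegment_subset_segment ℝ _ _ hF0)
            (openSegment_subset_segment ℝ _ _ hz'')
  have hmaps : MapsTo (fun x : Plane × Sym2 (subdivideGraph G c fst snd).edgeSet =>
      Sym2.map π x.2) D.CrossSet (S.crossings p) := by
    rintro ⟨z, r⟩ ⟨E, F, hne, hr, hE, hF⟩
    simp only at hr hE hF
    subst hr
    obtain ⟨-, -, h1, h2, h3, h4, h5, -⟩ := main E F z hne hE hF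
    exact ⟨π E, π F, h1, h2, h3, h4, h5, rfl⟩
  have hinj : InjOn (fun x : Plane × Sym2 (subdivideGraph G c fst snd).edgeSet =>
      Sym2.map π x.2) D.CrossSet := by
    rintro ⟨z, r⟩ ⟨E, F, hne, hr, hE, hF⟩ ⟨z', r'⟩ ⟨E', F', hne', hr', hE', hF'⟩ h
    simp only at hr hE hF hr' hE' hF' h
    subst hr hr'
    obtain ⟨o1, o2, -, -, -, -, -, hu⟩ := main E F z hne hE hF
    obtain ⟨o3, o4, -⟩ := main E' F' z' hne' hE' hF'
    have hπ : ∀ A B, Odd (oslot A) → Odd (oslot B) → π A = π B → A = B := by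
      intro A B ⟨m, hm⟩ ⟨n, hn⟩ h
      obtain ⟨h1, h2⟩ := Prod.mk.inj h
      exact hEF A B h1 (by omega)
    simp only [Sym2.map_mk] at h
    rcases Sym2.eq_iff.1 h with ⟨h1, h2⟩ | ⟨h1, h2⟩
    · obtain rfl := hπ _ _ o1 o3 h1
      obtain rfl := hπ _ _ o2 o4 h2
      rw [hu z' hE' hF']
    · obtain rfl := hπ _ _ o1 o4 h1
      obtain rfl := hπ _ _ o2 o3 h2
      rw [hu z' hF' hE', Sym2.eq_swap]
  exact ⟨D, hD, Finite.of_injOn hmaps hinj hX, ncard_le_ncard_of_injOn _ hmaps hinj hX⟩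

end PathSystem

/-! ### Planarizing a drawing -/

/-- Finitely many marked parameters on each edge of a drawing, including all the crossings; no
other edge passes through two consecutive marked points. -/
structure Marking {V : Type*} {G : SimpleGraph V} (D : Drawing G) where
  len : G.edgeSet → ℕ
  time : G.edgeSet → ℕ → ℝ
  len_pos : ∀ e, 0 < len e
  time_zero : ∀ e, time e 0 = 0
  time_len : ∀ e, time e (len e) = 1
  time_lt : ∀ e k l, k < l → l ≤ len e → time e k < time e l
  cross : ∀ e f, e ≠ f → ∀ s ∈ Ioo (0:ℝ) 1, D.arc e s ∈ D.interOf f →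
    ∃ k ≤ len e, time e k = s
  consec : ∀ e f k, e ≠ f → k < len e → D.arc e (time e k) ∈ D.arc f '' Icc 0 1 →
    D.arc e (time e (k + 1)) ∉ D.arc f '' Icc 0 1

namespace Marking

variable {V : Type*} {G : SimpleGraph V} {D : Drawing G} (M : Marking D)

theorem time_mem (e : G.edgeSet) {k : ℕ} (hk : k ≤ M.len e) : M.time e k ∈ Icc (0:ℝ) 1 := by
  constructor
  · rcases Nat.eq_zero_or_pos k with rfl | h
    · rw [M.time_zero]
    · rw [← M.time_zero e]; exact (M.time_lt e 0 k h hk).le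
  · rcases hk.eq_or_lt with rfl | h
    · rw [M.time_len]
    · rw [← M.time_len e]; exact (M.time_lt e k _ h le_rfl).le

theorem time_mem_Ioo (e : G.edgeSet) {k : ℕ} (h0 : 0 < k) (hk : k < M.len e) :
    M.time e k ∈ Ioo (0:ℝ) 1 := by
  constructor
  · rw [← M.time_zero e]; exact M.time_lt e 0 k h0 hk.le
  · rw [← M.time_len e]; exact M.time_lt e k _ hk le_rfl

theorem arc_time_inj (e : G.edgeSet) {k l : ℕ} (hk : k ≤ M.len e) (hl : l ≤ M.len e)
    (h : D.arc e (M.time e k) = D.arc e (M.time e l)) : k = l := by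
  have := D.arc_injOn e (M.time_mem e hk) (M.time_mem e hl) h
  rcases lt_trichotomy k l with h1 | h1 | h1
  · exact absurd this (M.time_lt e k l h1 hl).ne
  · exact h1
  · exact absurd this (M.time_lt e l k h1 hk).ne'

theorem exists_time_of_common {e f : G.edgeSet} (hef : e ≠ f) {s t : ℝ} (hs : s ∈ Icc (0:ℝ) 1)
    (ht : t ∈ Icc (0:ℝ) 1) (h : D.arc e s = D.arc f t) : ∃ k ≤ M.len e, M.time e k = s := by
  rcases hs.1.eq_or_lt with rfl | hs0
  · exact ⟨0, by omega, M.time_zero e⟩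
  rcases hs.2.eq_or_lt with rfl | hs1
  · exact ⟨_, le_rfl, M.time_len e⟩
  refine M.cross e f hef s ⟨hs0, hs1⟩ ⟨t, ⟨?_, ?_⟩, h.symm⟩
  · refine lt_of_le_of_ne ht.1 ?_
    rintro rfl
    obtain ⟨x, y, -, h0, -⟩ := D.arc_ends f
    rcases D.arc_avoid e s hs ⟨x, h.trans h0⟩ with rfl | rfl
    · exact lt_irrefl _ hs0
    · exact lt_irrefl _ hs1
  · refine lt_of_le_of_ne ht.2 ?_
    rintro rfl
    obtain ⟨x, y, -, -, h0⟩ := D.arc_ends f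
    rcases D.arc_avoid e s hs ⟨y, h.trans h0⟩ with rfl | rfl
    · exact lt_irrefl _ hs0
    · exact lt_irrefl _ hs1

theorem eq_end_of_time_mem {e : G.edgeSet} {k i : ℕ} (hk : k < M.len e) (hi : i ≤ M.len e)
    (h : M.time e i ∈ Icc (M.time e k) (M.time e (k + 1))) : i = k ∨ i = k + 1 := by
  rcases lt_trichotomy i k with h1 | h1 | h1
  · exact absurd h.1 (M.time_lt e i k h1 hk.le).not_ge
  · exact Or.inl h1
  · rcases Nat.lt_or_ge (k + 1) i with h2 | h2
    · exact absurd h.2 (M.time_lt e _ i h2 hi).not_ge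
    · right; omega

/-- The marked points and the vertices. -/
def nodes : Set Plane := range D.vert ∪ ⋃ e, D.arc e '' (M.time e '' Iic (M.len e))

theorem finite_nodes [Finite V] : M.nodes.Finite :=
  (finite_range _).union (finite_iUnion fun _ => ((finite_Iic _).image _).image _)

/-- The marked points along an edge. -/
def nodeAt (e : G.edgeSet) (k : ℕ) : M.nodes :=
  ⟨D.arc e (M.time e (min k (M.len e))), Or.inr (mem_iUnion.2 ⟨e, _, ⟨_, mem_Iic.2 (min_le_right _ _),
    rfl⟩, rfl⟩)⟩

theorem nodeAt_val (e : G.edgeSet) {k : ℕ} (hk : k ≤ M.len e) :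
    (M.nodeAt e k : Plane) = D.arc e (M.time e k) := by
  change D.arc e (M.time e (min k (M.len e))) = _
  rw [min_eq_left hk]

theorem nodeAt_inj (e : G.edgeSet) {k l : ℕ} (hk : k ≤ M.len e) (hl : l ≤ M.len e)
    (h : M.nodeAt e k = M.nodeAt e l) : k = l := by
  refine M.arc_time_inj e hk hl ?_
  rw [← M.nodeAt_val e hk, ← M.nodeAt_val e hl, h]

/-- The planarization of a drawing. -/
def graph : SimpleGraph M.nodes where
  Adj a b := ∃ e k, k < M.len e ∧ s(a, b) = s(M.nodeAt e k, M.nodeAt e (k + 1))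
  symm := ⟨fun a b ⟨e, k, hk, h⟩ => ⟨e, k, hk, by rw [Sym2.eq_swap, h]⟩⟩
  loopless := ⟨by
    rintro a ⟨e, k, hk, h⟩
    have h1 : M.nodeAt e k = M.nodeAt e (k + 1) := by
      rcases Sym2.eq_iff.1 h with ⟨h1, h2⟩ | ⟨h1, h2⟩
      · rw [← h1, ← h2]
      · rw [← h1, ← h2]
    have := M.nodeAt_inj e hk.le hk h1
    omega⟩

/-- The vertices as nodes of the planarization. -/
def incl (v : V) : M.nodes := ⟨D.vert v, Or.inl ⟨v, rfl⟩⟩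

theorem incl_injective : Function.Injective M.incl :=
  fun _ _ h => D.vert_inj (congrArg Subtype.val h)

theorem slot_inj {e f : G.edgeSet} {k l : ℕ} (hk : k < M.len e) (hl : l < M.len f)
    (h : s(M.nodeAt e k, M.nodeAt e (k + 1)) = s(M.nodeAt f l, M.nodeAt f (l + 1))) :
    e = f ∧ k = l := by
  have hef : e = f := by
    by_contra hne
    have hm : ∀ x, x ∈ s(M.nodeAt e k, M.nodeAt e (k + 1)) → (x : Plane) ∈ D.arc f '' Icc 0 1 := by
      intro x hx
      rw [h, Sym2.mem_iff] at hx
      rcases hx with rfl | rfl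
      · exact ⟨_, M.time_mem f hl.le, (M.nodeAt_val f hl.le).symm⟩
      · exact ⟨_, M.time_mem f hl, (M.nodeAt_val f hl).symm⟩
    refine M.consec e f k hne hk ?_ ?_
    · rw [← M.nodeAt_val e hk.le]; exact hm _ (Sym2.mem_mk_left _ _)
    · rw [← M.nodeAt_val e hk]; exact hm _ (Sym2.mem_mk_right _ _)
  subst hef
  refine ⟨rfl, ?_⟩
  rcases Sym2.eq_iff.1 h with ⟨h1, -⟩ | ⟨h1, h2⟩
  · exact M.nodeAt_inj e hk.le hl.le h1
  · have := M.nodeAt_inj e hk.le hl h1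
    have := M.nodeAt_inj e hk hl.le h2
    omega

/-- The edges of the graph as paths in the planarization. -/
def system {fst snd : G.edgeSet → V}
    (hD : ∀ e, D.arc e 0 = D.vert (fst e) ∧ D.arc e 1 = D.vert (snd e)) :
    PathSystem G M.graph M.incl fst snd where
  len := M.len
  node := M.nodeAt
  len_pos := M.len_pos
  node_zero e := Subtype.ext (by
    rw [M.nodeAt_val e (Nat.zero_le _), M.time_zero, (hD e).1]; rfl)
  node_len e := Subtype.ext (by rw [M.nodeAt_val e le_rfl, M.time_len, (hD e).2]; rfl)
  node_inner := by
    rintro e k h0 h1 ⟨v, hv⟩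
    have h2 := M.time_mem_Ioo e h0 h1
    have h3 := congrArg Subtype.val hv
    rw [M.nodeAt_val e h1.le] at h3
    rcases D.arc_avoid e _ (Ioo_subset_Icc_self h2) ⟨v, h3.symm⟩ with h | h
    · exact h2.1.ne' h
    · exact h2.2.ne h
  adj e k hk := ⟨e, k, hk, rfl⟩
  slot _ _ _ _ hk hl h := M.slot_inj hk hl h

theorem ht_graph [Finite V] : HT M.graph := by
  classical
  have hex : ∀ a b : M.nodes, ∃ γ : ℝ → Plane, M.graph.Adj a b →
      ContinuousOn γ (Icc 0 1) ∧ γ 0 = a ∧ γ 1 = b ∧ ∃ e k, k < M.len e ∧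
      s(a, b) = s(M.nodeAt e k, M.nodeAt e (k + 1)) ∧
      ∀ s ∈ Icc (0:ℝ) 1, γ s ∈ D.arc e '' Icc (M.time e k) (M.time e (k + 1)) := by
    intro a b
    by_cases h : M.graph.Adj a b
    swap
    · exact ⟨0, fun h' => absurd h' h⟩
    obtain ⟨e, k, hk, h⟩ := h
    have hlt := M.time_lt e k (k + 1) (by omega) hk
    have hm0 := M.time_mem e hk.le
    have hm1 := M.time_mem e hk
    have hm : ∀ s ∈ Icc (0:ℝ) 1, (1 - s) * M.time e k + s * M.time e (k + 1) ∈
        Icc (M.time e k) (M.time e (k + 1)) := fun s hs =>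
      ⟨by nlinarith [mul_nonneg hs.1 (sub_nonneg.2 hlt.le)],
        by nlinarith [mul_nonneg (sub_nonneg.2 hs.2) (sub_nonneg.2 hlt.le)]⟩
    have hsub : Icc (M.time e k) (M.time e (k + 1)) ⊆ Icc 0 1 := Icc_subset_Icc hm0.1 hm1.2
    have hc : ContinuousOn (fun s => D.arc e ((1 - s) * M.time e k + s * M.time e (k + 1)))
        (Icc 0 1) := (D.arc_cont e).comp (by fun_prop) fun s hs => hsub (hm s hs)
    have hr : ∀ s ∈ Icc (0:ℝ) 1, 1 - s ∈ Icc (0:ℝ) 1 := fun s hs =>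
      ⟨by linarith [hs.2], by linarith [hs.1]⟩
    rcases Sym2.eq_iff.1 h with ⟨rfl, rfl⟩ | ⟨rfl, rfl⟩
    · refine ⟨_, fun _ => ⟨hc, ?_, ?_, e, k, hk, h, fun s hs => ⟨_, hm s hs, rfl⟩⟩⟩
      · rw [M.nodeAt_val e hk.le]; simp
      · rw [M.nodeAt_val e hk]; simp
    · refine ⟨fun s => D.arc e ((1 - (1 - s)) * M.time e k + (1 - s) * M.time e (k + 1)),
        fun _ => ⟨hc.comp (f := fun s : ℝ => 1 - s) (by fun_prop) hr, ?_, ?_, e, k, hk, h,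
          fun s hs => ⟨_, hm _ (hr s hs), rfl⟩⟩⟩
      · rw [M.nodeAt_val e hk]; simp
      · rw [M.nodeAt_val e hk.le]; simp
  choose γ hγ using hex
  have : Finite M.nodes := M.finite_nodes
  refine HT.of_arcs Subtype.val γ (fun a b h => ⟨(hγ a b h).1, (hγ a b h).2.1, (hγ a b h).2.2.1⟩) ?_
  intro a b c d hab hcd hac had hbc hbd s hs t ht hst
  obtain ⟨-, -, -, e, k, hk, hs1, hs2⟩ := hγ a b hab
  obtain ⟨-, -, -, f, l, hl, ht1, ht2⟩ := hγ c d hcd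
  obtain ⟨s', hs', hs3⟩ := hs2 s hs
  obtain ⟨t', ht', ht3⟩ := ht2 t ht
  have hz : D.arc e s' = D.arc f t' := by rw [hs3, ht3, hst]
  have hse : s' ∈ Icc (0:ℝ) 1 := Icc_subset_Icc (M.time_mem e hk.le).1 (M.time_mem e hk).2 hs'
  have hte : t' ∈ Icc (0:ℝ) 1 := Icc_subset_Icc (M.time_mem f hl.le).1 (M.time_mem f hl).2 ht'
  have hdis : ∀ x, x ∈ s(a, b) → x ∉ s(c, d) := by
    intro x hx hx'
    rw [Sym2.mem_iff] at hx hx'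
    rcases hx with rfl | rfl <;> rcases hx' with rfl | rfl <;> contradiction
  rw [hs1, ht1] at hdis
  by_cases hef : e = f
  · subst hef
    obtain rfl := D.arc_injOn e hse hte hz
    rcases lt_trichotomy k l with h | h | h
    · have h1 : M.time e (k + 1) ≤ M.time e l := by
        rcases Nat.lt_or_ge (k + 1) l with h2 | h2
        · exact (M.time_lt e _ _ h2 hl.le).le
        · rw [show k + 1 = l by omega]
      have h2 := M.arc_time_inj e hk hl.le (by
        rw [le_antisymm h1 (ht'.1.trans hs'.2)])
      exact hdis _ (Sym2.mem_mk_right _ _) (h2 ▸ Sym2.mem_mk_left _ _)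
    · exact hdis _ (Sym2.mem_mk_left _ _) (h ▸ Sym2.mem_mk_left _ _)
    · have h1 : M.time e (l + 1) ≤ M.time e k := by
        rcases Nat.lt_or_ge (l + 1) k with h2 | h2
        · exact (M.time_lt e _ _ h2 hk.le).le
        · rw [show l + 1 = k by omega]
      have h2 := M.arc_time_inj e hl hk.le (by
        rw [le_antisymm h1 (hs'.1.trans ht'.2)])
      exact hdis _ (Sym2.mem_mk_left _ _) (h2 ▸ Sym2.mem_mk_right _ _)
  · obtain ⟨i, hi, rfl⟩ := M.exists_time_of_common hef hse hte hz
    obtain ⟨j, hj, rfl⟩ := M.exists_time_of_common (Ne.symm hef) hte hse hz.symm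
    have hij : M.nodeAt e i = M.nodeAt f j := Subtype.ext (by
      rw [M.nodeAt_val e hi, M.nodeAt_val f hj, hz])
    have h1 : M.nodeAt e i ∈ s(M.nodeAt e k, M.nodeAt e (k + 1)) := by
      rcases M.eq_end_of_time_mem hk hi hs' with rfl | rfl
      · exact Sym2.mem_mk_left _ _
      · exact Sym2.mem_mk_right _ _
    have h2 : M.nodeAt f j ∈ s(M.nodeAt f l, M.nodeAt f (l + 1)) := by
      rcases M.eq_end_of_time_mem hl hj ht' with rfl | rfl
      · exact Sym2.mem_mk_left _ _
      · exact Sym2.mem_mk_right _ _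
    exact hdis _ h1 (hij ▸ h2)

theorem ncard_meets_le (hfin : D.CrossSet.Finite) {fst snd : G.edgeSet → V}
    (hD : ∀ e, D.arc e 0 = D.vert (fst e) ∧ D.arc e 1 = D.vert (snd e)) :
    (M.system hD).meets.ncard ≤ D.CrossSet.ncard := by
  classical
  have hidx : ∀ e (z : Plane), ∃ k, ∀ l ≤ M.len e, D.arc e (M.time e l) = z → k = l := by
    intro e z
    by_cases h : ∃ k ≤ M.len e, D.arc e (M.time e k) = z
    · obtain ⟨k, hk, rfl⟩ := h
      exact ⟨k, fun l hl h => M.arc_time_inj e hk hl h.symm⟩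
    · exact ⟨0, fun l hl h' => absurd ⟨l, hl, h'⟩ h⟩
  choose idx hidx using hidx
  have hsub : (M.system hD).meets ⊆
      (fun x : Plane × Sym2 G.edgeSet => Sym2.map (fun e => (e, idx e x.1)) x.2) '' D.CrossSet := by
    rintro q ⟨⟨e, k⟩, ⟨f, l⟩, hne, ha, hb, hl, rfl⟩
    have hk' : k < M.len e := ha.2
    have hl' : l < M.len f := hb.2
    have hz : D.arc e (M.time e k) = D.arc f (M.time f l) := by
      rw [← M.nodeAt_val e hk'.le, ← M.nodeAt_val f hl'.le]
      exact congrArg Subtype.val hl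
    have hef : e ≠ f := by
      rintro rfl
      exact hne (by rw [M.arc_time_inj e hk'.le hl'.le hz])
    refine ⟨(D.arc e (M.time e k), s(e, f)), ⟨e, f, hef, rfl,
      ⟨_, M.time_mem_Ioo e ha.1 hk', rfl⟩, ⟨_, M.time_mem_Ioo f hb.1 hl', hz.symm⟩⟩, ?_⟩
    simp only [Sym2.map_mk]
    rw [hidx e _ k hk'.le rfl, hidx f _ l hl'.le hz.symm]
  exact (ncard_le_ncard hsub (hfin.image _)).trans (ncard_image_le hfin)

end Marking

/-! ### Exchanging subpaths -/

namespace PathSystem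

variable {V W : Type*} {G : SimpleGraph V} {H : SimpleGraph W} {ι : V → W}
  {fst snd : G.edgeSet → V} (S : PathSystem G H ι fst snd)

/-- The paths of `e` and `f` share the node at positions `i` and `j` and a later inner node at
positions `i + d` and `j + d'`. -/
structure Twice (e f : G.edgeSet) (i d j d' : ℕ) : Prop where
  ne : e ≠ f
  pos : 0 < d
  pos' : 0 < d'
  lt : i + d < S.len e
  lt' : j + d' < S.len f
  first : S.node e i = S.node f j
  second : S.node e (i + d) = S.node f (j + d')

variable {S} {e f : G.edgeSet} {i d j d' : ℕ}

theorem Twice.symm (h : S.Twice e f i d j d') : S.Twice f e j d' i d :=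
  ⟨h.ne.symm, h.pos', h.pos, h.lt', h.lt, h.first.symm, h.second.symm⟩

theorem Twice.eq_zero (h : S.Twice e f i d j d') (hj : j = 0) : i = 0 := by
  by_contra hi
  refine S.node_inner e i (Nat.pos_of_ne_zero hi) (by have := h.lt; omega) ⟨fst f, ?_⟩
  rw [h.first, hj, S.node_zero]

/-- Follow `e` up to position `i`, then `f` from position `j` for `d'` steps, and then `e` from
position `i + d` on. -/
def detour (e f : G.edgeSet) (i d j d' k : ℕ) : G.edgeSet × ℕ :=
  if k < i then (e, k) else if k < i + d' then (f, j + (k - i)) else (e, i + d + (k - i - d'))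

theorem detour_of_lt {k : ℕ} (h : k < i) : detour e f i d j d' k = (e, k) := if_pos h

theorem detour_of_mid {k : ℕ} (h : i ≤ k) (h' : k < i + d') :
    detour e f i d j d' k = (f, j + (k - i)) := by
  rw [detour, if_neg (by omega), if_pos h']

theorem detour_of_ge {k : ℕ} (h : i + d' ≤ k) :
    detour e f i d j d' k = (e, i + d + (k - i - d')) := by
  rw [detour, if_neg (by omega), if_neg (by omega)]

theorem Twice.loc_detour_succ (h : S.Twice e f i d j d') (k : ℕ) :
    S.loc (detour e f i d j d' (k + 1)) =
      S.node (detour e f i d j d' k).1 ((detour e f i d j d' k).2 + 1) := by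
  have h1 := h.pos'
  rcases lt_or_ge k i with hk | hk
  · rw [detour_of_lt hk]
    rcases Nat.lt_or_ge (k + 1) i with hk' | hk'
    · rw [detour_of_lt hk']; rfl
    · obtain rfl : i = k + 1 := by omega
      rw [detour_of_mid le_rfl (by omega)]
      simp only [loc, Nat.sub_self, Nat.add_zero]
      exact h.first.symm
  rcases lt_or_ge k (i + d') with hk2 | hk2
  · rw [detour_of_mid hk hk2]
    rcases Nat.lt_or_ge (k + 1) (i + d') with hk' | hk'
    · rw [detour_of_mid (by omega) hk']
      simp only [loc]
      congr 1
      omega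
    · rw [detour_of_ge hk']
      simp only [loc]
      rw [show i + d + (k + 1 - i - d') = i + d by omega, h.second]
      congr 1
      omega
  · rw [detour_of_ge hk2, detour_of_ge (by omega)]
    simp only [loc]
    congr 1
    omega

theorem Twice.detour_isPass (h : S.Twice e f i d j d') {k : ℕ} (h0 : 0 < k)
    (hk : k < S.len e - d + d') : S.IsPass (detour e f i d j d' k) := by
  have := h.lt
  have := h.lt'
  have := h.pos
  rcases lt_or_ge k i with hk1 | hk1
  · rw [detour_of_lt hk1]; exact ⟨h0, by simp only; omega⟩
  rcases lt_or_ge k (i + d') with hk2 | hk2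
  · rw [detour_of_mid hk1 hk2]
    refine ⟨?_, by simp only; omega⟩
    by_contra h2
    simp only [not_lt] at h2
    have := h.eq_zero (by omega)
    omega
  · rw [detour_of_ge hk2]
    exact ⟨by simp only; omega, by simp only; omega⟩

theorem Twice.detour_lt (h : S.Twice e f i d j d') {k : ℕ}
    (hk : k < S.len e - d + d') :
    (detour e f i d j d' k).2 < S.len (detour e f i d j d' k).1 := by
  rcases Nat.eq_zero_or_pos k with rfl | h0
  · have := h.lt
    have := h.lt'
    have := h.pos'
    rcases Nat.eq_zero_or_pos i with rfl | hi
    · rw [detour_of_mid le_rfl (by omega)]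
      simp only
      omega
    · rw [detour_of_lt hi]
      simp only
      omega
  · exact (h.detour_isPass h0 hk).2

theorem Twice.loc_detour_zero (h : S.Twice e f i d j d') :
    S.loc (detour e f i d j d' 0) = S.node e 0 := by
  rcases Nat.eq_zero_or_pos i with rfl | hi
  · rw [detour_of_mid le_rfl (by have := h.pos'; omega)]
    exact h.first.symm
  · rw [detour_of_lt hi]; rfl

theorem Twice.loc_detour_len (h : S.Twice e f i d j d') :
    S.loc (detour e f i d j d' (S.len e - d + d')) = S.node e (S.len e) := by
  have := h.lt
  rw [detour_of_ge (by omega)]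
  simp only [loc]
  congr 1
  omega

open Classical in
/-- Exchange the parts of the paths of `e` and `f` between two common nodes. -/
def exchange (e f : G.edgeSet) (i d j d' : ℕ) (a : G.edgeSet × ℕ) : G.edgeSet × ℕ :=
  if a.1 = e then detour e f i d j d' a.2
  else if a.1 = f then detour f e j d' i d a.2 else a

theorem exchange_left (k : ℕ) : exchange e f i d j d' (e, k) = detour e f i d j d' k := if_pos rfl

theorem exchange_right (hef : e ≠ f) (k : ℕ) :
    exchange e f i d j d' (f, k) = detour f e j d' i d k := by
  rw [exchange, if_neg hef.symm, if_pos rfl]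

theorem exchange_of_ne {g : G.edgeSet} (he : g ≠ e) (hf : g ≠ f) (k : ℕ) :
    exchange e f i d j d' (g, k) = (g, k) := by
  rw [exchange, if_neg he, if_neg hf]

theorem exchange_detour (hef : e ≠ f) (k : ℕ) :
    exchange e f i d' j d (detour e f i d j d' k) = (e, k) := by
  rcases lt_or_ge k i with hk1 | hk1
  · rw [detour_of_lt hk1, exchange_left, detour_of_lt hk1]
  rcases lt_or_ge k (i + d') with hk2 | hk2
  · rw [detour_of_mid hk1 hk2, exchange_right hef, detour_of_mid (by omega) (by omega)]
    congr 1
    omega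
  · rw [detour_of_ge hk2, exchange_left, detour_of_ge (by omega)]
    congr 1
    omega

theorem exchange_comm (hef : e ≠ f) (a : G.edgeSet × ℕ) :
    exchange e f i d j d' a = exchange f e j d' i d a := by
  obtain ⟨g, k⟩ := a
  by_cases he : g = e
  · subst he; rw [exchange_left, exchange_right hef.symm]
  by_cases hf : g = f
  · subst hf; rw [exchange_left, exchange_right hef]
  rw [exchange_of_ne he hf, exchange_of_ne hf he]

theorem exchange_exchange (hef : e ≠ f) (a : G.edgeSet × ℕ) :
    exchange e f i d' j d (exchange e f i d j d' a) = a := by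
  obtain ⟨g, k⟩ := a
  by_cases he : g = e
  · subst he; rw [exchange_left, exchange_detour hef]
  by_cases hf : g = f
  · subst hf; rw [exchange_right hef, exchange_comm hef, exchange_detour hef.symm]
  rw [exchange_of_ne he hf, exchange_of_ne he hf]

open Classical in
/-- The lengths of the paths after exchanging parts of the paths of `e` and `f`. -/
def exchangeLen (S : PathSystem G H ι fst snd) (e f : G.edgeSet) (d d' : ℕ) (g : G.edgeSet) : ℕ :=
  if g = e then S.len e - d + d' else if g = f then S.len f - d' + d else S.len g

theorem exchangeLen_left : S.exchangeLen e f d d' e = S.len e - d + d' := if_pos rfl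

theorem exchangeLen_right (hef : e ≠ f) : S.exchangeLen e f d d' f = S.len f - d' + d := by
  rw [exchangeLen, if_neg hef.symm, if_pos rfl]

theorem exchangeLen_of_ne {g : G.edgeSet} (he : g ≠ e) (hf : g ≠ f) :
    S.exchangeLen e f d d' g = S.len g := by
  rw [exchangeLen, if_neg he, if_neg hf]

theorem Twice.loc_exchange_succ (h : S.Twice e f i d j d') (g : G.edgeSet) (k : ℕ) :
    S.loc (exchange e f i d j d' (g, k + 1)) =
      S.node (exchange e f i d j d' (g, k)).1 ((exchange e f i d j d' (g, k)).2 + 1) := by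
  by_cases he : g = e
  · subst he; simp only [exchange_left]; exact h.loc_detour_succ k
  by_cases hf : g = f
  · subst hf; simp only [exchange_right h.ne]; exact h.symm.loc_detour_succ k
  simp only [exchange_of_ne he hf]
  rfl

theorem Twice.exchange_isPass (h : S.Twice e f i d j d') (g : G.edgeSet) {k : ℕ} (h0 : 0 < k)
    (hk : k < S.exchangeLen e f d d' g) : S.IsPass (exchange e f i d j d' (g, k)) := by
  by_cases he : g = e
  · subst he; rw [exchangeLen_left] at hk; rw [exchange_left]; exact h.detour_isPass h0 hk
  by_cases hf : g = f
  · subst hf; rw [exchangeLen_right h.ne] at hk; rw [exchange_right h.ne]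
    exact h.symm.detour_isPass h0 hk
  rw [exchangeLen_of_ne he hf] at hk
  rw [exchange_of_ne he hf]
  exact ⟨h0, hk⟩

theorem Twice.exchange_lt (h : S.Twice e f i d j d') (g : G.edgeSet) {k : ℕ}
    (hk : k < S.exchangeLen e f d d' g) :
    (exchange e f i d j d' (g, k)).2 < S.len (exchange e f i d j d' (g, k)).1 := by
  by_cases he : g = e
  · subst he; rw [exchangeLen_left] at hk; rw [exchange_left]; exact h.detour_lt hk
  by_cases hf : g = f
  · subst hf; rw [exchangeLen_right h.ne] at hk; rw [exchange_right h.ne]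
    exact h.symm.detour_lt hk
  rw [exchangeLen_of_ne he hf] at hk
  rwa [exchange_of_ne he hf]

/-- The system obtained by exchanging the parts of two paths between two common nodes. -/
def Twice.exchanged (h : S.Twice e f i d j d') : PathSystem G H ι fst snd where
  len := S.exchangeLen e f d d'
  node g k := S.loc (exchange e f i d j d' (g, k))
  len_pos g := by
    have := h.pos
    have := h.pos'
    have := S.len_pos g
    rw [exchangeLen]
    split_ifs <;> omega
  node_zero g := by
    by_cases he : g = e
    · subst he; rw [exchange_left, h.loc_detour_zero, S.node_zero]
    by_cases hf : g = f
    · subst hf; rw [exchange_right h.ne, h.symm.loc_detour_zero, S.node_zero]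
    rw [exchange_of_ne he hf]
    exact S.node_zero g
  node_len g := by
    by_cases he : g = e
    · subst he; rw [exchangeLen_left, exchange_left, h.loc_detour_len, S.node_len]
    by_cases hf : g = f
    · subst hf; rw [exchangeLen_right h.ne, exchange_right h.ne, h.symm.loc_detour_len, S.node_len]
    rw [exchangeLen_of_ne he hf, exchange_of_ne he hf]
    exact S.node_len g
  node_inner g k h0 hk :=
    have := h.exchange_isPass g h0 hk
    S.node_inner _ _ this.1 this.2
  adj g k hk := by
    rw [h.loc_exchange_succ]
    exact S.adj _ _ (h.exchange_lt g hk)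
  slot g g' k l hk hl heq := by
    rw [h.loc_exchange_succ, h.loc_exchange_succ] at heq
    obtain ⟨h1, h2⟩ := S.slot _ _ _ _ (h.exchange_lt g hk) (h.exchange_lt g' hl) heq
    have := congrArg (exchange e f i d' j d) (Prod.ext h1 h2)
    rw [exchange_exchange h.ne, exchange_exchange h.ne] at this
    exact ⟨congrArg Prod.fst this, congrArg Prod.snd this⟩

theorem Twice.ncard_meets_exchanged_le [Finite G.edgeSet] (h : S.Twice e f i d j d') :
    h.exchanged.meets.ncard ≤ S.meets.ncard := by
  have hinj : Function.Injective (exchange e f i d j d') :=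
    Function.LeftInverse.injective (exchange_exchange h.ne)
  refine ncard_le_ncard_of_injOn (Sym2.map (exchange e f i d j d')) ?_
    (Sym2.map.injective hinj).injOn S.finite_meets
  rintro q ⟨⟨g, k⟩, ⟨g', l⟩, hne, ha, hb, hl, rfl⟩
  exact ⟨_, _, hinj.ne hne, h.exchange_isPass g ha.1 ha.2, h.exchange_isPass g' hb.1 hb.2, hl, rfl⟩

variable (S) in
theorem Crosses.symm {p : W → Plane} {a b : G.edgeSet × ℕ} (hl : S.loc a = S.loc b)
    (h : S.Crosses p a b) : S.Crosses p b a := by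
  rw [Crosses, hl] at h
  exact SegCross.symm h

variable (S) in
theorem ncard_crossings_lt [Finite G.edgeSet] {p : W → Plane} {a b : G.edgeSet × ℕ} (hab : a ≠ b)
    (ha : S.IsPass a) (hb : S.IsPass b) (hl : S.loc a = S.loc b) (h : ¬S.Crosses p a b) :
    (S.crossings p).ncard < S.meets.ncard := by
  refine ncard_lt_ncard ⟨S.crossings_subset p, fun hsub => ?_⟩ S.finite_meets
  obtain ⟨a', b', -, -, -, hl', hc, hq⟩ := hsub ⟨a, b, hab, ha, hb, hl, rfl⟩
  rcases Sym2.eq_iff.1 hq with ⟨rfl, rfl⟩ | ⟨rfl, rfl⟩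
  · exact h hc
  · exact h (hc.symm S hl')

/-- If two paths meet twice, a crossing can be saved. -/
theorem Twice.exists_ncard_crossings_lt [Finite G.edgeSet] (h : S.Twice e f i d j d')
    (p : W → Plane) :
    ∃ S' : PathSystem G H ι fst snd, (S'.crossings p).ncard < S.meets.ncard := by
  have h1 := h.pos
  have h2 := h.pos'
  have h3 := h.lt
  have h4 := h.lt'
  have hne : ∀ k l : ℕ, (e, k) ≠ (f, l) := fun k l hkl => h.ne (congrArg Prod.fst hkl)
  by_cases hc : S.Crosses p (e, i + d) (f, j + d')
  swap
  · exact ⟨S, S.ncard_crossings_lt (hne _ _) ⟨by simp only; omega, h3⟩ ⟨by simp only; omega, h4⟩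
      h.second hc⟩
  refine ⟨h.exchanged, (h.exchanged.ncard_crossings_lt (a := (e, i + d')) (b := (f, j + d))
    (hne _ _) ⟨by simp only; omega, ?_⟩ ⟨by simp only; omega, ?_⟩ ?_ ?_).trans_le
    h.ncard_meets_exchanged_le⟩
  · change i + d' < S.exchangeLen e f d d' e
    rw [exchangeLen_left]; omega
  · change j + d < S.exchangeLen e f d d' f
    rw [exchangeLen_right h.ne]; omega
  · change S.loc (exchange e f i d j d' (e, i + d')) = S.loc (exchange e f i d j d' (f, j + d))
    rw [exchange_left, exchange_right h.ne, detour_of_ge le_rfl, detour_of_ge le_rfl]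
    simp only [loc, Nat.add_sub_cancel_left, Nat.sub_self, Nat.add_zero]
    exact h.second
  · intro hc'
    have e1 : ∀ (e f : G.edgeSet) (i d j d' : ℕ), S.loc (detour e f i d j d' (i + d')) =
        S.node e (i + d) := fun e f i d j d' => by
      rw [detour_of_ge le_rfl]; simp [loc]
    have e2 : ∀ (e f : G.edgeSet) (i d j d' : ℕ), S.loc (detour e f i d j d' (i + d' + 1)) =
        S.node e (i + d + 1) := fun e f i d j d' => by
      rw [detour_of_ge (by omega), loc]
      congr 1
      omega
    have e3 : ∀ (e f : G.edgeSet) (i d j d' : ℕ), 0 < d' →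
        S.loc (detour e f i d j d' (i + d' - 1)) = S.node f (j + d' - 1) :=
      fun e f i d j d' h => by
        rw [detour_of_mid (by omega) (by omega), loc]
        congr 1
        omega
    rw [Crosses] at hc'
    change SegCross (unitDir (p (S.loc (exchange e f i d j d' (e, i + d'))))
      (p (S.loc (exchange e f i d j d' (e, i + d' - 1)))))
      (unitDir (p (S.loc (exchange e f i d j d' (e, i + d'))))
        (p (S.loc (exchange e f i d j d' (e, i + d' + 1)))))
      (unitDir (p (S.loc (exchange e f i d j d' (e, i + d'))))
        (p (S.loc (exchange e f i d j d' (f, j + d - 1)))))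
      (unitDir (p (S.loc (exchange e f i d j d' (e, i + d'))))
        (p (S.loc (exchange e f i d j d' (f, j + d + 1))))) at hc'
    simp only [exchange_left, exchange_right h.ne] at hc'
    rw [e1, e2, e2, e3 _ _ _ _ _ _ h2, e3 _ _ _ _ _ _ h1] at hc'
    exact hc.not_swap hc'.symm

end PathSystem

/-! ### Optimal drawings -/

theorem exists_enum (Θ : Finset ℝ) (h0 : 0 ∈ Θ) (h1 : 1 ∈ Θ) (hΘ : ∀ s ∈ Θ, s ∈ Icc (0:ℝ) 1) :
    ∃ (n : ℕ) (t : ℕ → ℝ), n + 1 = Θ.card ∧ 0 < n ∧ t 0 = 0 ∧ t n = 1 ∧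
      (∀ k l, k < l → l ≤ n → t k < t l) ∧ (∀ k, t k ∈ Θ) ∧ ∀ s ∈ Θ, ∃ k ≤ n, t k = s := by
  obtain ⟨n, hn⟩ : ∃ n, Θ.card = n + 1 :=
    Nat.exists_eq_succ_of_ne_zero (Finset.card_pos.2 ⟨0, h0⟩).ne'
  have hlt : ∀ k, min k n < n + 1 := fun k => by omega
  set t : ℕ → ℝ := fun k => Θ.orderEmbOfFin hn ⟨min k n, hlt k⟩ with ht
  have hmono : ∀ k l, k < l → l ≤ n → t k < t l := by
    intro k l hkl hl
    refine (Θ.orderEmbOfFin hn).strictMono ?_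
    simp only [Fin.mk_lt_mk]
    omega
  have hmono' : ∀ k l, k ≤ l → l ≤ n → t k ≤ t l := by
    intro k l hkl hl
    rcases hkl.eq_or_lt with rfl | h
    · rfl
    · exact (hmono k l h hl).le
  have hmem : ∀ k, t k ∈ Θ := fun k => Finset.orderEmbOfFin_mem _ _ _
  have hsurj : ∀ s ∈ Θ, ∃ k ≤ n, t k = s := by
    intro s hs
    have : s ∈ Set.range (Θ.orderEmbOfFin hn) := by
      rw [Finset.range_orderEmbOfFin]; exact hs
    obtain ⟨k, rfl⟩ := this
    refine ⟨k, by omega, ?_⟩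
    exact congrArg (Θ.orderEmbOfFin hn) (Fin.ext (show min (k : ℕ) n = k by omega))
  have ht0 : t 0 = 0 := by
    obtain ⟨k, hk, h⟩ := hsurj 0 h0
    exact le_antisymm (h ▸ hmono' 0 k (Nat.zero_le _) hk) (hΘ _ (hmem 0)).1
  have ht1 : t n = 1 := by
    obtain ⟨k, hk, h⟩ := hsurj 1 h1
    exact le_antisymm (hΘ _ (hmem n)).2 (h ▸ hmono' k n hk le_rfl)
  refine ⟨n, t, hn.symm, Nat.pos_of_ne_zero ?_, ht0, ht1, hmono, hmem, hsurj⟩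
  rintro rfl
  rw [ht0] at ht1
  exact zero_ne_one ht1

namespace Drawing

variable {V : Type*} {G : SimpleGraph V} (D : Drawing G)

theorem exists_ends : ∃ fst snd : G.edgeSet → V, (∀ e : G.edgeSet, (e : Sym2 V) = s(fst e, snd e)) ∧
    ∀ e, D.arc e 0 = D.vert (fst e) ∧ D.arc e 1 = D.vert (snd e) := by
  choose fst snd h using D.arc_ends
  exact ⟨fst, snd, fun e => (h e).1, fun e => (h e).2⟩

theorem exists_marking (Θ : G.edgeSet → Finset ℝ) (h0 : ∀ e, 0 ∈ Θ e) (h1 : ∀ e, 1 ∈ Θ e)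
    (hΘ : ∀ e, ∀ s ∈ Θ e, s ∈ Icc (0:ℝ) 1)
    (hcross : ∀ e f, e ≠ f → ∀ s ∈ Ioo (0:ℝ) 1, D.arc e s ∈ D.interOf f → s ∈ Θ e)
    (hconsec : ∀ e f, e ≠ f → ∀ s ∈ Θ e, ∀ t ∈ Θ e, s < t → (∀ u ∈ Θ e, s < u → t ≤ u) →
      D.arc e s ∈ D.arc f '' Icc 0 1 → D.arc e t ∉ D.arc f '' Icc 0 1) :
    ∃ M : Marking D, ∀ e, M.len e + 1 = (Θ e).card := by
  choose len time hcard hpos ht0 ht1 hlt hmem hsurj using fun e =>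
    exists_enum (Θ e) (h0 e) (h1 e) (hΘ e)
  refine ⟨⟨len, time, hpos, ht0, ht1, hlt, fun e f hef s hs h => hsurj e s (hcross e f hef s hs h),
    fun e f k hef hk => ?_⟩, hcard⟩
  refine hconsec e f hef _ (hmem e k) _ (hmem e _) (hlt e k _ (by omega) hk) fun u hu hku => ?_
  obtain ⟨l, hl, rfl⟩ := hsurj e u hu
  rcases Nat.lt_or_ge k l with h | h
  · rcases (Nat.succ_le_of_lt h).eq_or_lt with h | h
    · exact (congrArg (time e) h).le
    · exact (hlt e _ _ h hl).le
  · rcases h.eq_or_lt with rfl | h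
    · exact absurd hku (lt_irrefl _)
    · exact absurd hku (hlt e l k h hk.le).not_gt

/-- The parameters at which an edge crosses another one. -/
def crossTimes (e : G.edgeSet) : Set ℝ :=
  {t | t ∈ Ioo (0:ℝ) 1 ∧ ∃ f, e ≠ f ∧ D.arc e t ∈ D.interOf f}

theorem finite_crossTimes (hfin : D.CrossSet.Finite) (e : G.edgeSet) :
    (D.crossTimes e).Finite := by
  refine Finite.of_finite_image (f := D.arc e) ((hfin.image Prod.fst).subset ?_)
    ((D.arc_injOn e).mono fun t ht => Ioo_subset_Icc_self ht.1)
  rintro _ ⟨t, ⟨ht, f, hef, hf⟩, rfl⟩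
  exact ⟨(D.arc e t, s(e, f)), ⟨e, f, hef, rfl, ⟨t, ht, rfl⟩, hf⟩, rfl⟩

/-- The crossings on an edge and its endpoints. -/
def stops (hfin : D.CrossSet.Finite) (e : G.edgeSet) : Finset ℝ :=
  insert 0 (insert 1 (D.finite_crossTimes hfin e).toFinset)

theorem mem_stops {hfin : D.CrossSet.Finite} {e : G.edgeSet} {t : ℝ} :
    t ∈ D.stops hfin e ↔ t = 0 ∨ t = 1 ∨ t ∈ D.crossTimes e := by
  simp [stops]

theorem stops_mem {hfin : D.CrossSet.Finite} {e : G.edgeSet} {t : ℝ} (ht : t ∈ D.stops hfin e) :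
    t ∈ Icc (0:ℝ) 1 := by
  rcases D.mem_stops.1 ht with rfl | rfl | h
  · simp
  · simp
  · exact Ioo_subset_Icc_self h.1

theorem mem_interOf_of_mem {e f : G.edgeSet} {s : ℝ} (hs : s ∈ Ioo (0:ℝ) 1)
    (h : D.arc e s ∈ D.arc f '' Icc 0 1) : D.arc e s ∈ D.interOf f := by
  obtain ⟨t, ht, h⟩ := h
  obtain ⟨x, y, -, h0, h1⟩ := D.arc_ends f
  have hav : ∀ v, D.arc e s ≠ D.vert v := fun v hv => by
    rcases D.arc_avoid e s (Ioo_subset_Icc_self hs) ⟨v, hv⟩ with rfl | rfl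
    · exact lt_irrefl _ hs.1
    · exact lt_irrefl _ hs.2
  refine ⟨t, ⟨lt_of_le_of_ne ht.1 ?_, lt_of_le_of_ne ht.2 ?_⟩, h⟩
  · rintro rfl; exact hav x (h ▸ h0)
  · rintro rfl; exact hav y (h ▸ h1)

theorem mem_stops_of_mem {hfin : D.CrossSet.Finite} {e f : G.edgeSet} (hef : e ≠ f) {s : ℝ}
    (hs : s ∈ Icc (0:ℝ) 1) (h : D.arc e s ∈ D.arc f '' Icc 0 1) : s ∈ D.stops hfin e := by
  rw [mem_stops]
  rcases hs.1.eq_or_lt with h0 | h0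
  · exact Or.inl h0.symm
  rcases hs.2.eq_or_lt with h1 | h1
  · exact Or.inr (Or.inl h1)
  exact Or.inr (Or.inr ⟨⟨h0, h1⟩, f, hef, D.mem_interOf_of_mem ⟨h0, h1⟩ h⟩)

theorem nonempty_marking (hfin : D.CrossSet.Finite) : Nonempty (Marking D) := by
  classical
  have hex : ∀ e, ∃ Θ : Finset ℝ, (∀ s ∈ D.stops hfin e, ∀ t ∈ D.stops hfin e, (s + t) / 2 ∈ Θ) ∧
      ∀ s ∈ Θ, s ∈ Icc (0:ℝ) 1 := by
    intro e
    refine ⟨(D.stops hfin e ×ˢ D.stops hfin e).image fun x : ℝ × ℝ => (x.1 + x.2) / 2,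
      fun s hs t ht => Finset.mem_image.2 ⟨(s, t), Finset.mem_product.2 ⟨hs, ht⟩, rfl⟩, ?_⟩
    intro s hs
    obtain ⟨⟨a, b⟩, hab, rfl⟩ := Finset.mem_image.1 hs
    have ha := D.stops_mem (Finset.mem_product.1 hab).1
    have hb := D.stops_mem (Finset.mem_product.1 hab).2
    exact ⟨by linarith [ha.1, hb.1], by linarith [ha.2, hb.2]⟩
  choose Θ hmid hIcc using hex
  have hin : ∀ e, ∀ s ∈ D.stops hfin e, s ∈ Θ e := fun e s hs => by
    simpa using hmid e s hs s hs
  obtain ⟨M, -⟩ := D.exists_marking Θ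
    (fun e => hin e 0 (D.mem_stops.2 (by simp))) (fun e => hin e 1 (D.mem_stops.2 (by simp))) hIcc
    (fun e f hef s hs h => hin e s (D.mem_stops.2 (Or.inr (Or.inr ⟨hs, f, hef, h⟩))))
    (fun e f hef s hs t ht hst hcons h1 h2 => by
      have := hcons _ (hmid e s (D.mem_stops_of_mem hef (hIcc e s hs) h1) t
        (D.mem_stops_of_mem hef (hIcc e t ht) h2)) (by linarith)
      linarith)
  exact ⟨M⟩

open Classical in
/-- Reverse the parametrization of some edges. -/
def flip (σ : G.edgeSet → Prop) : Drawing G where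
  vert := D.vert
  vert_inj := D.vert_inj
  arc e t := D.arc e (if σ e then 1 - t else t)
  arc_cont e := by
    split_ifs
    · refine (D.arc_cont e).comp (by fun_prop) fun t ht => ?_
      exact ⟨by linarith [ht.2], by linarith [ht.1]⟩
    · exact D.arc_cont e
  arc_injOn e := by
    split_ifs
    · intro s hs t ht h
      have := D.arc_injOn e (show 1 - s ∈ Icc (0:ℝ) 1 from ⟨by linarith [hs.2], by linarith [hs.1]⟩)
        (show 1 - t ∈ Icc (0:ℝ) 1 from ⟨by linarith [ht.2], by linarith [ht.1]⟩) h
      linarith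
    · exact D.arc_injOn e
  arc_ends e := by
    obtain ⟨x, y, h, h0, h1⟩ := D.arc_ends e
    split_ifs
    · exact ⟨y, x, by rw [h, Sym2.eq_swap], by simpa using h1, by simpa using h0⟩
    · exact ⟨x, y, h, h0, h1⟩
  arc_avoid e t ht hv := by
    split_ifs at hv
    · rcases D.arc_avoid e (1 - t) ⟨by linarith [ht.2], by linarith [ht.1]⟩ hv with h | h
      · right; linarith
      · left; linarith
    · exact D.arc_avoid e t ht hv

theorem flip_arc_of_pos {σ : G.edgeSet → Prop} {e : G.edgeSet} (h : σ e) (t : ℝ) :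
    (D.flip σ).arc e t = D.arc e (1 - t) := congrArg (D.arc e) (if_pos h)

theorem flip_arc_of_neg {σ : G.edgeSet → Prop} {e : G.edgeSet} (h : ¬σ e) (t : ℝ) :
    (D.flip σ).arc e t = D.arc e t := congrArg (D.arc e) (if_neg h)

theorem interOf_flip (σ : G.edgeSet → Prop) (e : G.edgeSet) :
    (D.flip σ).interOf e = D.interOf e := by
  by_cases h : σ e
  · have harc := D.flip_arc_of_pos h
    ext z
    constructor
    · rintro ⟨t, ht, rfl⟩
      exact ⟨1 - t, ⟨by linarith [ht.2], by linarith [ht.1]⟩, (harc t).symm⟩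
    · rintro ⟨t, ht, rfl⟩
      exact ⟨1 - t, ⟨by linarith [ht.2], by linarith [ht.1]⟩, by rw [harc, sub_sub_cancel]⟩
  · rw [interOf, funext (D.flip_arc_of_neg h), interOf]

theorem crossSet_flip (σ : G.edgeSet → Prop) : (D.flip σ).CrossSet = D.CrossSet := by
  simp only [CrossSet, interOf_flip]

/-- A drawing with the least number of crossings. -/
structure IsOptimal : Prop where
  finite : D.CrossSet.Finite
  le : ∀ D' : Drawing G, D'.CrossSet.Finite → D.CrossSet.ncard ≤ D'.CrossSet.ncard

variable {D}

theorem IsOptimal.flip (h : D.IsOptimal) (σ : G.edgeSet → Prop) : (D.flip σ).IsOptimal :=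
  ⟨(D.crossSet_flip σ).symm ▸ h.finite, fun D' hD' => (D.crossSet_flip σ).symm ▸ h.le D' hD'⟩

end Drawing

theorem Marking.exists_isSL {V : Type*} [Finite V] {G : SimpleGraph V} {D : Drawing G}
    (M : Marking D) (e : G.edgeSet) : ∃ p, IsSL M.graph p := by
  have : Finite M.nodes := M.finite_nodes
  have hadj : M.graph.Adj (M.nodeAt e 0) (M.nodeAt e 1) := ⟨e, 0, M.len_pos e, rfl⟩
  obtain ⟨p, -, hp, -⟩ := HT.exists_isSL_outerEdge _ rfl M.ht_graph hadj
  exact ⟨p, hp⟩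

namespace Drawing

variable {V : Type*} {G : SimpleGraph V} {D : Drawing G}

theorem IsOptimal.not_twice [Finite V] (h : D.IsOptimal) (M : Marking D) {fst snd : G.edgeSet → V}
    (hfs : ∀ e : G.edgeSet, (e : Sym2 V) = s(fst e, snd e))
    (hD : ∀ e, D.arc e 0 = D.vert (fst e) ∧ D.arc e 1 = D.vert (snd e))
    {e f : G.edgeSet} {i d j d' : ℕ} : ¬(M.system hD).Twice e f i d j d' := by
  intro ht
  have : Finite M.nodes := M.finite_nodes
  obtain ⟨p, hp⟩ := M.exists_isSL e
  obtain ⟨S', hS'⟩ := ht.exists_ncard_crossings_lt p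
  obtain ⟨D', -, hfin', hle'⟩ := S'.exists_rectilinear M.incl_injective hfs hp
  obtain ⟨D'', hfin'', hle'', -⟩ := exists_drawing_of_subdivide hfs D' hfin'
  have h1 := h.le D'' hfin''
  have h2 := M.ncard_meets_le h.finite hD
  omega

theorem IsOptimal.not_lt_lt [Finite V] (h : D.IsOptimal) {e f : G.edgeSet} (hef : e ≠ f)
    {s t s' t' : ℝ} (hs : s ∈ Icc (0:ℝ) 1) (hs' : s' ∈ Icc (0:ℝ) 1) (ht' : t' ∈ Icc (0:ℝ) 1)
    (ht : t ∈ Ioo (0:ℝ) 1) (hst : D.arc e s = D.arc f s') (htt : D.arc e t = D.arc f t')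
    (hlt : s < t) (hlt' : s' < t') : False := by
  obtain ⟨M⟩ := D.nonempty_marking h.finite
  obtain ⟨fst, snd, hfs, hD⟩ := D.exists_ends
  obtain ⟨i, hi, rfl⟩ := M.exists_time_of_common hef hs hs' hst
  obtain ⟨j, hj, rfl⟩ := M.exists_time_of_common hef.symm hs' hs hst.symm
  obtain ⟨k, hk, rfl⟩ := M.exists_time_of_common hef (Ioo_subset_Icc_self ht) ht' htt
  obtain ⟨l, hl, rfl⟩ := M.exists_time_of_common hef.symm ht' (Ioo_subset_Icc_self ht) htt.symm
  have hlt_of : ∀ (e : G.edgeSet) {i k : ℕ}, i ≤ M.len e → M.time e i < M.time e k → i < k := by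
    intro e i k hi h
    by_contra hik
    rcases (not_lt.1 hik).eq_or_lt with rfl | h'
    · exact lt_irrefl _ h
    · exact lt_asymm h (M.time_lt e k i h' hi)
  have hik := hlt_of e hi hlt
  have hjl := hlt_of f hj hlt'
  have hke : k < M.len e := hlt_of e hk (by rw [M.time_len]; exact ht.2)
  have hlf : l < M.len f := by
    refine hl.lt_of_ne ?_
    rintro rfl
    rw [M.time_len, (hD f).2] at htt
    rcases D.arc_avoid e _ (Ioo_subset_Icc_self ht) ⟨_, htt⟩ with h | h
    · exact ht.1.ne' h
    · exact ht.2.ne h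
  refine h.not_twice M hfs hD (e := e) (f := f) (i := i) (d := k - i) (j := j) (d' := l - j)
    ⟨hef, by omega, by omega, ?_, ?_, Subtype.ext ?_, Subtype.ext ?_⟩
  · change i + (k - i) < M.len e
    omega
  · change j + (l - j) < M.len f
    omega
  · change (M.nodeAt e i : Plane) = M.nodeAt f j
    rw [M.nodeAt_val e hi, M.nodeAt_val f hj, hst]
  · change (M.nodeAt e (i + (k - i)) : Plane) = M.nodeAt f (j + (l - j))
    rw [show i + (k - i) = k by omega, show j + (l - j) = l by omega, M.nodeAt_val e hk,
      M.nodeAt_val f hl, htt]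

/-- In an optimal drawing two edges with a common inner point have no other common point. -/
theorem IsOptimal.eq_of_common [Finite V] (h : D.IsOptimal) {e f : G.edgeSet} (hef : e ≠ f)
    {s t : ℝ} (hs : s ∈ Icc (0:ℝ) 1) (ht : t ∈ Ioo (0:ℝ) 1)
    (hst : D.arc e s ∈ D.arc f '' Icc 0 1) (htt : D.arc e t ∈ D.arc f '' Icc 0 1) : s = t := by
  classical
  by_contra hne
  obtain ⟨s', hs', hst⟩ := hst
  obtain ⟨t', ht', htt⟩ := htt
  have hne' : s' ≠ t' := by
    rintro rfl
    exact hne (D.arc_injOn e hs (Ioo_subset_Icc_self ht) (hst.symm.trans htt))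
  set σ : G.edgeSet → Prop := fun g => (g = e ∧ t < s) ∨ (g = f ∧ t' < s')
  have hσe : σ e ↔ t < s := by simp [σ, hef]
  have hσf : σ f ↔ t' < s' := by simp [σ, hef.symm]
  set r : G.edgeSet → ℝ → ℝ := fun g u => if σ g then 1 - u else u
  have harc : ∀ g u, (D.flip σ).arc g (r g u) = D.arc g u := by
    intro g u
    by_cases hg : σ g
    · rw [D.flip_arc_of_pos hg, show r g u = 1 - u from if_pos hg, sub_sub_cancel]
    · rw [D.flip_arc_of_neg hg, show r g u = u from if_neg hg]
  have hr : ∀ g, ∀ u ∈ Icc (0:ℝ) 1, r g u ∈ Icc (0:ℝ) 1 := by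
    intro g u hu
    simp only [r]
    split_ifs
    · exact ⟨by linarith [hu.2], by linarith [hu.1]⟩
    · exact hu
  refine (h.flip σ).not_lt_lt hef (hr e s hs) (hr f s' hs') (hr f t' ht') (t := r e t) ?_
    (by rw [harc, harc, hst]) (by rw [harc, harc, htt]) ?_ ?_
  · simp only [r]
    split_ifs
    · exact ⟨by linarith [ht.2], by linarith [ht.1]⟩
    · exact ht
  · simp only [r, hσe]
    split_ifs with h1
    · linarith
    · exact lt_of_le_of_ne (not_lt.1 h1) hne
  · simp only [r, hσf]
    split_ifs with h1
    · linarith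
    · exact lt_of_le_of_ne (not_lt.1 h1) hne'

theorem IsOptimal.ncard_crossTimes_lt [Finite V] (h : D.IsOptimal) (e : G.edgeSet) :
    (D.crossTimes e).ncard < G.edgeSet.ncard := by
  have hex : ∀ t, ∃ f : G.edgeSet, t ∈ D.crossTimes e → e ≠ f ∧ D.arc e t ∈ D.interOf f := by
    intro t
    by_cases ht : t ∈ D.crossTimes e
    · obtain ⟨f, hf⟩ := ht.2
      exact ⟨f, fun _ => hf⟩
    · exact ⟨e, fun h => absurd h ht⟩
  choose f hf using hex
  have hsub : ∀ t, D.interOf (f t) ⊆ D.arc (f t) '' Icc 0 1 := fun t =>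
    image_mono Ioo_subset_Icc_self
  have hinj : InjOn (fun t => (f t : Sym2 V)) (D.crossTimes e) := by
    intro t ht t' ht' heq
    have hft : f t = f t' := Subtype.ext heq
    have h1 := hf t ht
    have h2 := hf t' ht'
    rw [← hft] at h2
    exact h.eq_of_common h1.1 (Ioo_subset_Icc_self ht.1) ht'.1 (hsub t h1.2) (hsub t h2.2)
  rw [← hinj.ncard_image]
  refine ncard_lt_ncard ⟨?_, fun hss => ?_⟩ (toFinite _)
  · rintro _ ⟨t, -, rfl⟩
    exact (f t).2
  · obtain ⟨t, ht, heq⟩ := hss e.2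
    exact (hf t ht).1 (Subtype.ext heq.symm)

theorem IsOptimal.exists_marking [Finite V] (h : D.IsOptimal) :
    ∃ M : Marking D, ∀ e, M.len e ≤ G.edgeSet.ncard := by
  have hcons : ∀ e f, e ≠ f → ∀ s ∈ D.stops h.finite e, ∀ t ∈ D.stops h.finite e, s < t →
      (∀ u ∈ D.stops h.finite e, s < u → t ≤ u) →
      D.arc e s ∈ D.arc f '' Icc 0 1 → D.arc e t ∉ D.arc f '' Icc 0 1 := by
    intro e f hef s hs t ht hst _ h1 h2
    have hs' := D.stops_mem hs
    have ht' := D.stops_mem ht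
    have hs0 : s = 0 := by
      by_contra h0
      exact hst.ne' (h.eq_of_common hef ht'
        ⟨lt_of_le_of_ne hs'.1 (Ne.symm h0), hst.trans_le ht'.2⟩ h2 h1)
    have ht1 : t = 1 := by
      by_contra h0
      exact hst.ne (h.eq_of_common hef hs' ⟨hs'.1.trans_lt hst, lt_of_le_of_ne ht'.2 h0⟩ h1 h2)
    subst hs0 ht1
    obtain ⟨fst, snd, hfs, hD⟩ := D.exists_ends
    have hmem : ∀ v, D.vert v ∈ D.arc f '' Icc 0 1 → v = fst f ∨ v = snd f := by
      rintro v ⟨u, hu, huv⟩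
      rcases D.arc_avoid f u hu ⟨v, huv⟩ with rfl | rfl
      · exact Or.inl (D.vert_inj (huv.symm.trans (hD f).1))
      · exact Or.inr (D.vert_inj (huv.symm.trans (hD f).2))
    rw [(hD e).1] at h1
    rw [(hD e).2] at h2
    have hne : fst e ≠ snd e := fst_ne_snd hfs e
    apply hef
    apply Subtype.ext
    rw [hfs e, hfs f]
    rcases hmem _ h1 with h3 | h3 <;> rcases hmem _ h2 with h4 | h4
    · exact absurd (h3.trans h4.symm) hne
    · rw [h3, h4]
    · rw [h3, h4, Sym2.eq_swap]
    · exact absurd (h3.trans h4.symm) hne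
  obtain ⟨M, hM⟩ := D.exists_marking (D.stops h.finite) (fun e => D.mem_stops.2 (by simp))
    (fun e => D.mem_stops.2 (by simp)) (fun e s hs => D.stops_mem hs)
    (fun e f hef s hs hc => D.mem_stops.2 (Or.inr (Or.inr ⟨hs, f, hef, hc⟩))) hcons
  refine ⟨M, fun e => ?_⟩
  have h1 := h.ncard_crossTimes_lt e
  have h2 := hM e
  rw [ncard_eq_toFinset_card _ (D.finite_crossTimes h.finite e)] at h1
  have h3 : (D.stops h.finite e).card ≤ (D.finite_crossTimes h.finite e).toFinset.card + 1 + 1 :=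
    (Finset.card_insert_le _ _).trans (Nat.add_le_add_right (Finset.card_insert_le _ _) 1)
  omega

end Drawing

/-! ### The crossing numbers -/

theorem crNumP_of_isEmpty {V : Type*} {G : SimpleGraph V} [IsEmpty G.edgeSet]
    (P : Drawing G → Prop) : crNumP G P = 0 := by
  rw [crNumP, Nat.sInf_eq_zero]
  refine or_iff_not_imp_right.2 fun h => ?_
  obtain ⟨n, D, hP, hfin, rfl⟩ := nonempty_iff_ne_empty.2 h
  refine ⟨D, hP, hfin, ?_⟩
  have : D.CrossSet = ∅ := eq_empty_of_forall_notMem (by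
    rintro x ⟨e, -⟩
    exact isEmptyElim e)
  rw [this, ncard_empty]

theorem isEmpty_edgeSet_subdivideGraph {V : Type*} {G : SimpleGraph V} [IsEmpty G.edgeSet]
    (c : G.edgeSet → ℕ) (fst snd : G.edgeSet → V) :
    IsEmpty (subdivideGraph G c fst snd).edgeSet := by
  refine ⟨fun ⟨q, hq⟩ => ?_⟩
  induction q with
  | _ x y =>
    obtain ⟨-, h⟩ := hq
    rcases h with (⟨e, _⟩ | ⟨e, _⟩ | ⟨e, _⟩ | ⟨e, _⟩) | (⟨e, _⟩ | ⟨e, _⟩ | ⟨e, _⟩ | ⟨e, _⟩) <;>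
      exact isEmptyElim e

theorem exists_endpoints {V : Type*} (G : SimpleGraph V) : ∃ fst snd : G.edgeSet → V,
    ∀ e : G.edgeSet, (e : Sym2 V) = s(fst e, snd e) := by
  have : ∀ e : G.edgeSet, ∃ x : V × V, (e : Sym2 V) = s(x.1, x.2) := fun e =>
    ⟨(e : Sym2 V).out, (Quot.out_eq (e : Sym2 V)).symm⟩
  choose x hx using this
  exact ⟨fun e => (x e).1, fun e => (x e).2, hx⟩

theorem crNum_le_rcrNum_subdivideGraph {V : Type*} {G : SimpleGraph V} {c : G.edgeSet → ℕ}
    {fst snd : G.edgeSet → V} (hfs : ∀ e : G.edgeSet, (e : Sym2 V) = s(fst e, snd e))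
    (h : ∃ D : Drawing (subdivideGraph G c fst snd), D.IsRectilinear ∧ D.CrossSet.Finite) :
    crNum G ≤ rcrNum (subdivideGraph G c fst snd) := by
  obtain ⟨D, hrec, hfin⟩ := h
  have hne : { n | ∃ D : Drawing (subdivideGraph G c fst snd),
    D.IsRectilinear ∧ D.CrossSet.Finite ∧ D.CrossSet.ncard = n }.Nonempty :=
    ⟨_, D, hrec, hfin, rfl⟩
  obtain ⟨D', -, hfin', hD'⟩ := Nat.sInf_mem hne
  obtain ⟨D'', hfin'', hle, -⟩ := exists_drawing_of_subdivide hfs D' hfin'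
  rw [rcrNum, crNumP, ← hD']
  refine le_trans (Nat.sInf_le ?_) hle
  exact ⟨D'', trivial, hfin'', rfl⟩

/-- Theorem. For every finite simple graph `G` there exists a graph `G'`, obtained
from `G` by subdividing each edge of `G` at most `2 |E(G)|` times, such that
`rcr G' = cr G`. -/
theorem exists_subdivision_rcrNum_eq_crNum {V : Type*} [Fintype V]
    (G : SimpleGraph V) :
    ∃ (c : G.edgeSet → ℕ) (fst snd : G.edgeSet → V),
      (∀ e : G.edgeSet, (e : Sym2 V) = s(fst e, snd e)) ∧
      (∀ e : G.edgeSet, c e ≤ 2 * G.edgeSet.ncard) ∧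
      rcrNum (subdivideGraph G c fst snd) = crNum G := by
  rcases isEmpty_or_nonempty G.edgeSet with hE | ⟨⟨e₀⟩⟩
  · obtain ⟨fst, snd, hfs⟩ := exists_endpoints G
    refine ⟨fun _ => 0, fst, snd, hfs, fun _ => Nat.zero_le _, ?_⟩
    have := isEmpty_edgeSet_subdivideGraph (fun _ => 0) fst snd
    rw [rcrNum, crNumP_of_isEmpty, crNum, crNumP_of_isEmpty]
  by_cases hex : ∃ D : Drawing G, D.CrossSet.Finite
  · have hne : { n | ∃ D : Drawing G, True ∧ D.CrossSet.Finite ∧ D.CrossSet.ncard = n }.Nonempty :=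
      hex.elim fun D hD => ⟨_, D, trivial, hD, rfl⟩
    obtain ⟨D, -, hfin, hcr⟩ := Nat.sInf_mem hne
    have hopt : D.IsOptimal := ⟨hfin, fun D' hD' => hcr ▸ Nat.sInf_le ⟨D', trivial, hD', rfl⟩⟩
    obtain ⟨M, hM⟩ := hopt.exists_marking
    obtain ⟨fst, snd, hfs, hD⟩ := D.exists_ends
    have : Finite M.nodes := M.finite_nodes
    obtain ⟨p, hp⟩ := M.exists_isSL e₀
    obtain ⟨D', hrec, hfin', hle⟩ := (M.system hD).exists_rectilinear M.incl_injective hfs hp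
    refine ⟨_, fst, snd, hfs, fun e => ?_, le_antisymm ?_
      (crNum_le_rcrNum_subdivideGraph hfs ⟨D', hrec, hfin'⟩)⟩
    · have := hM e
      change 2 * (M.len e - 1) ≤ _
      omega
    · rw [crNum, crNumP, ← hcr]
      refine le_trans (Nat.sInf_le ?_) (hle.trans
        ((ncard_le_ncard (PathSystem.crossings_subset _ p) (PathSystem.finite_meets _)).trans
          (M.ncard_meets_le hfin hD)))
      exact ⟨D', hrec, hfin', rfl⟩
  · obtain ⟨fst, snd, hfs⟩ := exists_endpoints G
    refine ⟨fun _ => 0, fst, snd, hfs, fun _ => Nat.zero_le _, ?_⟩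
    have h1 : { n | ∃ D : Drawing G, True ∧ D.CrossSet.Finite ∧ D.CrossSet.ncard = n } = ∅ := by
      refine eq_empty_of_forall_notMem ?_
      rintro n ⟨D, -, hfin, -⟩
      exact hex ⟨D, hfin⟩
    have h2 : { n | ∃ D : Drawing (subdivideGraph G (fun _ => 0) fst snd),
        D.IsRectilinear ∧ D.CrossSet.Finite ∧ D.CrossSet.ncard = n } = ∅ := by
      refine eq_empty_of_forall_notMem ?_
      rintro n ⟨D', -, hfin', -⟩
      obtain ⟨D, hfin, -⟩ := exists_drawing_of_subdivide hfs D' hfin'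
      exact hex ⟨D, hfin⟩
    rw [rcrNum, crNum, crNumP, crNumP, h1, h2]

end
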